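/- Theorem 1.1 (critical one-arm upper bound): There exists a constant C ∈ (0,∞) such that for all x ∈ G and all R ≥ 3, ℙ(x ↔ B(x,R)^c in E^{≥0}) ≤ C q(R) R^{−ν/2}, where q(R) = log log R if ν = 1, q(R) = (log R)^{(ν−1)/2}(log log R)^ν if 1 < ν < α/2, and q(R) = (log R)^ν (log log R)^ν if ν = α/2. -/

import Mathlib

open MeasureTheory ProbabilityTheory Real Filter Topology
open scoped ENNReal NNReal BigOperators Classical

noncomputable section

/-! ## Generic exponents and corrections -/

/-- The exponent `b₁`: equal to `1` if `ν = 1` and `0` otherwise. -/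
def bOne (ν : ℝ) : ℝ := if ν = 1 then 1 else 0

/-- The exponent `b₂`: equal to `1` if `α = 2ν` and `0` otherwise. -/
def bTwo (ν α : ℝ) : ℝ := if α = 2 * ν then 1 else 0

/-- The polylogarithmic correction `q(r)` from Theorem 1.1. -/
def qArm (ν α r : ℝ) : ℝ :=
  if ν = 1 then Real.log (Real.log r)
  else if ν < α / 2 then Real.log r ^ ((ν - 1) / 2) * Real.log (Real.log r) ^ ν
  else Real.log r ^ ν * Real.log (Real.log r) ^ ν

/-- `exp(-t)` for an extended nonnegative real `t`. -/
def expNegE (t : ℝ≥0∞) : ℝ≥0∞ := if t = ⊤ then 0 else ENNReal.ofReal (Real.exp (-t.toReal))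

/-! ## Transient weighted graphs

A weighted graph `𝒢 = (G, λ)`, connected and locally finite, with controlled weights,
equipped with a metric `d`, a distinguished base point `o`, and exponents `α` (volume
growth) and `ν` (Green's function decay). -/

structure WGraph where
  (V : Type) (countableV : Countable V) (o : V)
  (lam : V → V → ℝ)
  (lam_nonneg : ∀ x y, 0 ≤ lam x y)
  (lam_symm : ∀ x y, lam x y = lam y x)
  (locFin : ∀ x, (Function.support (lam x)).Finite)
  (connectedG : ∀ x y, Relation.ReflTransGen (fun u v => 0 < lam u v) x y)
  -- controlled weights: `λ_{x,y}/λ_x ≥ c₀` for all neighbours `x ∼ y`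
  (ctrl : ∃ c₀ > (0:ℝ), ∀ x y, 0 < lam x y → c₀ * (∑ᶠ z, lam x z) ≤ lam x y)
  (d : V → V → ℝ)
  (d_symm : ∀ x y, d x y = d y x)
  (d_self : ∀ x, d x x = 0)
  (d_pos : ∀ x y, x ≠ y → 0 < d x y)
  (d_triangle : ∀ x y z, d x z ≤ d x y + d y z)
  (α : ℝ) (ν : ℝ)

namespace WGraph

variable (M : WGraph)

/-- Total weight `λ_x = Σ_{y} λ_{x,y}` at a vertex. -/
def lamTot (x : M.V) : ℝ := ∑ᶠ y, M.lam x y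

/-- The (closed) ball `B(x,r)` for the metric `d`. -/
def ball (x : M.V) (r : ℝ) : Set M.V := {y | M.d x y ≤ r}

/-- One-step transition probability of the random walk on `(G,λ)`. -/
def p (x y : M.V) : ℝ := M.lam x y / M.lamTot x

/-- `n`-step transition probability of the random walk. -/
def pstep : ℕ → M.V → M.V → ℝ
  | 0, x, y => if x = y then 1 else 0
  | n + 1, x, y => ∑ᶠ z, M.p x z * pstep n z y

/-- The Green's function `g(x,y) = λ_y^{-1} Σ_{n ≥ 0} P_x[Z_n = y]` of the walk. -/
def green (x y : M.V) : ℝ := (∑' n, M.pstep n x y) / M.lamTot y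

/-- Transience of the random walk on `𝒢`. -/
def Transient : Prop := ∀ x, Summable fun n => M.pstep n x x

/-- The volume growth condition `(V_α)`. -/
def VolGrowth : Prop :=
  ∃ c > (0:ℝ), ∃ C > (0:ℝ), ∀ (x : M.V) (r : ℝ), 1 ≤ r →
    c * r ^ M.α ≤ (∑ᶠ y ∈ M.ball x r, M.lamTot y) ∧
      (∑ᶠ y ∈ M.ball x r, M.lamTot y) ≤ C * r ^ M.α

/-- The Green's function decay condition `(G_ν)`. -/
def GreenDecay : Prop :=
  ∃ c > (0:ℝ), ∃ C > (0:ℝ),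
    (∀ x : M.V, c ≤ M.green x x ∧ M.green x x ≤ C) ∧
    ∀ x y : M.V, x ≠ y →
      c * M.d x y ^ (-M.ν) ≤ M.green x y ∧ M.green x y ≤ C * M.d x y ^ (-M.ν)

/-- The standing assumptions on the graph: transience, `(V_α)` and `(G_ν)`. -/
def Standing : Prop := M.Transient ∧ M.VolGrowth ∧ M.GreenDecay

/-- The graph distance `d_gr` on `𝒢`. -/
def graphDist (x y : M.V) : ℝ :=
  sInf {r : ℝ | ∃ n : ℕ, r = n ∧ ∃ γ : Fin (n + 1) → M.V, γ 0 = x ∧ γ (Fin.last n) = y ∧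
    ∀ i : Fin n, 0 < M.lam (γ i.castSucc) (γ i.succ)}

/-- Capacity of a finite set of vertices, via the variational characterization
`cap(K) = (inf_μ Σ_{x,y} μ(x) g(x,y) μ(y))⁻¹`, the infimum being over probability
measures supported on `K`. -/
def capFinset (K : Finset M.V) : ℝ :=
  (sInf {E : ℝ | ∃ μ : M.V → ℝ, (∀ x, 0 ≤ μ x) ∧ (∀ x, x ∉ K → μ x = 0) ∧
    (∑ x ∈ K, μ x) = 1 ∧ E = ∑ x ∈ K, ∑ y ∈ K, μ x * M.green x y * μ y})⁻¹

/-- Capacity of an arbitrary set of vertices. -/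
def cap (S : Set M.V) : ℝ := ⨆ K : {K : Finset M.V // ↑K ⊆ S}, M.capFinset K.1

/-- Weight `∏_{i<n} p(x_i, x_{i+1})` of a finite random walk trajectory. -/
def pathWt {n : ℕ} (γ : Fin (n + 1) → M.V) : ℝ := ∏ i : Fin n, M.p (γ i.castSucc) (γ i.succ)

/-- `P_z[H_x < H_O]`: the probability that the random walk started at `z` hits `x`
strictly before hitting the set `O`, expressed through a first-passage path decomposition. -/
def hitBefore (z x : M.V) (O : Set M.V) : ℝ :=
  ∑' n : ℕ, ∑' γ : Fin (n + 1) → M.V,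
    if γ 0 = z ∧ γ (Fin.last n) = x ∧ x ∉ O ∧
        (∀ i : Fin (n + 1), i ≠ Fin.last n → γ i ∉ O ∧ γ i ≠ x)
      then M.pathWt γ else 0

/-- Distance from a point to a set. -/
def dSet (x : M.V) (S : Set M.V) : ℝ := sInf (M.d x '' S)

/-! ### Discrete (rooted) loops

A rooted discrete loop visiting `m + 2` vertices (`m ≥ 0`), i.e. making at least two
jumps, encoded by its skeleton `Z_0, …, Z_{n-1}` (with `Z_n = Z_0`, indices mod `n`). -/

/-- The type of rooted discrete loops on `G` making `n = m + 2 ≥ 2` jumps. -/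
abbrev DLoop : Type := Σ m : ℕ, Fin (m + 2) → M.V

/-- The mass `(1/n) ∏_{0 ≤ i < n} λ_{x_i,x_{i+1}}/λ_{x_i}` that the loop measure `μ`
assigns to a given rooted discrete loop (its discrete skeleton intensity). -/
def dloopWt (γ : M.DLoop) : ℝ≥0∞ :=
  ENNReal.ofReal ((1 / ((γ.1 : ℝ) + 2)) * ∏ i : Fin (γ.1 + 2), M.p (γ.2 i) (γ.2 (i + 1)))

/-- The set of vertices visited by a discrete loop (`range(γ) ∩ G` for the
corresponding continuous loop). -/
def dloopRange (γ : M.DLoop) : Set M.V := Set.range γ.2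

/-- The loop measure `μ` evaluated on a set of (skeletons of) loops: since the events of
interest only depend on the vertices visited by a loop, the measure under `μ` of such an
event coincides with the total mass of the corresponding discrete skeletons. -/
def loopMeas (S : Set M.DLoop) : ℝ≥0∞ := ∑' γ : S, M.dloopWt γ

end WGraph

/-! ## Graphs equipped with an approximate renormalized lattice `Λ(L)` -/

structure LGraph extends WGraph where
  (Lat : ℝ → Set V)
  (Lat_base : ∀ L : ℝ, 1 ≤ L → o ∈ Lat L)
  (Lat_cover : ∀ L : ℝ, 1 ≤ L → ∀ x, ∃ y ∈ Lat L, d y x ≤ L)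
  (Lat_disj : ∀ L : ℝ, 1 ≤ L → ∀ y ∈ Lat L, ∀ z ∈ Lat L, y ≠ z →
    ∀ w, d y w ≤ L / 2 → ¬ d z w ≤ L / 2)
  (Lat_card : ∃ CΛ > (0:ℝ), ∀ L : ℝ, 1 ≤ L → ∀ (x : V) (N : ℕ), 1 ≤ N →
    {y | y ∈ Lat L ∧ d x y ≤ L * N}.Finite ∧
      ({y | y ∈ Lat L ∧ d x y ≤ L * N}.ncard : ℝ) ≤ CΛ * (N : ℝ) ^ α)

namespace LGraph

variable (M : LGraph)

/-- A path `π = (x_i)_{1 ≤ i ≤ M}` in `Λ(L)` from the base point `0` to `A ⊆ G`. -/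
def IsLatPath (L : ℝ) (A : Set M.V) {m : ℕ} (pa : Fin (m + 1) → M.V) : Prop :=
  pa 0 = M.o ∧ pa (Fin.last m) ∈ A ∧ (∀ i, pa i ∈ M.Lat L) ∧
    ∀ i : Fin m, ∃ x y, M.d (pa i.castSucc) x ≤ L ∧ M.d (pa i.succ) y ≤ L ∧ 0 < M.lam x y

/-- `𝒪 ⊆ G` is an `(L,R,n,κ)`-good obstacle: every path in `Λ(L)` from `0` to `B_R^c`
contains at least `n` points `y` (within `B_R`) with `cap(𝒪 ∩ B(y,L)) ≥ κ`. -/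
def GoodObstacle (O : Set M.V) (L R : ℝ) (n : ℝ) (κ : ℝ) : Prop :=
  ∀ (m : ℕ) (pa : Fin (m + 1) → M.V), M.IsLatPath L {y | R < M.d M.o y} pa →
    ∃ A : Finset M.V, (∀ y ∈ A, (∃ i, pa i = y) ∧ M.d M.o y ≤ R) ∧ n ≤ (A.card : ℝ) ∧
      ∀ y ∈ A, κ ≤ M.toWGraph.cap (O ∩ {z | M.d y z ≤ L})

/-- The layer `𝒜_k ⊆ Λ(L)` of lattice points whose `L`-ball meets the interior
boundary `∂B(0, C₁ k L)`. -/
def layer (C₁ L : ℝ) (k : ℕ) : Set M.V :=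
  {x | x ∈ M.Lat L ∧ ∃ y, M.d x y ≤ L ∧ M.d M.o y ≤ C₁ * k * L ∧
    ∃ z, 0 < M.lam y z ∧ C₁ * k * L < M.d M.o z}

/-- The annulus `𝔸_k = ∪_{x ∈ 𝒜_k} B(x,L)`. -/
def annulus (C₁ L : ℝ) (k : ℕ) : Set M.V := {v | ∃ x ∈ M.layer C₁ L k, M.d x v ≤ L}

end LGraph

/-! ## The Gaussian free field and its associated bond percolation `E^{≥a}` -/

/-- A transient weighted graph together with a Gaussian free field `φ` (law `ℙ`) and,
conditionally on `φ`, independent bond percolation configurations: each edge `{x,y}` is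
retained in `E^{≥a}` (i.e. `opn a`) independently with probability
`1 - exp(-2 λ_{x,y} (φ_x - a)_+ (φ_y - a)_+)`. -/
structure Model extends WGraph where
  (Ω : Type) [mΩ : MeasurableSpace Ω] (P : Measure Ω) (Pprob : IsProbabilityMeasure P)
  (φ : Ω → V → ℝ)
  (φ_meas : ∀ x, Measurable fun ω => φ ω x)
  -- `φ` is the centered Gaussian field with covariance the Green's function `g`
  (φ_gauss : ∀ (s : Finset V) (c : V → ℝ),
    Measure.map (fun ω => ∑ x ∈ s, c x * φ ω x) P =
      gaussianReal 0 (Real.toNNReal (∑ x ∈ s, ∑ y ∈ s, c x * c y * toWGraph.green x y)))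
  (opn : ℝ → Ω → V → V → Prop)
  (opn_symm : ∀ a ω x y, opn a ω x y → opn a ω y x)
  (opn_edge : ∀ a ω x y, opn a ω x y → 0 < lam x y)
  (opn_meas : ∀ a x y, MeasurableSet {ω | opn a ω x y})
  -- conditionally on `φ`, edges are open independently with the prescribed probabilities
  (opn_law : ∀ (a : ℝ) (s t : Finset (V × V)), Disjoint s t →
    (∀ e ∈ s ∪ t, ∀ f ∈ s ∪ t, e ≠ f → e ≠ Prod.swap f) →
    ∀ B : Set (V → ℝ), MeasurableSet B →
      P ({ω | φ ω ∈ B} ∩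
          {ω | (∀ e ∈ s, opn a ω e.1 e.2) ∧ (∀ e ∈ t, ¬ opn a ω e.1 e.2)}) =
      ∫⁻ ω in {ω | φ ω ∈ B},
        ENNReal.ofReal
          ((∏ e ∈ s,
            (1 - Real.exp (-(2 * lam e.1 e.2 * max (φ ω e.1 - a) 0 * max (φ ω e.2 - a) 0)))) *
           ∏ e ∈ t,
            Real.exp (-(2 * lam e.1 e.2 * max (φ ω e.1 - a) 0 * max (φ ω e.2 - a) 0))) ∂P)

attribute [instance] Model.mΩ

namespace Model

variable (M : Model)

/-- `x` and `y` are connected by a path of open edges of `E^{≥a}`. -/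
def conn (a : ℝ) (ω : M.Ω) (x y : M.V) : Prop :=
  Relation.ReflTransGen (fun u v => M.opn a ω u v) x y

/-- The open cluster `𝒦^a` of `x` in `E^{≥a}`. -/
def cluster (a : ℝ) (ω : M.Ω) (x : M.V) : Set M.V := {y | M.conn a ω x y}

/-- The probability of an event. -/
def prob (s : Set M.Ω) : ℝ := (M.P s).toReal

/-- The one-arm event `{x ↔ B(x,R)^c}` in `E^{≥0}`. -/
def armEvent (x : M.V) (R : ℝ) : Set M.Ω := {ω | ∃ y, R < M.d x y ∧ M.conn 0 ω x y}

/-- The truncated two-point function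
`τ_a^tr(x,y) = ℙ(x ↔ y in E^{≥a}, x ↮ ∞ in E^{≥a})`. -/
def tau (a : ℝ) (x y : M.V) : ℝ :=
  M.prob {ω | M.conn a ω x y ∧ (M.cluster a ω x).Finite}

/-- The truncated expected cluster volume `𝔼[|𝒦^a| 1_{|𝒦^a| < ∞}]`. -/
def clusterVol (a : ℝ) (x : M.V) : ℝ≥0∞ :=
  ∫⁻ ω, (if (M.cluster a ω x).Finite then ((M.cluster a ω x).ncard : ℝ≥0∞) else 0) ∂M.P

end Model

/-! ## The concrete case `G = ℤ³` with unit weights and the Euclidean distance -/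

/-- The vertex set `ℤ³`. -/
abbrev Z3 : Type := Fin 3 → ℤ

/-- Euclidean distance on `ℤ³`. -/
def dZ (x y : Z3) : ℝ := Real.sqrt (∑ i, ((x i : ℝ) - (y i : ℝ)) ^ 2)

/-- Unit weights: `λ_{x,y} = 1_{|x-y| = 1}`. -/
def lamZ (x y : Z3) : ℝ := if dZ x y = 1 then 1 else 0

/-- Transition probabilities of simple random walk on `ℤ³`. -/
def pZ (x y : Z3) : ℝ := lamZ x y / 6

/-- `n`-step transition probabilities of simple random walk on `ℤ³`. -/
def pstepZ : ℕ → Z3 → Z3 → ℝ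
  | 0, x, y => if x = y then 1 else 0
  | n + 1, x, y => ∑ᶠ z, pZ x z * pstepZ n z y

/-- The Green's function of simple random walk on `ℤ³` (with the normalization
`g(x,y) = λ_y^{-1} Σ_n P_x[Z_n = y]`, `λ_y = 6`). -/
def greenZ (x y : Z3) : ℝ := (∑' n, pstepZ n x y) / 6

/-- Euclidean distance between a point of `ℝ³` and a point of `ℤ³`. -/
def dMix (u : Fin 3 → ℝ) (z : Z3) : ℝ := Real.sqrt (∑ i, (u i - (z i : ℝ)) ^ 2)

/-- The Gaussian free field on `ℤ³` together with the associated bond percolation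
configurations `E^{≥a}`. -/
structure PercZ3 where
  (Ω : Type) [mΩ : MeasurableSpace Ω] (P : Measure Ω) (Pprob : IsProbabilityMeasure P)
  (φ : Ω → Z3 → ℝ)
  (φ_meas : ∀ x, Measurable fun ω => φ ω x)
  (φ_gauss : ∀ (s : Finset Z3) (c : Z3 → ℝ),
    Measure.map (fun ω => ∑ x ∈ s, c x * φ ω x) P =
      gaussianReal 0 (Real.toNNReal (∑ x ∈ s, ∑ y ∈ s, c x * c y * greenZ x y)))
  (opn : ℝ → Ω → Z3 → Z3 → Prop)
  (opn_symm : ∀ a ω x y, opn a ω x y → opn a ω y x)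
  (opn_edge : ∀ a ω x y, opn a ω x y → 0 < lamZ x y)
  (opn_meas : ∀ a x y, MeasurableSet {ω | opn a ω x y})
  (opn_law : ∀ (a : ℝ) (s t : Finset (Z3 × Z3)), Disjoint s t →
    (∀ e ∈ s ∪ t, ∀ f ∈ s ∪ t, e ≠ f → e ≠ Prod.swap f) →
    ∀ B : Set (Z3 → ℝ), MeasurableSet B →
      P ({ω | φ ω ∈ B} ∩
          {ω | (∀ e ∈ s, opn a ω e.1 e.2) ∧ (∀ e ∈ t, ¬ opn a ω e.1 e.2)}) =
      ∫⁻ ω in {ω | φ ω ∈ B},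
        ENNReal.ofReal
          ((∏ e ∈ s,
            (1 - Real.exp (-(2 * lamZ e.1 e.2 * max (φ ω e.1 - a) 0 * max (φ ω e.2 - a) 0)))) *
           ∏ e ∈ t,
            Real.exp (-(2 * lamZ e.1 e.2 * max (φ ω e.1 - a) 0 * max (φ ω e.2 - a) 0))) ∂P)

attribute [instance] PercZ3.mΩ

namespace PercZ3

variable (M : PercZ3)

/-- Connectivity by open edges in `E^{≥a}`. -/
def conn (a : ℝ) (ω : M.Ω) (x y : Z3) : Prop :=
  Relation.ReflTransGen (fun u v => M.opn a ω u v) x y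

/-- The open cluster of `x` in `E^{≥a}`. -/
def cluster (a : ℝ) (ω : M.Ω) (x : Z3) : Set Z3 := {y | M.conn a ω x y}

/-- The truncated two-point function on `ℤ³`. -/
def tau (a : ℝ) (x y : Z3) : ℝ :=
  ((M.P {ω | M.conn a ω x y ∧ (M.cluster a ω x).Finite}).toReal)

end PercZ3

/-! ## The metric graph (cable system) `𝔾̃`, killed Green's functions and killed GFFs -/

/-- The cable system `𝔾̃` over a graph `𝒢` (with renormalized lattice), together with the
killed Green's functions `g_U` and the laws `ℙ_U` of the Gaussian free field on open sets
`U ⊆ 𝔾̃` (the field killed outside `U`). -/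
structure CableG extends LGraph where
  (Gt : Type) [topGt : TopologicalSpace Gt] [msGt : MeasurableSpace Gt]
  (ι : V → Gt) (ι_inj : Function.Injective ι)
  (gU : Set Gt → Gt → Gt → ℝ)
  (gU_symm : ∀ U x y, gU U x y = gU U y x)
  (gU_zero : ∀ U x y, x ∉ U → gU U x y = 0)
  -- the Green's function of the full cable system restricts to `g` on `G`
  (gU_univ : ∀ x y : V, gU Set.univ (ι x) (ι y) = toWGraph.green x y)
  (PU : Set Gt → Measure (Gt → ℝ))
  (PU_prob : ∀ U, IsProbabilityMeasure (PU U))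
  -- `ℙ_U` is the law of the centered Gaussian field with covariance `g_U`
  (PU_gauss : ∀ (U : Set Gt) (s : Finset Gt) (c : Gt → ℝ),
    Measure.map (fun h => ∑ q ∈ s, c q * h q) (PU U) =
      gaussianReal 0 (Real.toNNReal (∑ q ∈ s, ∑ q' ∈ s, c q * c q' * gU U q q')))

attribute [instance] CableG.topGt CableG.msGt

/-- A probability space. -/
structure ProbSpace where
  (Ω : Type) [mΩ : MeasurableSpace Ω] (P : Measure Ω) (Pprob : IsProbabilityMeasure P)

attribute [instance] ProbSpace.mΩ

/-- A cable system as above, together with the laws of the vacant sets `Ṽ^u` of random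
interlacements at level `u > 0` on `𝔾̃`, axiomatized through their characterizing
properties: `Ṽ^u` is open and `ℙ(F ⊆ Ṽ^u) = exp(-u cap(F))` for finite `F ⊆ G`. -/
structure CableRI extends CableG where
  [msSetGt : MeasurableSpace (Set Gt)]
  (RIVacant : ℝ → Measure (Set Gt))
  (RIVacant_prob : ∀ u : ℝ, 0 < u → IsProbabilityMeasure (RIVacant u))
  (RIVacant_open : ∀ u : ℝ, 0 < u → ∀ᵐ S ∂(RIVacant u), @IsOpen Gt topGt S)
  (RIVacant_cap : ∀ u : ℝ, 0 < u → ∀ F : Finset V,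
    (RIVacant u {S | ∀ x ∈ F, ι x ∈ S}).toReal =
      Real.exp (-(u * toWGraph.capFinset F)))

attribute [instance] CableRI.msSetGt

/-! ## The Markovian loop soup at intensity `1/2` on the cable system -/

/-- The Poisson loop soup `ℒ` of intensity `(1/2)μ` on the cable system `𝔾̃` of a graph
`𝒢` (with renormalized lattice), under the law `Q`.  Continuous loops are axiomatized
through their ranges in `𝔾̃` and their discrete skeletons; the intensity measure `μ` is
pinned down via its (concrete) discrete skeleton intensity, and the law of the soup via
its void probabilities `Q(ℒ ∩ S = ∅) = exp(-μ(S)/2)`. -/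
structure LoopSoup extends LGraph where
  -- the cable system
  (Gt : Type) [topGt : TopologicalSpace Gt]
  (ι : V → Gt) (ι_inj : Function.Injective ι)
  (cable : V → V → Set Gt)
  (cable_symm : ∀ x y, cable x y = cable y x)
  (cable_ends : ∀ x y, 0 < lam x y → ι x ∈ cable x y ∧ ι y ∈ cable x y)
  (cable_vertices : ∀ x y, 0 < lam x y → ∀ v : V, ι v ∈ cable x y → v = x ∨ v = y)
  (cable_cover : ∀ q : Gt, (∃ v, q = ι v) ∨ ∃ x y, 0 < lam x y ∧ q ∈ cable x y)
  -- continuous loops on the cable system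
  (CLoop : Type) [msLoop : MeasurableSpace CLoop]
  (crange : CLoop → Set Gt)
  (traceG : CLoop → Set V)
  (trace_spec : ∀ γ, traceG γ = {v | ι v ∈ crange γ})
  -- the loop measure `μ` and its discrete skeleton
  (μC : Measure CLoop)
  (skel : CLoop → Option (Σ m : ℕ, Fin (m + 2) → V))
  (skel_spec : ∀ γ dγ, skel γ = some dγ → traceG γ = Set.range dγ.2)
  (skel_trivial : ∀ γ, skel γ = none → (traceG γ).Subsingleton)
  (μC_skel : ∀ S : Set (Σ m : ℕ, Fin (m + 2) → V),
    μC {γ | ∃ dγ ∈ S, skel γ = some dγ} = toWGraph.loopMeas S)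
  -- the loop soup and its law
  (Ωq : Type) [mΩq : MeasurableSpace Ωq] (Q : Measure Ωq) (Qprob : IsProbabilityMeasure Q)
  (soup : Ωq → Set CLoop)
  (soup_void : ∀ S : Set CLoop, MeasurableSet S →
    Q {ω | ∀ γ ∈ soup ω, γ ∉ S} = expNegE (μC S / 2))

attribute [instance] LoopSoup.topGt LoopSoup.msLoop LoopSoup.mΩq

namespace LoopSoup

variable (M : LoopSoup)

/-- Two loops of the soup are linked if they can be joined by a finite chain of loops of
the soup whose ranges successively intersect. -/
def linked (ω : M.Ωq) (γ γ' : M.CLoop) : Prop :=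
  Relation.ReflTransGen
    (fun g g' => g ∈ M.soup ω ∧ g' ∈ M.soup ω ∧ (M.crange g ∩ M.crange g').Nonempty) γ γ'

/-- The trace `𝒞` on `𝔾̃` of the cluster of loops of `ℒ` containing the base point `0`. -/
def C0 (ω : M.Ωq) : Set M.Gt :=
  {q | ∃ γ ∈ M.soup ω, q ∈ M.crange γ ∧
    ∃ γ₀ ∈ M.soup ω, M.ι M.o ∈ M.crange γ₀ ∧ M.linked ω γ γ₀}

/-- A loop is big (for the parameters `δ, L`) if `cap(range(γ) ∩ G) ≥ δ L^ν (log L)^{-b₂}`. -/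
def isBig (δ L : ℝ) (γ : M.CLoop) : Prop :=
  δ * L ^ M.ν * Real.log L ^ (-(bTwo M.ν M.α)) ≤ M.toWGraph.cap (M.traceG γ)

/-- The box `B̃(x,L) ⊆ 𝔾̃`: the ball `B(x,L)` together with all cables joining
neighbouring vertices of `B(x,L)`. -/
def Btilde (x : M.V) (L : ℝ) : Set M.Gt :=
  (M.ι '' {y | M.d x y ≤ L}) ∪
    ⋃ (u : M.V) (v : M.V) (_ : 0 < M.lam u v ∧ M.d x u ≤ L ∧ M.d x v ≤ L), M.cable u v

/-- A loop belongs to (the support of) `ℒ_k^b`: it is big and its range is contained in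
`B̃(x,L)` for some `x ∈ 𝒜_k`. -/
def inLayerBig (C₁ δ L : ℝ) (k : ℕ) (γ : M.CLoop) : Prop :=
  M.isBig δ L γ ∧ ∃ x ∈ M.toLGraph.layer C₁ L k, M.crange γ ⊆ M.Btilde x L

/-- The event `𝐁_k`: the cluster `𝒞` of `0` reaches `B_R^c` but contains no big loop of
`ℒ_k^b`. -/
def Bk (C₁ δ L R : ℝ) (k : ℕ) : Set M.Ωq :=
  {ω | (∃ y : M.V, R < M.d M.o y ∧ M.ι y ∈ M.C0 ω) ∧
    ∀ γ ∈ M.soup ω, M.inLayerBig C₁ δ L k γ → ¬ M.crange γ ⊆ M.C0 ω}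

/-- The number `N` of bad annuli among `k ∈ {1, …, ℓ}`. -/
def Nbad (C₁ δ L R : ℝ) (ℓ : ℕ) (ω : M.Ωq) : ℕ :=
  ((Finset.Icc 1 ℓ).filter fun k => ω ∈ M.Bk C₁ δ L R k).card

/-- The obstacle set `𝒪 = G ∩ 𝐼̃_D^b`: all vertices visited by a big loop of the soup
contained in a box `B̃(x,L)` with `x ∈ 𝒜_k` for some `k ∈ D`. -/
def obstacleD (C₁ δ L : ℝ) (D : Finset ℕ) (ω : M.Ωq) : Set M.V :=
  {v | ∃ γ ∈ M.soup ω, (∃ k ∈ D, M.inLayerBig C₁ δ L k γ) ∧ M.ι v ∈ M.crange γ}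

end LoopSoup

section StieltjesMatrices

open Matrix

variable {ι : Type*} [Fintype ι] [DecidableEq ι]

/-- Symmetric positive definite matrices with nonpositive off-diagonal entries. -/
structure Stieltjes (Q : Matrix ι ι ℝ) : Prop where
  symm : ∀ x y, Q x y = Q y x
  off : ∀ x y, x ≠ y → Q x y ≤ 0
  pos : ∀ f : ι → ℝ, f ≠ 0 → 0 < f ⬝ᵥ (Q *ᵥ f)

omit [DecidableEq ι] in
/-- Cauchy–Schwarz for positive semidefinite symmetric forms. -/
lemma form_cauchy_schwarz (G : Matrix ι ι ℝ) (hs : ∀ x y, G x y = G y x)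
    (hp : ∀ f : ι → ℝ, 0 ≤ f ⬝ᵥ (G *ᵥ f)) (u v : ι → ℝ) :
    (u ⬝ᵥ (G *ᵥ v)) ^ 2 ≤ (u ⬝ᵥ (G *ᵥ u)) * (v ⬝ᵥ (G *ᵥ v)) := by
  have hsym : v ⬝ᵥ (G *ᵥ u) = u ⬝ᵥ (G *ᵥ v) := by
    rw [Matrix.dotProduct_mulVec, dotProduct_comm, ← Matrix.mulVec_transpose]
    congr 2
    ext x y
    exact hs y x
  have h : ∀ t : ℝ, 0 ≤ (u ⬝ᵥ (G *ᵥ u)) * (t * t) + (2 * (u ⬝ᵥ (G *ᵥ v))) * t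
      + v ⬝ᵥ (G *ᵥ v) := by
    intro t
    have := hp (t • u + v)
    simp only [Matrix.mulVec_add, Matrix.mulVec_smul, dotProduct_add, add_dotProduct,
      smul_dotProduct, dotProduct_smul, smul_eq_mul, hsym] at this
    linarith
  have := discrim_le_zero h
  unfold discrim at this
  linarith

namespace Stieltjes

variable {Q : Matrix ι ι ℝ} (hQ : Stieltjes Q)

include hQ

omit [DecidableEq ι] in
lemma nonneg_form (f : ι → ℝ) : 0 ≤ f ⬝ᵥ (Q *ᵥ f) := by
  by_cases h : f = 0
  · simp [h]
  · exact (hQ.pos f h).le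

omit [DecidableEq ι] in
lemma form_comm (f g : ι → ℝ) : f ⬝ᵥ (Q *ᵥ g) = g ⬝ᵥ (Q *ᵥ f) := by
  rw [Matrix.dotProduct_mulVec, dotProduct_comm, ← Matrix.mulVec_transpose]
  congr 2
  ext x y
  exact hQ.symm y x

/-- Maximum principle for subharmonic functions. -/
lemma max_principle (T : Finset ι) (f : ι → ℝ) (h1 : ∀ x ∈ T, (Q *ᵥ f) x ≤ 0)
    (h2 : ∀ y, y ∉ T → (∃ x ∈ T, Q x y ≠ 0) → f y ≤ 0) : ∀ x ∈ T, f x ≤ 0 := by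
  set u : ι → ℝ := fun x => if x ∈ T then max (f x) 0 else 0 with hu
  have hu0 : ∀ x, 0 ≤ u x := by
    intro x; simp only [hu]; split_ifs <;> simp
  have hle : u ⬝ᵥ (Q *ᵥ u) ≤ 0 := by
    calc u ⬝ᵥ (Q *ᵥ u) ≤ u ⬝ᵥ (Q *ᵥ f) := by
          simp only [dotProduct, mulVec]
          refine Finset.sum_le_sum fun x _ => ?_
          by_cases hux : u x = 0
          · simp [hux]
          have hxT : x ∈ T := by
            by_contra h; exact hux (by simp [hu, h])
          refine mul_le_mul_of_nonneg_left (Finset.sum_le_sum fun y _ => ?_) (hu0 x)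
          by_cases hxy : x = y
          · subst hxy
            have : u x = f x := by
              have h3 : u x = max (f x) 0 := by simp [hu, hxT]
              rcases max_choice (f x) 0 with h | h
              · rw [h3, h]
              · exact absurd (h3.trans h) hux
            rw [this]
          · have hq := hQ.off x y hxy
            by_cases hyT : y ∈ T
            · have : f y ≤ u y := by simp [hu, hyT]
              nlinarith
            · have hy0 : u y = 0 := by simp [hu, hyT]
              rw [hy0, mul_zero]
              by_cases hqq : Q x y = 0
              · simp [hqq]
              · have := h2 y hyT ⟨x, hxT, hqq⟩
                nlinarith
      _ ≤ 0 := by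
          refine Finset.sum_nonpos fun x _ => ?_
          by_cases hxT : x ∈ T
          · exact mul_nonpos_of_nonneg_of_nonpos (hu0 x) (h1 x hxT)
          · simp [hu, hxT]
  have hu_zero : u = 0 := by
    by_contra h
    exact absurd (hQ.pos u h) (not_lt.mpr hle)
  intro x hx
  have := congrFun hu_zero x
  simp only [hu, hx, if_true, Pi.zero_apply] at this
  exact (le_max_left _ _).trans this.le

/-- Uniqueness for the Dirichlet problem. -/
lemma eq_zero_of_harmonic (T : Finset ι) (f : ι → ℝ) (h1 : ∀ x ∈ T, (Q *ᵥ f) x = 0)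
    (h2 : ∀ y, y ∉ T → f y = 0) : f = 0 := by
  ext x
  by_cases hx : x ∈ T
  · refine le_antisymm (hQ.max_principle T f (fun x hx => (h1 x hx).le)
      (fun y hy _ => (h2 y hy).le) x hx) ?_
    have := hQ.max_principle T (-f) (fun x hx => by simp [Matrix.mulVec_neg, h1 x hx])
      (fun y hy _ => by simp [h2 y hy]) x hx
    simpa using this
  · exact h2 x hx

end Stieltjes

/-- The matrix `Q` on `U`, completed by the identity outside `U`. -/
def killedMatrix (Q : Matrix ι ι ℝ) (U : Finset ι) : Matrix ι ι ℝ := fun x y =>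
  if x ∈ U ∧ y ∈ U then Q x y else if x = y then 1 else 0

/-- The Green's function of `Q` killed outside `U`. -/
def gk (Q : Matrix ι ι ℝ) (U : Finset ι) : Matrix ι ι ℝ := fun x y =>
  if x ∈ U ∧ y ∈ U then (killedMatrix Q U)⁻¹ x y else 0

lemma gk_of_notMem_left (Q : Matrix ι ι ℝ) {U : Finset ι} {x : ι} (hx : x ∉ U) (y : ι) :
    gk Q U x y = 0 := by simp [gk, hx]

lemma gk_of_notMem_right (Q : Matrix ι ι ℝ) {U : Finset ι} {y : ι} (hy : y ∉ U) (x : ι) :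
    gk Q U x y = 0 := by simp [gk, hy]

namespace Stieltjes

variable {Q : Matrix ι ι ℝ} (hQ : Stieltjes Q)

include hQ

lemma isUnit_killedMatrix (U : Finset ι) : IsUnit (killedMatrix Q U) := by
  rw [← Matrix.mulVec_injective_iff_isUnit]
  have key : ∀ f : ι → ℝ, killedMatrix Q U *ᵥ f = 0 → f = 0 := by
    intro f hf
    have h2 : ∀ y, y ∉ U → f y = 0 := by
      intro y hy
      have := congrFun hf y
      simpa [mulVec, dotProduct, killedMatrix, hy] using this
    refine hQ.eq_zero_of_harmonic U f (fun x hx => ?_) h2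
    have := congrFun hf x
    simp only [mulVec, dotProduct, Pi.zero_apply] at this ⊢
    rw [← this]
    refine Finset.sum_congr rfl fun y _ => ?_
    by_cases hy : y ∈ U
    · simp [killedMatrix, hx, hy]
    · simp [h2 y hy]
  intro f g hfg
  have := key (f - g) (by rw [Matrix.mulVec_sub]; exact sub_eq_zero.mpr hfg)
  exact sub_eq_zero.mp this

lemma killedMatrix_inv_symm (U : Finset ι) (x y : ι) :
    (killedMatrix Q U)⁻¹ x y = (killedMatrix Q U)⁻¹ y x := by
  have h : (killedMatrix Q U)ᵀ = killedMatrix Q U := by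
    ext x y
    simp only [transpose_apply, killedMatrix, hQ.symm y x, and_comm, eq_comm]
  have := Matrix.transpose_nonsing_inv (killedMatrix Q U)
  rw [h] at this
  exact congrFun (congrFun this y) x

lemma gk_symm (U : Finset ι) (x y : ι) : gk Q U x y = gk Q U y x := by
  simp only [gk, hQ.killedMatrix_inv_symm U x y, and_comm]

lemma mulVec_gk (U : Finset ι) {x z : ι} (hx : x ∈ U) (hz : z ∈ U) :
    (Q *ᵥ fun y => gk Q U y z) x = if x = z then 1 else 0 := by
  have h : killedMatrix Q U * (killedMatrix Q U)⁻¹ = 1 :=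
    Matrix.mul_nonsing_inv _ ((Matrix.isUnit_iff_isUnit_det _).mp (hQ.isUnit_killedMatrix U))
  have h2 := congrFun (congrFun h x) z
  rw [Matrix.one_apply, Matrix.mul_apply] at h2
  rw [← h2]
  simp only [mulVec, dotProduct]
  refine Finset.sum_congr rfl fun y _ => ?_
  by_cases hy : y ∈ U
  · simp [killedMatrix, gk, hx, hy, hz]
  · have hxy : x ≠ y := fun h => hy (h ▸ hx)
    simp [killedMatrix, gk, hy, hxy]

/-- Green's representation of functions vanishing outside `U`. -/
lemma gk_mulVec_mulVec (U : Finset ι) (f : ι → ℝ) (hf : ∀ y, y ∉ U → f y = 0) (x : ι) :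
    (gk Q U *ᵥ (Q *ᵥ f)) x = f x := by
  by_cases hx : x ∈ U
  · have h1 : (gk Q U *ᵥ (Q *ᵥ f)) x = (fun y => gk Q U y x) ⬝ᵥ (Q *ᵥ f) := by
      simp only [mulVec, dotProduct]
      exact Finset.sum_congr rfl fun y _ => by rw [hQ.gk_symm U x y]
    rw [h1, hQ.form_comm, dotProduct, Finset.sum_eq_single x]
    · rw [hQ.mulVec_gk U hx hx]; simp
    · intro y _ hyx
      by_cases hy : y ∈ U
      · rw [hQ.mulVec_gk U hy hx]; simp [hyx]
      · simp [hf y hy]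
    · simp
  · rw [hf x hx]
    simp [mulVec, dotProduct, gk_of_notMem_left Q hx]

lemma gk_nonneg (U : Finset ι) (x z : ι) : 0 ≤ gk Q U x z := by
  by_cases hz : z ∈ U
  · by_cases hx : x ∈ U
    · have := hQ.max_principle U (-fun y => gk Q U y z) (fun y hy => by
        rw [Matrix.mulVec_neg, Pi.neg_apply, hQ.mulVec_gk U hy hz]
        split_ifs <;> norm_num) (fun y hy _ => by simp [gk_of_notMem_left Q hy]) x hx
      simpa using this
    · rw [gk_of_notMem_left Q hx]
  · rw [gk_of_notMem_right Q hz]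

lemma gk_mono {U U' : Finset ι} (h : U ⊆ U') (x z : ι) : gk Q U x z ≤ gk Q U' x z := by
  by_cases hz : z ∈ U
  · by_cases hx : x ∈ U
    · have := hQ.max_principle U ((fun y => gk Q U y z) - fun y => gk Q U' y z) (fun y hy => by
        rw [Matrix.mulVec_sub, Pi.sub_apply, hQ.mulVec_gk U hy hz,
          hQ.mulVec_gk U' (h hy) (h hz), sub_self])
        (fun y hy _ => by simp [gk_of_notMem_left Q hy, hQ.gk_nonneg U' y z]) x hx
      simpa using this
    · rw [gk_of_notMem_left Q hx]; exact hQ.gk_nonneg U' x z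
  · rw [gk_of_notMem_right Q hz]; exact hQ.gk_nonneg U' x z

lemma mulVec_nonpos_of_eq_zero {f : ι → ℝ} (hf : ∀ y, 0 ≤ f y) {x : ι} (hx : f x = 0) :
    (Q *ᵥ f) x ≤ 0 := by
  refine Finset.sum_nonpos fun y _ => ?_
  by_cases hxy : x = y
  · subst hxy; simp [hx]
  · exact mul_nonpos_of_nonpos_of_nonneg (hQ.off x y hxy) (hf y)

lemma mulVec_gk_nonpos (U : Finset ι) {x z : ι} (hxz : x ≠ z) :
    (Q *ᵥ fun y => gk Q U y z) x ≤ 0 := by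
  by_cases hx : x ∈ U
  · by_cases hz : z ∈ U
    · rw [hQ.mulVec_gk U hx hz]; simp [hxz]
    · simp [mulVec, dotProduct, gk_of_notMem_right Q hz]
  · exact hQ.mulVec_nonpos_of_eq_zero (fun y => hQ.gk_nonneg U y z) (gk_of_notMem_left Q hx z)

lemma gk_form_nonneg (U : Finset ι) (μ : ι → ℝ) : 0 ≤ μ ⬝ᵥ (gk Q U *ᵥ μ) := by
  set f := gk Q U *ᵥ μ with hf
  have h : ∀ y ∈ U, (Q *ᵥ f) y = μ y := by
    intro y hy
    have h1 : (Q *ᵥ f) y = ∑ z, (Q *ᵥ fun y => gk Q U y z) y * μ z := by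
      simp only [hf, mulVec, dotProduct, Finset.mul_sum, Finset.sum_mul]
      rw [Finset.sum_comm]
      exact Finset.sum_congr rfl fun _ _ => Finset.sum_congr rfl fun _ _ => by ring
    rw [h1, Finset.sum_eq_single y]
    · rw [hQ.mulVec_gk U hy hy]; simp
    · intro z _ hz
      by_cases hzU : z ∈ U
      · rw [hQ.mulVec_gk U hy hzU]; simp [hz.symm]
      · have : (fun y => gk Q U y z) = 0 := by ext; simp [gk_of_notMem_right Q hzU]
        simp [this]
    · simp
  have h2 : μ ⬝ᵥ f = f ⬝ᵥ (Q *ᵥ f) := by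
    rw [dotProduct_comm]
    refine Finset.sum_congr rfl fun y _ => ?_
    by_cases hy : y ∈ U
    · rw [h y hy]
    · have : f y = 0 := by simp [hf, mulVec, dotProduct, gk_of_notMem_left Q hy]
      simp [this]
  rw [h2]
  exact hQ.nonneg_form f

/-- Sweeping out the unit mass at `z` onto `A`. -/
lemma exists_balayage (U A : Finset ι) {z : ι} (hz : z ∈ U) :
    ∃ m : ι → ℝ, (∀ x, x ∉ A ∩ U → m x = 0) ∧ (∀ x, x ∈ U → 0 ≤ m x) ∧
      ∀ y, (gk Q U *ᵥ m) y = gk Q U y z - gk Q (U \ A) y z := by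
  by_cases hzA : z ∈ A
  · refine ⟨Pi.single z 1, ?_, ?_, ?_⟩
    · intro x hx
      rw [Pi.single_apply, if_neg]
      rintro rfl
      exact hx (Finset.mem_inter.mpr ⟨hzA, hz⟩)
    · intro x _; rw [Pi.single_apply]; split_ifs <;> norm_num
    · intro y
      rw [gk_of_notMem_right Q (by simp [hzA] : z ∉ U \ A)]
      simp
  set w : ι → ℝ := (fun y => gk Q U y z) - fun y => gk Q (U \ A) y z with hw
  have hzU : z ∈ U \ A := by simp [hz, hzA]
  refine ⟨fun x => if x ∈ U then (Q *ᵥ w) x else 0, ?_, ?_, ?_⟩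
  · intro x hx
    dsimp only
    split_ifs with hxU
    · have hxA : x ∈ U \ A := by
        simp only [Finset.mem_inter, Finset.mem_sdiff] at hx ⊢; tauto
      rw [hw, Matrix.mulVec_sub, Pi.sub_apply, hQ.mulVec_gk U hxU hz,
        hQ.mulVec_gk _ hxA hzU, sub_self]
    · rfl
  · intro x hx
    simp only [hx, if_true]
    rw [hw, Matrix.mulVec_sub, Pi.sub_apply, hQ.mulVec_gk U hx hz]
    by_cases hxz : x = z
    · subst hxz; rw [hQ.mulVec_gk _ hzU hzU]; simp
    · have := hQ.mulVec_gk_nonpos (U \ A) hxz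
      simp [hxz, this]
  · intro y
    have h := hQ.gk_mulVec_mulVec U w (fun y hy => by
      have : y ∉ U \ A := by simp [hy]
      simp [hw, gk_of_notMem_left Q hy, gk_of_notMem_left Q this]) y
    have hwy : w y = gk Q U y z - gk Q (U \ A) y z := by simp [hw]
    rw [← hwy, ← h]
    simp only [mulVec, dotProduct]
    refine Finset.sum_congr rfl fun x _ => ?_
    by_cases hx : x ∈ U
    · simp [hx]
    · simp [hx, gk_of_notMem_right Q hx]

/-- Projection bound for the decrease of the Green's function due to killing on `A`. -/
lemma sq_gk_mulVec_le (U A : Finset ι) {z : ι} (hz : z ∈ U) (μ : ι → ℝ)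
    (hμ : ∀ x, x ∉ A → μ x = 0) :
    ((gk Q U *ᵥ μ) z) ^ 2 ≤ (gk Q U z z - gk Q (U \ A) z z) * (μ ⬝ᵥ (gk Q U *ᵥ μ)) := by
  obtain ⟨m, hm0, -, hm⟩ := hQ.exists_balayage U A hz
  have key : ∀ η : ι → ℝ, (∀ x, x ∉ A → η x = 0) → (gk Q U *ᵥ η) z = η ⬝ᵥ (gk Q U *ᵥ m) := by
    intro η hη
    simp only [mulVec, dotProduct] at hm ⊢
    refine Finset.sum_congr rfl fun x _ => ?_
    by_cases hx : x ∈ A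
    · rw [hm x, gk_of_notMem_left Q (by simp [hx] : x ∉ U \ A), hQ.gk_symm U z x]; ring
    · simp [hη x hx]
  have h1 := key μ hμ
  have h2 := key m (fun x hx => hm0 x (by simp [hx]))
  rw [h1, mul_comm, ← hm z, h2]
  exact form_cauchy_schwarz _ (hQ.gk_symm U) (hQ.gk_form_nonneg U) μ m

lemma gk_diag_pos (U : Finset ι) {z : ι} (hz : z ∈ U) : 0 < gk Q U z z := by
  set f : ι → ℝ := fun y => gk Q U y z with hf
  have h2 : f ⬝ᵥ (Q *ᵥ f) = gk Q U z z := by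
    rw [dotProduct, Finset.sum_eq_single z]
    · rw [hf, hQ.mulVec_gk U hz hz]; simp
    · intro y _ hyz
      by_cases hy : y ∈ U
      · rw [hf, hQ.mulVec_gk U hy hz]; simp [hyz]
      · simp [hf, gk_of_notMem_left Q hy]
    · simp
  rw [← h2]
  refine hQ.pos f fun h => ?_
  have := hQ.mulVec_gk U hz hz
  rw [← hf, h] at this
  simp at this

/-- Killing at a single point. -/
lemma gk_sub_singleton (U : Finset ι) {z v : ι} (hz : z ∈ U) (hv : v ∈ U) :
    gk Q U z z - gk Q (U \ {v}) z z = gk Q U z v ^ 2 / gk Q U v v := by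
  obtain ⟨m, hm0, -, hm⟩ := hQ.exists_balayage U {v} hz
  have hmv : m = Pi.single v (m v) := by
    ext x
    rw [Pi.single_apply]
    split_ifs with h
    · rw [h]
    · exact hm0 x (by simp [h])
  rw [hmv] at hm
  have hpos := hQ.gk_diag_pos U hv
  have e1 := hm v
  have e2 := hm z
  rw [gk_of_notMem_left Q (by simp : v ∉ U \ {v})] at e1
  simp only [Matrix.mulVec_single, Pi.smul_apply, Matrix.col_apply, MulOpposite.smul_eq_mul_unop,
    MulOpposite.unop_op] at e1 e2
  rw [← e2, eq_div_iff hpos.ne', hQ.gk_symm U z v]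
  rw [hQ.gk_symm U v z] at *
  linear_combination (gk Q U z v) * e1

end Stieltjes

end StieltjesMatrices

section StieltjesPotential

open Matrix

variable {ι : Type*} [Fintype ι] [DecidableEq ι]

lemma pair_bound_aux {a b c s s' X : ℝ} (hs : 0 < s) (hs' : 0 < s') (ha0 : 0 ≤ a) (hb0 : 0 ≤ b)
    (hc0 : 0 ≤ c) (hc : 2 * c ^ 2 ≤ s * s') (hX0 : 0 ≤ X)
    (h3 : (a * (a * s' - b * c) + b * (b * s - a * c)) ^ 2 ≤ X * ((a * s' - b * c) *
      (s * (a * s' - b * c) + c * (b * s - a * c)) + (b * s - a * c) *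
      (c * (a * s' - b * c) + s' * (b * s - a * c)))) :
    a ^ 2 / s + b ^ 2 / s' - X ≤ 4 * a * b * c / (s * s') := by
  have hss := mul_pos hs hs'
  obtain ⟨Δ, hΔ⟩ : ∃ Δ, Δ = s * s' - c ^ 2 := ⟨_, rfl⟩
  have hΔpos : 0 < Δ := by linarith
  obtain ⟨e, he⟩ : ∃ e, e = a ^ 2 * s' - 2 * (a * b * c) + b ^ 2 * s := ⟨_, rfl⟩
  have h4 : e ^ 2 ≤ X * (Δ * e) := by
    convert h3 using 1
    · rw [he]; ring
    · rw [he, hΔ]; ring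
  have he0 : 0 ≤ e := by
    have : e * s = Δ * a ^ 2 + (b * s - a * c) ^ 2 := by rw [he, hΔ]; ring
    have h5 : 0 ≤ e * s := by rw [this]; positivity
    exact nonneg_of_mul_nonneg_left h5 hs
  have h5 : e ≤ X * Δ := by
    rcases he0.eq_or_lt with h | h
    · rw [← h]; positivity
    · have : e * e ≤ (X * Δ) * e := by linarith
      exact le_of_mul_le_mul_right this h
  have h6 : a ^ 2 / s + b ^ 2 / s' - e / Δ ≤ 2 * (a * b * c) / Δ := by
    have hle : Δ ≤ s * s' := by rw [hΔ]; linarith [sq_nonneg c]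
    have k1 : a ^ 2 / s ≤ a ^ 2 * s' / Δ := by
      rw [div_le_div_iff₀ hs hΔpos]
      have := mul_le_mul_of_nonneg_left hle (sq_nonneg a)
      linarith
    have k2 : b ^ 2 / s' ≤ b ^ 2 * s / Δ := by
      rw [div_le_div_iff₀ hs' hΔpos]
      have := mul_le_mul_of_nonneg_left hle (sq_nonneg b)
      linarith
    have k3 : a ^ 2 * s' / Δ + b ^ 2 * s / Δ - e / Δ = 2 * (a * b * c) / Δ := by
      rw [he]; ring
    linarith
  have h7 : 2 * (a * b * c) / Δ ≤ 4 * a * b * c / (s * s') := by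
    rw [div_le_div_iff₀ hΔpos hss]
    have h8 : s * s' ≤ 2 * Δ := by rw [hΔ]; linarith
    have habc : 0 ≤ a * b * c := by positivity
    have := mul_le_mul_of_nonneg_left h8 habc
    linarith
  have h8 : e / Δ ≤ X := by rwa [div_le_iff₀ hΔpos]
  linarith

namespace Stieltjes

variable {Q : Matrix ι ι ℝ} (hQ : Stieltjes Q)

include hQ

lemma diag_pos (x : ι) : 0 < Q x x := by
  have := hQ.pos (Pi.single x 1) (by simp)
  simpa using this

/-- If two points are not too correlated, then killing at both of them is almost additive. -/
lemma gk_pair_le {z v v' : ι}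
    (hc : 2 * gk Q Finset.univ v v' ^ 2 ≤ gk Q Finset.univ v v * gk Q Finset.univ v' v') :
    gk Q Finset.univ z z - gk Q {v}ᶜ z z - gk Q {v'}ᶜ z z + gk Q ({v, v'} : Finset ι)ᶜ z z ≤
      4 * gk Q Finset.univ z v * gk Q Finset.univ z v' * gk Q Finset.univ v v' /
        (gk Q Finset.univ v v * gk Q Finset.univ v' v') := by
  have hs := hQ.gk_diag_pos Finset.univ (Finset.mem_univ v)
  have hs' := hQ.gk_diag_pos Finset.univ (Finset.mem_univ v')
  have hc0 := hQ.gk_nonneg Finset.univ v v'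
  have ha0 := hQ.gk_nonneg Finset.univ z v
  have hb0 := hQ.gk_nonneg Finset.univ z v'
  have hvv : v ≠ v' := by
    rintro rfl
    nlinarith [mul_pos hs hs]
  have h1 := hQ.gk_sub_singleton Finset.univ (Finset.mem_univ z) (Finset.mem_univ v)
  have h2 := hQ.gk_sub_singleton Finset.univ (Finset.mem_univ z) (Finset.mem_univ v')
  set a := gk Q Finset.univ z v
  set b := gk Q Finset.univ z v'
  set c := gk Q Finset.univ v v' with hcdef
  set s := gk Q Finset.univ v v
  set s' := gk Q Finset.univ v' v'
  have h3 := hQ.sq_gk_mulVec_le Finset.univ {v, v'} (Finset.mem_univ z)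
    (Pi.single v (a * s' - b * c) + Pi.single v' (b * s - a * c))
    (fun x hx => by
      simp only [Finset.mem_insert, Finset.mem_singleton, not_or] at hx
      simp [hx.1, hx.2])
  rw [← Finset.compl_eq_univ_sdiff] at h3
  have hvc : gk Q Finset.univ v' v = c := hQ.gk_symm _ _ _
  simp only [Matrix.mulVec_add, Matrix.mulVec_single, Pi.add_apply, Pi.smul_apply, Matrix.col_apply,
    MulOpposite.smul_eq_mul_unop, MulOpposite.unop_op, add_dotProduct, single_dotProduct] at h3
  change (a * (a * s' - b * c) + b * (b * s - a * c)) ^ 2 ≤ _ * ((a * s' - b * c) *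
    (s * (a * s' - b * c) + c * (b * s - a * c)) + (b * s - a * c) *
    (gk Q Finset.univ v' v * (a * s' - b * c) + s' * (b * s - a * c))) at h3
  rw [hvc] at h3
  have hX0 : 0 ≤ gk Q Finset.univ z z - gk Q ({v, v'} : Finset ι)ᶜ z z :=
    sub_nonneg.mpr (hQ.gk_mono (Finset.subset_univ _) z z)
  have := pair_bound_aux hs hs' ha0 hb0 hc0 hc hX0 h3
  rw [← h1, ← h2, ← Finset.compl_eq_univ_sdiff, ← Finset.compl_eq_univ_sdiff] at this
  linarith

/-- Solvability of the Dirichlet problem. -/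
lemma exists_dirichlet (T : Finset ι) (b : ι → ℝ) :
    ∃ f : ι → ℝ, (∀ x ∈ T, (Q *ᵥ f) x = 0) ∧ ∀ x, x ∉ T → f x = b x := by
  set b' : ι → ℝ := fun x => if x ∈ T then 0 else b x with hb'
  refine ⟨b' - fun x => ∑ y ∈ T, gk Q T x y * (Q *ᵥ b') y, ?_, ?_⟩
  · intro x hx
    rw [Matrix.mulVec_sub, Pi.sub_apply, sub_eq_zero]
    symm
    have h1 : (Q *ᵥ fun x => ∑ y ∈ T, gk Q T x y * (Q *ᵥ b') y) x =
        ∑ y ∈ T, (Q *ᵥ fun x => gk Q T x y) x * (Q *ᵥ b') y := by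
      generalize Q *ᵥ b' = w
      simp only [mulVec, dotProduct, Finset.mul_sum, Finset.sum_mul]
      rw [Finset.sum_comm]
      exact Finset.sum_congr rfl fun _ _ => Finset.sum_congr rfl fun _ _ => by ring
    rw [h1, Finset.sum_eq_single x]
    · rw [hQ.mulVec_gk T hx hx]; simp
    · intro y hy hyx
      rw [hQ.mulVec_gk T hx hy, if_neg hyx.symm, zero_mul]
    · exact fun h => absurd hx h
  · intro x hx
    simp [hb', hx, gk_of_notMem_left Q hx]

/-- Comparison of a subharmonic function vanishing on `B` with the probability of leaving `W`
before hitting `B`. -/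
lemma le_mul_of_dirichlet (W B : Finset ι) {v f : ι → ℝ} {M : ℝ}
    (hv : ∀ y ∈ W \ B, (Q *ᵥ v) y = 0) (hvB : ∀ y ∈ B ∩ W, 0 ≤ v y) (hv1 : ∀ y, y ∉ W → v y = 1)
    (hM : 0 ≤ M) (hf : ∀ y ∈ W \ B, (Q *ᵥ f) y ≤ 0) (hfB : ∀ y ∈ B ∩ W, f y ≤ 0)
    (hf1 : ∀ y, y ∉ W → (∃ x ∈ W, Q x y ≠ 0) → f y ≤ M) {x : ι} (hx : x ∈ W) :
    f x ≤ M * v x := by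
  have hbd : ∀ y ∈ B ∩ W, (f - M • v) y ≤ 0 := by
    intro y hy
    have := mul_nonneg hM (hvB y hy)
    simp only [Pi.sub_apply, Pi.smul_apply, smul_eq_mul]
    linarith [hfB y hy]
  have key : (f - M • v) x ≤ 0 := by
    by_cases hxB : x ∈ B
    · exact hbd x (by simp [hx, hxB])
    refine hQ.max_principle (W \ B) (f - M • v) (fun y hy => ?_) (fun y hy hn => ?_) x
      (by simp [hx, hxB])
    · rw [Matrix.mulVec_sub, Matrix.mulVec_smul, Pi.sub_apply, Pi.smul_apply, hv y hy]
      simpa using hf y hy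
    · by_cases hyW : y ∈ W
      · refine hbd y ?_
        simp only [Finset.mem_sdiff, Finset.mem_inter] at hy ⊢
        tauto
      · obtain ⟨x, hxW, hxy⟩ := hn
        have := hf1 y hyW ⟨x, (Finset.mem_sdiff.mp hxW).1, hxy⟩
        simp [hv1 y hyW, this]
  simpa using key

omit hQ [DecidableEq ι] in
lemma mulVec_const_eq_zero {x : ι} (hx : ∑ y, Q x y = 0) (c : ℝ) :
    (Q *ᵥ fun _ => c) x = 0 := by
  simp [mulVec, dotProduct, ← Finset.sum_mul, hx]

/-- Lower bound for the probability of hitting `B` before leaving `W`. -/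
lemma gk_sub_le_mul_hit (W B B' : Finset ι) (hrow : ∀ y ∈ W, ∑ y', Q y y' = 0) {v : ι → ℝ}
    (hv : ∀ y ∈ W \ B, (Q *ᵥ v) y = 0) (hvB : ∀ y ∈ B ∩ W, v y = 0) (hv1 : ∀ y, y ∉ W → v y = 1)
    (hB' : B' ⊆ B ∩ W) {x : ι} (hx : x ∈ W) {M : ℝ} (hM : 0 ≤ M)
    (hgM : ∀ y ∈ B', gk Q W y x ≤ M) :
    gk Q W x x - gk Q (W \ B') x x ≤ M * (1 - v x) := by
  by_cases hxB : x ∈ B'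
  · rw [gk_of_notMem_left Q (by simp [hxB] : x ∉ W \ B'), hvB x (hB' hxB)]
    simpa using hgM x hxB
  have hxW' : x ∈ W \ B' := by simp [hx, hxB]
  set F : ι → ℝ := (fun y => gk Q W y x) - fun y => gk Q (W \ B') y x with hF
  have hFh : ∀ y ∈ W \ B', (Q *ᵥ F) y = 0 := by
    intro y hy
    rw [hF, Matrix.mulVec_sub, Pi.sub_apply, hQ.mulVec_gk _ hy hxW',
      hQ.mulVec_gk _ (Finset.mem_sdiff.mp hy).1 hx, sub_self]
  have hFB : ∀ y ∈ B', F y ≤ M := by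
    intro y hy
    simp only [hF, Pi.sub_apply, gk_of_notMem_left Q (by simp [hy] : y ∉ W \ B'), sub_zero]
    exact hgM y hy
  have hF0 : ∀ y, y ∉ W → F y = 0 := by
    intro y hy
    simp [hF, gk_of_notMem_left Q hy, gk_of_notMem_left Q (by simp [hy] : y ∉ W \ B')]
  have hFM : ∀ y ∈ W, F y ≤ M := by
    intro y hy
    by_cases hyB : y ∈ B'
    · exact hFB y hyB
    have := hQ.max_principle (W \ B') (F - fun _ => M) (fun y hy => by
      rw [Matrix.mulVec_sub, Pi.sub_apply, hFh y hy,
        mulVec_const_eq_zero (hrow y (Finset.mem_sdiff.mp hy).1)]; simp)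
      (fun y hy _ => by
        by_cases hyW : y ∈ W
        · have : y ∈ B' := by by_contra h; exact hy (by simp [hyW, h])
          simpa using hFB y this
        · simp [hF0 y hyW, hM]) y (by simp [hy, hyB])
    simpa using this
  have hfin : ∀ y ∈ B ∩ W, (F + M • v - fun _ => M : ι → ℝ) y ≤ 0 := by
    intro y hy
    simpa [hvB y hy] using hFM y (Finset.mem_inter.mp hy).2
  have key : (F + M • v - fun _ => M : ι → ℝ) x ≤ 0 := by
    by_cases hxB2 : x ∈ B
    · exact hfin x (by simp [hx, hxB2])
    refine hQ.max_principle (W \ B) (F + M • v - fun _ => M) (fun y hy => ?_)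
      (fun y hy _ => ?_) x (by simp [hx, hxB2])
    · have hy' : y ∈ W \ B' := by
        simp only [Finset.mem_sdiff] at hy ⊢
        exact ⟨hy.1, fun h => hy.2 (Finset.mem_inter.mp (hB' h)).1⟩
      rw [Matrix.mulVec_sub, Matrix.mulVec_add, Matrix.mulVec_smul, Pi.sub_apply, Pi.add_apply,
        Pi.smul_apply, hv y hy, hFh y hy',
        mulVec_const_eq_zero (hrow y (Finset.mem_sdiff.mp hy).1)]
      simp
    · by_cases hyW : y ∈ W
      · refine hfin y ?_
        simp only [Finset.mem_sdiff, Finset.mem_inter] at hy ⊢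
        tauto
      · simp [hF0 y hyW, hv1 y hyW]
  have hFx : F x = gk Q W x x - gk Q (W \ B') x x := by simp [hF]
  rw [← hFx]
  simp only [Pi.add_apply, Pi.sub_apply, Pi.smul_apply, smul_eq_mul] at key
  linarith

/-- Killing outside `W` decreases the Green's function by at most its maximum outside `W`. -/
lemma sub_le_gk (W : Finset ι) (hrow : ∀ y ∈ W, ∑ y', Q y y' = 0) {x v : ι} (hx : x ∈ W)
    (hv : v ∈ W) {M : ℝ} (hM : ∀ y, y ∉ W → gk Q Finset.univ y v ≤ M) :
    gk Q Finset.univ x v - M ≤ gk Q W x v := by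
  have := hQ.max_principle W
    ((fun y => gk Q Finset.univ y v) - (fun y => gk Q W y v) - fun _ => M) (fun y hy => by
      rw [Matrix.mulVec_sub, Matrix.mulVec_sub, Pi.sub_apply, Pi.sub_apply, hQ.mulVec_gk _ hy hv,
        hQ.mulVec_gk _ (Finset.mem_univ y) (Finset.mem_univ v),
        mulVec_const_eq_zero (hrow y hy)]
      simp) (fun y hy _ => by simpa [gk_of_notMem_left Q hy] using hM y hy) x hx
  simp only [Pi.sub_apply] at this
  linarith

/-- The killed Green's functions at `z` are the avoidance functional of a random finite set. -/
lemma exists_mixture (z : ι) : ∃ r : Finset ι → ℝ, (∀ B, 0 ≤ r B) ∧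
    ∀ A : Finset ι, ∑ B, (if Disjoint B A then r B else 0) = gk Q Aᶜ z z := by
  set P : ι → ι → ℝ := fun x y => if x = y then 0 else -Q x y / Q x x with hP
  have hP0 : ∀ x y, 0 ≤ P x y := by
    intro x y
    simp only [hP]
    split_ifs with h
    · exact le_rfl
    · exact div_nonneg (neg_nonneg.mpr (hQ.off x y h)) (hQ.diag_pos x).le
  have hPQ : ∀ (f : ι → ℝ) (x : ι), (Q *ᵥ f) x = Q x x * (f x - ∑ y, P x y * f y) := by
    intro f x
    have hx := (hQ.diag_pos x).ne'
    rw [mul_sub, Finset.mul_sum]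
    simp only [mulVec, dotProduct]
    rw [← Finset.add_sum_erase _ _ (Finset.mem_univ x),
      ← Finset.add_sum_erase _ (fun y => Q x x * (P x y * f y)) (Finset.mem_univ x)]
    have : ∀ y ∈ Finset.univ.erase x, Q x y * f y = -(Q x x * (P x y * f y)) := by
      intro y hy
      have hxy : x ≠ y := (Finset.ne_of_mem_erase hy).symm
      simp only [hP, hxy, if_false]
      field_simp
    rw [Finset.sum_congr rfl this, Finset.sum_neg_distrib]
    simp [hP]
    ring
  let step : (ι → Finset ι → ℝ) → ι → Finset ι → ℝ := fun r x B' =>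
    (if B' = {x} ∧ x = z then 1 / Q z z else 0) +
      ∑ y, P x y * ∑ B, if insert x B = B' then r y B else 0
  have step_mono : ∀ r r', (∀ x B, r x B ≤ r' x B) → ∀ x B, step r x B ≤ step r' x B := by
    intro r r' h x B'
    refine add_le_add le_rfl (Finset.sum_le_sum fun y _ =>
      mul_le_mul_of_nonneg_left (Finset.sum_le_sum fun B _ => ?_) (hP0 x y))
    split_ifs
    · exact h y B
    · exact le_rfl
  let r : ℕ → ι → Finset ι → ℝ := fun n => step^[n] 0
  have r_succ : ∀ n, r (n + 1) = step (r n) := fun n => Function.iterate_succ_apply' step n 0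
  have r_nonneg1 : ∀ x B, r 0 x B ≤ r 1 x B := by
    intro x B
    change 0 ≤ step 0 x B
    refine add_nonneg ?_ (Finset.sum_nonneg fun y _ => mul_nonneg (hP0 x y)
      (Finset.sum_nonneg fun B _ => by simp))
    split_ifs
    · exact (one_div_pos.mpr (hQ.diag_pos z)).le
    · exact le_rfl
  have r_mono_succ : ∀ n x B, r n x B ≤ r (n + 1) x B := by
    intro n
    induction n with
    | zero => exact r_nonneg1
    | succ n ih => rw [r_succ (n + 1), r_succ n]; exact step_mono _ _ (by rw [← r_succ]; exact ih)
  have r_mono : ∀ x B, Monotone fun n => r n x B :=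
    fun x B => monotone_nat_of_le_succ fun n => r_mono_succ n x B
  have r_nonneg : ∀ n x B, 0 ≤ r n x B := fun n x B => r_mono x B (Nat.zero_le n)
  let h : (ι → Finset ι → ℝ) → Finset ι → ι → ℝ := fun r A x =>
    ∑ B, if Disjoint B A then r x B else 0
  have h_step : ∀ r A x, h (step r) A x =
      if x ∈ A then 0 else (if x = z then 1 / Q z z else 0) + ∑ y, P x y * h r A y := by
    intro r A x
    have e1 : h (step r) A x = (∑ B', if Disjoint B' A then
        (if B' = {x} ∧ x = z then 1 / Q z z else 0) else 0) +
        ∑ y, P x y * ∑ B, if Disjoint (insert x B) A then r y B else 0 := by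
      simp only [h, step]
      have : ∀ B' : Finset ι, (if Disjoint B' A then
          (if B' = {x} ∧ x = z then 1 / Q z z else 0) +
            ∑ y, P x y * ∑ B, (if insert x B = B' then r y B else 0) else 0) =
          (if Disjoint B' A then (if B' = {x} ∧ x = z then 1 / Q z z else 0) else 0) +
          ∑ y, P x y * ∑ B, (if insert x B = B' then
            (if Disjoint (insert x B) A then r y B else 0) else 0) := by
        intro B'
        by_cases hd : Disjoint B' A
        · simp only [hd, if_true]
          congr 1
          refine Finset.sum_congr rfl fun y _ => ?_
          congr 1
          refine Finset.sum_congr rfl fun B _ => ?_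
          split_ifs with h1 h2
          · rfl
          · exact absurd (h1 ▸ hd) h2
          · rfl
        · simp only [hd, if_false, zero_add]
          symm
          refine Finset.sum_eq_zero fun y _ => mul_eq_zero_of_right _
            (Finset.sum_eq_zero fun B _ => ?_)
          split_ifs with h1 h2
          · exact absurd (h1 ▸ h2) hd
          · rfl
          · rfl
      rw [Finset.sum_congr rfl fun B' _ => this B', Finset.sum_add_distrib]
      congr 1
      rw [Finset.sum_comm]
      refine Finset.sum_congr rfl fun y _ => ?_
      rw [← Finset.mul_sum, Finset.sum_comm]
      congr 1
      refine Finset.sum_congr rfl fun B _ => ?_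
      rw [Finset.sum_ite_eq]
      simp
    rw [e1]
    by_cases hx : x ∈ A
    · have hd : ∀ B, ¬ Disjoint (insert x B) A := fun B hd =>
        Finset.disjoint_left.mp hd (Finset.mem_insert_self x B) hx
      have hd' : ¬ Disjoint ({x} : Finset ι) A := by simpa using hx
      simp only [hd, if_false, hx, if_true, Finset.sum_const_zero, mul_zero, add_zero]
      refine Finset.sum_eq_zero fun B' _ => ?_
      split_ifs with h1 h2
      · exact absurd (h2.1 ▸ h1) hd'
      · rfl
      · rfl
    · simp only [hx, if_false]
      congr 1
      · rw [Finset.sum_eq_single {x}]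
        · simp [hx]
        · intro B _ hB
          simp [hB]
        · simp
      · refine Finset.sum_congr rfl fun y _ => ?_
        congr 1
        refine Finset.sum_congr rfl fun B _ => ?_
        simp [Finset.disjoint_insert_left, hx]
  have h_le : ∀ n A x, h (r n) A x ≤ gk Q Aᶜ x z := by
    intro n
    induction n with
    | zero =>
      intro A x
      have : h (r 0) A x = 0 := Finset.sum_eq_zero fun B _ => by simp [r]
      rw [this]; exact hQ.gk_nonneg _ _ _
    | succ n ih =>
      intro A x
      rw [r_succ, h_step]
      split_ifs with hx hxz
      · exact hQ.gk_nonneg _ _ _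
      · subst hxz
        have hxA : x ∈ Aᶜ := by simpa using hx
        have h1 := hQ.mulVec_gk Aᶜ hxA hxA
        rw [hPQ, if_pos rfl] at h1
        have hq := hQ.diag_pos x
        have h2 : gk Q Aᶜ x x = 1 / Q x x + ∑ y, P x y * gk Q Aᶜ y x := by
          field_simp at h1 ⊢; linarith
        rw [h2]
        exact add_le_add le_rfl (Finset.sum_le_sum fun y _ =>
          mul_le_mul_of_nonneg_left (ih A y) (hP0 x y))
      · have hxA : x ∈ Aᶜ := by simpa using hx
        have hq := hQ.diag_pos x
        have h2 : ∑ y, P x y * gk Q Aᶜ y z ≤ gk Q Aᶜ x z := by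
          by_cases hz : z ∈ Aᶜ
          · have h1 := hQ.mulVec_gk Aᶜ hxA hz
            rw [hPQ, if_neg hxz] at h1
            have := (mul_eq_zero.mp h1).resolve_left hq.ne'
            linarith
          · simp [gk_of_notMem_right Q hz]
        rw [zero_add]
        exact (Finset.sum_le_sum fun y _ =>
          mul_le_mul_of_nonneg_left (ih A y) (hP0 x y)).trans h2
  have r_bdd : ∀ x B, BddAbove (Set.range fun n => r n x B) := by
    intro x B
    refine ⟨gk Q (∅ : Finset ι)ᶜ x z, ?_⟩
    rintro _ ⟨n, rfl⟩
    refine le_trans ?_ (h_le n ∅ x)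
    have := Finset.single_le_sum (f := fun B => if Disjoint B ∅ then r n x B else 0)
      (fun B _ => by split_ifs; exacts [r_nonneg n x B, le_rfl]) (Finset.mem_univ B)
    simpa [h] using this
  let R : ι → Finset ι → ℝ := fun x B => ⨆ n, r n x B
  have r_tend : ∀ x B, Tendsto (fun n => r n x B) atTop (𝓝 (R x B)) :=
    fun x B => tendsto_atTop_ciSup (r_mono x B) (r_bdd x B)
  have h_tend : ∀ A x, Tendsto (fun n => h (r n) A x) atTop (𝓝 (h R A x)) := by
    intro A x
    refine tendsto_finsetSum _ fun B _ => ?_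
    split_ifs
    · exact r_tend x B
    · exact tendsto_const_nhds
  have h_fix : ∀ A x, h R A x =
      if x ∈ A then 0 else (if x = z then 1 / Q z z else 0) + ∑ y, P x y * h R A y := by
    intro A x
    have t1 := (tendsto_add_atTop_iff_nat 1).mpr (h_tend A x)
    refine tendsto_nhds_unique t1 ?_
    simp only [r_succ, h_step]
    split_ifs
    · exact tendsto_const_nhds
    · exact tendsto_const_nhds.add (tendsto_finsetSum _ fun y _ =>
        (h_tend A y).const_mul _)
    · exact tendsto_const_nhds.add (tendsto_finsetSum _ fun y _ =>
        (h_tend A y).const_mul _)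
  refine ⟨R z, fun B => (r_nonneg 0 z B).trans (le_ciSup (r_bdd z B) 0), fun A => ?_⟩
  change h R A z = _
  have hzero : ∀ y, y ∉ Aᶜ → h R A y = 0 := by
    intro y hy
    have hyA : y ∈ A := by simpa using hy
    rw [h_fix]; simp [hyA]
  by_cases hz : z ∈ A
  · rw [hzero z (by simpa using hz), gk_of_notMem_left Q (by simpa using hz)]
  have hz' : z ∈ Aᶜ := by simpa using hz
  have := hQ.eq_zero_of_harmonic Aᶜ (h R A - fun x => gk Q Aᶜ x z) (fun x hx => by
    rw [Matrix.mulVec_sub, Pi.sub_apply, hQ.mulVec_gk _ hx hz', hPQ]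
    have hxA : x ∉ A := by simpa using hx
    have h1 := h_fix A x
    simp only [hxA, if_false] at h1
    have hq := (hQ.diag_pos x).ne'
    by_cases hxz : x = z
    · subst hxz
      rw [if_pos rfl] at h1
      rw [if_pos rfl, h1]
      field_simp
      ring
    · rw [if_neg hxz] at h1
      rw [if_neg hxz, h1]
      ring) (fun y hy => by
        simp [hzero y hy, gk_of_notMem_left Q hy])
  have := congrFun this z
  simp only [Pi.sub_apply, Pi.zero_apply] at this
  linarith

end Stieltjes

end StieltjesPotential

section RandomLayers

open Matrix

universe u

variable {ι : Type u} [Fintype ι] [DecidableEq ι]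

/-- Occupation counts and union of `N` independent copies of a random finite set. -/
lemma exists_iid_union (r : Finset ι → ℝ) (hr : ∀ B, 0 ≤ r B) (hr1 : ∑ B, r B = 1) (N : ℕ) :
    ∃ (τ : Type u) (_ : Fintype τ) (w : τ → ℝ) (cnt : τ → ι → ℝ) (S : τ → Finset ι),
      (∀ t, 0 ≤ w t) ∧ ∑ t, w t = 1 ∧ (∀ t v, 0 ≤ cnt t v) ∧ (∀ t v, v ∉ S t → cnt t v = 0) ∧
      (∀ A : Finset ι, ∑ t, (if Disjoint (S t) A then w t else 0) =
        (∑ B, if Disjoint B A then r B else 0) ^ N) ∧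
      (∀ v, ∑ t, w t * cnt t v = N * ∑ B, if v ∈ B then r B else 0) ∧
      ∀ v v', ∑ t, w t * (cnt t v * cnt t v') ≤
        N * (∑ B, if v ∈ B ∧ v' ∈ B then r B else 0) +
        N ^ 2 * ((∑ B, if v ∈ B then r B else 0) * ∑ B, if v' ∈ B then r B else 0) := by
  induction N with
  | zero =>
    refine ⟨PUnit, inferInstance, fun _ => 1, fun _ _ => 0, fun _ => ∅, ?_⟩
    simp
  | succ N ih =>
    obtain ⟨τ, _, w, cnt, S, hw, hw1, hc, hcS, hA, h1, h2⟩ := ih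
    refine ⟨τ × Finset ι, inferInstance, fun t => w t.1 * r t.2,
      fun t v => cnt t.1 v + if v ∈ t.2 then 1 else 0, fun t => S t.1 ∪ t.2,
      fun t => mul_nonneg (hw _) (hr _), ?_, ?_, ?_, ?_, ?_, ?_⟩
    · rw [Fintype.sum_prod_type, ← Finset.sum_mul_sum, hw1, hr1, one_mul]
    · intro t v
      exact add_nonneg (hc _ _) (by split_ifs <;> norm_num)
    · intro t v hv
      simp only [Finset.mem_union, not_or] at hv
      simp [hv.2, hcS _ _ hv.1]
    · intro A
      rw [pow_succ, ← hA A, Finset.sum_mul_sum, Fintype.sum_prod_type]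
      refine Finset.sum_congr rfl fun t _ => Finset.sum_congr rfl fun B _ => ?_
      simp only [Finset.disjoint_union_left]
      split_ifs <;> simp_all
    · intro v
      rw [Fintype.sum_prod_type]
      calc _ = ∑ t, ∑ B, (w t * cnt t v * r B + w t * (if v ∈ B then r B else 0)) := by
            refine Finset.sum_congr rfl fun t _ => Finset.sum_congr rfl fun B _ => ?_
            dsimp only
            split_ifs <;> ring
        _ = _ := by
            simp only [Finset.sum_add_distrib, ← Finset.mul_sum, ← Finset.sum_mul, hw1, hr1, h1]
            push_cast; ring
    · intro v v'
      rw [Fintype.sum_prod_type]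
      set p := ∑ B, if v ∈ B then r B else 0
      set p' := ∑ B, if v' ∈ B then r B else 0
      have hp : 0 ≤ p := Finset.sum_nonneg fun B _ => by split_ifs; exacts [hr B, le_rfl]
      have hp' : 0 ≤ p' := Finset.sum_nonneg fun B _ => by split_ifs; exacts [hr B, le_rfl]
      calc _ = ∑ t, ∑ B, (w t * (cnt t v * cnt t v') * r B +
              w t * cnt t v * (if v' ∈ B then r B else 0) +
              w t * cnt t v' * (if v ∈ B then r B else 0) +
              w t * (if v ∈ B ∧ v' ∈ B then r B else 0)) := by
            refine Finset.sum_congr rfl fun t _ => Finset.sum_congr rfl fun B _ => ?_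
            dsimp only
            by_cases h : v ∈ B <;> by_cases h' : v' ∈ B <;> simp [h, h'] <;> ring
        _ = (∑ t, w t * (cnt t v * cnt t v')) + N * p * p' + N * p' * p +
              ∑ B, (if v ∈ B ∧ v' ∈ B then r B else 0) := by
            simp only [Finset.sum_add_distrib, ← Finset.mul_sum, ← Finset.sum_mul, hw1, hr1, h1,
              mul_one, one_mul]
            rfl
        _ ≤ _ := by
            have := h2 v v'
            have := mul_nonneg hp hp'
            push_cast
            nlinarith

namespace Stieltjes

variable {Q : Matrix ι ι ℝ} (hQ : Stieltjes Q)

include hQ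

/-- A random subset of `S` avoiding a given set with high probability, but hitting well
the walk started at any point around which `S` is thick. -/
lemma exists_layer (z : ι) (S : Finset ι) (N : ℕ) :
    ∃ (τ : Type u) (_ : Fintype τ) (w : τ → ℝ) (B : τ → Finset ι),
      (∀ t, 0 ≤ w t) ∧ ∑ t, w t = 1 ∧
      (∀ K : Finset ι, exp (-min 1 (N * (1 - gk Q (K ∩ S)ᶜ z z / gk Q Finset.univ z z))) ≤
        ∑ t, if Disjoint (B t) K then w t else 0) ∧
      ∀ (x : ι) (W W' : Finset ι) (v : τ → ι → ℝ) (M m E₁ E₂ : ℝ),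
        x ∈ W → W' ⊆ W → W' ⊆ S → (∀ y ∈ W, ∑ y', Q y y' = 0) →
        (∀ t, ∀ y ∈ W \ B t, (Q *ᵥ v t) y = 0) → (∀ t, ∀ y ∈ B t ∩ W, v t y = 0) →
        (∀ t y, y ∉ W → v t y = 1) → 0 < M → (∀ y ∈ W', gk Q W y x ≤ M) →
        0 ≤ m → (∀ y ∈ W', m ≤ gk Q W x y) → 0 ≤ E₁ →
        (E₁ ≤ N * ∑ y ∈ W', (1 - gk Q {y}ᶜ z z / gk Q Finset.univ z z)) → 0 < E₂ →
        (∑ y ∈ W', ∑ y' ∈ W', gk Q W y y' *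
          (N * (1 - gk Q {y}ᶜ z z / gk Q Finset.univ z z - gk Q {y'}ᶜ z z / gk Q Finset.univ z z +
            gk Q ({y, y'} : Finset ι)ᶜ z z / gk Q Finset.univ z z) +
          N ^ 2 * ((1 - gk Q {y}ᶜ z z / gk Q Finset.univ z z) *
            (1 - gk Q {y'}ᶜ z z / gk Q Finset.univ z z))) ≤ E₂) →
        (m * E₁) ^ 2 / (2 * M * E₂) ≤ ∑ t, w t * (1 - v t x) := by
  obtain ⟨r₀, hr₀, hr₀A⟩ := hQ.exists_mixture z
  have hG := hQ.gk_diag_pos Finset.univ (Finset.mem_univ z)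
  set G := gk Q Finset.univ z z with hGdef
  set r : Finset ι → ℝ := fun B => r₀ B / G with hr
  have hrA : ∀ A : Finset ι, (∑ B, if Disjoint B A then r B else 0) = gk Q Aᶜ z z / G := by
    intro A
    rw [← hr₀A A, Finset.sum_div]
    refine Finset.sum_congr rfl fun B _ => ?_
    split_ifs <;> simp [hr]
  have hrn : ∀ B, 0 ≤ r B := fun B => div_nonneg (hr₀ B) hG.le
  have hr1 : ∑ B, r B = 1 := by
    have := hrA ∅
    simpa [← hGdef, hG.ne'] using this
  have hmem : ∀ y, (∑ B, if y ∈ B then r B else 0) = 1 - gk Q {y}ᶜ z z / G := by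
    intro y
    rw [← hrA {y}, ← hr1, ← Finset.sum_sub_distrib]
    refine Finset.sum_congr rfl fun B _ => ?_
    by_cases h : y ∈ B <;> simp [h]
  have hmem2 : ∀ y y', (∑ B, if y ∈ B ∧ y' ∈ B then r B else 0) =
      1 - gk Q {y}ᶜ z z / G - gk Q {y'}ᶜ z z / G + gk Q ({y, y'} : Finset ι)ᶜ z z / G := by
    intro y y'
    rw [← hrA {y}, ← hrA {y'}, ← hrA {y, y'}, ← hr1, ← Finset.sum_sub_distrib,
      ← Finset.sum_sub_distrib, ← Finset.sum_add_distrib]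
    refine Finset.sum_congr rfl fun B _ => ?_
    by_cases h : y ∈ B <;> by_cases h' : y' ∈ B <;> simp [h, h']
  obtain ⟨τ, _, w, cnt, D, hw, hw1, hc, hcS, hA, h1, h2⟩ := exists_iid_union r hrn hr1 N
  refine ⟨Option τ, inferInstance, fun t => t.elim (1 / 2) fun t => w t / 2,
    fun t => t.elim ∅ fun t => D t ∩ S, ?_, ?_, ?_, ?_⟩
  · rintro (_ | t)
    · norm_num
    · exact div_nonneg (hw t) zero_le_two
  · rw [Fintype.sum_option]
    simp only [Option.elim, ← Finset.sum_div, hw1]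
    norm_num
  · intro K
    have e1 : ∑ t : Option τ, (if Disjoint (t.elim ∅ fun t => D t ∩ S) K then
        t.elim (1 / 2 : ℝ) fun t => w t / 2 else 0) = 1 / 2 + (gk Q (K ∩ S)ᶜ z z / G) ^ N / 2 := by
      rw [Fintype.sum_option, ← hrA, ← hA, Finset.sum_div]
      simp only [Option.elim, Finset.disjoint_empty_left, if_true]
      congr 1
      refine Finset.sum_congr rfl fun t _ => ?_
      have : Disjoint (D t ∩ S) K ↔ Disjoint (D t) (K ∩ S) := by
        simp only [Finset.disjoint_left, Finset.mem_inter]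
        constructor
        · exact fun h a ha hb => h ⟨ha, hb.2⟩ hb.1
        · exact fun h a ha hb => h ha.1 ⟨hb, ha.2⟩
      simp only [this]
      split_ifs <;> simp
    rw [e1]
    set a := gk Q (K ∩ S)ᶜ z z / G
    have ha0 : 0 ≤ a := div_nonneg (hQ.gk_nonneg _ _ _) hG.le
    have ha1 : a ≤ 1 := (div_le_one hG).mpr (hQ.gk_mono (Finset.subset_univ _) z z)
    have hexp : exp (-1) ≤ 1 / 2 := by
      have := Real.exp_one_gt_d9
      rw [Real.exp_neg, ← one_div]
      exact one_div_le_one_div_of_le two_pos (by linarith)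
    rcases le_total 1 (N * (1 - a)) with h | h
    · rw [min_eq_left h]
      have : 0 ≤ a ^ N := pow_nonneg ha0 N
      linarith
    · rw [min_eq_right h]
      have hb : 1 - N * (1 - a) ≤ a ^ N := by
        have := one_add_mul_le_pow (a := a - 1) (by linarith) N
        simp only [add_sub_cancel] at this
        linarith
      have hs0 : 0 ≤ N * (1 - a) := mul_nonneg (Nat.cast_nonneg N) (by linarith)
      set s := N * (1 - a)
      have hcv := convexOn_exp.2 (Set.mem_univ 0) (Set.mem_univ (-1)) (sub_nonneg.mpr h) hs0
        (by ring)
      simp only [smul_eq_mul, mul_zero, zero_add, mul_neg, mul_one, exp_zero] at hcv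
      nlinarith
  · intro x W W' v M m E₁ E₂ hx hW'W hW'S hrow hv hvB hv1 hM hgM hm hgm hE₁ hE₁le hE₂ hE₂le
    have hhit := fun (t : Option τ) (B' : Finset ι) hB' (hB'M : ∀ y ∈ B', gk Q W y x ≤ M) =>
      hQ.gk_sub_le_mul_hit W (t.elim ∅ fun t => D t ∩ S) B' hrow (hv t) (hvB t) (hv1 t) hB' hx
        hM.le hB'M
    have hv_le : ∀ t, 0 ≤ 1 - v t x := by
      intro t
      have := hhit t ∅ (by simp) (by simp)
      rw [Finset.sdiff_empty, sub_self] at this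
      exact nonneg_of_mul_nonneg_right this hM
    rw [Fintype.sum_option]
    simp only [Option.elim]
    let μ : τ → ι → ℝ := fun t y => if y ∈ W' then cnt t y else 0
    let X : τ → ℝ := fun t => ∑ y ∈ W', cnt t y
    let Y : τ → ℝ := fun t => μ t ⬝ᵥ (gk Q W *ᵥ μ t)
    have hX0 : ∀ t, 0 ≤ X t := fun t => Finset.sum_nonneg fun y _ => hc t y
    have hY0 : ∀ t, 0 ≤ Y t := fun t => hQ.gk_form_nonneg W (μ t)
    have hY : ∀ t, Y t = ∑ y ∈ W', ∑ y' ∈ W', gk Q W y y' * (cnt t y * cnt t y') := by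
      intro t
      have e : ∀ y, μ t y * (gk Q W *ᵥ μ t) y =
          if y ∈ W' then ∑ y' ∈ W', gk Q W y y' * (cnt t y * cnt t y') else 0 := by
        intro y
        simp only [μ, mulVec, dotProduct, mul_ite, mul_zero, Finset.sum_ite_mem,
          Finset.univ_inter, ite_mul, zero_mul, Finset.mul_sum]
        split_ifs
        · exact Finset.sum_congr rfl fun _ _ => by ring
        · simp
      simp only [Y, dotProduct, e, Finset.sum_ite_mem, Finset.univ_inter]
    have hXY : ∀ t, (m * X t) ^ 2 ≤ M * (1 - v (some t) x) * Y t := by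
      intro t
      have hB' : W' ∩ D t ⊆ (D t ∩ S) ∩ W := by
        intro y hy
        simp only [Finset.mem_inter] at hy ⊢
        exact ⟨⟨hy.2, hW'S hy.1⟩, hW'W hy.1⟩
      have h3 := hhit (some t) (W' ∩ D t) hB' (fun y hy => hgM y (Finset.mem_inter.mp hy).1)
      have h4 := hQ.sq_gk_mulVec_le W (W' ∩ D t) hx (μ t) (fun y hy => by
        simp only [Finset.mem_inter, not_and_or] at hy
        simp only [μ]
        split_ifs with h
        · exact hcS t y (hy.resolve_left (by simpa using h))
        · rfl)
      have h5 : m * X t ≤ (gk Q W *ᵥ μ t) x := by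
        simp only [X, μ, mulVec, dotProduct, mul_ite, mul_zero, Finset.sum_ite_mem,
          Finset.univ_inter, Finset.mul_sum]
        exact Finset.sum_le_sum fun y hy => mul_le_mul_of_nonneg_right (hgm y hy) (hc t y)
      calc (m * X t) ^ 2 ≤ ((gk Q W *ᵥ μ t) x) ^ 2 :=
            pow_le_pow_left₀ (mul_nonneg hm (hX0 t)) h5 2
        _ ≤ _ := h4
        _ ≤ _ := mul_le_mul_of_nonneg_right h3 (hY0 t)
    have hCS : (∑ t, w t * (m * X t)) ^ 2 ≤
        (∑ t, w t * (M * (1 - v (some t) x))) * ∑ t, w t * Y t := by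
      refine Finset.sum_sq_le_sum_mul_sum_of_sq_le_mul _ (fun t _ => ?_) (fun t _ => ?_)
        fun t _ => ?_
      · exact mul_nonneg (hw t) (mul_nonneg hM.le (hv_le _))
      · exact mul_nonneg (hw t) (hY0 t)
      · have := mul_le_mul_of_nonneg_left (hXY t) (mul_nonneg (hw t) (hw t))
        nlinarith
    have hX1 : E₁ ≤ ∑ t, w t * X t := by
      refine hE₁le.trans (le_of_eq ?_)
      simp only [X, Finset.mul_sum]
      rw [Finset.sum_comm]
      refine Finset.sum_congr rfl fun y _ => ?_
      rw [h1 y, hmem]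
    have hY1 : ∑ t, w t * Y t ≤ E₂ := by
      refine le_trans ?_ hE₂le
      simp only [hY, Finset.mul_sum]
      rw [Finset.sum_comm]
      refine Finset.sum_le_sum fun y _ => ?_
      rw [Finset.sum_comm]
      refine Finset.sum_le_sum fun y' _ => ?_
      rw [← hmem2, ← hmem, ← hmem]
      refine le_trans (le_of_eq ?_) (mul_le_mul_of_nonneg_left (h2 y y') (hQ.gk_nonneg W y y'))
      rw [Finset.mul_sum]
      exact Finset.sum_congr rfl fun _ _ => by ring
    set q := ∑ t, w t * (1 - v (some t) x) with hq
    have hq0 : 0 ≤ q := Finset.sum_nonneg fun t _ => mul_nonneg (hw t) (hv_le _)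
    have e1 : ∑ t, w t * (M * (1 - v (some t) x)) = M * q := by
      rw [hq, Finset.mul_sum]; exact Finset.sum_congr rfl fun _ _ => by ring
    have e2 : ∑ t, w t * (m * X t) = m * ∑ t, w t * X t := by
      rw [Finset.mul_sum]; exact Finset.sum_congr rfl fun _ _ => by ring
    have e3 : ∑ t, w t / 2 * (1 - v (some t) x) = q / 2 := by
      rw [hq, Finset.sum_div]; exact Finset.sum_congr rfl fun _ _ => by ring
    rw [e1, e2] at hCS
    rw [e3]
    have hfin : (m * E₁) ^ 2 ≤ M * q * E₂ := by
      calc (m * E₁) ^ 2 ≤ (m * ∑ t, w t * X t) ^ 2 :=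
            pow_le_pow_left₀ (mul_nonneg hm hE₁) (mul_le_mul_of_nonneg_left hX1 hm) 2
        _ ≤ _ := hCS
        _ ≤ _ := mul_le_mul_of_nonneg_left hY1 (mul_nonneg hM.le hq0)
    have h0 := hv_le none
    have : (m * E₁) ^ 2 / (2 * M * E₂) ≤ q / 2 := by
      rw [div_le_iff₀ (by positivity)]
      linarith
    linarith

/-- Iterated layers: if each of `n` random layers stops the walk with probability at least `p`,
then a family of sets which is rarely disjoint from given sets rarely avoids the layers. -/
lemma layers_bound {b x₀ : ι} {Cg p : ℝ} (hCg : ∀ x, gk Q Finset.univ x b ≤ Cg) (hCg0 : 0 ≤ Cg)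
    (hp1 : p ≤ 1) (n : ℕ) (T : ℕ → Finset ι) (τ : ℕ → Type u) [∀ j, Fintype (τ j)]
    (w : ∀ j, τ j → ℝ) (hw : ∀ j t, 0 ≤ w j t) (B : ∀ j, τ j → Finset ι)
    (hw1 : ∀ j, ∑ t, w j t = 1)
    (hrow : ∀ j, j < n → ∀ x ∈ T (j + 1), ∑ y, Q x y = 0) (hb : ∀ j < n, b ∉ T (j + 1))
    (hW : ∀ j < n, ∀ x, x ∉ T (j + 1) → (∃ x' ∈ T (j + 1), Q x' x ≠ 0) →
      ∃ W : Finset ι, x ∈ W ∧ b ∉ W ∧ (∀ u, u ∉ W → (∃ y ∈ W, Q y u ≠ 0) → u ∈ T j) ∧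
        ∀ v : τ j → ι → ℝ, (∀ t, ∀ y ∈ W \ B j t, (Q *ᵥ v t) y = 0) →
          (∀ t, ∀ y ∈ B j t ∩ W, v t y = 0) → (∀ t y, y ∉ W → v t y = 1) →
          p ≤ ∑ t, w j t * (1 - v t x))
    (hx₀ : x₀ ∈ T n) (c : Finset ι → ℝ)
    (hc : ∀ A : Finset ι, ∑ K, (if Disjoint K A then c K else 0) ≤ gk Q Aᶜ x₀ b) :
    ∑ K, c K * ∏ j ∈ Finset.range n, (∑ t, if Disjoint (B j t) K then w j t else 0) ≤
      Cg * (1 - p) ^ n := by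
  let U : ℕ → Finset ι → ι → ℝ := fun j => Nat.rec (fun A x => gk Q Aᶜ x b)
    (fun j U A x => ∑ t, w j t * U (A ∪ B j t) x) j
  have hU0 : ∀ A x, U 0 A x = gk Q Aᶜ x b := fun _ _ => rfl
  have hU1 : ∀ j A x, U (j + 1) A x = ∑ t, w j t * U j (A ∪ B j t) x := fun _ _ _ => rfl
  have hUsub : ∀ j A x, x ≠ b → (Q *ᵥ U j A) x ≤ 0 := by
    intro j
    induction j with
    | zero => intro A x hx; exact hQ.mulVec_gk_nonpos Aᶜ hx
    | succ j ih =>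
      intro A x hx
      have : (Q *ᵥ U (j + 1) A) x = ∑ t, w j t * (Q *ᵥ U j (A ∪ B j t)) x := by
        simp only [mulVec, dotProduct, hU1, Finset.mul_sum]
        rw [Finset.sum_comm]
        exact Finset.sum_congr rfl fun _ _ => Finset.sum_congr rfl fun _ _ => by ring
      rw [this]
      exact Finset.sum_nonpos fun t _ => mul_nonpos_of_nonneg_of_nonpos (hw j t) (ih _ x hx)
  have hUzero : ∀ j A x, x ∈ A → U j A x = 0 := by
    intro j
    induction j with
    | zero => intro A x hx; exact gk_of_notMem_left Q (by simpa using hx) b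
    | succ j ih =>
      intro A x hx
      rw [hU1]
      exact Finset.sum_eq_zero fun t _ => by rw [ih _ x (Finset.mem_union_left _ hx), mul_zero]
  have hUle : ∀ j, j ≤ n → ∀ A, ∀ x ∈ T j, U j A x ≤ Cg * (1 - p) ^ j := by
    intro j
    induction j with
    | zero =>
      intro _ A x _
      rw [hU0, pow_zero, mul_one]
      exact (hQ.gk_mono (Finset.subset_univ _) x b).trans (hCg x)
    | succ j ih =>
      intro hj A x hx
      have hjn : j < n := hj
      have hM : 0 ≤ Cg * (1 - p) ^ j := mul_nonneg hCg0 (pow_nonneg (by linarith) j)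
      have := hQ.max_principle (T (j + 1)) (U (j + 1) A - fun _ => Cg * (1 - p) ^ (j + 1))
        (fun y hy => by
          have hyb : y ≠ b := fun h => hb j hjn (h ▸ hy)
          rw [Matrix.mulVec_sub, Pi.sub_apply, mulVec_const_eq_zero (hrow j hjn y hy), sub_zero]
          exact hUsub (j + 1) A y hyb)
        (fun y hy hn => by
          obtain ⟨W, hyW, hbW, hWT, hWv⟩ := hW j hjn y hy hn
          choose v hv1 hv2 using fun t =>
            hQ.exists_dirichlet (W \ B j t) (fun y => if y ∈ W then 0 else 1)
          have hvB : ∀ t, ∀ y ∈ B j t ∩ W, v t y = 0 := by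
            intro t y hy
            simp only [Finset.mem_inter] at hy
            rw [hv2 t y (by simp [hy.1])]
            simp [hy.2]
          have hvo : ∀ t y, y ∉ W → v t y = 1 := by
            intro t y hy
            rw [hv2 t y (by simp [hy])]
            simp [hy]
          have hp := hWv v hv1 hvB hvo
          have hle : ∀ t, U j (A ∪ B j t) y ≤ Cg * (1 - p) ^ j * v t y := by
            intro t
            refine hQ.le_mul_of_dirichlet W (B j t) (hv1 t) (fun y hy => (hvB t y hy).ge) (hvo t)
              hM (fun u hu => hUsub _ _ _ fun h => hbW (h ▸ (Finset.mem_sdiff.mp hu).1))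
              (fun u hu => ?_) (fun u hu hn => ih hjn.le _ _ (hWT u hu hn)) hyW
            rw [hUzero _ _ _ (Finset.mem_union_right _ (Finset.mem_inter.mp hu).1)]
          simp only [Pi.sub_apply, sub_nonpos, hU1]
          calc ∑ t, w j t * U j (A ∪ B j t) y
              ≤ ∑ t, w j t * (Cg * (1 - p) ^ j * v t y) :=
                Finset.sum_le_sum fun t _ => mul_le_mul_of_nonneg_left (hle t) (hw j t)
            _ = Cg * (1 - p) ^ j * (1 - ∑ t, w j t * (1 - v t y)) := by
                simp only [mul_sub, mul_one, Finset.sum_sub_distrib, hw1, Finset.mul_sum]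
                rw [sub_sub_cancel]
                exact Finset.sum_congr rfl fun _ _ => by ring
            _ ≤ Cg * (1 - p) ^ j * (1 - p) := mul_le_mul_of_nonneg_left (by linarith) hM
            _ = _ := by ring) x hx
      simpa using this
  have hX : ∀ j A, ∑ K, (if Disjoint K A then c K *
      ∏ i ∈ Finset.range j, (∑ t, if Disjoint (B i t) K then w i t else 0) else 0) ≤
        U j A x₀ := by
    intro j
    induction j with
    | zero => intro A; simpa only [Finset.range_zero, Finset.prod_empty, mul_one, hU0] using hc A
    | succ j ih =>
      intro A
      rw [hU1]
      refine le_trans (le_of_eq ?_)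
        (Finset.sum_le_sum fun t _ => mul_le_mul_of_nonneg_left (ih (A ∪ B j t)) (hw j t))
      simp only [Finset.mul_sum]
      rw [Finset.sum_comm]
      refine Finset.sum_congr rfl fun K _ => ?_
      simp only [Finset.disjoint_union_right, Finset.prod_range_succ]
      by_cases hK : Disjoint K A
      · simp only [hK, true_and, if_true, Finset.mul_sum]
        refine Finset.sum_congr rfl fun t _ => ?_
        by_cases h : Disjoint K (B j t)
        · rw [if_pos h, if_pos h.symm]; ring
        · rw [if_neg h, if_neg fun h' => h h'.symm]; ring
      · simp [hK]
  have h1 := hX n ∅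
  simp only [Finset.disjoint_empty_right, if_true] at h1
  exact h1.trans (hUle n le_rfl ∅ x₀ hx₀)

end Stieltjes

end RandomLayers

section SeparatedShells

open Matrix

variable {ι : Type*} [Fintype ι] [DecidableEq ι] {Q : Matrix ι ι ℝ}

/-- Almost additivity of the capacities of well separated pieces of a set. -/
lemma Stieltjes.sum_min_le (hQ : Stieltjes Q) (z : ι) {N γ S : ℝ} (hN : 0 < N) (hγ : 0 < γ)
    (n : ℕ) (A : ℕ → Finset ι) (hAγ : ∀ k < n, ∀ v ∈ A k, γ ≤ gk Q Finset.univ z v)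
    (θ : ℕ → ℕ → ℝ) (hθ0 : ∀ k l, 0 ≤ θ k l)
    (hθ : ∀ k < n, ∀ l < n, k ≠ l → ∀ v ∈ A k, ∀ v' ∈ A l, gk Q Finset.univ v v' ≤ θ k l)
    (hS : ∀ k < n, 1 + ∑ l ∈ (Finset.range n).erase k,
      θ k l * gk Q Finset.univ z z / (N * γ ^ 2) ≤ S)
    (K : Finset ι) (hK : ∀ k < n, A k ⊆ K)
    (hS0 : 0 ≤ S) :
    ∑ k ∈ Finset.range n, min 1 (N * (1 - gk Q (A k)ᶜ z z / gk Q Finset.univ z z)) ≤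
      N * S * (1 - gk Q Kᶜ z z / gk Q Finset.univ z z) := by
  have hG := hQ.gk_diag_pos Finset.univ (Finset.mem_univ z)
  set G := gk Q Finset.univ with hGdef
  choose ν hν0 hνn hν using fun k => hQ.exists_balayage Finset.univ (A k) (Finset.mem_univ z)
  simp only [Finset.inter_univ, ← Finset.compl_eq_univ_sdiff, ← hGdef, Finset.mem_univ,
    true_implies] at hν0 hνn hν
  set C : ℕ → ℝ := fun k => G z z - gk Q (A k)ᶜ z z with hC
  have hCm : ∀ k < n, γ * ∑ v, ν k v ≤ C k := by
    intro k hk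
    rw [show C k = (G *ᵥ ν k) z from (hν k z).symm, Finset.mul_sum]
    refine Finset.sum_le_sum fun v _ => ?_
    by_cases hv : v ∈ A k
    · exact mul_le_mul_of_nonneg_right (hAγ k hk v hv) (hνn k v)
    · simp [hν0 k v hv]
  have hC0 : ∀ k < n, 0 ≤ C k := fun k hk =>
    (mul_nonneg hγ.le (Finset.sum_nonneg fun v _ => hνn k v)).trans (hCm k hk)
  have hee : ∀ k, ν k ⬝ᵥ (G *ᵥ ν k) = C k := by
    intro k
    rw [show C k = (G *ᵥ ν k) z from (hν k z).symm]
    simp only [mulVec, dotProduct] at hν ⊢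
    refine Finset.sum_congr rfl fun v _ => ?_
    by_cases hv : v ∈ A k
    · rw [hν k v, gk_of_notMem_left Q (by simp [hv] : v ∉ (A k)ᶜ), hGdef, hQ.gk_symm _ v z]
      ring
    · simp [hν0 k v hv]
  have hekl : ∀ k < n, ∀ l < n, k ≠ l → ν k ⬝ᵥ (G *ᵥ ν l) ≤ θ k l * (C k / γ) * (C l / γ) := by
    intro k hk l hl hkl
    have h1 : ν k ⬝ᵥ (G *ᵥ ν l) ≤ θ k l * (∑ v, ν k v) * (∑ v, ν l v) := by
      simp only [mulVec, dotProduct]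
      rw [mul_assoc, Finset.sum_mul_sum, Finset.mul_sum]
      refine Finset.sum_le_sum fun v _ => ?_
      rw [Finset.mul_sum, Finset.mul_sum]
      refine Finset.sum_le_sum fun v' _ => ?_
      by_cases hv : v ∈ A k
      · by_cases hv' : v' ∈ A l
        · have := mul_le_mul_of_nonneg_right (hθ k hk l hl hkl v hv v' hv')
            (mul_nonneg (hνn k v) (hνn l v'))
          linarith
        · simp [hν0 l v' hv']
      · simp [hν0 k v hv]
    refine h1.trans ?_
    have h2 : ∀ k < n, ∑ v, ν k v ≤ C k / γ := fun k hk => by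
      rw [le_div_iff₀ hγ]; linarith [hCm k hk]
    have h3 : ∀ k, 0 ≤ ∑ v, ν k v := fun k => Finset.sum_nonneg fun v _ => hνn k v
    exact mul_le_mul (mul_le_mul_of_nonneg_left (h2 k hk) (hθ0 k l)) (h2 l hl) (h3 l)
      (mul_nonneg (hθ0 k l) ((h3 k).trans (h2 k hk)))
  set ρ : ℕ → ℝ := fun k => 1 - gk Q (A k)ᶜ z z / G z z with hρ
  have hCρ : ∀ k, C k = G z z * ρ k := fun k => by simp only [hC, hρ]; field_simp
  set s : ℕ → ℝ := fun k => if N * ρ k ≤ 1 then 1 else 1 / (N * ρ k) with hs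
  have hs0 : ∀ k, 0 ≤ s k := by
    intro k
    simp only [hs]
    split_ifs with h
    · exact zero_le_one
    · exact div_nonneg zero_le_one (by linarith)
  have hs1 : ∀ k, s k ≤ 1 := by
    intro k
    simp only [hs]
    split_ifs with h
    · exact le_rfl
    · rw [div_le_one (by linarith)]; linarith
  have hsC : ∀ k, s k * C k = G z z / N * min 1 (N * ρ k) := by
    intro k
    rw [hCρ]
    simp only [hs]
    split_ifs with h
    · rw [min_eq_right h]; field_simp
    · have : N * ρ k ≠ 0 := by linarith
      have : ρ k ≠ 0 := right_ne_zero_of_mul this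
      rw [min_eq_left (by linarith)]; field_simp
  set τ := ∑ k ∈ Finset.range n, min 1 (N * ρ k) with hτ
  have hμ := hQ.sq_gk_mulVec_le Finset.univ K (Finset.mem_univ z)
    (∑ k ∈ Finset.range n, s k • ν k) (fun x hx => by
      simp only [Finset.sum_apply, Pi.smul_apply, smul_eq_mul]
      refine Finset.sum_eq_zero fun k hk => ?_
      rw [hν0 k x fun h => hx (hK k (Finset.mem_range.mp hk) h), mul_zero])
  rw [← Finset.compl_eq_univ_sdiff, ← hGdef] at hμ
  have hz : (G *ᵥ ∑ k ∈ Finset.range n, s k • ν k) z = G z z / N * τ := by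
    rw [Matrix.mulVec_sum, Finset.sum_apply, hτ, Finset.mul_sum]
    refine Finset.sum_congr rfl fun k _ => ?_
    rw [Matrix.mulVec_smul, Pi.smul_apply, smul_eq_mul, hν, ← hsC]
  have hGN : 0 < G z z / N := div_pos hG hN
  have hmin0 : ∀ k < n, 0 ≤ min 1 (N * ρ k) := by
    intro k hk
    have h := hC0 k hk
    rw [hCρ] at h
    exact le_min zero_le_one (mul_nonneg hN.le (nonneg_of_mul_nonneg_right h hG))
  have hform : (∑ k ∈ Finset.range n, s k • ν k) ⬝ᵥ (G *ᵥ ∑ k ∈ Finset.range n, s k • ν k) ≤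
      G z z / N * τ * S := by
    rw [Matrix.mulVec_sum, sum_dotProduct, hτ, Finset.mul_sum, Finset.sum_mul]
    refine Finset.sum_le_sum fun k hk => ?_
    have hk' := Finset.mem_range.mp hk
    rw [dotProduct_sum, ← Finset.add_sum_erase _ _ hk]
    simp only [Matrix.mulVec_smul, dotProduct_smul, smul_dotProduct, smul_eq_mul, hee]
    have ha : 0 ≤ s k * C k := mul_nonneg (hs0 k) (hC0 k hk')
    rw [← hsC]
    refine le_trans ?_ (mul_le_mul_of_nonneg_left (hS k hk') ha)
    rw [mul_add, mul_one, Finset.mul_sum]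
    refine add_le_add ?_ (Finset.sum_le_sum fun l hl => ?_)
    · exact mul_le_of_le_one_left ha (hs1 k)
    · obtain ⟨hlk, hl⟩ := Finset.mem_erase.mp hl
      have hl' := Finset.mem_range.mp hl
      have h1 := mul_le_mul_of_nonneg_left (hekl k hk' l hl' (Ne.symm hlk))
        (mul_nonneg (hs0 k) (hs0 l))
      have h2 : s l * C l ≤ G z z / N := by
        rw [hsC]; exact mul_le_of_le_one_right hGN.le (min_le_left _ _)
      have h3 := mul_le_mul_of_nonneg_left h2
        (mul_nonneg (mul_nonneg ha (hθ0 k l)) (inv_nonneg.mpr (sq_nonneg γ)))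
      calc s l * (s k * (ν k ⬝ᵥ (G *ᵥ ν l))) = s k * s l * (ν k ⬝ᵥ (G *ᵥ ν l)) := by ring
        _ ≤ _ := h1
        _ = s k * C k * θ k l * (γ ^ 2)⁻¹ * (s l * C l) := by field_simp
        _ ≤ _ := h3
        _ = _ := by field_simp
  rw [hz] at hμ
  have hCK0 : 0 ≤ G z z - gk Q Kᶜ z z := sub_nonneg.mpr (hQ.gk_mono (Finset.subset_univ _) z z)
  have hτ0 : 0 ≤ τ := Finset.sum_nonneg fun k hk => hmin0 k (Finset.mem_range.mp hk)
  have hfin : (G z z / N * τ) ^ 2 ≤ (G z z - gk Q Kᶜ z z) * (G z z / N * τ * S) :=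
    hμ.trans (mul_le_mul_of_nonneg_left hform hCK0)
  have hrw : N * S * (1 - gk Q Kᶜ z z / G z z) =
      (G z z - gk Q Kᶜ z z) * S / (G z z / N) := by field_simp
  rw [hrw, le_div_iff₀ hGN]
  rcases hτ0.eq_or_lt with h0 | h0
  · rw [← h0, zero_mul]
    exact mul_nonneg hCK0 hS0
  · have hp : 0 < G z z / N * τ := mul_pos hGN h0
    have : (G z z / N * τ) * (G z z / N * τ) ≤
        (G z z / N * τ) * ((G z z - gk Q Kᶜ z z) * S) := by nlinarith
    have := le_of_mul_le_mul_left this hp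
    linarith

end SeparatedShells

section EdwardsSokal

open Matrix

variable {ι : Type*} [Fintype ι] [DecidableEq ι]

/-- Probability that the bond `e` is closed given the field. -/
def bondClosed (a : ι × ι → ℝ) (φ : ι → ℝ) (e : ι × ι) : ℝ :=
  exp (-(a e * max (φ e.1 * φ e.2) 0))

/-- Probability of the bond configuration `ω` given the field. -/
def bondWt (a : ι × ι → ℝ) (φ : ι → ℝ) (ω : Finset (ι × ι)) : ℝ :=
  (∏ e ∈ ω, (1 - bondClosed a φ e)) * ∏ e ∈ ωᶜ, bondClosed a φ e

/-- Unnormalized Gaussian density with inverse covariance `Q`. -/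
def gaussDens (Q : Matrix ι ι ℝ) (φ : ι → ℝ) : ℝ := exp (-(φ ⬝ᵥ (Q *ᵥ φ)) / 2)

/-- Unnormalized joint density of the field and the bonds. -/
def jointWt (Q : Matrix ι ι ℝ) (a : ι × ι → ℝ) (ω : Finset (ι × ι)) (φ : ι → ℝ) : ℝ :=
  gaussDens Q φ * bondWt a φ ω

/-- The bond strengths `a` are compatible with the inverse covariance `Q`. -/
structure IsBond (Q : Matrix ι ι ℝ) (a : ι × ι → ℝ) : Prop where
  nonneg : ∀ e, 0 ≤ a e
  diag : ∀ x, a (x, x) = 0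
  add_swap : ∀ x y, x ≠ y → a (x, y) + a (y, x) = -2 * Q x y

/-- Two vertices are connected by open bonds, with either orientation. -/
def bondConn (ω : Finset (ι × ι)) : ι → ι → Prop :=
  Relation.ReflTransGen fun u v => (u, v) ∈ ω ∨ (v, u) ∈ ω

/-- The set of vertices connected to `T`. -/
def bondCluster (ω : Finset (ι × ι)) (T : Finset ι) : Finset ι :=
  Finset.univ.filter fun y => ∃ x ∈ T, bondConn ω x y

/-- Change of sign of the field on `A`. -/
def flipOn (A : Finset ι) (φ : ι → ℝ) : ι → ℝ := fun x => if x ∈ A then -φ x else φ x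

omit [Fintype ι] [DecidableEq ι] in
lemma bondConn_symm {ω : Finset (ι × ι)} {x y : ι} (h : bondConn ω x y) : bondConn ω y x := by
  induction h with
  | refl => exact Relation.ReflTransGen.refl
  | tail _ h ih => exact Relation.ReflTransGen.head h.symm ih

omit [DecidableEq ι] in
lemma mem_bondCluster {ω : Finset (ι × ι)} {T : Finset ι} {y : ι} :
    y ∈ bondCluster ω T ↔ ∃ x ∈ T, bondConn ω x y := by simp [bondCluster]

omit [DecidableEq ι] in
lemma subset_bondCluster (ω : Finset (ι × ι)) (T : Finset ι) : T ⊆ bondCluster ω T :=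
  fun x hx => mem_bondCluster.mpr ⟨x, hx, Relation.ReflTransGen.refl⟩

omit [DecidableEq ι] in
lemma bondCluster_closed (ω : Finset (ι × ι)) (T : Finset ι) :
    ∀ e ∈ ω, (e.1 ∈ bondCluster ω T ↔ e.2 ∈ bondCluster ω T) := by
  rintro ⟨u, v⟩ he
  simp only [mem_bondCluster]
  exact ⟨fun ⟨x, hx, h⟩ => ⟨x, hx, h.tail (Or.inl he)⟩,
    fun ⟨x, hx, h⟩ => ⟨x, hx, h.tail (Or.inr he)⟩⟩

omit [Fintype ι] [DecidableEq ι] in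
lemma mem_of_bondConn {ω : Finset (ι × ι)} {A : Finset ι} (hA : ∀ e ∈ ω, (e.1 ∈ A ↔ e.2 ∈ A))
    {x y : ι} (h : bondConn ω x y) : x ∈ A ↔ y ∈ A := by
  induction h with
  | refl => rfl
  | tail _ h ih =>
    rcases h with h | h
    · exact ih.trans (hA _ h)
    · exact ih.trans (hA _ h).symm

omit [Fintype ι] [DecidableEq ι] in
lemma bondClosed_pos (a : ι × ι → ℝ) (φ : ι → ℝ) (e : ι × ι) : 0 < bondClosed a φ e := exp_pos _

omit [Fintype ι] [DecidableEq ι] in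
lemma bondClosed_le_one {a : ι × ι → ℝ} (ha : ∀ e, 0 ≤ a e) (φ : ι → ℝ) (e : ι × ι) :
    bondClosed a φ e ≤ 1 :=
  exp_le_one_iff.mpr (neg_nonpos.mpr (mul_nonneg (ha e) (le_max_right _ _)))

omit [DecidableEq ι] in
lemma gaussDens_pos (Q : Matrix ι ι ℝ) (φ : ι → ℝ) : 0 < gaussDens Q φ := exp_pos _

lemma bondWt_nonneg {a : ι × ι → ℝ} (ha : ∀ e, 0 ≤ a e) (φ : ι → ℝ) (ω : Finset (ι × ι)) :
    0 ≤ bondWt a φ ω :=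
  mul_nonneg (Finset.prod_nonneg fun e _ => sub_nonneg.mpr (bondClosed_le_one ha φ e))
    (Finset.prod_nonneg fun e _ => (bondClosed_pos a φ e).le)

lemma sum_bondWt (a : ι × ι → ℝ) (φ : ι → ℝ) : ∑ ω, bondWt a φ ω = 1 := by
  have := Finset.prod_add (fun e => 1 - bondClosed a φ e) (bondClosed a φ) Finset.univ
  simp only [sub_add_cancel, Finset.prod_const_one, Finset.powerset_univ] at this
  rw [this]
  exact Finset.sum_congr rfl fun ω _ => by rw [bondWt, Finset.compl_eq_univ_sdiff]

lemma bondWt_le_one {a : ι × ι → ℝ} (ha : ∀ e, 0 ≤ a e) (φ : ι → ℝ) (ω : Finset (ι × ι)) :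
    bondWt a φ ω ≤ 1 := by
  rw [← sum_bondWt a φ]
  exact Finset.single_le_sum (fun ω _ => bondWt_nonneg ha φ ω) (Finset.mem_univ ω)

lemma jointWt_nonneg {a : ι × ι → ℝ} (ha : ∀ e, 0 ≤ a e) (Q : Matrix ι ι ℝ) (ω : Finset (ι × ι))
    (φ : ι → ℝ) : 0 ≤ jointWt Q a ω φ :=
  mul_nonneg (gaussDens_pos Q φ).le (bondWt_nonneg ha φ ω)

lemma sum_jointWt (Q : Matrix ι ι ℝ) (a : ι × ι → ℝ) (φ : ι → ℝ) :
    ∑ ω, jointWt Q a ω φ = gaussDens Q φ := by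
  simp only [jointWt, ← Finset.mul_sum, sum_bondWt, mul_one]

/-- The field has constant sign on clusters. -/
lemma mul_pos_of_bondConn {Q : Matrix ι ι ℝ} {a : ι × ι → ℝ} {ω : Finset (ι × ι)} {φ : ι → ℝ}
    (h0 : jointWt Q a ω φ ≠ 0) {x y : ι} (h : bondConn ω x y) : x = y ∨ 0 < φ x * φ y := by
  have hedge : ∀ e ∈ ω, 0 < φ e.1 * φ e.2 := by
    intro e he
    by_contra hn
    apply h0
    have : bondClosed a φ e = 1 := by
      rw [bondClosed, max_eq_right (not_lt.mp hn), mul_zero, neg_zero, exp_zero]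
    rw [jointWt, bondWt, Finset.prod_eq_zero he (by rw [this, sub_self]), zero_mul, mul_zero]
  induction h with
  | refl => exact Or.inl rfl
  | @tail b c _ h ih =>
    have hbc : 0 < φ b * φ c := by
      rcases h with h | h
      · exact hedge _ h
      · rw [mul_comm]; exact hedge _ h
    rcases ih with rfl | ih
    · exact Or.inr hbc
    · right
      have : 0 < (φ x * φ c) * (φ b) ^ 2 := by nlinarith [mul_pos ih hbc]
      exact pos_of_mul_pos_left this (sq_nonneg _)

/-- The joint law is invariant under sign changes on unions of clusters. -/
lemma IsBond.jointWt_flipOn {Q : Matrix ι ι ℝ} {a : ι × ι → ℝ} (ha : IsBond Q a)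
    (hsymm : ∀ x y, Q x y = Q y x) {ω : Finset (ι × ι)}
    {A : Finset ι} (hA : ∀ e ∈ ω, (e.1 ∈ A ↔ e.2 ∈ A)) (φ : ι → ℝ) :
    jointWt Q a ω (flipOn A φ) = jointWt Q a ω φ := by
  have hin : ∀ e : ι × ι, (e.1 ∈ A ↔ e.2 ∈ A) →
      flipOn A φ e.1 * flipOn A φ e.2 = φ e.1 * φ e.2 := by
    intro e he
    simp only [flipOn]
    by_cases h : e.1 ∈ A
    · rw [if_pos h, if_pos (he.mp h)]; ring
    · rw [if_neg h, if_neg fun h' => h (he.mpr h')]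
  have hout : ∀ e : ι × ι, ¬(e.1 ∈ A ↔ e.2 ∈ A) →
      flipOn A φ e.1 * flipOn A φ e.2 = -(φ e.1 * φ e.2) := by
    intro e he
    simp only [flipOn]
    by_cases h : e.1 ∈ A
    · rw [if_pos h, if_neg fun h' => he ⟨fun _ => h', fun _ => h⟩]; ring
    · rw [if_neg h, if_pos (by tauto)]; ring
  have hopen : ∏ e ∈ ω, (1 - bondClosed a (flipOn A φ) e) = ∏ e ∈ ω, (1 - bondClosed a φ e) :=
    Finset.prod_congr rfl fun e he => by rw [bondClosed, bondClosed, hin e (hA e he)]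
  have hexp : ∀ ψ : ι → ℝ, gaussDens Q ψ * ∏ e ∈ ωᶜ, bondClosed a ψ e =
      exp (∑ e : ι × ι, (-(Q e.1 e.2 * (ψ e.1 * ψ e.2)) / 2 -
        if e ∈ ωᶜ then a e * max (ψ e.1 * ψ e.2) 0 else 0)) := by
    intro ψ
    simp only [gaussDens, bondClosed]
    rw [← exp_sum, ← exp_add, Finset.sum_sub_distrib, sub_eq_add_neg, Finset.sum_neg_distrib,
      Finset.sum_ite_mem, Finset.univ_inter]
    congr 2
    simp only [dotProduct, mulVec, Fintype.sum_prod_type, Finset.mul_sum, ← Finset.sum_div,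
      ← Finset.sum_neg_distrib]
    refine congrArg (· / 2) (Finset.sum_congr rfl fun x _ => Finset.sum_congr rfl fun y _ => ?_)
    ring
  have hcross : ∑ e : ι × ι, (if (e.1 ∈ A ↔ e.2 ∈ A) then 0 else
      (Q e.1 e.2 + a e) * (φ e.1 * φ e.2)) = 0 := by
    set F : ι × ι → ℝ := fun e => if (e.1 ∈ A ↔ e.2 ∈ A) then 0 else
      (Q e.1 e.2 + a e) * (φ e.1 * φ e.2) with hF
    have h1 : ∑ e, F (Prod.swap e) = ∑ e, F e := (Equiv.prodComm ι ι).sum_comp F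
    have h2 : ∑ e, (F e + F (Prod.swap e)) = 0 := by
      refine Finset.sum_eq_zero fun e _ => ?_
      obtain ⟨x, y⟩ := e
      simp only [hF, Prod.swap]
      by_cases h : (x ∈ A ↔ y ∈ A)
      · rw [if_pos h, if_pos h.symm, add_zero]
      · rw [if_neg h, if_neg fun h' => h h'.symm]
        have hxy : x ≠ y := by rintro rfl; exact h Iff.rfl
        have := ha.add_swap x y hxy
        rw [hsymm y x]
        linear_combination (φ x * φ y) * this
    rw [Finset.sum_add_distrib, h1] at h2
    linarith
  simp only [jointWt, bondWt]
  rw [hopen, mul_left_comm, hexp, mul_left_comm, hexp]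
  congr 2
  rw [← sub_eq_zero, ← Finset.sum_sub_distrib]
  refine (Finset.sum_congr rfl fun e _ => ?_).trans hcross
  by_cases h : (e.1 ∈ A ↔ e.2 ∈ A)
  · rw [if_pos h, hin e h, sub_self]
  · have he : e ∈ ωᶜ := Finset.mem_compl.mpr fun he => h (hA e he)
    rw [if_neg h, if_pos he, if_pos he, hout e h]
    have : max (-(φ e.1 * φ e.2)) 0 = max (φ e.1 * φ e.2) 0 - φ e.1 * φ e.2 := by
      rcases le_total 0 (φ e.1 * φ e.2) with h | h
      · rw [max_eq_right (by linarith), max_eq_left h]; ring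
      · rw [max_eq_left (by linarith), max_eq_right h]; ring
    rw [this]
    ring

/-- Given the field, the law of the cluster of `T` factorizes. -/
lemma exists_cluster_factor (a : ι × ι → ℝ) (T S : Finset ι) :
    ∃ b : (ι → ℝ) → ℝ, (∀ φ ψ : ι → ℝ, (∀ x ∈ S, φ x = ψ x) → b φ = b ψ) ∧
      ∀ φ, ∑ ω, (if bondCluster ω T = S then bondWt a φ ω else 0) =
        b φ * ∏ e : ι × ι, (if (e.1 ∈ S ↔ e.2 ∈ S) then 1 else bondClosed a φ e) := by
  set D : Finset (ι × ι) := Finset.univ.filter fun e => e.1 ∈ S ∧ e.2 ∈ S with hD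
  have hconn : ∀ (ω : Finset (ι × ι)), (∀ e ∈ ω, (e.1 ∈ S ↔ e.2 ∈ S)) →
      ∀ x y, x ∈ S → bondConn ω x y → bondConn (ω ∩ D) x y ∧ y ∈ S := by
    intro ω hω x y hx h
    induction h with
    | refl => exact ⟨Relation.ReflTransGen.refl, hx⟩
    | @tail b c _ h ih =>
      rcases h with h | h
      · have hc := (hω _ h).mp ih.2
        exact ⟨ih.1.tail (Or.inl (by simp [hD, h, ih.2, hc])), hc⟩
      · have hc := (hω _ h).mpr ih.2
        exact ⟨ih.1.tail (Or.inr (by simp [hD, h, ih.2, hc])), hc⟩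
  have hmono : ∀ (ω : Finset (ι × ι)) x y, bondConn (ω ∩ D) x y → bondConn ω x y := by
    intro ω x y h
    induction h with
    | refl => exact Relation.ReflTransGen.refl
    | tail _ h ih =>
      exact ih.tail (h.imp (fun h => (Finset.mem_inter.mp h).1) fun h => (Finset.mem_inter.mp h).1)
  have hiff : ∀ ω : Finset (ι × ι), bondCluster ω T = S ↔
      (∀ e ∈ ω, (e.1 ∈ S ↔ e.2 ∈ S)) ∧ bondCluster (ω ∩ D) T = S := by
    intro ω
    have hsub : bondCluster (ω ∩ D) T ⊆ bondCluster ω T := by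
      intro y hy
      obtain ⟨x, hx, h⟩ := mem_bondCluster.mp hy
      exact mem_bondCluster.mpr ⟨x, hx, hmono ω x y h⟩
    constructor
    · intro h
      have hc : ∀ e ∈ ω, (e.1 ∈ S ↔ e.2 ∈ S) := h ▸ bondCluster_closed ω T
      refine ⟨hc, (h ▸ hsub).antisymm fun y hy => ?_⟩
      obtain ⟨x, hx, hxy⟩ := mem_bondCluster.mp (h ▸ hy : y ∈ bondCluster ω T)
      exact mem_bondCluster.mpr ⟨x, hx, (hconn ω hc x y (h ▸ subset_bondCluster ω T hx) hxy).1⟩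
    · rintro ⟨hc, h⟩
      refine Finset.Subset.antisymm (fun y hy => ?_) (h ▸ hsub)
      obtain ⟨x, hx, hxy⟩ := mem_bondCluster.mp hy
      exact (hconn ω hc x y (h ▸ subset_bondCluster (ω ∩ D) T hx) hxy).2
  have hfac : ∀ (φ : ι → ℝ) (ω₁ : Finset (ι × ι)),
      ∑ ω, (if (∀ e ∈ ω, (e.1 ∈ S ↔ e.2 ∈ S)) ∧ ω ∩ D = ω₁ then bondWt a φ ω else 0) =
      if ω₁ ⊆ D then (∏ e ∈ D, if e ∈ ω₁ then 1 - bondClosed a φ e else bondClosed a φ e) *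
        ∏ e : ι × ι, (if (e.1 ∈ S ↔ e.2 ∈ S) then 1 else bondClosed a φ e) else 0 := by
    intro φ ω₁
    split_ifs with hω₁
    swap
    · refine Finset.sum_eq_zero fun ω _ => if_neg fun h => hω₁ ?_
      rw [← h.2]; exact Finset.inter_subset_right
    set f : ι × ι → ℝ := fun e => if (e.1 ∈ S ↔ e.2 ∈ S) then
      (if e ∈ D then (if e ∈ ω₁ then 1 - bondClosed a φ e else 0) else 1 - bondClosed a φ e)
      else 0 with hf
    set g : ι × ι → ℝ := fun e =>
      if e ∈ D then (if e ∈ ω₁ then 0 else bondClosed a φ e) else bondClosed a φ e with hg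
    have h1 := Finset.prod_add f g Finset.univ
    have h2 : ∏ e, (f e + g e) =
        (∏ e ∈ D, if e ∈ ω₁ then 1 - bondClosed a φ e else bondClosed a φ e) *
        ∏ e : ι × ι, (if (e.1 ∈ S ↔ e.2 ∈ S) then 1 else bondClosed a φ e) := by
      have : ∏ e ∈ D, (if e ∈ ω₁ then 1 - bondClosed a φ e else bondClosed a φ e) =
          ∏ e, (if e ∈ D then (if e ∈ ω₁ then 1 - bondClosed a φ e else bondClosed a φ e)
            else 1) := by
        rw [Finset.prod_ite_mem, Finset.univ_inter]
      rw [this, ← Finset.prod_mul_distrib]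
      refine Finset.prod_congr rfl fun e _ => ?_
      simp only [hf, hg, hD, Finset.mem_filter, Finset.mem_univ, true_and]
      by_cases h1 : e.1 ∈ S <;> by_cases h2 : e.2 ∈ S <;> by_cases h3 : e ∈ ω₁ <;>
        simp [h1, h2, h3]
    rw [← h2, h1, Finset.powerset_univ]
    refine Finset.sum_congr rfl fun ω _ => ?_
    split_ifs with h
    · rw [bondWt, Finset.compl_eq_univ_sdiff]
      congr 1
      · refine Finset.prod_congr rfl fun e he => ?_
        have h3 : e ∈ D → e ∈ ω₁ := fun h' => by rw [← h.2]; exact Finset.mem_inter.mpr ⟨he, h'⟩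
        simp only [hf, if_pos (h.1 e he)]
        split_ifs <;> tauto
      · refine Finset.prod_congr rfl fun e he => ?_
        have h3 : e ∉ ω₁ := fun h' => by
          rw [← h.2] at h'
          exact (Finset.mem_sdiff.mp he).2 (Finset.mem_inter.mp h').1
        simp only [hg, if_neg h3, ite_self]
    · symm
      rw [not_and_or] at h
      rcases h with h | h
      · push Not at h
        obtain ⟨e, he, h⟩ := h
        have h' : ¬(e.1 ∈ S ↔ e.2 ∈ S) := by tauto
        rw [Finset.prod_eq_zero he (by simp only [hf, if_neg h']), zero_mul]
      · by_cases hsub : ω ∩ D ⊆ ω₁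
        · have : ∃ e ∈ ω₁, e ∉ ω ∩ D := by
            by_contra hn
            push Not at hn
            exact h (hsub.antisymm hn)
          obtain ⟨e, he, hn⟩ := this
          have heD := hω₁ he
          have heω : e ∉ ω := fun h' => hn (Finset.mem_inter.mpr ⟨h', heD⟩)
          rw [Finset.prod_eq_zero (Finset.mem_sdiff.mpr ⟨Finset.mem_univ e, heω⟩)
            (by simp only [hg, if_pos heD, if_pos he]), mul_zero]
        · rw [Finset.not_subset] at hsub
          obtain ⟨e, he, hn⟩ := hsub
          obtain ⟨he, heD⟩ := Finset.mem_inter.mp he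
          rw [Finset.prod_eq_zero he (by simp only [hf, if_pos heD, if_neg hn, ite_self]),
            zero_mul]
  refine ⟨fun φ => ∑ ω₁, if bondCluster ω₁ T = S then (if ω₁ ⊆ D then
    (∏ e ∈ D, if e ∈ ω₁ then 1 - bondClosed a φ e else bondClosed a φ e) else 0) else 0, ?_, ?_⟩
  · intro φ ψ h
    refine Finset.sum_congr rfl fun ω₁ _ => ?_
    congr 2
    refine Finset.prod_congr rfl fun e he => ?_
    have he' := (Finset.mem_filter.mp he).2
    simp only [bondClosed, h _ he'.1, h _ he'.2]
  · intro φ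
    rw [Finset.sum_mul]
    have : ∀ ω₁ : Finset (ι × ι), (if bondCluster ω₁ T = S then (if ω₁ ⊆ D then
        (∏ e ∈ D, if e ∈ ω₁ then 1 - bondClosed a φ e else bondClosed a φ e) else 0) else 0) *
        ∏ e : ι × ι, (if (e.1 ∈ S ↔ e.2 ∈ S) then 1 else bondClosed a φ e) =
        ∑ ω, if bondCluster ω₁ T = S ∧ (∀ e ∈ ω, (e.1 ∈ S ↔ e.2 ∈ S)) ∧ ω ∩ D = ω₁
          then bondWt a φ ω else 0 := by
      intro ω₁
      by_cases h : bondCluster ω₁ T = S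
      · simp only [h, true_and]
        rw [hfac]
        split_ifs <;> simp
      · simp [h]
    rw [Finset.sum_congr rfl fun ω₁ _ => this ω₁, Finset.sum_comm]
    refine Finset.sum_congr rfl fun ω _ => ?_
    rw [Finset.sum_eq_single (ω ∩ D) (fun ω₁ _ h => if_neg fun h' => h h'.2.2.symm)
      (fun h => absurd (Finset.mem_univ _) h)]
    exact if_congr (by rw [hiff ω]; tauto) rfl rfl

end EdwardsSokal

section GaussianIntegrals

open Matrix

variable {ι : Type*} [Fintype ι] [DecidableEq ι]

/-- Measurable functions with at most exponential growth. -/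
def ExpGrowth (h : (ι → ℝ) → ℝ) : Prop :=
  Measurable h ∧ ∃ C c : ℝ, 0 ≤ C ∧ 0 ≤ c ∧ ∀ φ, |h φ| ≤ C * exp (c * ∑ i, |φ i|)

namespace ExpGrowth

omit [DecidableEq ι] in
lemma of_bounded {h : (ι → ℝ) → ℝ} (hm : Measurable h) {C : ℝ} (hC : ∀ φ, |h φ| ≤ C) :
    ExpGrowth h := by
  refine ⟨hm, C, 0, (abs_nonneg _).trans (hC 0), le_rfl, fun φ => ?_⟩
  simpa using hC φ

omit [DecidableEq ι] in
lemma mul {h k : (ι → ℝ) → ℝ} (hh : ExpGrowth h) (hk : ExpGrowth k) :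
    ExpGrowth fun φ => h φ * k φ := by
  obtain ⟨hm, C, c, hC, hc, hb⟩ := hh
  obtain ⟨km, C', c', hC', hc', kb⟩ := hk
  refine ⟨hm.mul km, C * C', c + c', mul_nonneg hC hC', add_nonneg hc hc', fun φ => ?_⟩
  rw [abs_mul, add_mul, exp_add]
  calc _ ≤ _ := mul_le_mul (hb φ) (kb φ) (abs_nonneg _) (mul_nonneg hC (exp_pos _).le)
    _ = _ := by ring

omit [DecidableEq ι] in
lemma add {h k : (ι → ℝ) → ℝ} (hh : ExpGrowth h) (hk : ExpGrowth k) :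
    ExpGrowth fun φ => h φ + k φ := by
  obtain ⟨hm, C, c, hC, hc, hb⟩ := hh
  obtain ⟨km, C', c', hC', hc', kb⟩ := hk
  refine ⟨hm.add km, C + C', c + c', add_nonneg hC hC', add_nonneg hc hc', fun φ => ?_⟩
  have hS : 0 ≤ ∑ i, |φ i| := Finset.sum_nonneg fun i _ => abs_nonneg _
  have h1 : exp (c * ∑ i, |φ i|) ≤ exp ((c + c') * ∑ i, |φ i|) :=
    exp_le_exp.mpr (mul_le_mul_of_nonneg_right (by linarith) hS)
  have h2 : exp (c' * ∑ i, |φ i|) ≤ exp ((c + c') * ∑ i, |φ i|) :=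
    exp_le_exp.mpr (mul_le_mul_of_nonneg_right (by linarith) hS)
  calc |h φ + k φ| ≤ |h φ| + |k φ| := abs_add_le _ _
    _ ≤ C * exp (c * ∑ i, |φ i|) + C' * exp (c' * ∑ i, |φ i|) := add_le_add (hb φ) (kb φ)
    _ ≤ _ := by rw [add_mul]; gcongr

omit [DecidableEq ι] in
lemma const (c : ℝ) : ExpGrowth fun _ : ι → ℝ => c := of_bounded measurable_const fun _ => le_rfl

omit [DecidableEq ι] in
lemma exp_coord (h : ℝ) (z : ι) : ExpGrowth fun φ : ι → ℝ => exp (h * φ z) := by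
  refine ⟨by fun_prop, 1, |h|, zero_le_one, abs_nonneg h, fun φ => ?_⟩
  rw [abs_of_pos (exp_pos _), one_mul, exp_le_exp]
  calc h * φ z ≤ |h| * |φ z| := by rw [← abs_mul]; exact le_abs_self _
    _ ≤ _ := mul_le_mul_of_nonneg_left (Finset.single_le_sum (f := fun i => |φ i|)
      (fun i _ => abs_nonneg _) (Finset.mem_univ z)) (abs_nonneg h)

omit [DecidableEq ι] in
lemma coord (z : ι) : ExpGrowth fun φ : ι → ℝ => φ z := by
  refine ⟨by fun_prop, 1, 1, zero_le_one, zero_le_one, fun φ => ?_⟩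
  have h1 : |φ z| ≤ ∑ i, |φ i| := Finset.single_le_sum (f := fun i => |φ i|)
    (fun i _ => abs_nonneg _) (Finset.mem_univ z)
  rw [one_mul, one_mul]
  linarith [add_one_le_exp (∑ i, |φ i|)]

omit [DecidableEq ι] in
lemma abs {h : (ι → ℝ) → ℝ} (hh : ExpGrowth h) : ExpGrowth fun φ => |h φ| := by
  obtain ⟨hm, C, c, hC, hc, hb⟩ := hh
  exact ⟨hm.abs, C, c, hC, hc, fun φ => by rw [abs_abs]; exact hb φ⟩

end ExpGrowth

lemma Stieltjes.sq_le_form {Q : Matrix ι ι ℝ} (hQ : Stieltjes Q) (φ : ι → ℝ) (x : ι) :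
    φ x ^ 2 ≤ gk Q Finset.univ x x * (φ ⬝ᵥ (Q *ᵥ φ)) := by
  set u : ι → ℝ := fun y => gk Q Finset.univ y x
  have h1 : ∀ f : ι → ℝ, f ⬝ᵥ (Q *ᵥ u) = f x := by
    intro f
    simp only [dotProduct]
    rw [Finset.sum_eq_single x]
    · rw [hQ.mulVec_gk _ (Finset.mem_univ x) (Finset.mem_univ x), if_pos rfl, mul_one]
    · intro y _ hy
      rw [hQ.mulVec_gk _ (Finset.mem_univ y) (Finset.mem_univ x), if_neg hy, mul_zero]
    · intro h; exact absurd (Finset.mem_univ x) h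
  have h2 := form_cauchy_schwarz Q hQ.symm hQ.nonneg_form φ u
  rw [h1, h1] at h2
  linarith

lemma Stieltjes.exists_gaussDens_le {Q : Matrix ι ι ℝ} (hQ : Stieltjes Q) :
    ∃ κ > 0, ∀ φ, gaussDens Q φ ≤ exp (-κ * ∑ i, φ i ^ 2) := by
  set s := ∑ x, gk Q Finset.univ x x
  have hs : 0 ≤ s := Finset.sum_nonneg fun x _ => hQ.gk_nonneg _ x x
  refine ⟨1 / (2 * (s + 1)), by positivity, fun φ => exp_le_exp.mpr ?_⟩
  have h1 : ∑ i, φ i ^ 2 ≤ s * (φ ⬝ᵥ (Q *ᵥ φ)) := by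
    rw [Finset.sum_mul]
    exact Finset.sum_le_sum fun x _ => hQ.sq_le_form φ x
  have h2 := hQ.nonneg_form φ
  have h3 : 1 / (2 * (s + 1)) * ∑ i, φ i ^ 2 ≤ (φ ⬝ᵥ (Q *ᵥ φ)) / 2 := by
    rw [div_mul_eq_mul_div, div_le_div_iff₀ (by positivity) two_pos]
    nlinarith
  linarith

omit [DecidableEq ι] in
lemma integrable_exp_neg_sum_sq {κ : ℝ} (hκ : 0 < κ) :
    Integrable fun φ : ι → ℝ => exp (-κ * ∑ i, φ i ^ 2) := by
  have := Integrable.fintype_prod (ι := ι) (f := fun _ t => exp (-κ * t ^ 2))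
    (fun _ => integrable_exp_neg_mul_sq hκ)
  rw [volume_pi]
  simpa only [← exp_sum, ← Finset.mul_sum] using this

omit [DecidableEq ι] in
lemma continuous_gaussDens (Q : Matrix ι ι ℝ) : Continuous (gaussDens Q) := by
  unfold gaussDens dotProduct Matrix.mulVec dotProduct
  fun_prop

lemma Stieltjes.integrable_mul_gaussDens {Q : Matrix ι ι ℝ} (hQ : Stieltjes Q)
    {h : (ι → ℝ) → ℝ} (hh : ExpGrowth h) : Integrable fun φ => h φ * gaussDens Q φ := by
  obtain ⟨hm, C, c, hC, hc, hb⟩ := hh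
  obtain ⟨κ, hκ, hf⟩ := hQ.exists_gaussDens_le
  refine Integrable.mono' ((integrable_exp_neg_sum_sq (ι := ι) (half_pos hκ)).const_mul
    (C * exp (∑ _i : ι, c ^ 2 / (2 * κ)))) (hm.mul (continuous_gaussDens Q).measurable
      ).aestronglyMeasurable (Eventually.of_forall fun φ => ?_)
  rw [norm_mul, Real.norm_eq_abs, Real.norm_eq_abs, abs_of_pos (gaussDens_pos Q φ)]
  calc |h φ| * gaussDens Q φ ≤ C * exp (c * ∑ i, |φ i|) * exp (-κ * ∑ i, φ i ^ 2) :=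
        mul_le_mul (hb φ) (hf φ) (gaussDens_pos Q φ).le (mul_nonneg hC (exp_pos _).le)
    _ = C * exp (c * ∑ i, |φ i| + -κ * ∑ i, φ i ^ 2) := by rw [exp_add, mul_assoc]
    _ ≤ C * exp (∑ _i : ι, c ^ 2 / (2 * κ) + -(κ / 2) * ∑ i, φ i ^ 2) := by
        refine mul_le_mul_of_nonneg_left (exp_le_exp.mpr ?_) hC
        simp only [Finset.mul_sum, ← Finset.sum_add_distrib]
        refine Finset.sum_le_sum fun i _ => ?_
        have h1 : c ^ 2 / (2 * κ) + -(κ / 2) * φ i ^ 2 - (c * |φ i| + -κ * φ i ^ 2) =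
            (c - κ * |φ i|) ^ 2 / (2 * κ) := by
          rw [← sq_abs (φ i)]; field_simp; ring
        have h2 : 0 ≤ (c - κ * |φ i|) ^ 2 / (2 * κ) := by positivity
        linarith
    _ = _ := by rw [exp_add, mul_assoc]

lemma continuous_bondWt (a : ι × ι → ℝ) (ω : Finset (ι × ι)) :
    Continuous fun φ => bondWt a φ ω := by
  unfold bondWt bondClosed
  fun_prop

lemma IsBond.expGrowth_bondWt {Q : Matrix ι ι ℝ} {a : ι × ι → ℝ} (ha : IsBond Q a)
    (ω : Finset (ι × ι)) : ExpGrowth fun φ => bondWt a φ ω :=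
  ExpGrowth.of_bounded (continuous_bondWt a ω).measurable fun φ => by
    rw [abs_of_nonneg (bondWt_nonneg ha.nonneg φ ω)]; exact bondWt_le_one ha.nonneg φ ω

lemma Stieltjes.integrable_mul_jointWt {Q : Matrix ι ι ℝ} (hQ : Stieltjes Q) {a : ι × ι → ℝ}
    (ha : IsBond Q a) {h : (ι → ℝ) → ℝ} (hh : ExpGrowth h) (ω : Finset (ι × ι)) :
    Integrable fun φ => h φ * jointWt Q a ω φ := by
  have := hQ.integrable_mul_gaussDens (hh.mul (ha.expGrowth_bondWt ω))
  refine this.congr (Eventually.of_forall fun φ => ?_)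
  simp only [jointWt]
  ring

lemma measurePreserving_flipOn (A : Finset ι) :
    MeasurePreserving (flipOn A : (ι → ℝ) → ι → ℝ) := by
  have : (flipOn A : (ι → ℝ) → ι → ℝ) =
      fun φ i => (fun t : ℝ => if i ∈ A then -t else t) (φ i) := rfl
  rw [this]
  refine volume_preserving_pi (f := fun i (t : ℝ) => if i ∈ A then -t else t) fun i => ?_
  by_cases h : i ∈ A
  · simpa only [h, if_true] using Measure.measurePreserving_neg (volume : Measure ℝ)
  · simp only [h, if_false]
    exact MeasurePreserving.id _

lemma integral_flipOn (A : Finset ι) (F : (ι → ℝ) → ℝ) :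
    ∫ φ, F (flipOn A φ) = ∫ φ, F φ := by
  have hmp := measurePreserving_flipOn A
  have hinv : Function.Involutive (flipOn A : (ι → ℝ) → ι → ℝ) := by
    intro φ
    ext i
    simp only [flipOn]
    split_ifs <;> simp
  have hemb : MeasurableEmbedding (flipOn A : (ι → ℝ) → ι → ℝ) :=
    (MeasurableEquiv.mk (hinv.toPerm _) hmp.measurable hmp.measurable).measurableEmbedding
  exact hmp.integral_comp hemb F

/-- Vanishing of the integral of a partial derivative, allowing a kink on a hyperplane. -/
lemma integral_partial_eq_zero (x : ι) (H D : (ι → ℝ) → ℝ) (hH : Integrable H)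
    (hD : Integrable D) (hcont : ∀ φ, Continuous fun t => H (Function.update φ x t))
    (hder : ∀ φ t, t ≠ 0 → HasDerivAt (fun t => H (Function.update φ x t))
      (D (Function.update φ x t)) t) : ∫ φ, D φ = 0 := by
  have hline : ∀ u v : ℝ → ℝ, Continuous u → (∀ t, t ≠ 0 → HasDerivAt u (v t) t) →
      Integrable u → Integrable v → ∫ t, v t = 0 := by
    intro u v hu huv hui hvi
    have h1 : ∫ t in Set.Ioi (0 : ℝ), v t = 0 - u 0 := by
      refine integral_Ioi_of_hasDerivAt_of_tendsto hu.continuousWithinAt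
        (fun t ht => huv t (ne_of_gt ht)) hvi.integrableOn ?_
      exact tendsto_zero_of_hasDerivAt_of_integrableOn_Ioi (a := 0)
        (fun t ht => huv t (ne_of_gt ht)) hvi.integrableOn hui.integrableOn
    have h2 : ∫ t in Set.Iic (0 : ℝ), v t = u 0 - 0 := by
      refine integral_Iic_of_hasDerivAt_of_tendsto hu.continuousWithinAt
        (fun t ht => huv t (ne_of_lt ht)) hvi.integrableOn ?_
      exact tendsto_zero_of_hasDerivAt_of_integrableOn_Iic (a := -1)
        (fun t ht => huv t (ne_of_lt (lt_of_le_of_lt ht (by norm_num)))) hvi.integrableOn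
        hui.integrableOn
    rw [← intervalIntegral.integral_Iic_add_Ioi hvi.integrableOn hvi.integrableOn (b := 0), h1, h2]
    ring
  have hUn : Unique {i : ι // ¬ i ≠ x} := ⟨⟨⟨x, by simp⟩⟩, fun ⟨y, hy⟩ => by
    simp only [not_not] at hy; subst hy; rfl⟩
  set e := MeasurableEquiv.piEquivPiSubtypeProd (fun _ : ι => ℝ) (fun i => i ≠ x)
  have he : MeasurePreserving e.symm :=
    (volume_preserving_piEquivPiSubtypeProd (fun _ : ι => ℝ) _).symm e
  set u := MeasurableEquiv.funUnique {i : ι // ¬ i ≠ x} ℝ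
  have hu : MeasurePreserving u.symm :=
    by convert (volume_preserving_funUnique {i : ι // ¬ i ≠ x} ℝ).symm u
  set E := (MeasurableEquiv.prodCongr (MeasurableEquiv.refl ({i : ι // i ≠ x} → ℝ)) u.symm).trans
    e.symm
  have hE : MeasurePreserving E := he.comp ((MeasurePreserving.id _).prod hu)
  have hEu : ∀ f t, E (f, t) = Function.update (E (f, 0)) x t := by
    intro f t
    ext i
    by_cases hi : i = x
    · subst hi
      rw [Function.update_self]
      have : E (f, t) i = if h : i ≠ i then f ⟨i, h⟩ else t := rfl
      rw [this]; simp
    · rw [Function.update_of_ne hi]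
      have h1 : ∀ s, E (f, s) i = if h : i ≠ x then f ⟨i, h⟩ else s := fun s => rfl
      rw [h1, h1]; simp [hi]
  have hDi : Integrable (fun q => D (E q)) := hE.integrable_comp_of_integrable hD
  have hHi : Integrable (fun q => H (E q)) := hE.integrable_comp_of_integrable hH
  rw [← hE.integral_comp E.measurableEmbedding D]
  rw [Measure.volume_eq_prod] at hDi hHi ⊢
  rw [integral_prod _ hDi]
  refine integral_eq_zero_of_ae ?_
  filter_upwards [hDi.prod_right_ae, hHi.prod_right_ae] with f hf1 hf2
  refine hline (fun t => H (E (f, t))) _ ?_ ?_ hf2 hf1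
  · rw [show (fun t => H (E (f, t))) = fun t => H (Function.update (E (f, 0)) x t) from
      funext fun t => by rw [← hEu]]
    exact hcont _
  · intro t ht
    have := hder (E (f, 0)) t ht
    rw [show (fun t => H (E (f, t))) = fun t => H (Function.update (E (f, 0)) x t) from
      funext fun t => by rw [← hEu]]
    rwa [← hEu] at this

end GaussianIntegrals

section ClusterWeights

open Matrix

variable {ι : Type*} [Fintype ι] [DecidableEq ι]

/-- The joint weight of the field and the event that the cluster of `T` equals `S`. -/
def clusterWt (Q : Matrix ι ι ℝ) (a : ι × ι → ℝ) (T S : Finset ι) (φ : ι → ℝ) : ℝ :=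
  ∑ ω, if bondCluster ω T = S then jointWt Q a ω φ else 0

/-- The effective energy seen from outside of `S`, given that `S` is a union of clusters. -/
def clusterEnergy (Q : Matrix ι ι ℝ) (S : Finset ι) (φ : ι → ℝ) : ℝ :=
  (-1 / 2) * (∑ u ∈ Sᶜ, ∑ v ∈ Sᶜ, φ u * Q u v * φ v) + ∑ u ∈ Sᶜ, ∑ v ∈ S, |φ u| * Q u v * |φ v|

/-- The sign function as a difference of indicators. -/
def sgn (t : ℝ) : ℝ := (if 0 < t then 1 else 0) - (if t < 0 then 1 else 0)

lemma sgn_neg (t : ℝ) : sgn (-t) = -sgn t := by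
  simp [sgn]

lemma abs_sgn_le (t : ℝ) : |sgn t| ≤ 1 := by
  unfold sgn; split_ifs <;> norm_num

lemma measurable_sgn : Measurable sgn :=
  (Measurable.ite measurableSet_Ioi measurable_const measurable_const).sub
    (Measurable.ite measurableSet_Iio measurable_const measurable_const)

lemma hasDerivAt_abs_sgn {t : ℝ} (ht : t ≠ 0) : HasDerivAt (fun s : ℝ => |s|) (sgn t) t := by
  rcases lt_or_gt_of_ne ht with h | h
  · simpa [sgn, h, h.le, not_lt.mpr h.le] using hasDerivAt_abs_neg h
  · simpa [sgn, h, not_lt.mpr h.le] using hasDerivAt_abs_pos h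

lemma IsBond.sum_mixed {Q : Matrix ι ι ℝ} {a : ι × ι → ℝ}
    (ha : IsBond Q a) (S : Finset ι) (φ : ι → ℝ) :
    (∑ e : ι × ι, if (e.1 ∈ S ↔ e.2 ∈ S) then 0 else a e * max (φ e.1 * φ e.2) 0) =
      -∑ u ∈ Sᶜ, ∑ v ∈ S, (φ u * Q u v * φ v + |φ u| * Q u v * |φ v|) := by
  rw [Fintype.sum_prod_type]
  have hsplit : ∀ f : ι → ℝ, ∑ u, f u = ∑ u ∈ S, f u + ∑ u ∈ Sᶜ, f u := fun f =>
    (Finset.sum_add_sum_compl S f).symm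
  rw [hsplit]
  have h1 : ∑ u ∈ S, ∑ v, (if (u ∈ S ↔ v ∈ S) then 0 else a (u, v) * max (φ u * φ v) 0) =
      ∑ u ∈ Sᶜ, ∑ v ∈ S, a (v, u) * max (φ u * φ v) 0 := by
    rw [Finset.sum_comm (s := Sᶜ)]
    refine Finset.sum_congr rfl fun u hu => ?_
    rw [hsplit, Finset.sum_eq_zero, zero_add]
    · refine Finset.sum_congr rfl fun v hv => ?_
      rw [if_neg, mul_comm (φ u)]
      simp only [Finset.mem_compl] at hv
      tauto
    · intro v hv; rw [if_pos]; tauto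
  have h2 : ∑ u ∈ Sᶜ, ∑ v, (if (u ∈ S ↔ v ∈ S) then 0 else a (u, v) * max (φ u * φ v) 0) =
      ∑ u ∈ Sᶜ, ∑ v ∈ S, a (u, v) * max (φ u * φ v) 0 := by
    refine Finset.sum_congr rfl fun u hu => ?_
    rw [hsplit, add_comm, Finset.sum_eq_zero, zero_add]
    · refine Finset.sum_congr rfl fun v hv => ?_
      rw [if_neg]
      simp only [Finset.mem_compl] at hu
      tauto
    · intro v hv
      simp only [Finset.mem_compl] at hu hv
      rw [if_pos]; tauto
  rw [h1, h2, ← Finset.sum_add_distrib, ← Finset.sum_neg_distrib]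
  refine Finset.sum_congr rfl fun u hu => ?_
  rw [← Finset.sum_add_distrib, ← Finset.sum_neg_distrib]
  refine Finset.sum_congr rfl fun v hv => ?_
  have huv : u ≠ v := by
    rintro rfl; exact (Finset.mem_compl.mp hu) hv
  have h3 : max (φ u * φ v) 0 = (φ u * φ v + |φ u| * |φ v|) / 2 := by
    rw [← abs_mul]
    rcases le_total 0 (φ u * φ v) with h | h
    · rw [max_eq_left h, abs_of_nonneg h]; ring
    · rw [max_eq_right h, abs_of_nonpos h]; ring
  rw [← add_mul, add_comm (a (v, u)), ha.add_swap u v huv, h3]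
  ring

lemma IsBond.exists_clusterWt_eq {Q : Matrix ι ι ℝ} (hsymm : ∀ x y, Q x y = Q y x)
    {a : ι × ι → ℝ} (ha : IsBond Q a) (T S : Finset ι) :
    ∃ b : (ι → ℝ) → ℝ, (∀ φ ψ : ι → ℝ, (∀ x ∈ S, φ x = ψ x) → b φ = b ψ) ∧
      ∀ φ, clusterWt Q a T S φ = b φ * exp (clusterEnergy Q S φ) := by
  obtain ⟨b, hb, hbe⟩ := exists_cluster_factor a T S
  refine ⟨fun φ => b φ * exp ((-1 / 2) * ∑ u ∈ S, ∑ v ∈ S, φ u * Q u v * φ v), ?_, ?_⟩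
  · intro φ ψ h
    simp only
    rw [hb φ ψ h]
    congr 3
    exact Finset.sum_congr rfl fun u hu => Finset.sum_congr rfl fun v hv => by
      rw [h u hu, h v hv]
  · intro φ
    have h1 : clusterWt Q a T S φ =
        gaussDens Q φ * ∑ ω, (if bondCluster ω T = S then bondWt a φ ω else 0) := by
      rw [Finset.mul_sum]
      exact Finset.sum_congr rfl fun ω _ => by
        split_ifs
        · rfl
        · rw [mul_zero]
    have h2 : ∏ e : ι × ι, (if (e.1 ∈ S ↔ e.2 ∈ S) then 1 else bondClosed a φ e) =
        exp (∑ u ∈ Sᶜ, ∑ v ∈ S, (φ u * Q u v * φ v + |φ u| * Q u v * |φ v|)) := by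
      rw [← neg_neg (∑ u ∈ Sᶜ, _), ← ha.sum_mixed S φ, ← Finset.sum_neg_distrib, exp_sum]
      refine Finset.prod_congr rfl fun e _ => ?_
      split_ifs
      · simp
      · rfl
    have h3 : φ ⬝ᵥ (Q *ᵥ φ) = (∑ u ∈ S, ∑ v ∈ S, φ u * Q u v * φ v) +
        (∑ u ∈ Sᶜ, ∑ v ∈ Sᶜ, φ u * Q u v * φ v) + 2 * ∑ u ∈ Sᶜ, ∑ v ∈ S, φ u * Q u v * φ v := by
      have : φ ⬝ᵥ (Q *ᵥ φ) = ∑ u, ∑ v, φ u * Q u v * φ v := by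
        simp only [dotProduct, mulVec, Finset.mul_sum, mul_assoc]
      rw [this, ← Finset.sum_add_sum_compl S]
      have hc : ∀ u, ∑ v, φ u * Q u v * φ v = ∑ v ∈ S, φ u * Q u v * φ v +
        ∑ v ∈ Sᶜ, φ u * Q u v * φ v := fun u => (Finset.sum_add_sum_compl S _).symm
      simp only [hc, Finset.sum_add_distrib]
      have : ∑ u ∈ S, ∑ v ∈ Sᶜ, φ u * Q u v * φ v = ∑ u ∈ Sᶜ, ∑ v ∈ S, φ u * Q u v * φ v := by
        rw [Finset.sum_comm]
        exact Finset.sum_congr rfl fun u _ => Finset.sum_congr rfl fun v _ => by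
          rw [hsymm]; ring
      rw [this]; ring
    rw [h1, hbe, h2, gaussDens, h3, clusterEnergy]
    rw [mul_left_comm, ← exp_add, mul_assoc, ← exp_add]
    congr 2
    simp only [Finset.sum_add_distrib]
    ring

omit [Fintype ι] in
lemma hasDerivAt_update_coord (φ : ι → ℝ) (x u : ι) (t : ℝ) :
    HasDerivAt (fun s => Function.update φ x s u) (if u = x then 1 else 0) t := by
  by_cases h : u = x
  · subst h; simp only [Function.update_self, if_true]; exact hasDerivAt_id t
  · simpa [h] using hasDerivAt_const t (φ u)

omit [Fintype ι] in
lemma hasDerivAt_abs_update (φ : ι → ℝ) (x u : ι) {t : ℝ} (ht : t ≠ 0) :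
    HasDerivAt (fun s => |Function.update φ x s u|) (if u = x then sgn t else 0) t := by
  by_cases h : u = x
  · subst h; simpa using hasDerivAt_abs_sgn ht
  · simpa [h] using hasDerivAt_const t (|φ u|)

/-- The derivative of the effective energy in the direction of a vertex outside of `S`. -/
def clusterForce (Q : Matrix ι ι ℝ) (S : Finset ι) (x : ι) (φ : ι → ℝ) : ℝ :=
  -(∑ v ∈ Sᶜ, Q x v * φ v) + ∑ v ∈ S, Q x v * (sgn (φ x) * |φ v|)

lemma hasDerivAt_clusterEnergy {Q : Matrix ι ι ℝ} (hsymm : ∀ x y, Q x y = Q y x) (S : Finset ι)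
    {x : ι} (hx : x ∉ S) (φ : ι → ℝ) {t : ℝ} (ht : t ≠ 0) :
    HasDerivAt (fun s => clusterEnergy Q S (Function.update φ x s))
      (clusterForce Q S x (Function.update φ x t)) t := by
  have hxc : x ∈ Sᶜ := Finset.mem_compl.mpr hx
  have h1 := (HasDerivAt.fun_sum fun u (_ : u ∈ Sᶜ) => HasDerivAt.fun_sum fun v (_ : v ∈ Sᶜ) =>
    ((hasDerivAt_update_coord φ x u t).mul_const (Q u v)).mul
      (hasDerivAt_update_coord φ x v t)).const_mul
      (-1 / 2 : ℝ)
  have h2 := HasDerivAt.fun_sum fun u (_ : u ∈ Sᶜ) => HasDerivAt.fun_sum fun v (_ : v ∈ S) =>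
    ((hasDerivAt_abs_update φ x u ht).mul_const (Q u v)).mul (hasDerivAt_abs_update φ x v ht)
  refine (h1.add h2).congr_deriv ?_
  have e1 : ∑ u ∈ Sᶜ, ∑ v ∈ Sᶜ, ((if u = x then (1 : ℝ) else 0) * Q u v *
      Function.update φ x t v + Function.update φ x t u * Q u v * if v = x then 1 else 0) =
      2 * ∑ v ∈ Sᶜ, Q x v * Function.update φ x t v := by
    simp only [Finset.sum_add_distrib, ite_mul, one_mul, zero_mul, mul_ite, mul_one, mul_zero]
    rw [Finset.sum_comm]
    simp only [Finset.sum_ite_eq', hxc, if_true]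
    rw [two_mul]
    congr 1
    exact Finset.sum_congr rfl fun v _ => by rw [hsymm, mul_comm]
  have e2 : ∑ u ∈ Sᶜ, ∑ v ∈ S, ((if u = x then sgn t else 0) * Q u v *
      |Function.update φ x t v| + |Function.update φ x t u| * Q u v * if v = x then sgn t else 0) =
      ∑ v ∈ S, Q x v * (sgn t * |Function.update φ x t v|) := by
    rw [Finset.sum_eq_single x]
    · refine Finset.sum_congr rfl fun v hv => ?_
      have : v ≠ x := by rintro rfl; exact hx hv
      simp only [if_true, this, if_false]; ring
    · intro u _ hu
      refine Finset.sum_eq_zero fun v hv => ?_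
      have : v ≠ x := by rintro rfl; exact hx hv
      simp [hu, this]
    · intro h; exact absurd hxc h
  rw [e1, e2, clusterForce, Function.update_self]
  ring

lemma hasDerivAt_clusterWt {Q : Matrix ι ι ℝ} (hsymm : ∀ x y, Q x y = Q y x)
    {a : ι × ι → ℝ} (ha : IsBond Q a) (T S : Finset ι) {x : ι} (hx : x ∉ S) (φ : ι → ℝ)
    {t : ℝ} (ht : t ≠ 0) :
    HasDerivAt (fun s => clusterWt Q a T S (Function.update φ x s))
      (clusterForce Q S x (Function.update φ x t) *
        clusterWt Q a T S (Function.update φ x t)) t := by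
  obtain ⟨b, hb, hbe⟩ := ha.exists_clusterWt_eq hsymm T S
  have h0 : ∀ s, clusterWt Q a T S (Function.update φ x s) =
      b φ * exp (clusterEnergy Q S (Function.update φ x s)) := by
    intro s
    rw [hbe, hb (Function.update φ x s) φ]
    intro y hy
    exact Function.update_of_ne (by rintro rfl; exact hx hy) _ _
  simp only [h0]
  refine ((hasDerivAt_clusterEnergy hsymm S hx φ ht).exp.const_mul (b φ)).congr_deriv ?_
  ring

lemma Stieltjes.integrable_mul_clusterWt {Q : Matrix ι ι ℝ} (hQ : Stieltjes Q) {a : ι × ι → ℝ}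
    (ha : IsBond Q a) {h : (ι → ℝ) → ℝ} (hh : ExpGrowth h) (T S : Finset ι) :
    Integrable fun φ => h φ * clusterWt Q a T S φ := by
  simp only [clusterWt, Finset.mul_sum]
  refine integrable_finsetSum _ fun ω _ => ?_
  split_ifs
  · exact hQ.integrable_mul_jointWt ha hh ω
  · simp

lemma integral_mul_clusterWt {Q : Matrix ι ι ℝ} (hQ : Stieltjes Q) {a : ι × ι → ℝ}
    (ha : IsBond Q a) {h : (ι → ℝ) → ℝ} (hh : ExpGrowth h) (T S : Finset ι) :
    ∫ φ, h φ * clusterWt Q a T S φ =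
      ∑ ω, if bondCluster ω T = S then ∫ φ, h φ * jointWt Q a ω φ else 0 := by
  simp only [clusterWt, Finset.mul_sum]
  rw [integral_finsetSum]
  · refine Finset.sum_congr rfl fun ω _ => ?_
    split_ifs
    · rfl
    · simp
  · intro ω _
    split_ifs
    · exact hQ.integrable_mul_jointWt ha hh ω
    · simp

lemma continuous_clusterWt (Q : Matrix ι ι ℝ) (a : ι × ι → ℝ) (T S : Finset ι) :
    Continuous (clusterWt Q a T S) := by
  unfold clusterWt
  refine continuous_finsetSum _ fun ω _ => ?_
  split_ifs
  · exact (continuous_gaussDens Q).mul (continuous_bondWt a ω)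
  · exact continuous_const

omit [DecidableEq ι] in
lemma expGrowth_sgn_mul_abs (x v : ι) : ExpGrowth fun φ : ι → ℝ => sgn (φ x) * |φ v| :=
  ExpGrowth.mul (ExpGrowth.of_bounded (measurable_sgn.comp (measurable_pi_apply x))
    fun _ => abs_sgn_le _) (ExpGrowth.coord v).abs

lemma integral_nonneg_of_flip {F : (ι → ℝ) → ℝ} (hF : Integrable F) (A : Finset ι)
    (h : ∀ φ, 0 ≤ F φ + F (flipOn A φ)) : 0 ≤ ∫ φ, F φ := by
  have hi : Integrable fun φ => F (flipOn A φ) := by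
    have := (measurePreserving_flipOn A).integrable_comp_of_integrable hF
    exact this
  have h1 : 0 ≤ ∫ φ, (F φ + F (flipOn A φ)) := integral_nonneg h
  rw [integral_add hF hi, integral_flipOn] at h1
  linarith

lemma Stieltjes.integral_sgn_nonneg {Q : Matrix ι ι ℝ} (hQ : Stieltjes Q) {a : ι × ι → ℝ}
    (ha : IsBond Q a) {k : ℝ → ℝ} (hk : Monotone k) (x z v : ι)
    (hkz : ExpGrowth fun φ : ι → ℝ => k (φ z)) (ω : Finset (ι × ι)) :
    0 ≤ ∫ φ, (sgn (φ x) * |φ v| * k (φ z)) * jointWt Q a ω φ := by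
  set A := bondCluster ω {x}
  refine integral_nonneg_of_flip
    (hQ.integrable_mul_jointWt ha ((expGrowth_sgn_mul_abs x v).mul hkz) ω) A fun φ => ?_
  have hA := bondCluster_closed ω {x}
  rw [ha.jointWt_flipOn hQ.symm hA]
  have hxA : x ∈ A := mem_bondCluster.mpr ⟨x, by simp, Relation.ReflTransGen.refl⟩
  have h1 : flipOn A φ x = -φ x := if_pos hxA
  have h2 : |flipOn A φ v| = |φ v| := by
    simp only [flipOn]; split_ifs <;> simp
  rw [h1, h2, sgn_neg, ← add_mul]
  by_cases h0 : jointWt Q a ω φ = 0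
  · rw [h0, mul_zero]
  by_cases hz : z ∈ A
  · have h3 : flipOn A φ z = -φ z := if_pos hz
    have hs : x = z ∨ 0 < φ x * φ z := by
      obtain ⟨y, hy, hc⟩ := mem_bondCluster.mp hz
      rw [Finset.mem_singleton] at hy
      subst hy
      exact mul_pos_of_bondConn h0 hc
    rw [h3]
    refine mul_nonneg ?_ (jointWt_nonneg ha.nonneg Q ω φ)
    have : sgn (φ x) = sgn (φ z) := by
      rcases hs with rfl | hs
      · rfl
      · rcases mul_pos_iff.mp hs with ⟨p, q⟩ | ⟨p, q⟩
        · simp [sgn, p, q, not_lt.mpr p.le, not_lt.mpr q.le]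
        · simp [sgn, p, q, not_lt.mpr p.le, not_lt.mpr q.le]
    have h4 : sgn (φ x) * |φ v| * k (φ z) + -sgn (φ x) * |φ v| * k (-φ z) =
        |φ v| * (sgn (φ z) * (k (φ z) - k (-φ z))) := by rw [this]; ring
    rw [h4]
    refine mul_nonneg (abs_nonneg _) ?_
    rcases lt_trichotomy (φ z) 0 with h | h | h
    · have := hk (show φ z ≤ -φ z by linarith)
      simp only [sgn, h, if_true, not_lt.mpr h.le, if_false]; linarith
    · simp [h, sgn]
    · have := hk (show -φ z ≤ φ z by linarith)
      simp only [sgn, h, if_true, not_lt.mpr h.le, if_false]; linarith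
  · have h3 : flipOn A φ z = φ z := if_neg hz
    rw [h3]
    apply le_of_eq
    ring

/-- Integration by parts outside of a cluster. -/
lemma Stieltjes.integral_coord_mul_clusterWt_le {Q : Matrix ι ι ℝ} (hQ : Stieltjes Q)
    {a : ι × ι → ℝ} (ha : IsBond Q a) (T S : Finset ι) {z : ι} (hz : z ∉ S) {k k' : ℝ → ℝ}
    (hk : Monotone k) (hkd : ∀ t, HasDerivAt k (k' t) t)
    (hkz : ExpGrowth fun φ : ι → ℝ => k (φ z)) (hkz' : ExpGrowth fun φ : ι → ℝ => k' (φ z))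
    {x : ι} (hx : x ∉ S) :
    ∫ φ, (φ x * k (φ z)) * clusterWt Q a T S φ ≤
      gk Q Sᶜ x z * ∫ φ, k' (φ z) * clusterWt Q a T S φ := by
  set W := clusterWt Q a T S
  set M' := ∫ φ, k' (φ z) * W φ
  set m : ι → ℝ := fun v => if v ∈ S then 0 else ∫ φ, (φ v * k (φ z)) * W φ
  have hI : ∀ h : (ι → ℝ) → ℝ, ExpGrowth h → Integrable fun φ => h φ * W φ := fun h hh =>
    hQ.integrable_mul_clusterWt ha hh T S
  have hcv : ∀ v, ExpGrowth fun φ : ι → ℝ => φ v * k (φ z) := fun v => (ExpGrowth.coord v).mul hkz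
  have hsv : ∀ x v, ExpGrowth fun φ : ι → ℝ => sgn (φ x) * |φ v| * k (φ z) := fun x v =>
    (expGrowth_sgn_mul_abs x v).mul hkz
  have hJ : ∀ x v, 0 ≤ ∫ φ, (sgn (φ x) * |φ v| * k (φ z)) * W φ := by
    intro x v
    rw [integral_mul_clusterWt hQ ha (hsv x v)]
    refine Finset.sum_nonneg fun ω _ => ?_
    split_ifs
    · exact hQ.integral_sgn_nonneg ha hk x z v hkz ω
    · exact le_rfl
  have key : ∀ y, y ∉ S → (Q *ᵥ m) y ≤ if y = z then M' else 0 := by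
    intro y hy
    have hD : ∀ φ, ((if z = y then k' (φ z) else 0) + k (φ z) * clusterForce Q S y φ) * W φ =
        (if z = y then k' (φ z) * W φ else 0) - (∑ v ∈ Sᶜ, Q y v * ((φ v * k (φ z)) * W φ)) +
          ∑ v ∈ S, Q y v * ((sgn (φ y) * |φ v| * k (φ z)) * W φ) := by
      intro φ
      have e1 : ∑ v ∈ Sᶜ, Q y v * ((φ v * k (φ z)) * W φ) =
          (∑ v ∈ Sᶜ, Q y v * φ v) * (k (φ z) * W φ) := by
        rw [Finset.sum_mul]; exact Finset.sum_congr rfl fun v _ => by ring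
      have e2 : ∑ v ∈ S, Q y v * ((sgn (φ y) * |φ v| * k (φ z)) * W φ) =
          (∑ v ∈ S, Q y v * (sgn (φ y) * |φ v|)) * (k (φ z) * W φ) := by
        rw [Finset.sum_mul]; exact Finset.sum_congr rfl fun v _ => by ring
      rw [e1, e2, clusterForce]
      split_ifs <;> ring
    have i1 : Integrable fun φ => if z = y then k' (φ z) * W φ else 0 := by
      split_ifs
      · exact hI _ hkz'
      · simp
    have i2 : Integrable fun φ => ∑ v ∈ Sᶜ, Q y v * ((φ v * k (φ z)) * W φ) :=
      integrable_finsetSum _ fun v _ => (hI _ (hcv v)).const_mul _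
    have i3 : Integrable fun φ => ∑ v ∈ S, Q y v * ((sgn (φ y) * |φ v| * k (φ z)) * W φ) :=
      integrable_finsetSum _ fun v _ => (hI _ (hsv y v)).const_mul _
    have h0 := integral_partial_eq_zero y (fun φ => k (φ z) * W φ)
      (fun φ => ((if z = y then k' (φ z) else 0) + k (φ z) * clusterForce Q S y φ) * W φ)
      (hI _ hkz) (by simp only [hD]; exact (i1.sub i2).add i3)
      (fun φ => by
        have hkc : Continuous k := continuous_iff_continuousAt.mpr fun t => (hkd t).continuousAt
        have hu : Continuous fun t => Function.update φ y t :=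
          continuous_const.update y continuous_id
        exact (hkc.comp ((continuous_apply z).comp hu)).mul
          ((continuous_clusterWt Q a T S).comp hu))
      (fun φ t ht => by
        have d1 := HasDerivAt.comp (h₂ := k) (h := fun s => Function.update φ y s z) t
          (hkd _) (hasDerivAt_update_coord φ y z t)
        have d2 := hasDerivAt_clusterWt hQ.symm ha T S hy φ ht
        refine (d1.mul d2).congr_deriv ?_
        simp only [Function.comp]
        split_ifs <;> ring)
    simp only [hD] at h0
    have i12 : Integrable fun φ => (if z = y then k' (φ z) * W φ else 0) -
        ∑ v ∈ Sᶜ, Q y v * ((φ v * k (φ z)) * W φ) := i1.sub i2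
    rw [integral_add i12 i3, integral_sub i1 i2,
      integral_finsetSum _ fun v _ => (hI _ (hcv v)).const_mul _,
      integral_finsetSum _ fun v _ => (hI _ (hsv y v)).const_mul _] at h0
    simp only [integral_const_mul] at h0
    have e3 : (∫ φ, if z = y then k' (φ z) * W φ else 0) = if y = z then M' else 0 := by
      by_cases h : z = y
      · simp [h, M']
      · simp [h, Ne.symm h]
    have e4 : (Q *ᵥ m) y = ∑ v ∈ Sᶜ, Q y v * ∫ φ, (φ v * k (φ z)) * W φ := by
      rw [mulVec, dotProduct, ← Finset.sum_add_sum_compl S, Finset.sum_eq_zero, zero_add]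
      · exact Finset.sum_congr rfl fun v hv => by
          simp only [m, Finset.mem_compl.mp hv, if_false]
      · intro v hv; simp only [m, hv, if_true, mul_zero]
    have e5 : ∑ v ∈ S, Q y v * ∫ φ, (sgn (φ y) * |φ v| * k (φ z)) * W φ ≤ 0 :=
      Finset.sum_nonpos fun v hv => mul_nonpos_of_nonpos_of_nonneg
        (hQ.off y v (by rintro rfl; exact hy hv)) (hJ y v)
    rw [e3, ← e4] at h0
    linarith
  have hmp := hQ.max_principle Sᶜ (fun y => m y - M' * gk Q Sᶜ y z) (by
    intro y hy
    have h1 : (Q *ᵥ fun y => m y - M' * gk Q Sᶜ y z) y =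
        (Q *ᵥ m) y - M' * (Q *ᵥ fun y => gk Q Sᶜ y z) y := by
      simp only [mulVec, dotProduct, mul_sub, Finset.sum_sub_distrib, Finset.mul_sum]
      congr 1
      exact Finset.sum_congr rfl fun v _ => by ring
    rw [h1, hQ.mulVec_gk _ hy (Finset.mem_compl.mpr hz)]
    have := key y (Finset.mem_compl.mp hy)
    split_ifs at this ⊢ <;> linarith) (by
    intro y hy _
    have hyS : y ∈ S := by simpa using hy
    simp only [m, hyS, if_true, gk_of_notMem_left Q hy, mul_zero, sub_zero, le_refl]) x
    (Finset.mem_compl.mpr hx)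
  have : m x = ∫ φ, (φ x * k (φ z)) * W φ := if_neg hx
  rw [this] at hmp
  linarith

end ClusterWeights

section ClusterEstimates

open Matrix

variable {ι : Type*} [Fintype ι] [DecidableEq ι]

lemma Stieltjes.integrable_gaussDens {Q : Matrix ι ι ℝ} (hQ : Stieltjes Q) :
    Integrable (gaussDens Q) := by
  simpa using hQ.integrable_mul_gaussDens (ExpGrowth.const 1)

lemma sum_clusterWt (Q : Matrix ι ι ℝ) (a : ι × ι → ℝ) (T : Finset ι) (φ : ι → ℝ) :
    ∑ S, clusterWt Q a T S φ = gaussDens Q φ := by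
  simp only [clusterWt]
  rw [Finset.sum_comm, ← sum_jointWt Q a φ]
  exact Finset.sum_congr rfl fun ω _ => by simp

lemma clusterWt_nonneg (Q : Matrix ι ι ℝ) {a : ι × ι → ℝ} (ha : ∀ e, 0 ≤ a e) (T S : Finset ι)
    (φ : ι → ℝ) : 0 ≤ clusterWt Q a T S φ :=
  Finset.sum_nonneg fun ω _ => by
    split_ifs
    · exact jointWt_nonneg ha Q ω φ
    · exact le_rfl

lemma Stieltjes.integrable_clusterWt {Q : Matrix ι ι ℝ} (hQ : Stieltjes Q) {a : ι × ι → ℝ}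
    (ha : IsBond Q a) (T S : Finset ι) : Integrable (clusterWt Q a T S) := by
  simpa using hQ.integrable_mul_clusterWt ha (ExpGrowth.const 1) T S

lemma Stieltjes.sum_integral_clusterWt {Q : Matrix ι ι ℝ} (hQ : Stieltjes Q) {a : ι × ι → ℝ}
    (ha : IsBond Q a) (T : Finset ι) :
    ∑ S, ∫ φ, clusterWt Q a T S φ = ∫ φ, gaussDens Q φ := by
  rw [← integral_finsetSum _ fun S _ => hQ.integrable_clusterWt ha T S]
  simp only [sum_clusterWt]

lemma Stieltjes.integral_mul_jointWt_of_conn {Q : Matrix ι ι ℝ} {a : ι × ι → ℝ}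
    {ω : Finset (ι × ι)} {x b : ι} (h : bondConn ω x b) :
    ∫ φ, (φ x * φ b) * jointWt Q a ω φ = ∫ φ, |φ x * φ b| * jointWt Q a ω φ := by
  congr 1
  ext φ
  by_cases h0 : jointWt Q a ω φ = 0
  · rw [h0, mul_zero, mul_zero]
  · rw [abs_of_nonneg]
    rcases mul_pos_of_bondConn h0 h with rfl | h
    · exact mul_self_nonneg _
    · exact h.le

lemma Stieltjes.integral_mul_jointWt_of_not_conn {Q : Matrix ι ι ℝ} (hQ : Stieltjes Q)
    {a : ι × ι → ℝ} (ha : IsBond Q a) {ω : Finset (ι × ι)} {x b : ι} (h : ¬ bondConn ω x b) :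
    ∫ φ, (φ x * φ b) * jointWt Q a ω φ = 0 := by
  have h1 := integral_flipOn (bondCluster ω {x}) fun φ => (φ x * φ b) * jointWt Q a ω φ
  simp only [ha.jointWt_flipOn hQ.symm (bondCluster_closed ω {x})] at h1
  have hx : x ∈ bondCluster ω {x} := subset_bondCluster _ _ (Finset.mem_singleton_self x)
  have hb : b ∉ bondCluster ω {x} := by
    rw [mem_bondCluster]; rintro ⟨y, hy, hc⟩
    rw [Finset.mem_singleton] at hy; subst hy; exact h hc
  simp only [flipOn, hx, hb, if_true, if_false, neg_mul, integral_neg] at h1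
  linarith

/-- The two-point weight restricted to clusters avoiding `B` is bounded by the Green's function
killed on `B`. -/
lemma Stieltjes.sum_conn_avoid_le {Q : Matrix ι ι ℝ} (hQ : Stieltjes Q) {a : ι × ι → ℝ}
    (ha : IsBond Q a) (x b : ι) (B : Finset ι) :
    ∑ ω, (if bondConn ω x b ∧ Disjoint (bondCluster ω {x}) B
      then ∫ φ, |φ x * φ b| * jointWt Q a ω φ else 0) ≤
      gk Q Bᶜ x b * ∫ φ, gaussDens Q φ := by
  have hxb : ExpGrowth fun φ : ι → ℝ => φ x * φ b := (ExpGrowth.coord x).mul (ExpGrowth.coord b)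
  have hS : ∀ S : Finset ι, (if x ∉ S ∧ b ∉ S then
      ∫ φ, (φ x * φ b) * clusterWt Q a B S φ else 0) ≤
      gk Q Bᶜ x b * ∫ φ, clusterWt Q a B S φ := by
    intro S
    have hn : 0 ≤ ∫ φ, clusterWt Q a B S φ := integral_nonneg (clusterWt_nonneg Q ha.nonneg B S)
    split_ifs with h
    · by_cases hBS : B ⊆ S
      · have h1 := hQ.integral_coord_mul_clusterWt_le ha B S h.2 (k := fun t => t)
          (k' := fun _ => 1) monotone_id (fun t => hasDerivAt_id t) (ExpGrowth.coord b)
          (ExpGrowth.const 1) h.1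
        simp only [one_mul] at h1
        exact h1.trans (mul_le_mul_of_nonneg_right
          (hQ.gk_mono (Finset.compl_subset_compl.mpr hBS) x b) hn)
      · have : ∀ φ, clusterWt Q a B S φ = 0 := fun φ => Finset.sum_eq_zero fun ω _ => by
          rw [if_neg]; rintro rfl; exact hBS (subset_bondCluster ω B)
        simp [this]
    · exact mul_nonneg (hQ.gk_nonneg _ _ _) hn
  have h2 := Finset.sum_le_sum fun S (_ : S ∈ Finset.univ) => hS S
  rw [← Finset.mul_sum, hQ.sum_integral_clusterWt ha] at h2
  refine le_trans (le_of_eq ?_) h2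
  have h3 : ∀ S : Finset ι, (if x ∉ S ∧ b ∉ S then
      ∫ φ, (φ x * φ b) * clusterWt Q a B S φ else 0) = ∑ ω, if bondCluster ω B = S then
        (if x ∉ S ∧ b ∉ S then ∫ φ, (φ x * φ b) * jointWt Q a ω φ else 0) else 0 := by
    intro S
    by_cases h : x ∉ S ∧ b ∉ S
    · simp only [if_pos h]; exact integral_mul_clusterWt hQ ha hxb B S
    · simp [if_neg h]
  simp only [h3]
  rw [Finset.sum_comm]
  refine Finset.sum_congr rfl fun ω _ => ?_
  rw [Finset.sum_ite_eq, if_pos (Finset.mem_univ _)]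
  have hd : Disjoint (bondCluster ω {x}) B ↔ x ∉ bondCluster ω B := by
    rw [Finset.disjoint_left, mem_bondCluster]
    constructor
    · rintro h ⟨y, hy, hc⟩
      exact h (mem_bondCluster.mpr ⟨x, Finset.mem_singleton_self x, bondConn_symm hc⟩) hy
    · intro h y hy hyB
      obtain ⟨x', hx', hc⟩ := mem_bondCluster.mp hy
      rw [Finset.mem_singleton] at hx'; subst hx'
      exact h ⟨y, hyB, bondConn_symm hc⟩
  by_cases hc : bondConn ω x b
  · have hb : b ∈ bondCluster ω B ↔ x ∈ bondCluster ω B :=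
      (mem_of_bondConn (bondCluster_closed ω B) hc).symm
    simp only [hc, hd, hb, true_and, and_self, integral_mul_jointWt_of_conn hc]
  · rw [if_neg (fun h => hc h.1), hQ.integral_mul_jointWt_of_not_conn ha hc, ite_self]

lemma Stieltjes.hasDerivAt_integral_exp {Q : Matrix ι ι ℝ} (hQ : Stieltjes Q) {a : ι × ι → ℝ}
    (ha : IsBond Q a) (T S : Finset ι) (z : ι) (h : ℝ) :
    HasDerivAt (fun s => ∫ φ, exp (s * φ z) * clusterWt Q a T S φ)
      (∫ φ, (φ z * exp (h * φ z)) * clusterWt Q a T S φ) h := by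
  have hW : ∀ φ, 0 ≤ clusterWt Q a T S φ := clusterWt_nonneg Q ha.nonneg T S
  have hI : ∀ f : (ι → ℝ) → ℝ, ExpGrowth f → Integrable fun φ => f φ * clusterWt Q a T S φ :=
    fun f hf => hQ.integrable_mul_clusterWt ha hf T S
  refine (hasDerivAt_integral_of_dominated_loc_of_deriv_le (s := Metric.ball h 1)
    (bound := fun φ => (|φ z| * (exp ((h + 1) * φ z) + exp ((h - 1) * φ z))) *
      clusterWt Q a T S φ)
    (F := fun s φ => exp (s * φ z) * clusterWt Q a T S φ)
    (F' := fun s φ => (φ z * exp (s * φ z)) * clusterWt Q a T S φ)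
    (Metric.ball_mem_nhds h one_pos) ?_ (hI _ (ExpGrowth.exp_coord h z)) ?_ ?_ ?_ ?_).2
  · exact Eventually.of_forall fun s => (hI _ (ExpGrowth.exp_coord s z)).aestronglyMeasurable
  · exact (hI _ ((ExpGrowth.coord z).mul (ExpGrowth.exp_coord h z))).aestronglyMeasurable
  · refine Eventually.of_forall fun φ s hs => ?_
    rw [norm_mul, norm_mul, Real.norm_eq_abs, Real.norm_eq_abs, Real.norm_eq_abs,
      abs_of_nonneg (hW φ), abs_of_pos (exp_pos _)]
    refine mul_le_mul_of_nonneg_right (mul_le_mul_of_nonneg_left ?_ (abs_nonneg _)) (hW φ)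
    rw [Metric.mem_ball, Real.dist_eq, abs_lt] at hs
    rcases le_total 0 (φ z) with hz | hz
    · exact (exp_le_exp.mpr (mul_le_mul_of_nonneg_right (by linarith) hz)).trans
        (le_add_of_nonneg_right (exp_pos _).le)
    · exact (exp_le_exp.mpr (mul_le_mul_of_nonpos_right (by linarith) hz)).trans
        (le_add_of_nonneg_left (exp_pos _).le)
  · exact hI _ ((ExpGrowth.coord z).abs.mul ((ExpGrowth.exp_coord _ z).add
      (ExpGrowth.exp_coord _ z)))
  · refine Eventually.of_forall fun φ s _ => ?_
    have h1 : HasDerivAt (fun s : ℝ => s * φ z) (φ z) s := by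
      simpa using (hasDerivAt_id s).mul_const (φ z)
    refine (h1.exp.mul_const _).congr_deriv ?_
    ring

lemma Stieltjes.integral_exp_clusterWt_le {Q : Matrix ι ι ℝ} (hQ : Stieltjes Q) {a : ι × ι → ℝ}
    (ha : IsBond Q a) (T S : Finset ι) {z : ι} (hz : z ∉ S) {h : ℝ} (hh : 0 ≤ h) :
    ∫ φ, exp (h * φ z) * clusterWt Q a T S φ ≤
      exp (h ^ 2 / 2 * gk Q Sᶜ z z) * ∫ φ, clusterWt Q a T S φ := by
  set g := gk Q Sᶜ z z
  set m : ℝ → ℝ := fun s => ∫ φ, exp (s * φ z) * clusterWt Q a T S φ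
  have hm : ∀ s, HasDerivAt m (∫ φ, (φ z * exp (s * φ z)) * clusterWt Q a T S φ) s :=
    fun s => hQ.hasDerivAt_integral_exp ha T S z s
  have hd : ∀ s, 0 ≤ s → (∫ φ, (φ z * exp (s * φ z)) * clusterWt Q a T S φ) ≤ g * (s * m s) := by
    intro s hs
    have := hQ.integral_coord_mul_clusterWt_le ha T S hz (k := fun t => exp (s * t))
      (k' := fun t => s * exp (s * t))
      (fun t t' htt => exp_le_exp.mpr (mul_le_mul_of_nonneg_left htt hs))
      (fun t => by
        have h1 : HasDerivAt (fun t : ℝ => s * t) s t := by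
          simpa using (hasDerivAt_id t).const_mul s
        refine h1.exp.congr_deriv ?_
        ring)
      (ExpGrowth.exp_coord s z) ((ExpGrowth.const s).mul (ExpGrowth.exp_coord s z)) hz
    simp only [mul_assoc, integral_const_mul] at this ⊢
    exact this
  set f : ℝ → ℝ := fun s => exp (-(s ^ 2 / 2 * g)) * m s
  have hf : ∀ s, HasDerivAt f (exp (-(s ^ 2 / 2 * g)) *
      ((∫ φ, (φ z * exp (s * φ z)) * clusterWt Q a T S φ) - g * (s * m s))) s := by
    intro s
    have h1 : HasDerivAt (fun s : ℝ => -(s ^ 2 / 2 * g)) (-(s * g)) s := by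
      refine ((((hasDerivAt_id s).pow 2).div_const 2).mul_const g).neg.congr_deriv ?_
      simp
    refine (h1.exp.mul (hm s)).congr_deriv ?_
    ring
  have hanti : AntitoneOn f (Set.Ici 0) := by
    refine antitoneOn_of_deriv_nonpos (convex_Ici 0)
      (fun s _ => (hf s).continuousAt.continuousWithinAt)
      (fun s _ => (hf s).differentiableAt.differentiableWithinAt) fun s hs => ?_
    rw [interior_Ici, Set.mem_Ioi] at hs
    rw [(hf s).deriv]
    exact mul_nonpos_of_nonneg_of_nonpos (exp_pos _).le (sub_nonpos.mpr (hd s hs.le))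
  have h0 := hanti (Set.mem_Ici.mpr le_rfl) (Set.mem_Ici.mpr hh) hh
  simp only [f, m, zero_mul, exp_zero, one_mul] at h0
  norm_num at h0
  rwa [Real.exp_neg, inv_mul_le_iff₀ (exp_pos _)] at h0

omit [DecidableEq ι] in
lemma expGrowth_indicator {s : Set ℝ} [DecidablePred (· ∈ s)] (hs : MeasurableSet s) (x : ι) :
    ExpGrowth fun φ : ι → ℝ => if φ x ∈ s then (1 : ℝ) else 0 :=
  ExpGrowth.of_bounded (C := 1)
    (Measurable.ite (measurable_pi_apply x hs) measurable_const measurable_const)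
    fun φ => by split_ifs <;> norm_num

lemma Stieltjes.two_integral_neg_exp_le {Q : Matrix ι ι ℝ} (hQ : Stieltjes Q) {a : ι × ι → ℝ}
    (ha : IsBond Q a) (x z : ι) {h : ℝ} (hh : 0 ≤ h) (ω : Finset (ι × ι)) :
    2 * ∫ φ, ((if φ x ∈ Set.Iio 0 then 1 else 0) * exp (h * φ z)) * jointWt Q a ω φ ≤
      ∫ φ, (if z ∈ bondCluster ω {x} then 1 else exp (h * φ z)) * jointWt Q a ω φ := by
  set A := bondCluster ω {x}
  have hA := bondCluster_closed ω {x}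
  have hxA : x ∈ A := subset_bondCluster _ _ (Finset.mem_singleton_self x)
  have g1 : ExpGrowth fun φ : ι → ℝ => (if φ x ∈ Set.Iio 0 then (1 : ℝ) else 0) * exp (h * φ z) :=
    (expGrowth_indicator measurableSet_Iio x).mul (ExpGrowth.exp_coord h z)
  have g2 : ExpGrowth fun φ : ι → ℝ => if z ∈ A then 1 else exp (h * φ z) := by
    split_ifs
    · exact ExpGrowth.const 1
    · exact ExpGrowth.exp_coord h z
  have i1 := hQ.integrable_mul_jointWt ha g1 ω
  have i2 := hQ.integrable_mul_jointWt ha g2 ω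
  rw [← sub_nonneg, ← integral_const_mul, ← integral_sub i2 (i1.const_mul 2)]
  refine integral_nonneg_of_flip (i2.sub (i1.const_mul 2)) A fun φ => ?_
  rw [ha.jointWt_flipOn hQ.symm hA]
  by_cases h0 : jointWt Q a ω φ = 0
  · simp [h0]
  have hjw := jointWt_nonneg ha.nonneg Q ω φ
  have h1 : flipOn A φ x = -φ x := if_pos hxA
  rw [h1]
  simp only [Set.mem_Iio, Left.neg_neg_iff]
  by_cases hz : z ∈ A
  · have h3 : flipOn A φ z = -φ z := if_pos hz
    have hs : x = z ∨ 0 < φ x * φ z := by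
      obtain ⟨y, hy, hc⟩ := mem_bondCluster.mp hz
      rw [Finset.mem_singleton] at hy
      subst hy
      exact mul_pos_of_bondConn h0 hc
    simp only [hz, if_true, h3]
    rcases lt_trichotomy (φ x) 0 with hx | hx | hx
    · have hφz : φ z < 0 := by
        rcases hs with rfl | hs
        · exact hx
        · exact neg_of_mul_pos_right hs hx.le
      have : exp (h * φ z) ≤ 1 := exp_le_one_iff.mpr (mul_nonpos_of_nonneg_of_nonpos hh hφz.le)
      simp only [hx, not_lt.mpr hx.le, if_true, if_false]
      nlinarith
    · simp only [hx, lt_irrefl, if_false]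
      nlinarith
    · have hφz : 0 < φ z := by
        rcases hs with rfl | hs
        · exact hx
        · exact pos_of_mul_pos_right hs hx.le
      have : exp (h * -φ z) ≤ 1 := exp_le_one_iff.mpr (by nlinarith)
      simp only [hx, not_lt.mpr hx.le, if_true, if_false]
      nlinarith
  · have h3 : flipOn A φ z = φ z := if_neg hz
    simp only [hz, if_false, h3]
    have he := exp_pos (h * φ z)
    rcases lt_trichotomy (φ x) 0 with hx | hx | hx
    · simp only [hx, not_lt.mpr hx.le, if_true, if_false]
      apply le_of_eq; ring
    · simp only [hx, lt_irrefl, if_false]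
      have := mul_nonneg he.le hjw
      nlinarith
    · simp only [hx, not_lt.mpr hx.le, if_true, if_false]
      apply le_of_eq; ring

lemma Stieltjes.gaussDens_add {Q : Matrix ι ι ℝ} (hQ : Stieltjes Q) (z : ι) (h : ℝ) (φ : ι → ℝ) :
    exp (h * (φ + fun y => h * gk Q Finset.univ y z) z) *
      gaussDens Q (φ + fun y => h * gk Q Finset.univ y z) =
      exp (h ^ 2 / 2 * gk Q Finset.univ z z) * gaussDens Q φ := by
  set u : ι → ℝ := fun y => gk Q Finset.univ y z
  have hu : Q *ᵥ u = Pi.single z 1 := by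
    ext x
    rw [hQ.mulVec_gk _ (Finset.mem_univ x) (Finset.mem_univ z), Pi.single_apply]
  have e1 : (fun y => h * u y) = h • u := rfl
  have e2 : (φ + h • u) ⬝ᵥ (Q *ᵥ (φ + h • u)) = φ ⬝ᵥ (Q *ᵥ φ) + 2 * h * φ z + h ^ 2 * u z := by
    rw [mulVec_add, mulVec_smul, add_dotProduct, dotProduct_add, dotProduct_add,
      smul_dotProduct, smul_dotProduct, hQ.form_comm u φ, dotProduct_smul, dotProduct_smul, hu]
    simp only [dotProduct_single, smul_eq_mul, mul_one]
    ring
  have e3 : gk Q Finset.univ z z = u z := rfl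
  rw [e1, gaussDens, gaussDens, e2, e3, ← exp_add, ← exp_add]
  congr 1
  simp only [Pi.add_apply, Pi.smul_apply, smul_eq_mul]
  ring

/-- Capacity tail bound: the defect of the killed Green's function under the cluster law. -/
lemma Stieltjes.sum_one_sub_exp_le {Q : Matrix ι ι ℝ} (hQ : Stieltjes Q) {a : ι × ι → ℝ}
    (ha : IsBond Q a) (x z : ι) {h : ℝ} (hh : 0 ≤ h) :
    ∑ A, (1 - exp (-(h ^ 2 / 2 * (gk Q Finset.univ z z - gk Q Aᶜ z z)))) *
      ∫ φ, clusterWt Q a {x} A φ ≤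
      ∫ φ, (if φ x ∈ Set.Icc (-(h * gk Q Finset.univ x z)) (h * gk Q Finset.univ x z)
        then 1 else 0) * gaussDens Q φ := by
  set t := h * gk Q Finset.univ x z
  set E := exp (h ^ 2 / 2 * gk Q Finset.univ z z)
  have ht : 0 ≤ t := mul_nonneg hh (hQ.gk_nonneg _ _ _)
  have s1 : 2 * ∫ φ, ((if φ x ∈ Set.Iio 0 then 1 else 0) * exp (h * φ z)) * gaussDens Q φ ≤
      ∑ A, exp (h ^ 2 / 2 * gk Q Aᶜ z z) * ∫ φ, clusterWt Q a {x} A φ := by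
    have g1 : ExpGrowth fun φ : ι → ℝ =>
        (if φ x ∈ Set.Iio 0 then (1 : ℝ) else 0) * exp (h * φ z) :=
      (expGrowth_indicator measurableSet_Iio x).mul (ExpGrowth.exp_coord h z)
    have e1 : ∫ φ, ((if φ x ∈ Set.Iio 0 then 1 else 0) * exp (h * φ z)) * gaussDens Q φ =
        ∑ ω, ∫ φ, ((if φ x ∈ Set.Iio 0 then 1 else 0) * exp (h * φ z)) * jointWt Q a ω φ := by
      rw [← integral_finsetSum _ fun ω _ => hQ.integrable_mul_jointWt ha g1 ω]
      simp only [← Finset.mul_sum, sum_jointWt]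
    rw [e1, Finset.mul_sum]
    refine (Finset.sum_le_sum fun ω _ => hQ.two_integral_neg_exp_le ha x z hh ω).trans ?_
    have e2 : ∑ ω, ∫ φ, (if z ∈ bondCluster ω {x} then 1 else exp (h * φ z)) * jointWt Q a ω φ =
        ∑ A : Finset ι, ∫ φ, (if z ∈ A then 1 else exp (h * φ z)) * clusterWt Q a {x} A φ := by
      have : ∀ A : Finset ι, ∫ φ, (if z ∈ A then 1 else exp (h * φ z)) * clusterWt Q a {x} A φ =
          ∑ ω, if bondCluster ω {x} = A then
            ∫ φ, (if z ∈ A then 1 else exp (h * φ z)) * jointWt Q a ω φ else 0 := by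
        intro A
        refine integral_mul_clusterWt hQ ha ?_ {x} A
        split_ifs
        · exact ExpGrowth.const 1
        · exact ExpGrowth.exp_coord h z
      simp only [this]
      rw [Finset.sum_comm]
      exact Finset.sum_congr rfl fun ω _ => by
        rw [Finset.sum_ite_eq, if_pos (Finset.mem_univ _)]
    rw [e2]
    refine Finset.sum_le_sum fun A _ => ?_
    by_cases hz : z ∈ A
    · simp only [hz, if_true, one_mul]
      rw [gk_of_notMem_left Q (by simpa using hz), mul_zero, exp_zero, one_mul]
    · simp only [hz, if_false]
      exact hQ.integral_exp_clusterWt_le ha {x} A hz hh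
  have s2 : ∫ φ, ((if φ x ∈ Set.Iio 0 then 1 else 0) * exp (h * φ z)) * gaussDens Q φ =
      E * ∫ φ, (if φ x ∈ Set.Iio (-t) then 1 else 0) * gaussDens Q φ := by
    rw [← integral_add_right_eq_self _ (fun y => h * gk Q Finset.univ y z), ← integral_const_mul]
    congr 1
    ext φ
    rw [mul_assoc, hQ.gaussDens_add z h φ]
    have : (φ + fun y => h * gk Q Finset.univ y z) x ∈ Set.Iio 0 ↔ φ x ∈ Set.Iio (-t) := by
      simp only [Pi.add_apply, Set.mem_Iio, t]
      constructor <;> intro <;> linarith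
    simp only [this]
    split_ifs <;> ring
  have g3 : ∀ (s : Set ℝ) [DecidablePred (· ∈ s)], MeasurableSet s →
      Integrable fun φ : ι → ℝ => (if φ x ∈ s then (1 : ℝ) else 0) * gaussDens Q φ := fun s _ hs =>
    hQ.integrable_mul_gaussDens (expGrowth_indicator hs x)
  have s3 : ∫ φ, (if φ x ∈ Set.Ioi t then (1 : ℝ) else 0) * gaussDens Q φ =
      ∫ φ, (if φ x ∈ Set.Iio (-t) then 1 else 0) * gaussDens Q φ := by
    rw [← integral_neg_eq_self]
    congr 1
    ext φ
    have e1 : gaussDens Q (-φ) = gaussDens Q φ := by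
      simp [gaussDens, mulVec_neg]
    have e2 : (-φ) x ∈ Set.Ioi t ↔ φ x ∈ Set.Iio (-t) := by
      simp only [Pi.neg_apply, Set.mem_Ioi, Set.mem_Iio]
      constructor <;> intro <;> linarith
    simp only [e1, e2]
  have s4 : ∫ φ, gaussDens Q φ = (∫ φ, (if φ x ∈ Set.Icc (-t) t then 1 else 0) * gaussDens Q φ) +
      (∫ φ, (if φ x ∈ Set.Ioi t then (1 : ℝ) else 0) * gaussDens Q φ) +
      ∫ φ, (if φ x ∈ Set.Iio (-t) then 1 else 0) * gaussDens Q φ := by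
    have j1 : Integrable fun φ => (if φ x ∈ Set.Icc (-t) t then 1 else 0) * gaussDens Q φ +
      (if φ x ∈ Set.Ioi t then (1 : ℝ) else 0) * gaussDens Q φ :=
      (g3 (Set.Icc (-t) t) measurableSet_Icc).add (g3 (Set.Ioi t) measurableSet_Ioi)
    rw [← integral_add (g3 (Set.Icc (-t) t) measurableSet_Icc) (g3 (Set.Ioi t) measurableSet_Ioi),
      ← integral_add j1 (g3 (Set.Iio (-t)) measurableSet_Iio)]
    congr 1
    ext φ
    simp only [← add_mul]
    by_cases h1 : φ x < -t
    · have h2 : ¬ -t ≤ φ x := not_le.mpr h1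
      have h3 : ¬ t < φ x := by linarith
      simp [h1, h2, h3]
    · by_cases h2 : t < φ x
      · have h3 : ¬ φ x ≤ t := not_le.mpr h2
        simp [h1, h2, h3]
      · have h3 : φ x ≤ t := not_lt.mp h2
        have h4 : -t ≤ φ x := not_lt.mp h1
        simp [h1, h2, h3, h4]
  have s5 : ∑ A, exp (h ^ 2 / 2 * gk Q Aᶜ z z) * ∫ φ, clusterWt Q a {x} A φ =
      E * ∑ A, exp (-(h ^ 2 / 2 * (gk Q Finset.univ z z - gk Q Aᶜ z z))) *
        ∫ φ, clusterWt Q a {x} A φ := by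
    rw [Finset.mul_sum]
    refine Finset.sum_congr rfl fun A _ => ?_
    rw [← mul_assoc, ← exp_add]
    congr 2
    ring
  rw [s2, s5, mul_left_comm] at s1
  have s6 := le_of_mul_le_mul_left s1 (exp_pos _)
  simp only [sub_mul, one_mul, Finset.sum_sub_distrib]
  rw [hQ.sum_integral_clusterWt ha, s4, s3]
  linarith

end ClusterEstimates

section GaussianLaw

open Matrix

variable {ι : Type*} [Fintype ι] [DecidableEq ι]

/-- A random variable with a centered Gaussian moment generating function is Gaussian. -/
lemma map_eq_gaussianReal_of_mgf {Ω : Type*} [MeasurableSpace Ω] {μ : Measure Ω}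
    [IsProbabilityMeasure μ] {X : Ω → ℝ} (hX : AEMeasurable X μ) (v : ℝ≥0)
    (h : ∀ t, mgf X μ t = exp (v * t ^ 2 / 2)) : μ.map X = gaussianReal 0 v := by
  have h1 : mgf X μ = mgf id (gaussianReal 0 v) := by
    rw [mgf_id_gaussianReal]
    ext t
    rw [h t]
    congr 1
    ring
  have h2 : integrableExpSet X μ = Set.univ := by
    rw [integrableExpSet_eq_of_mgf h1, integrableExpSet_id_gaussianReal]
  have h3 := eqOn_complexMGF_of_mgf h1
  have h4 : complexMGF X μ = complexMGF id (gaussianReal 0 v) := by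
    ext z
    exact h3 (by simp [h2])
  simpa using Measure.ext_of_complexMGF_eq hX aemeasurable_id h4

lemma Stieltjes.exp_dotProduct_mul_gaussDens_add {Q : Matrix ι ι ℝ} (hQ : Stieltjes Q)
    (c φ : ι → ℝ) :
    exp (c ⬝ᵥ (φ + gk Q Finset.univ *ᵥ c)) * gaussDens Q (φ + gk Q Finset.univ *ᵥ c) =
      exp (c ⬝ᵥ (gk Q Finset.univ *ᵥ c) / 2) * gaussDens Q φ := by
  set u : ι → ℝ := gk Q Finset.univ *ᵥ c with hu0
  have hu : Q *ᵥ u = c := by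
    have : Q * gk Q Finset.univ = 1 := by
      ext x y
      have := hQ.mulVec_gk _ (Finset.mem_univ x) (Finset.mem_univ y)
      rw [Matrix.mul_apply, Matrix.one_apply]
      simpa [Matrix.mulVec, dotProduct] using this
    rw [hu0, mulVec_mulVec, this, one_mulVec]
  have e2 : (φ + u) ⬝ᵥ (Q *ᵥ (φ + u)) = φ ⬝ᵥ (Q *ᵥ φ) + 2 * (c ⬝ᵥ φ) + c ⬝ᵥ u := by
    rw [mulVec_add, add_dotProduct, dotProduct_add, dotProduct_add, hQ.form_comm u φ, hu,
      dotProduct_comm φ c, dotProduct_comm u c]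
    ring
  rw [gaussDens, gaussDens, e2, dotProduct_add, ← Real.exp_add, ← Real.exp_add]
  congr 1
  ring

lemma Stieltjes.integral_exp_mul_gaussDens {Q : Matrix ι ι ℝ} (hQ : Stieltjes Q) (c : ι → ℝ) :
    ∫ φ, exp (c ⬝ᵥ φ) * gaussDens Q φ =
      exp (c ⬝ᵥ (gk Q Finset.univ *ᵥ c) / 2) * ∫ φ, gaussDens Q φ := by
  rw [← integral_add_right_eq_self _ (gk Q Finset.univ *ᵥ c), ← integral_const_mul]
  simp only [hQ.exp_dotProduct_mul_gaussDens_add]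

lemma Stieltjes.integral_gaussDens_pos {Q : Matrix ι ι ℝ} (hQ : Stieltjes Q) :
    0 < ∫ φ, gaussDens Q φ := by
  rw [integral_pos_iff_support_of_nonneg (fun φ => (gaussDens_pos Q φ).le) hQ.integrable_gaussDens]
  have : Function.support (gaussDens Q) = Set.univ := by
    ext φ
    simp [(gaussDens_pos Q φ).ne']
  rw [this]
  exact Measure.measure_univ_pos.2 (NeZero.ne _)

/-- The centered Gaussian measure with precision matrix `Q`. -/
def gaussLaw (Q : Matrix ι ι ℝ) : Measure (ι → ℝ) :=
  volume.withDensity fun φ => ENNReal.ofReal (gaussDens Q φ / ∫ ψ, gaussDens Q ψ)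

lemma Stieltjes.isProbabilityMeasure_gaussLaw {Q : Matrix ι ι ℝ} (hQ : Stieltjes Q) :
    IsProbabilityMeasure (gaussLaw Q) := by
  constructor
  rw [gaussLaw, withDensity_apply _ MeasurableSet.univ, setLIntegral_univ,
    ← ofReal_integral_eq_lintegral_ofReal (hQ.integrable_gaussDens.div_const _)
      (ae_of_all _ fun φ => (div_pos (gaussDens_pos Q φ) hQ.integral_gaussDens_pos).le),
    integral_div, div_self hQ.integral_gaussDens_pos.ne', ENNReal.ofReal_one]

lemma Stieltjes.integral_gaussLaw {Q : Matrix ι ι ℝ} (hQ : Stieltjes Q) (F : (ι → ℝ) → ℝ) :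
    ∫ φ, F φ ∂gaussLaw Q = (∫ φ, F φ * gaussDens Q φ) / ∫ φ, gaussDens Q φ := by
  rw [gaussLaw, integral_withDensity_eq_integral_toReal_smul₀
    ((continuous_gaussDens Q).measurable.div_const _).ennreal_ofReal.aemeasurable
    (ae_of_all _ fun φ => ENNReal.ofReal_lt_top), ← integral_div]
  congr 1
  ext φ
  rw [ENNReal.toReal_ofReal (div_pos (gaussDens_pos Q φ) hQ.integral_gaussDens_pos).le, smul_eq_mul]
  ring

lemma Stieltjes.map_dotProduct_gaussLaw {Q : Matrix ι ι ℝ} (hQ : Stieltjes Q) (c : ι → ℝ) :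
    (gaussLaw Q).map (fun φ => c ⬝ᵥ φ) =
      gaussianReal 0 (Real.toNNReal (c ⬝ᵥ (gk Q Finset.univ *ᵥ c))) := by
  have := hQ.isProbabilityMeasure_gaussLaw
  have hm : Measurable fun φ : ι → ℝ => c ⬝ᵥ φ := by
    unfold dotProduct
    fun_prop
  refine map_eq_gaussianReal_of_mgf hm.aemeasurable _ fun t => ?_
  rw [Real.coe_toNNReal _ (hQ.gk_form_nonneg _ _), mgf, hQ.integral_gaussLaw]
  have := hQ.integral_exp_mul_gaussDens (t • c)
  simp only [smul_dotProduct, mulVec_smul, dotProduct_smul, smul_eq_mul] at this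
  rw [this, mul_div_assoc, div_self hQ.integral_gaussDens_pos.ne', mul_one]
  congr 1
  ring

/-- Identification of a Gaussian vector with covariance `Q⁻¹`. -/
lemma Stieltjes.map_eq_gaussLaw {Q : Matrix ι ι ℝ} (hQ : Stieltjes Q) {Ω : Type*}
    [MeasurableSpace Ω] {P : Measure Ω} [IsProbabilityMeasure P] {X : Ω → ι → ℝ}
    (hX : Measurable X)
    (h : ∀ c : ι → ℝ, P.map (fun ω => c ⬝ᵥ X ω) =
      gaussianReal 0 (Real.toNNReal (c ⬝ᵥ (gk Q Finset.univ *ᵥ c)))) :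
    P.map X = gaussLaw Q := by
  have := hQ.isProbabilityMeasure_gaussLaw
  have := Measure.isProbabilityMeasure_map (μ := P) hX.aemeasurable
  refine Measure.ext_of_charFunDual ?_
  ext L
  rw [charFunDual_eq_charFun_map_one, charFunDual_eq_charFun_map_one]
  congr 1
  have hL : ⇑L = fun φ : ι → ℝ => (fun i => L (Pi.single i 1)) ⬝ᵥ φ := by
    ext φ
    have : φ = ∑ i, φ i • (Pi.single i 1 : ι → ℝ) := by
      ext j
      simp [Finset.sum_apply, Pi.single_apply]
    conv_lhs => rw [this]
    simp [dotProduct, mul_comm]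
  rw [hL, hQ.map_dotProduct_gaussLaw, Measure.map_map _ hX, ← h]
  · rfl
  · unfold dotProduct
    fun_prop

/-- A centered Gaussian variable is unlikely to be small. -/
lemma gaussianReal_Icc_le {v : ℝ} (hv : 0 < v) {t : ℝ} (ht : 0 ≤ t) :
    (gaussianReal 0 (Real.toNNReal v)).real (Set.Icc (-t) t) ≤ t / √v := by
  have hv' : Real.toNNReal v ≠ 0 := by simpa using hv
  have h1 : gaussianReal 0 (Real.toNNReal v) (Set.Icc (-t) t) ≤ ENNReal.ofReal (t / √v) := by
    rw [gaussianReal_apply _ hv']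
    calc _ ≤ ∫⁻ x in Set.Icc (-t) t, ENNReal.ofReal ((√v)⁻¹ / 2) := by
          refine lintegral_mono fun x => ?_
          rw [gaussianPDF]
          refine ENNReal.ofReal_le_ofReal ?_
          rw [gaussianPDFReal, Real.coe_toNNReal _ hv.le, Real.sqrt_mul (by positivity), mul_inv]
          have e1 : exp (-(x - 0) ^ 2 / (2 * v)) ≤ 1 :=
            Real.exp_le_one_iff.2 (div_nonpos_of_nonpos_of_nonneg
              (neg_nonpos.2 (sq_nonneg _)) (by positivity))
          have e2 : (√(2 * π))⁻¹ ≤ 2⁻¹ := by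
            refine inv_anti₀ (by norm_num) (Real.le_sqrt_of_sq_le ?_)
            linarith [Real.pi_gt_three]
          calc _ ≤ 2⁻¹ * (√v)⁻¹ * 1 := by gcongr
            _ = _ := by ring
      _ = ENNReal.ofReal (t / √v) := by
          rw [setLIntegral_const, Real.volume_Icc, ← ENNReal.ofReal_mul (by positivity)]
          congr 1
          ring
  exact ENNReal.toReal_le_of_le_ofReal (by positivity) h1

lemma Stieltjes.integral_indicator_le {Q : Matrix ι ι ℝ} (hQ : Stieltjes Q) (x : ι) {t : ℝ}
    (ht : 0 ≤ t) :
    ∫ φ, (if φ x ∈ Set.Icc (-t) t then 1 else 0) * gaussDens Q φ ≤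
      t / √(gk Q Finset.univ x x) * ∫ φ, gaussDens Q φ := by
  have := hQ.isProbabilityMeasure_gaussLaw
  rw [← div_le_iff₀ hQ.integral_gaussDens_pos, ← hQ.integral_gaussLaw]
  have h1 := hQ.map_dotProduct_gaussLaw (Pi.single x 1)
  have hG : (Pi.single x 1 : ι → ℝ) ⬝ᵥ (gk Q Finset.univ *ᵥ Pi.single x 1) =
      gk Q Finset.univ x x := by simp
  rw [hG] at h1
  simp only [single_dotProduct, one_mul] at h1
  have hm : Measurable fun φ : ι → ℝ => φ x := measurable_pi_apply x
  refine le_trans (le_of_eq ?_)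
    (gaussianReal_Icc_le (hQ.gk_diag_pos _ (Finset.mem_univ x)) ht)
  rw [← h1, map_measureReal_apply hm measurableSet_Icc, ← integral_indicator_one
    (hm measurableSet_Icc)]
  congr 1
  ext φ
  by_cases h : φ x ∈ Set.Icc (-t) t <;> simp [Set.indicator, h]

/-- The cluster of `x` has large capacity seen from `z` only with small probability. -/
lemma Stieltjes.sum_clusterWt_ge_le {Q : Matrix ι ι ℝ} (hQ : Stieltjes Q) {a : ι × ι → ℝ}
    (ha : IsBond Q a) (x z : ι) {s : ℝ} (hs : 0 < s) :
    (∑ A, if s ≤ gk Q Finset.univ z z - gk Q Aᶜ z z then ∫ φ, clusterWt Q a {x} A φ else 0) ≤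
      4 * gk Q Finset.univ x z / √(s * gk Q Finset.univ x x) * ∫ φ, gaussDens Q φ := by
  set G := gk Q Finset.univ
  have hh : 0 ≤ √(2 / s) := Real.sqrt_nonneg _
  have h1 := hQ.sum_one_sub_exp_le ha x z hh
  have h2 := hQ.integral_indicator_le x (mul_nonneg hh (hQ.gk_nonneg Finset.univ x z))
  rw [Real.sq_sqrt (by positivity)] at h1
  have hpos : ∀ A, 0 ≤ ∫ φ, clusterWt Q a {x} A φ := fun A =>
    integral_nonneg fun φ => clusterWt_nonneg Q ha.nonneg _ _ _
  have h3 : (1 / 2) * (∑ A, if s ≤ G z z - gk Q Aᶜ z z then ∫ φ, clusterWt Q a {x} A φ else 0) ≤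
      ∑ A, (1 - exp (-(2 / s / 2 * (gk Q Finset.univ z z - gk Q Aᶜ z z)))) *
      ∫ φ, clusterWt Q a {x} A φ := by
    rw [Finset.mul_sum]
    refine Finset.sum_le_sum fun A _ => ?_
    have hC : 0 ≤ G z z - gk Q Aᶜ z z := sub_nonneg.2 (hQ.gk_mono (Finset.subset_univ _) _ _)
    split_ifs with h
    · refine mul_le_mul_of_nonneg_right ?_ (hpos A)
      have e1 : 1 ≤ 2 / s / 2 * (G z z - gk Q Aᶜ z z) := by
        rw [div_div, mul_comm s 2, ← div_div, div_self two_ne_zero, one_div_mul_eq_div,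
          one_le_div hs]
        exact h
      have e2 : exp (-(2 / s / 2 * (G z z - gk Q Aᶜ z z))) ≤ exp (-1) := by
        gcongr
      have e3 : exp (-1) ≤ 1 / 2 := by
        rw [Real.exp_neg, ← one_div]
        exact one_div_le_one_div_of_le (by norm_num) (by linarith [Real.add_one_le_exp (1 : ℝ)])
      linarith
    · rw [mul_zero]
      refine mul_nonneg (sub_nonneg.2 (Real.exp_le_one_iff.2 ?_)) (hpos A)
      exact neg_nonpos.2 (mul_nonneg (by positivity) hC)
  have h4 : √(2 / s) * G x z / √(G x x) ≤ 2 * G x z / √(s * G x x) := by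
    rw [Real.sqrt_mul hs.le, Real.sqrt_div two_pos.le, div_mul_eq_mul_div, div_div]
    have : √2 ≤ 2 := by
      rw [Real.sqrt_le_left (by norm_num)]
      norm_num
    have := hQ.gk_nonneg Finset.univ x z
    gcongr
  have hZ := hQ.integral_gaussDens_pos
  have h5 := (h3.trans (h1.trans h2)).trans (mul_le_mul_of_nonneg_right h4 hZ.le)
  calc _ = 2 * ((1 / 2) * (∑ A, if s ≤ G z z - gk Q Aᶜ z z then
        ∫ φ, clusterWt Q a {x} A φ else 0)) := by ring
    _ ≤ 2 * (2 * G x z / √(s * G x x) * ∫ φ, gaussDens Q φ) := by gcongr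
    _ = _ := by ring

end GaussianLaw

section ArmEstimate

open Matrix

lemma sum_powerset_mono_prob {β : Type*} [DecidableEq β] (s : Finset β) {p q : β → ℝ}
    (hp : ∀ e, 0 ≤ p e) (hpq : ∀ e, p e ≤ q e) (hq : ∀ e, q e ≤ 1) (H : Finset β → ℝ)
    (hH : Monotone H) :
    ∑ ω ∈ s.powerset, H ω * ((∏ e ∈ ω, p e) * ∏ e ∈ s \ ω, (1 - p e)) ≤
      ∑ ω ∈ s.powerset, H ω * ((∏ e ∈ ω, q e) * ∏ e ∈ s \ ω, (1 - q e)) := by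
  induction s using Finset.induction_on generalizing H with
  | empty => simp
  | insert a s ha ih =>
    have key : ∀ r : β → ℝ, ∑ ω ∈ (insert a s).powerset,
        H ω * ((∏ e ∈ ω, r e) * ∏ e ∈ insert a s \ ω, (1 - r e)) =
        ∑ ω ∈ s.powerset, ((1 - r a) * H ω + r a * H (insert a ω)) *
          ((∏ e ∈ ω, r e) * ∏ e ∈ s \ ω, (1 - r e)) := by
      intro r
      rw [Finset.sum_powerset_insert ha, ← Finset.sum_add_distrib]
      refine Finset.sum_congr rfl fun ω hω => ?_
      have haω : a ∉ ω := fun h => ha (Finset.mem_powerset.1 hω h)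
      rw [Finset.prod_insert haω, Finset.insert_sdiff_of_notMem _ haω,
        Finset.prod_insert (by simp [ha]), Finset.insert_sdiff_insert,
        Finset.sdiff_insert_of_notMem ha]
      ring
    rw [key, key]
    have hins : Monotone fun ω => H (insert a ω) := fun ω ω' h =>
      hH (Finset.insert_subset_insert a h)
    refine (ih (fun ω => (1 - p a) * H ω + p a * H (insert a ω)) ?_).trans ?_
    · intro ω ω' h
      have h1 := hH h
      have h2 := hins h
      have := (hpq a).trans (hq a)
      have := hp a
      dsimp only at h2 ⊢
      gcongr
    · refine Finset.sum_le_sum fun ω _ => mul_le_mul_of_nonneg_right ?_ ?_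
      · have h1 : H ω ≤ H (insert a ω) := hH (Finset.subset_insert a ω)
        nlinarith [mul_nonneg (sub_nonneg.2 (hpq a)) (sub_nonneg.2 h1)]
      · exact mul_nonneg (Finset.prod_nonneg fun e _ => (hp e).trans (hpq e))
          (Finset.prod_nonneg fun e _ => sub_nonneg.2 (hq e))

variable {ι : Type*} [Fintype ι] [DecidableEq ι]

omit [Fintype ι] [DecidableEq ι] in
lemma bondConn_mono {ω ω' : Finset (ι × ι)} (h : ω ⊆ ω') {x y : ι} (hxy : bondConn ω x y) :
    bondConn ω' x y :=
  Relation.ReflTransGen.mono (fun _ _ => Or.imp (fun k => h k) fun k => h k) _ _ hxy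

/-- The bonds dominate independent percolation with smaller edge probabilities. -/
lemma sum_conn_le_sum_bondWt (E : Finset (ι × ι)) {a : ι × ι → ℝ} (ha : ∀ e, 0 ≤ a e)
    (φ : ι → ℝ) (p : ι × ι → ℝ) (hp : ∀ e, 0 ≤ p e) (hpE : ∀ e ∈ E, p e ≤ 1 - bondClosed a φ e)
    (x : ι) (F : Finset ι) :
    ∑ ω ∈ E.powerset, (if ∃ b ∈ F, bondConn ω x b then
      (∏ e ∈ ω, p e) * ∏ e ∈ E \ ω, (1 - p e) else 0) ≤
      ∑ ω, if ∃ b ∈ F, bondConn ω x b then bondWt a φ ω else 0 := by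
  set H : Finset (ι × ι) → ℝ := fun ω => if ∃ b ∈ F, bondConn ω x b then 1 else 0 with hHdef
  have hH : Monotone H := by
    intro ω ω' h
    simp only [hHdef]
    split_ifs with h1 h2
    · exact le_rfl
    · obtain ⟨b, hb, hc⟩ := h1
      exact absurd ⟨b, hb, bondConn_mono h hc⟩ h2
    · exact zero_le_one
    · exact le_rfl
  set p' : ι × ι → ℝ := fun e => if e ∈ E then p e else 0 with hp'
  have h1 := sum_powerset_mono_prob Finset.univ (p := p') (q := fun e => 1 - bondClosed a φ e)
    (fun e => by
      simp only [hp']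
      split_ifs
      exacts [hp e, le_rfl])
    (fun e => by
      simp only [hp']
      split_ifs with h
      exacts [hpE e h, sub_nonneg.2 (bondClosed_le_one ha φ e)])
    (fun e => by linarith [bondClosed_pos a φ e]) H hH
  have e1 : ∑ ω, (if ∃ b ∈ F, bondConn ω x b then bondWt a φ ω else 0) =
      ∑ ω ∈ Finset.univ.powerset, H ω * ((∏ e ∈ ω, (1 - bondClosed a φ e)) *
        ∏ e ∈ Finset.univ \ ω, (1 - (1 - bondClosed a φ e))) := by
    rw [Finset.powerset_univ]
    refine Finset.sum_congr rfl fun ω _ => ?_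
    simp only [hHdef, ite_mul, one_mul, zero_mul, sub_sub_cancel, bondWt,
      Finset.compl_eq_univ_sdiff]
  have e2 : ∑ ω ∈ E.powerset, (if ∃ b ∈ F, bondConn ω x b then
      (∏ e ∈ ω, p e) * ∏ e ∈ E \ ω, (1 - p e) else 0) =
      ∑ ω ∈ Finset.univ.powerset, H ω * ((∏ e ∈ ω, p' e) *
        ∏ e ∈ Finset.univ \ ω, (1 - p' e)) := by
    refine Finset.sum_subset_zero_on_sdiff (Finset.powerset_mono.2 (Finset.subset_univ _)) ?_ ?_
    · intro ω hω
      rw [Finset.mem_sdiff, Finset.mem_powerset, Finset.mem_powerset] at hω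
      obtain ⟨e, he, heE⟩ := Finset.not_subset.1 hω.2
      rw [Finset.prod_eq_zero he (by simp [hp', heE]), zero_mul, mul_zero]
    · intro ω hω
      rw [Finset.mem_powerset] at hω
      have e3 : ∏ e ∈ ω, p' e = ∏ e ∈ ω, p e :=
        Finset.prod_congr rfl fun e he => by simp [hp', hω he]
      have e4 : ∏ e ∈ Finset.univ \ ω, (1 - p' e) = ∏ e ∈ E \ ω, (1 - p e) := by
        refine (Finset.prod_subset_one_on_sdiff (Finset.sdiff_subset_sdiff
          (Finset.subset_univ _) le_rfl) ?_ ?_).symm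
        · intro e he
          have : e ∉ E := by
            simp only [Finset.mem_sdiff, Finset.mem_univ, true_and, not_and, not_not] at he
            exact fun h => he.1 (he.2 h)
          simp [hp', this]
        · intro e he
          simp [hp', (Finset.mem_sdiff.1 he).1]
      rw [e3, e4]
      simp only [hHdef, ite_mul, one_mul, zero_mul]
  rw [e1, e2]
  exact h1

/-- Reduction of the arm probability to small clusters weighted by the field. -/
lemma Stieltjes.sum_conn_le {Q : Matrix ι ι ℝ} (hQ : Stieltjes Q) {a : ι × ι → ℝ}
    (ha : IsBond Q a) (x z : ι) (F : Finset ι) {s ε D : ℝ} (hs : 0 < s) (hε : 0 < ε)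
    (hD : ∀ b ∈ F, ∀ c : Finset ι → ℝ, (∀ K, 0 ≤ c K) →
      (∀ A : Finset ι, ∑ K, (if Disjoint K A then c K else 0) ≤ gk Q Aᶜ x b) →
      ∑ K, (if gk Q Finset.univ z z - gk Q Kᶜ z z < s then c K else 0) ≤ D) :
    (∑ ω, if ∃ b ∈ F, bondConn ω x b then ∫ φ, jointWt Q a ω φ else 0) ≤
      (4 * gk Q Finset.univ x z / √(s * gk Q Finset.univ x x) + ε / √(gk Q Finset.univ x x) +
        ∑ b ∈ F, (ε / √(gk Q Finset.univ b b) + D / ε ^ 2)) * ∫ φ, gaussDens Q φ := by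
  set Z := ∫ φ, gaussDens Q φ
  have hZ : 0 < Z := hQ.integral_gaussDens_pos
  set C : Finset ι → ℝ := fun K => gk Q Finset.univ z z - gk Q Kᶜ z z with hC
  set I : ι → (ι → ℝ) → ℝ := fun y φ => if φ y ∈ Set.Icc (-ε) ε then 1 else 0 with hI
  have hIg : ∀ y, ExpGrowth (I y) := fun y => expGrowth_indicator measurableSet_Icc y
  have hpr : ∀ b, ExpGrowth fun φ : ι → ℝ => |φ x * φ b| := fun b =>
    ((ExpGrowth.coord x).mul (ExpGrowth.coord b)).abs
  have hI0 : ∀ y φ, 0 ≤ I y φ := fun y φ => by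
    simp only [hI]
    split_ifs <;> norm_num
  have hJ0 := jointWt_nonneg ha.nonneg Q
  have hIJ0 : ∀ y ω, 0 ≤ ∫ φ, I y φ * jointWt Q a ω φ := fun y ω =>
    integral_nonneg fun φ => mul_nonneg (hI0 y φ) (hJ0 ω φ)
  have hPJ0 : ∀ b ω, 0 ≤ ∫ φ, |φ x * φ b| * jointWt Q a ω φ := fun b ω =>
    integral_nonneg fun φ => mul_nonneg (abs_nonneg _) (hJ0 ω φ)
  have hJi : ∀ ω, Integrable fun φ => jointWt Q a ω φ := fun ω => by
    simpa using hQ.integrable_mul_jointWt ha (ExpGrowth.const 1) ω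
  set c : ι → Finset ι → ℝ := fun b K => Z⁻¹ * ∑ ω, if bondConn ω x b ∧ bondCluster ω {x} = K then
    ∫ φ, |φ x * φ b| * jointWt Q a ω φ else 0 with hc
  have hc0 : ∀ b K, 0 ≤ c b K := fun b K => by
    refine mul_nonneg (inv_nonneg.2 hZ.le) (Finset.sum_nonneg fun ω _ => ?_)
    split_ifs
    exacts [hPJ0 b ω, le_rfl]
  have hcsum : ∀ b (p : Finset ι → Prop) [DecidablePred p], ∑ K, (if p K then c b K else 0) =
      Z⁻¹ * ∑ ω, if bondConn ω x b ∧ p (bondCluster ω {x}) then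
        ∫ φ, |φ x * φ b| * jointWt Q a ω φ else 0 := by
    intro b p _
    simp only [hc, ← mul_ite_zero, ← Finset.mul_sum]
    congr 1
    have : ∀ K, (if p K then ∑ ω, (if bondConn ω x b ∧ bondCluster ω {x} = K then
        ∫ φ, |φ x * φ b| * jointWt Q a ω φ else 0) else 0) =
        ∑ ω, if bondCluster ω {x} = K then (if bondConn ω x b ∧ p (bondCluster ω {x}) then
        ∫ φ, |φ x * φ b| * jointWt Q a ω φ else 0) else 0 := by
      intro K
      split_ifs with h
      · refine Finset.sum_congr rfl fun ω _ => ?_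
        by_cases h' : bondCluster ω {x} = K
        · simp [h', h]
        · simp [h']
      · refine (Finset.sum_eq_zero fun ω _ => ?_).symm
        by_cases h' : bondCluster ω {x} = K
        · simp [h', h]
        · simp [h']
    simp only [this]
    rw [Finset.sum_comm]
    simp
  have hcb : ∀ b ∈ F, ∑ ω, (if bondConn ω x b ∧ C (bondCluster ω {x}) < s then
      ∫ φ, |φ x * φ b| * jointWt Q a ω φ else 0) ≤ D * Z := by
    intro b hb
    have h1 := hD b hb (c b) (hc0 b) fun A => ?_
    · rw [hcsum b fun K => C K < s] at h1
      rwa [inv_mul_le_iff₀ hZ, mul_comm] at h1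
    · rw [hcsum b fun K => Disjoint K A, inv_mul_le_iff₀ hZ, mul_comm]
      exact hQ.sum_conn_avoid_le ha x b A
  have hsum : ∀ y, ∑ ω, ∫ φ, I y φ * jointWt Q a ω φ ≤ ε / √(gk Q Finset.univ y y) * Z := by
    intro y
    rw [← integral_finsetSum _ fun ω _ => hQ.integrable_mul_jointWt ha (hIg y) ω]
    simp only [← Finset.mul_sum, sum_jointWt]
    exact hQ.integral_indicator_le y hε.le
  have hcap : ∑ ω, (if s ≤ C (bondCluster ω {x}) then ∫ φ, jointWt Q a ω φ else 0) ≤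
      4 * gk Q Finset.univ x z / √(s * gk Q Finset.univ x x) * Z := by
    refine le_trans (le_of_eq ?_) (hQ.sum_clusterWt_ge_le ha x z hs)
    have : ∀ A, ∫ φ, clusterWt Q a {x} A φ =
        ∑ ω, if bondCluster ω {x} = A then ∫ φ, jointWt Q a ω φ else 0 := by
      intro A
      simpa using integral_mul_clusterWt hQ ha (ExpGrowth.const 1) {x} A
    simp only [this]
    have e : ∀ A, (if s ≤ gk Q Finset.univ z z - gk Q Aᶜ z z then
        ∑ ω, (if bondCluster ω {x} = A then ∫ φ, jointWt Q a ω φ else 0) else 0) =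
        ∑ ω, if bondCluster ω {x} = A then
          (if s ≤ C (bondCluster ω {x}) then ∫ φ, jointWt Q a ω φ else 0) else 0 := by
      intro A
      split_ifs with h
      · refine Finset.sum_congr rfl fun ω _ => ?_
        by_cases h' : bondCluster ω {x} = A
        · simp [h', hC, h]
        · simp [h']
      · refine (Finset.sum_eq_zero fun ω _ => ?_).symm
        by_cases h' : bondCluster ω {x} = A
        · simp only [h', if_true, hC, if_neg h]
        · simp [h']
    simp only [e]
    rw [Finset.sum_comm]
    simp
  have hpt : ∀ ω, (if ∃ b ∈ F, bondConn ω x b then ∫ φ, jointWt Q a ω φ else 0) ≤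
      (if s ≤ C (bondCluster ω {x}) then ∫ φ, jointWt Q a ω φ else 0) +
      (∫ φ, I x φ * jointWt Q a ω φ) +
      ∑ b ∈ F, ((∫ φ, I b φ * jointWt Q a ω φ) +
        1 / ε ^ 2 * (if bondConn ω x b ∧ C (bondCluster ω {x}) < s then
          ∫ φ, |φ x * φ b| * jointWt Q a ω φ else 0)) := by
    intro ω
    have hterm : ∀ b, 0 ≤ (∫ φ, I b φ * jointWt Q a ω φ) +
        1 / ε ^ 2 * (if bondConn ω x b ∧ C (bondCluster ω {x}) < s then
          ∫ φ, |φ x * φ b| * jointWt Q a ω φ else 0) := fun b => by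
      refine add_nonneg (hIJ0 b ω) (mul_nonneg (by positivity) ?_)
      split_ifs
      exacts [hPJ0 b ω, le_rfl]
    have hrest := Finset.sum_nonneg fun b (_ : b ∈ F) => hterm b
    have hJω : 0 ≤ ∫ φ, jointWt Q a ω φ := integral_nonneg fun φ => hJ0 ω φ
    by_cases h1 : ∃ b ∈ F, bondConn ω x b
    · rw [if_pos h1]
      obtain ⟨b, hb, hconn⟩ := h1
      by_cases h2 : s ≤ C (bondCluster ω {x})
      · rw [if_pos h2]
        linarith [hIJ0 x ω]
      · rw [if_neg h2, zero_add]
        have h3 := Finset.single_le_sum (fun b (_ : b ∈ F) => hterm b) hb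
        refine le_trans ?_ (add_le_add le_rfl h3)
        rw [if_pos ⟨hconn, not_le.1 h2⟩, ← integral_const_mul]
        have i1 := hQ.integrable_mul_jointWt ha (hIg x) ω
        have i2 := hQ.integrable_mul_jointWt ha (hIg b) ω
        have i3 := (hQ.integrable_mul_jointWt ha (hpr b) ω).const_mul (1 / ε ^ 2)
        have i4 : Integrable fun φ => I b φ * jointWt Q a ω φ +
          1 / ε ^ 2 * (|φ x * φ b| * jointWt Q a ω φ) := i2.add i3
        have i5 : Integrable fun φ => I x φ * jointWt Q a ω φ + (I b φ * jointWt Q a ω φ +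
          1 / ε ^ 2 * (|φ x * φ b| * jointWt Q a ω φ)) := i1.add i4
        rw [← integral_add i2 i3, ← integral_add i1 i4]
        refine integral_mono (hJi ω) i5 fun φ => ?_
        have key : 1 ≤ I x φ + (I b φ + 1 / ε ^ 2 * |φ x * φ b|) := by
          by_cases hx : φ x ∈ Set.Icc (-ε) ε
          · have : I x φ = 1 := if_pos hx
            have := hI0 b φ
            have : 0 ≤ 1 / ε ^ 2 * |φ x * φ b| := by positivity
            linarith
          by_cases hb : φ b ∈ Set.Icc (-ε) ε
          · have : I b φ = 1 := if_pos hb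
            have := hI0 x φ
            have : 0 ≤ 1 / ε ^ 2 * |φ x * φ b| := by positivity
            linarith
          · have hxε : ε ≤ |φ x| := by
              by_contra h
              exact hx ⟨(abs_lt.1 (not_le.1 h)).1.le, (abs_lt.1 (not_le.1 h)).2.le⟩
            have hbε : ε ≤ |φ b| := by
              by_contra h
              exact hb ⟨(abs_lt.1 (not_le.1 h)).1.le, (abs_lt.1 (not_le.1 h)).2.le⟩
            have : 1 ≤ 1 / ε ^ 2 * |φ x * φ b| := by
              rw [abs_mul, one_div_mul_eq_div, one_le_div (by positivity), sq]
              exact mul_le_mul hxε hbε hε.le (abs_nonneg _)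
            linarith [hI0 x φ, hI0 b φ]
        dsimp only
        nlinarith [mul_le_mul_of_nonneg_right key (hJ0 ω φ)]
    · rw [if_neg h1]
      refine add_nonneg (add_nonneg ?_ (hIJ0 x ω)) hrest
      split_ifs
      exacts [hJω, le_rfl]
  refine (Finset.sum_le_sum fun ω _ => hpt ω).trans ?_
  rw [Finset.sum_add_distrib, Finset.sum_add_distrib, add_mul, add_mul]
  refine add_le_add (add_le_add hcap (hsum x)) ?_
  rw [Finset.sum_comm, Finset.sum_mul]
  refine Finset.sum_le_sum fun b hb => ?_
  rw [Finset.sum_add_distrib, ← Finset.mul_sum, add_mul]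
  refine add_le_add (hsum b) ?_
  calc _ ≤ 1 / ε ^ 2 * (D * Z) := mul_le_mul_of_nonneg_left (hcb b hb) (by positivity)
    _ = _ := by ring

end ArmEstimate

section GraphGreen

namespace WGraph

variable (M : WGraph)

/-- The finite set of neighbours. -/
def nbrs (x : M.V) : Finset M.V := (M.locFin x).toFinset

lemma mem_nbrs {x y : M.V} : y ∈ M.nbrs x ↔ M.lam x y ≠ 0 := by simp [nbrs]

lemma mem_nbrs_comm {x y : M.V} : y ∈ M.nbrs x ↔ x ∈ M.nbrs y := by
  rw [mem_nbrs, mem_nbrs, M.lam_symm]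

lemma lamTot_eq_sum (x : M.V) : M.lamTot x = ∑ y ∈ M.nbrs x, M.lam x y :=
  finsum_eq_sum_of_support_subset _ (by simp [nbrs])

lemma lamTot_nonneg (x : M.V) : 0 ≤ M.lamTot x := by
  rw [lamTot_eq_sum]
  exact Finset.sum_nonneg fun y _ => M.lam_nonneg x y

lemma pstep_succ (n : ℕ) (x y : M.V) :
    M.pstep (n + 1) x y = ∑ z ∈ M.nbrs x, M.p x z * M.pstep n z y := by
  refine finsum_eq_sum_of_support_subset _ fun z hz => ?_
  simp only [Function.mem_support, p] at hz
  simp only [Finset.mem_coe, mem_nbrs]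
  rintro h
  simp [h] at hz

lemma p_nonneg (x y : M.V) : 0 ≤ M.p x y := div_nonneg (M.lam_nonneg x y) (M.lamTot_nonneg x)

lemma pstep_nonneg (n : ℕ) (x y : M.V) : 0 ≤ M.pstep n x y := by
  induction n generalizing x with
  | zero =>
    simp only [pstep]
    split_ifs <;> norm_num
  | succ n ih =>
    rw [pstep_succ]
    exact Finset.sum_nonneg fun z _ => mul_nonneg (M.p_nonneg x z) (ih z)

lemma pstep_succ_right (n : ℕ) (x y : M.V) :
    M.pstep (n + 1) x y = ∑ z ∈ M.nbrs y, M.pstep n x z * M.p z y := by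
  induction n generalizing x with
  | zero =>
    rw [pstep_succ]
    simp only [pstep, mul_ite, mul_one, mul_zero, ite_mul, one_mul, zero_mul]
    rw [Finset.sum_ite_eq', Finset.sum_ite_eq]
    simp only [M.mem_nbrs_comm (x := x)]
  | succ n ih =>
    rw [pstep_succ]
    simp only [ih, Finset.mul_sum]
    rw [Finset.sum_comm]
    refine Finset.sum_congr rfl fun w _ => ?_
    rw [pstep_succ, Finset.sum_mul]
    exact Finset.sum_congr rfl fun z _ => by ring

variable {M}

lemma pstep_reversible (hpos : ∀ x, 0 < M.lamTot x) (n : ℕ) (x y : M.V) :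
    M.lamTot x * M.pstep n x y = M.lamTot y * M.pstep n y x := by
  induction n generalizing x with
  | zero =>
    by_cases h : x = y
    · rw [h]
    · simp [pstep, h, Ne.symm h]
  | succ n ih =>
    rw [pstep_succ, pstep_succ_right, Finset.mul_sum, Finset.mul_sum]
    refine Finset.sum_congr rfl fun z _ => ?_
    rw [← mul_assoc, ← mul_assoc, ← ih z, p, p, M.lam_symm z x]
    have := (hpos x).ne'
    have := (hpos z).ne'
    field_simp

lemma green_comm (hpos : ∀ x, 0 < M.lamTot x) (x y : M.V) : M.green x y = M.green y x := by
  rw [green, green, div_eq_div_iff (hpos y).ne' (hpos x).ne', mul_comm, ← tsum_mul_left,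
    mul_comm (∑' n, _), ← tsum_mul_left]
  simp only [pstep_reversible hpos _ x y]

lemma green_equation (hpos : ∀ x, 0 < M.lamTot x)
    (hsum : ∀ x y, Summable fun n => M.pstep n x y) (x y : M.V) :
    M.lamTot x * M.green x y - ∑ z ∈ M.nbrs x, M.lam x z * M.green z y =
      if x = y then 1 else 0 := by
  have h1 : ∑' n, M.pstep n x y = (if x = y then 1 else 0) +
      ∑ z ∈ M.nbrs x, M.p x z * ∑' n, M.pstep n z y := by
    rw [(hsum x y).tsum_eq_zero_add]
    congr 1
    simp only [pstep_succ]
    rw [Summable.tsum_finsetSum fun z _ => (hsum z y).mul_left _]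
    exact Finset.sum_congr rfl fun z _ => tsum_mul_left
  have hx := (hpos x).ne'
  have hy := (hpos y).ne'
  have h2 : ∑ z ∈ M.nbrs x, M.lam x z * M.green z y =
      M.lamTot x * (∑ z ∈ M.nbrs x, M.p x z * ∑' n, M.pstep n z y) / M.lamTot y := by
    rw [Finset.mul_sum, Finset.sum_div]
    refine Finset.sum_congr rfl fun z _ => ?_
    rw [green, p]
    field_simp
  rw [h2, green, h1]
  split_ifs with h
  · subst h
    field_simp
    ring
  · field_simp
    ring

/-- Minimum principle for functions vanishing at infinity. -/
lemma nonneg_of_superharmonic {f : M.V → ℝ} {S : Set M.V}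
    (hS : S.Nonempty) (hfin : ∀ ε > 0, {x | f x ≤ -ε}.Finite) (hfS : ∀ x ∈ S, 0 ≤ f x)
    (hf : ∀ x, x ∉ S → ∑ z ∈ M.nbrs x, M.lam x z * f z ≤ M.lamTot x * f x) (x : M.V) :
    0 ≤ f x := by
  by_contra hx
  push Not at hx
  obtain ⟨m, hm, hmin⟩ := Set.exists_min_image {y | f y ≤ f x} f
    (by simpa using hfin (-f x) (by linarith)) ⟨x, le_refl (f x)⟩
  have hall : ∀ y, f m ≤ f y := fun y => by
    by_cases h : f y ≤ f x
    · exact hmin y h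
    · exact le_trans hm (not_le.1 h).le
  have hstep : ∀ u v, f u = f m → 0 < M.lam u v → f v = f m := by
    intro u v hu huv
    have huS : u ∉ S := fun h => by
      have : f m ≤ f x := hm
      linarith [hfS u h]
    have h1 := hf u huS
    rw [hu, lamTot_eq_sum, Finset.sum_mul] at h1
    have h2 : ∀ z ∈ M.nbrs u, M.lam u z * f m ≤ M.lam u z * f z := fun z _ =>
      mul_le_mul_of_nonneg_left (hall z) (M.lam_nonneg u z)
    have h3 := (Finset.sum_eq_sum_iff_of_le h2).1 (le_antisymm (Finset.sum_le_sum h2) h1) v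
      (M.mem_nbrs.2 huv.ne')
    exact (mul_left_cancel₀ huv.ne' h3).symm
  have hconst : ∀ s, f s = f m := fun s => by
    induction M.connectedG m s with
    | refl => rfl
    | tail _ h ih => exact hstep _ _ ih h
  obtain ⟨s, hs⟩ := hS
  have hmx : f m ≤ f x := hm
  linarith [hfS s hs, hconst s]

/-- Uniform consequences of the standing assumptions. -/
structure Regular (M : WGraph) (c C : ℝ) : Prop where
  c_pos : 0 < c
  c_le : c ≤ 1
  C_ge : 1 ≤ C
  lamTot_pos : ∀ x, 0 < M.lamTot x
  ball_finite : ∀ x r, (M.ball x r).Finite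
  card_ball_ge : ∀ x r, 1 ≤ r → c * r ^ M.α ≤ (M.ball x r).ncard
  card_ball_le : ∀ x r, 1 ≤ r → ((M.ball x r).ncard : ℝ) ≤ C * r ^ M.α
  green_self_ge : ∀ x, c ≤ M.green x x
  green_le : ∀ x y, M.green x y ≤ C
  green_ge_rpow : ∀ x y, x ≠ y → c * M.d x y ^ (-M.ν) ≤ M.green x y
  green_le_rpow : ∀ x y, x ≠ y → M.green x y ≤ C * M.d x y ^ (-M.ν)
  d_ge : ∀ x y, x ≠ y → c ≤ M.d x y
  d_le : ∀ x y, M.lam x y ≠ 0 → M.d x y ≤ C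
  green_symm : ∀ x y, M.green x y = M.green y x
  equation : ∀ x y, M.lamTot x * M.green x y - ∑ z ∈ M.nbrs x, M.lam x z * M.green z y =
    if x = y then 1 else 0
  lam_le : ∀ x y, M.lam x y ≤ C

namespace Regular

variable {c C : ℝ}

lemma green_pos (h : M.Regular c C) (x y : M.V) : 0 < M.green x y := by
  by_cases hxy : x = y
  · rw [hxy]
    exact h.c_pos.trans_le (h.green_self_ge y)
  · exact (mul_pos h.c_pos (Real.rpow_pos_of_pos (M.d_pos x y hxy) _)).trans_le
      (h.green_ge_rpow x y hxy)

end Regular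

/-- The Green's function vanishes at infinity. -/
lemma finite_green_ge (hν : 1 ≤ M.ν) {C : ℝ} (hball : ∀ x r, (M.ball x r).Finite)
    (hC : 0 < C) (hg : ∀ x y, x ≠ y → M.green x y ≤ C * M.d x y ^ (-M.ν)) (y : M.V) {ε : ℝ}
    (hε : 0 < ε) : {x | ε ≤ M.green x y}.Finite := by
  refine (hball y (max 0 ((C / ε) ^ (1 / M.ν)))).subset fun x hx => ?_
  simp only [ball, Set.mem_ofPred_eq] at hx ⊢
  by_cases hxy : x = y
  · rw [hxy, M.d_self]
    exact le_max_left _ _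
  · refine le_trans ?_ (le_max_right _ _)
    have hd := M.d_pos x y hxy
    have h1 := hx.trans (hg x y hxy)
    rw [Real.rpow_neg hd.le, ← div_eq_mul_inv, le_div_iff₀ (Real.rpow_pos_of_pos hd _)] at h1
    rw [M.d_symm, one_div, Real.le_rpow_inv_iff_of_pos hd.le (by positivity) (by linarith)]
    rw [le_div_iff₀ hε]
    linarith

end WGraph

open Matrix

lemma form_pos_of_supersolution {ι : Type*} [Fintype ι] {Q : Matrix ι ι ℝ}
    (hsymm : ∀ x y, Q x y = Q y x) (hoff : ∀ x y, x ≠ y → Q x y ≤ 0) {u : ι → ℝ}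
    (hu : ∀ x, 0 < u x) (hQu : ∀ x, 0 < (Q *ᵥ u) x) {f : ι → ℝ} (hf : f ≠ 0) :
    0 < f ⬝ᵥ (Q *ᵥ f) := by
  set D : ι → ι → ℝ := fun x y => Q x y * (f x * f y - u y * (f x ^ 2 / u x)) with hD
  have hDD : ∀ x y, 0 ≤ D x y + D y x := by
    intro x y
    have hx := (hu x).ne'
    have hy := (hu y).ne'
    have : D x y + D y x = -Q x y * (u x * u y) * (f x / u x - f y / u y) ^ 2 := by
      simp only [hD, hsymm y x]
      field_simp
      ring
    rw [this]
    by_cases hxy : x = y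
    · simp [hxy]
    · exact mul_nonneg (mul_nonneg (neg_nonneg.2 (hoff x y hxy)) (mul_pos (hu x) (hu y)).le)
        (sq_nonneg _)
  have hsum : 0 ≤ ∑ x, ∑ y, D x y := by
    have h1 : ∑ x, ∑ y, D x y = ∑ x, ∑ y, D y x := Finset.sum_comm
    have h2 : 0 ≤ ∑ x, ∑ y, (D x y + D y x) :=
      Finset.sum_nonneg fun x _ => Finset.sum_nonneg fun y _ => hDD x y
    simp only [Finset.sum_add_distrib] at h2
    linarith
  have hform : f ⬝ᵥ (Q *ᵥ f) = ∑ x, f x ^ 2 / u x * (Q *ᵥ u) x + ∑ x, ∑ y, D x y := by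
    rw [← Finset.sum_add_distrib]
    refine Finset.sum_congr rfl fun x _ => ?_
    simp only [mulVec, dotProduct, Finset.mul_sum, ← Finset.sum_add_distrib, hD]
    exact Finset.sum_congr rfl fun y _ => by ring
  rw [hform]
  refine add_pos_of_pos_of_nonneg ?_ hsum
  obtain ⟨x, hx⟩ := Function.ne_iff.1 hf
  refine Finset.sum_pos' (fun y _ => ?_) ⟨x, Finset.mem_univ x, ?_⟩
  · exact mul_nonneg (div_nonneg (sq_nonneg _) (hu y).le) (hQu y).le
  · exact mul_pos (div_pos (sq_pos_of_ne_zero hx) (hu x)) (hQu x)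

namespace WGraph

variable {M : WGraph}

/-- The inverse of the Green's function restricted to a finite set is a Stieltjes matrix. -/
lemma exists_stieltjes (hg : ∀ x y, 0 < M.green x y)
    (hsymm : ∀ x y, M.green x y = M.green y x)
    (heq : ∀ x y, M.lamTot x * M.green x y - ∑ z ∈ M.nbrs x, M.lam x z * M.green z y =
      if x = y then 1 else 0)
    (hfin : ∀ y, ∀ ε > 0, {x | ε ≤ M.green x y}.Finite) (Λ : Finset M.V) :
    ∃ Q : Matrix Λ Λ ℝ, Stieltjes Q ∧ (∀ i j, gk Q Finset.univ i j = M.green i j) ∧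
      ∀ i : Λ, M.nbrs i ⊆ Λ → ∀ j : Λ, Q i j = (if i = j then M.lamTot i else 0) - M.lam i j := by
  set A : Matrix Λ Λ ℝ := Matrix.of fun i j => M.green i j with hA
  set pot : (Λ → ℝ) → M.V → ℝ := fun k x => ∑ w : Λ, k w * M.green x w with hpot
  have hpotA : ∀ k (i : Λ), pot k i = (A *ᵥ k) i := fun k i => by
    simp only [hpot, hA, mulVec, dotProduct, Matrix.of_apply, mul_comm]
  have hlap : ∀ k x, M.lamTot x * pot k x - ∑ z ∈ M.nbrs x, M.lam x z * pot k z =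
      ∑ w : Λ, if x = w then k w else 0 := by
    intro k x
    simp only [hpot, Finset.mul_sum]
    rw [Finset.sum_comm, ← Finset.sum_sub_distrib]
    refine Finset.sum_congr rfl fun w _ => ?_
    have := congrArg (fun t => k w * t) (heq x w)
    simp only [mul_sub, Finset.mul_sum, mul_ite, mul_one, mul_zero] at this
    rw [← this]
    congr 1
    · ring
    · exact Finset.sum_congr rfl fun z _ => by ring
  have hlap_in : ∀ k (i : Λ), M.lamTot i * pot k i - ∑ z ∈ M.nbrs i, M.lam i z * pot k z = k i := by
    intro k i
    rw [hlap]
    simp only [Subtype.coe_inj, Finset.sum_ite_eq, Finset.mem_univ, if_true]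
  have hlap_out : ∀ k x, x ∉ (Λ : Set M.V) →
      M.lamTot x * pot k x - ∑ z ∈ M.nbrs x, M.lam x z * pot k z = 0 := by
    intro k x hx
    rw [hlap]
    refine Finset.sum_eq_zero fun w _ => if_neg ?_
    rintro rfl
    exact hx w.2
  have hpfin : ∀ k, ∀ ε > 0, {x | pot k x ≤ -ε}.Finite := by
    intro k ε hε
    set κ := ∑ w, |k w| with hκ
    have hκ0 : 0 ≤ κ := Finset.sum_nonneg fun w _ => abs_nonneg _
    refine (Set.finite_iUnion fun w : Λ => hfin w (ε / (κ + 1)) (by positivity)).subset ?_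
    intro x hx
    simp only [Set.mem_iUnion, Set.mem_ofPred_eq] at hx ⊢
    by_contra hcon
    push Not at hcon
    have h1 : -pot k x ≤ ∑ w, |k w| * (ε / (κ + 1)) := by
      simp only [hpot, ← Finset.sum_neg_distrib]
      refine Finset.sum_le_sum fun w _ => ?_
      rw [← neg_mul]
      exact mul_le_mul (neg_le_abs _) (hcon w).le (hg _ _).le (abs_nonneg _)
    rw [← Finset.sum_mul, ← hκ, mul_div_assoc'] at h1
    have h2 : κ * ε / (κ + 1) < ε := by
      rw [div_lt_iff₀ (by positivity)]
      nlinarith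
    linarith
  have hmin : ∀ k, (∀ i : Λ, 0 ≤ (A *ᵥ k) i) → Nonempty Λ → ∀ x, 0 ≤ pot k x := by
    intro k hk hne
    obtain ⟨i⟩ := hne
    refine nonneg_of_superharmonic (S := (Λ : Set M.V)) ⟨i, i.2⟩ (hpfin k) ?_ ?_
    · intro x hx
      rw [hpotA k ⟨x, hx⟩]
      exact hk _
    · intro x hx
      linarith [hlap_out k x hx]
  have hpotneg : ∀ k x, pot (-k) x = -pot k x := fun k x => by
    simp [hpot]
  have hinj : Function.Injective A.mulVec := by
    rw [← Matrix.coe_mulVecLin, ← LinearMap.ker_eq_bot, LinearMap.ker_eq_bot']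
    intro k hk
    rw [Matrix.mulVecLin_apply] at hk
    ext i
    have h1 := hmin k (fun i => by simp [hk]) ⟨i⟩
    have h2 := hmin (-k) (fun i => by simp [mulVec_neg, hk]) ⟨i⟩
    have h3 : ∀ x, pot k x = 0 := fun x => by
      have := h2 x
      rw [hpotneg] at this
      linarith [h1 x]
    have := hlap_in k i
    simp only [h3, mul_zero, Finset.sum_const_zero, sub_zero] at this
    exact this.symm
  have hunit : IsUnit A := Matrix.mulVec_injective_iff_isUnit.1 hinj
  have hdet : IsUnit A.det := (Matrix.isUnit_iff_isUnit_det A).1 hunit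
  set Q := A⁻¹ with hQ
  have hQA : Q * A = 1 := Matrix.nonsing_inv_mul A hdet
  have hAQ : A * Q = 1 := Matrix.mul_nonsing_inv A hdet
  have hAsymm : Aᵀ = A := by
    ext i j
    exact hsymm j i
  have hQsymm : ∀ x y, Q x y = Q y x := by
    intro x y
    have : Qᵀ = Q := by rw [hQ, Matrix.transpose_nonsing_inv, hAsymm]
    exact (congrFun (congrFun this x) y).symm
  have hrow : ∀ i : Λ, M.nbrs i ⊆ Λ → ∀ j : Λ,
      Q i j = (if i = j then M.lamTot i else 0) - M.lam i j := by
    intro i hi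
    set r : Λ → ℝ := fun j => (if i = j then M.lamTot i else 0) - M.lam i j with hr
    have h1 : r ᵥ* A = Pi.single i 1 := by
      ext j
      simp only [vecMul, dotProduct, hr, hA, Matrix.of_apply, sub_mul, Finset.sum_sub_distrib,
        ite_mul, zero_mul, Finset.sum_ite_eq, Finset.mem_univ, if_true, Pi.single_apply]
      have h2 : ∑ z : Λ, M.lam i z * M.green z j = ∑ z ∈ M.nbrs i, M.lam i z * M.green z j := by
        rw [Finset.sum_coe_sort Λ fun z => M.lam i z * M.green z j]
        refine (Finset.sum_subset hi fun z _ hz => ?_).symm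
        rw [mem_nbrs, not_not] at hz
        rw [hz, zero_mul]
      rw [h2, heq]
      simp only [Subtype.coe_inj, eq_comm]
    have h2 : r = Pi.single i 1 ᵥ* Q := by
      rw [← h1, vecMul_vecMul, hAQ, vecMul_one]
    intro j
    have := congrFun h2 j
    rw [single_one_vecMul] at this
    exact this.symm
  have hoff : ∀ x y, x ≠ y → Q x y ≤ 0 := by
    intro x y hxy
    set k : Λ → ℝ := fun w => Q w y with hk
    have hAk : A *ᵥ k = Pi.single y 1 := by
      ext w
      have := congrFun (congrFun hAQ w) y
      rw [Matrix.one_apply] at this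
      rw [Pi.single_apply, ← this]
      rfl
    have h0 := hmin k (fun i => by
      rw [hAk, Pi.single_apply]
      split_ifs <;> norm_num) ⟨x⟩
    have h1 := hlap_in k x
    rw [hpotA, hAk, Pi.single_eq_of_ne hxy, mul_zero, zero_sub] at h1
    have : k x ≤ 0 := by
      rw [← h1, neg_nonpos]
      exact Finset.sum_nonneg fun z _ => mul_nonneg (M.lam_nonneg _ _) (h0 z)
    exact this
  have hst : Stieltjes Q := by
    refine ⟨hQsymm, hoff, fun f hf => ?_⟩
    have hQu : Q *ᵥ (A *ᵥ fun _ => 1) = fun _ => 1 := by rw [mulVec_mulVec, hQA, one_mulVec]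
    obtain ⟨i0, -⟩ := Function.ne_iff.1 hf
    refine form_pos_of_supersolution hQsymm hoff (u := A *ᵥ fun _ => 1) (fun x => ?_)
      (fun x => by rw [hQu]; exact one_pos) hf
    simp only [mulVec, dotProduct, mul_one]
    exact Finset.sum_pos (fun j _ => hg _ _) ⟨i0, Finset.mem_univ _⟩
  refine ⟨Q, hst, fun i j => ?_, hrow⟩
  have h1 : Q * gk Q Finset.univ = 1 := by
    ext x y
    have := hst.mulVec_gk _ (Finset.mem_univ x) (Finset.mem_univ y)
    rw [Matrix.mul_apply, Matrix.one_apply]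
    simpa [Matrix.mulVec, dotProduct] using this
  have h2 : gk Q Finset.univ = A := by
    rw [← Matrix.one_mul (gk Q Finset.univ), ← hAQ, Matrix.mul_assoc, h1, Matrix.mul_one]
  rw [h2]
  rfl

end WGraph

end GraphGreen

section GraphRegular

namespace WGraph

variable {M : WGraph}

lemma green_diag_le_of_pair {g : M.V → M.V → ℝ} {x y : M.V}
    {Q : Matrix ({x, y} : Finset M.V) ({x, y} : Finset M.V) ℝ} (hQ : Stieltjes Q)
    (hG : ∀ i j, gk Q Finset.univ i j = g i j) (hsymm : g x y = g y x) :
    2 * g x y ≤ g x x + g y y := by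
  set i : ({x, y} : Finset M.V) := ⟨x, by simp⟩
  set j : ({x, y} : Finset M.V) := ⟨y, by simp⟩
  have h := hQ.gk_form_nonneg Finset.univ (Pi.single i 1 - Pi.single j 1)
  simp only [Matrix.mulVec_sub, sub_dotProduct, dotProduct_sub, single_dotProduct,
    Matrix.mulVec_single_one, Matrix.col_apply, hG, one_mul] at h
  simp only [i, j] at h
  linarith

/-- The standing assumptions imply uniform regularity. -/
lemma exists_regular (hS : M.Standing) (hν : 1 ≤ M.ν) : ∃ c C, M.Regular c C := by
  obtain ⟨-, ⟨cV, hcV, CV, hCV, hV⟩, cG, hcG, CG, hCG, hGd, hGo⟩ := hS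
  have hν0 : 0 < M.ν := by linarith
  have hg : ∀ x y, 0 < M.green x y := fun x y => by
    by_cases hxy : x = y
    · rw [hxy]
      exact hcG.trans_le (hGd y).1
    · exact (mul_pos hcG (Real.rpow_pos_of_pos (M.d_pos x y hxy) _)).trans_le (hGo x y hxy).1
  have hpos : ∀ x, 0 < M.lamTot x := fun x => by
    refine lt_of_le_of_ne (M.lamTot_nonneg x) fun h => ?_
    have := hg x x
    rw [green, ← h, div_zero] at this
    exact lt_irrefl _ this
  have hsum : ∀ x y, Summable fun n => M.pstep n x y := fun x y => by
    by_contra h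
    have := hg x y
    rw [green, tsum_eq_zero_of_not_summable h, zero_div] at this
    exact lt_irrefl _ this
  have hsymm := green_comm hpos
  have heq := green_equation hpos hsum
  have hball1 : ∀ x r, 1 ≤ r → (M.ball x r).Finite := by
    intro x r hr
    by_contra h
    have h1 : ∑ᶠ y ∈ M.ball x r, M.lamTot y = 0 := by
      refine finsum_mem_eq_zero_of_infinite ?_
      have : Function.support M.lamTot = Set.univ := by
        ext y
        simp [(hpos y).ne']
      rw [this, Set.inter_univ]
      exact h
    have h2 := (hV x r hr).1
    rw [h1] at h2
    exact absurd (mul_pos hcV (Real.rpow_pos_of_pos (by linarith) M.α)) (not_lt.2 h2)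
  have hball : ∀ x r, (M.ball x r).Finite := fun x r =>
    (hball1 x (max 1 r) (le_max_left _ _)).subset fun y hy =>
      (show M.d x y ≤ r from hy).trans (le_max_right _ _)
  have hfsum : ∀ x r, ∑ᶠ y ∈ M.ball x r, M.lamTot y = ∑ y ∈ (hball x r).toFinset, M.lamTot y :=
    fun x r => finsum_mem_eq_finite_toFinset_sum _ _
  have hlam_le : ∀ x, M.lamTot x ≤ CV := by
    intro x
    have h1 := (hV x 1 le_rfl).2
    rw [Real.one_rpow, mul_one, hfsum] at h1
    refine le_trans (Finset.single_le_sum (f := M.lamTot) (fun y _ => (hpos y).le) ?_) h1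
    simp [ball, M.d_self]
  have hlam_ge : ∀ x, CG⁻¹ ≤ M.lamTot x := by
    intro x
    rw [inv_le_comm₀ hCG (hpos x)]
    refine le_trans ?_ (hGd x).2
    rw [green, inv_eq_one_div]
    refine div_le_div_of_nonneg_right ?_ (hpos x).le
    have := (hsum x x).le_tsum 0 fun n _ => M.pstep_nonneg n x x
    simpa [pstep] using this
  have hfin := fun y ε (hε : 0 < ε) =>
    finite_green_ge hν hball hCG (fun x y h => (hGo x y h).2) y hε
  have hgle : ∀ x y, M.green x y ≤ CG := by
    intro x y
    by_cases hxy : x = y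
    · rw [hxy]
      exact (hGd y).2
    · obtain ⟨Q, hQ, hG, -⟩ := exists_stieltjes hg hsymm heq hfin {x, y}
      have := green_diag_le_of_pair hQ hG (hsymm x y)
      linarith [(hGd x).2, (hGd y).2]
  obtain ⟨c₀, hc₀, hctrl⟩ := M.ctrl
  have hinv : ∀ {a b t : ℝ}, 0 < a → 0 < b → 0 < t → a * t ^ (-M.ν) ≤ b →
      (a / b) ^ (M.ν⁻¹) ≤ t := by
    intro a b t ha hb ht h
    rw [Real.rpow_inv_le_iff_of_pos (by positivity) ht.le hν0, div_le_iff₀ hb]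
    rw [Real.rpow_neg ht.le, ← div_eq_mul_inv, div_le_iff₀ (Real.rpow_pos_of_pos ht _)] at h
    linarith
  have hinv' : ∀ {a b t : ℝ}, 0 < a → 0 < b → 0 < t → b ≤ a * t ^ (-M.ν) →
      t ≤ (a / b) ^ (M.ν⁻¹) := by
    intro a b t ha hb ht h
    rw [Real.le_rpow_inv_iff_of_pos ht.le (by positivity) hν0, le_div_iff₀ hb]
    rw [Real.rpow_neg ht.le, ← div_eq_mul_inv, le_div_iff₀ (Real.rpow_pos_of_pos ht _)] at h
    linarith
  have hdge : ∀ x y, x ≠ y → (cG / CG) ^ (M.ν⁻¹) ≤ M.d x y := fun x y hxy =>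
    hinv hcG hCG (M.d_pos x y hxy) ((hGo x y hxy).1.trans (hgle x y))
  have hdle : ∀ x y, M.lam x y ≠ 0 → M.d x y ≤ (CG / (c₀ * cG)) ^ (M.ν⁻¹) := by
    intro x y hl
    by_cases hxy : x = y
    · rw [hxy, M.d_self]
      positivity
    have hl' : 0 < M.lam x y := lt_of_le_of_ne (M.lam_nonneg x y) (Ne.symm hl)
    refine hinv' hCG (by positivity) (M.d_pos x y hxy) (le_trans ?_ (hGo x y hxy).2)
    have h1 := heq x y
    rw [if_neg hxy, sub_eq_zero] at h1
    have h2 : M.lam x y * M.green y y ≤ M.lamTot x * M.green x y := by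
      rw [h1]
      exact Finset.single_le_sum (f := fun z => M.lam x z * M.green z y)
        (fun z _ => mul_nonneg (M.lam_nonneg _ _) (hg _ _).le) (M.mem_nbrs.2 hl)
    have h3 : c₀ * M.lamTot x ≤ M.lam x y := hctrl x y hl'
    have h4 : M.lamTot x * (c₀ * cG) ≤ M.lamTot x * M.green x y := by
      refine le_trans ?_ h2
      calc M.lamTot x * (c₀ * cG) = c₀ * M.lamTot x * cG := by ring
        _ ≤ _ := mul_le_mul h3 (hGd y).1 hcG.le hl'.le
    exact le_of_mul_le_mul_left h4 (hpos x)
  have hcard : ∀ x r, ((M.ball x r).ncard : ℝ) = ∑ y ∈ (hball x r).toFinset, (1 : ℝ) := by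
    intro x r
    rw [Set.ncard_eq_toFinset_card _ (hball x r)]
    simp
  set c := min 1 (min cG (min ((cG / CG) ^ (M.ν⁻¹)) (cV / CV))) with hc
  set C := max 1 (max CG (max ((CG / (c₀ * cG)) ^ (M.ν⁻¹)) (max CV (CV * CG)))) with hC
  have c1 : c ≤ 1 := min_le_left _ _
  have c2 : c ≤ cG := (min_le_right _ _).trans (min_le_left _ _)
  have c3 : c ≤ (cG / CG) ^ (M.ν⁻¹) :=
    (min_le_right _ _).trans ((min_le_right _ _).trans (min_le_left _ _))
  have c4 : c ≤ cV / CV := (min_le_right _ _).trans ((min_le_right _ _).trans (min_le_right _ _))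
  have C1 : 1 ≤ C := le_max_left _ _
  have C2 : CG ≤ C := (le_max_left _ _).trans (le_max_right _ _)
  have C3 : (CG / (c₀ * cG)) ^ (M.ν⁻¹) ≤ C :=
    (le_max_left _ _).trans ((le_max_right _ _).trans (le_max_right _ _))
  have C4' : max CV (CV * CG) ≤ C :=
    (le_max_right _ _).trans ((le_max_right _ _).trans (le_max_right _ _))
  have C4 : CV ≤ C := (le_max_left _ _).trans C4'
  have C5 : CV * CG ≤ C := (le_max_right _ _).trans C4'
  refine ⟨c, C, ?_, c1, C1, hpos, hball, ?_, ?_, fun x => c2.trans (hGd x).1,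
    fun x y => (hgle x y).trans C2, ?_, ?_, fun x y h => c3.trans (hdge x y h),
    fun x y h => (hdle x y h).trans C3, hsymm, heq, ?_⟩
  · have : 0 < (cG / CG) ^ (M.ν⁻¹) := Real.rpow_pos_of_pos (by positivity) _
    have : 0 < cV / CV := by positivity
    simp only [hc, lt_min_iff]
    exact ⟨one_pos, hcG, ‹_›, ‹_›⟩
  · intro x r hr
    have hr0 : 0 < r ^ M.α := Real.rpow_pos_of_pos (by linarith) _
    have h1 := (hV x r hr).1
    rw [hfsum] at h1
    have h2 : ∑ y ∈ (hball x r).toFinset, M.lamTot y ≤ CV * (M.ball x r).ncard := by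
      rw [hcard, Finset.mul_sum]
      exact Finset.sum_le_sum fun y _ => by simpa using hlam_le y
    calc c * r ^ M.α ≤ cV / CV * r ^ M.α := by gcongr
      _ = cV * r ^ M.α / CV := by ring
      _ ≤ _ := by
        rw [div_le_iff₀ hCV]
        linarith
  · intro x r hr
    have hr0 : 0 < r ^ M.α := Real.rpow_pos_of_pos (by linarith) _
    have h1 := (hV x r hr).2
    rw [hfsum] at h1
    have h2 : CG⁻¹ * (M.ball x r).ncard ≤ ∑ y ∈ (hball x r).toFinset, M.lamTot y := by
      rw [hcard, Finset.mul_sum]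
      exact Finset.sum_le_sum fun y _ => by simpa using hlam_ge y
    have h3 := h2.trans h1
    rw [inv_mul_le_iff₀ hCG] at h3
    calc _ ≤ CG * (CV * r ^ M.α) := h3
      _ = CV * CG * r ^ M.α := by ring
      _ ≤ _ := by gcongr
  · intro x y h
    refine le_trans ?_ (hGo x y h).1
    have := Real.rpow_nonneg (M.d_pos x y h).le (-M.ν)
    gcongr
  · intro x y h
    refine (hGo x y h).2.trans ?_
    have := Real.rpow_nonneg (M.d_pos x y h).le (-M.ν)
    gcongr
  · intro x y
    refine le_trans ?_ ((hlam_le x).trans C4)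
    by_cases hxy : M.lam x y = 0
    · rw [hxy]
      exact M.lamTot_nonneg x
    rw [lamTot_eq_sum]
    exact Finset.single_le_sum (fun z _ => M.lam_nonneg x z) (M.mem_nbrs.2 hxy)

/-- Inverse Green matrix on a finite set in the regular setting. -/
lemma Regular.exists_stieltjes {c C : ℝ} (h : M.Regular c C) (hν : 1 ≤ M.ν) (Λ : Finset M.V) :
    ∃ Q : Matrix Λ Λ ℝ, Stieltjes Q ∧ (∀ i j, gk Q Finset.univ i j = M.green i j) ∧
      ∀ i : Λ, M.nbrs i ⊆ Λ → ∀ j : Λ, Q i j = (if i = j then M.lamTot i else 0) - M.lam i j :=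
  WGraph.exists_stieltjes h.green_pos h.green_symm h.equation
    (fun y ε hε => finite_green_ge hν h.ball_finite (by linarith [h.C_ge])
      h.green_le_rpow y hε) Λ

end WGraph

end GraphRegular

section ModelReduction

open Matrix

lemma exists_isBond {ι : Type*} [Fintype ι] [DecidableEq ι] {Q : Matrix ι ι ℝ} (hQ : Stieltjes Q)
    (r : ι → ℕ) (hr : Function.Injective r) :
    IsBond Q fun e => if r e.1 < r e.2 then -2 * Q e.1 e.2 else 0 := by
  refine ⟨fun e => ?_, fun x => by simp, fun x y hxy => ?_⟩
  · split_ifs with h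
    · have := hQ.off e.1 e.2 (fun h' => by rw [h'] at h; exact lt_irrefl _ h)
      linarith
    · exact le_rfl
  · rcases lt_trichotomy (r x) (r y) with h | h | h
    · simp [h, h.not_gt]
    · exact absurd (hr h) hxy
    · simp [h, h.not_gt, hQ.symm y x]

namespace Model

variable (M : Model)

instance : IsProbabilityMeasure M.P := M.Pprob

/-- Opening probability of the edge `e` at level `0` given the field. -/
def openProb (φ : M.V → ℝ) (e : M.V × M.V) : ℝ :=
  1 - Real.exp (-(2 * M.lam e.1 e.2 * max (φ e.1) 0 * max (φ e.2) 0))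

lemma openProb_nonneg (φ : M.V → ℝ) (e : M.V × M.V) : 0 ≤ M.openProb φ e := by
  have h : 0 ≤ 2 * M.lam e.1 e.2 * max (φ e.1) 0 * max (φ e.2) 0 :=
    mul_nonneg (mul_nonneg (mul_nonneg zero_le_two (M.lam_nonneg _ _)) (le_max_right _ _))
      (le_max_right _ _)
  exact sub_nonneg.2 (exp_le_one_iff.2 (neg_nonpos.2 h))

lemma openProb_le_one (φ : M.V → ℝ) (e : M.V × M.V) : M.openProb φ e ≤ 1 :=
  sub_le_self _ (exp_pos _).le

lemma map_eq_gaussLaw (Λ : Finset M.V) {Q : Matrix Λ Λ ℝ} (hQ : Stieltjes Q)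
    (hG : ∀ i j, gk Q Finset.univ i j = M.green i j) :
    M.P.map (fun ω (i : Λ) => M.φ ω i) = gaussLaw Q := by
  refine hQ.map_eq_gaussLaw (measurable_pi_lambda _ fun i => M.φ_meas i) fun c => ?_
  have h := M.φ_gauss Λ fun v => if hv : v ∈ Λ then c ⟨v, hv⟩ else 0
  have h1 : ∀ ω, ∑ x ∈ Λ, (if hv : x ∈ Λ then c ⟨x, hv⟩ else 0) * M.φ ω x =
      c ⬝ᵥ fun i : Λ => M.φ ω i := fun ω => by
    rw [← Finset.sum_coe_sort Λ, dotProduct]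
    exact Finset.sum_congr rfl fun i _ => by simp
  have h2 : ∑ x ∈ Λ, ∑ y ∈ Λ, (if hv : x ∈ Λ then c ⟨x, hv⟩ else 0) *
      (if hv : y ∈ Λ then c ⟨y, hv⟩ else 0) * M.green x y =
      c ⬝ᵥ (gk Q Finset.univ *ᵥ c) := by
    rw [← Finset.sum_coe_sort Λ, dotProduct]
    refine Finset.sum_congr rfl fun i _ => ?_
    rw [← Finset.sum_coe_sort Λ, Matrix.mulVec, dotProduct, Finset.mul_sum]
    refine Finset.sum_congr rfl fun j _ => ?_
    simp only [Finset.coe_mem, dite_true, Subtype.coe_eta, hG]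
    ring
  simp only [h1, h2] at h
  exact h

lemma prob_open_eq {Λ : Finset M.V} (r : Λ → ℕ) (E ω₀ : Finset (Λ × Λ))
    (hE : ∀ e ∈ E, r e.1 < r e.2) (hω : ω₀ ⊆ E) :
    M.P {ω | E.filter (fun e : Λ × Λ => M.opn 0 ω e.1 e.2) = ω₀} ≤
      ∫⁻ ω, ENNReal.ofReal ((∏ e ∈ ω₀, M.openProb (M.φ ω) (e.1, e.2)) *
        ∏ e ∈ E \ ω₀, (1 - M.openProb (M.φ ω) (e.1, e.2))) ∂M.P := by
  set f : Λ × Λ ↪ M.V × M.V :=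
    (Function.Embedding.subtype _).prodMap (Function.Embedding.subtype _) with hf
  have hf1 : ∀ e, f e = (e.1.1, e.2.1) := fun e => rfl
  have h := M.opn_law 0 (ω₀.map f) ((E \ ω₀).map f)
    ((Finset.disjoint_map f).2 Finset.disjoint_sdiff) ?_ Set.univ MeasurableSet.univ
  · simp only [Set.mem_univ, Set.ofPred_true, Set.univ_inter, Measure.restrict_univ,
      Finset.prod_map, hf1, sub_zero, Finset.forall_mem_map] at h
    have hp : ∀ (ω) (e : Λ × Λ), 1 - M.openProb (M.φ ω) (e.1, e.2) =
        Real.exp (-(2 * M.lam e.1 e.2 * max (M.φ ω e.1) 0 * max (M.φ ω e.2) 0)) :=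
      fun ω e => by simp [openProb]
    simp only [hp]
    refine le_trans (measure_mono fun ω hω' => ?_) h.le
    simp only [Set.mem_ofPred_eq] at hω' ⊢
    subst hω'
    refine ⟨fun e he => (Finset.mem_filter.1 he).2, fun e he hop => ?_⟩
    rw [Finset.mem_sdiff] at he
    exact he.2 (Finset.mem_filter.2 ⟨he.1, hop⟩)
  · rw [← Finset.map_union, Finset.union_sdiff_of_subset hω]
    simp only [Finset.forall_mem_map]
    intro e he e' he' _ hsw
    rw [hf1, hf1, Prod.swap_prod_mk, Prod.mk.injEq] at hsw
    have h1 := hE e he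
    rw [Subtype.ext hsw.1, Subtype.ext hsw.2] at h1
    exact lt_asymm h1 (hE e' he')

lemma exists_bondConn_of_conn {Λ : Finset M.V} {r : Λ → ℕ} (hr : Function.Injective r)
    {E : Finset (Λ × Λ)} (hE : ∀ e : Λ × Λ, e ∈ E ↔
      r e.1 < r e.2 ∧ (M.nbrs e.1 ⊆ Λ ∨ M.nbrs e.2 ⊆ Λ))
    (x : Λ) {R : ℝ} (hR : 0 ≤ R) (hinner : ∀ y, M.d x y ≤ R → M.nbrs y ⊆ Λ)
    {F : Finset Λ} (hF : ∀ y : Λ, R < M.d x y → y ∈ F) {ω : M.Ω} (hω : ω ∈ M.armEvent x R) :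
    ∃ b ∈ F, bondConn (E.filter fun e : Λ × Λ => M.opn 0 ω e.1 e.2) x b := by
  obtain ⟨y, hy, hxy⟩ := hω
  have key : ∀ y, M.conn 0 ω x y →
      (∃ b ∈ F, bondConn (E.filter fun e : Λ × Λ => M.opn 0 ω e.1 e.2) x b) ∨
        ∃ hy : y ∈ Λ, M.d x y ≤ R ∧
          bondConn (E.filter fun e : Λ × Λ => M.opn 0 ω e.1 e.2) x ⟨y, hy⟩ := by
    intro y h
    induction h with
    | refl => exact Or.inr ⟨x.2, by rw [M.d_self]; exact hR, Relation.ReflTransGen.refl⟩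
    | @tail u v _ huv ih =>
      rcases ih with ih | ⟨hu, hud, huc⟩
      · exact Or.inl ih
      · have hlam := M.opn_edge _ _ _ _ huv
        have hv : v ∈ Λ := hinner u hud (M.mem_nbrs.2 hlam.ne')
        have hc : bondConn (E.filter fun e : Λ × Λ => M.opn 0 ω e.1 e.2) x ⟨v, hv⟩ := by
          rcases lt_trichotomy (r ⟨u, hu⟩) (r ⟨v, hv⟩) with h | h | h
          · exact huc.tail (Or.inl (Finset.mem_filter.2
              ⟨(hE (⟨u, hu⟩, ⟨v, hv⟩)).2 ⟨h, Or.inl (hinner u hud)⟩, huv⟩))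
          · have := hr h
            rw [← this]; exact huc
          · exact huc.tail (Or.inr (Finset.mem_filter.2
              ⟨(hE (⟨v, hv⟩, ⟨u, hu⟩)).2 ⟨h, Or.inr (hinner u hud)⟩, M.opn_symm _ _ _ _ huv⟩))
        by_cases hvd : M.d x v ≤ R
        · exact Or.inr ⟨hv, hvd, hc⟩
        · exact Or.inl ⟨_, hF ⟨v, hv⟩ (not_le.1 hvd), hc⟩
  rcases key y hxy with h | ⟨_, h, _⟩
  · exact h
  · exact absurd hy (not_lt.2 h)

theorem prob_armEvent_le (Λ : Finset M.V) {Q : Matrix Λ Λ ℝ} (hQ : Stieltjes Q)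
    (hG : ∀ i j, gk Q Finset.univ i j = M.green i j)
    (hloc : ∀ i : Λ, M.nbrs i ⊆ Λ → ∀ j : Λ,
      Q i j = (if i = j then M.lamTot i else 0) - M.lam i j)
    (x z : Λ) {R : ℝ} (hR : 0 ≤ R) (hinner : ∀ y, M.d x y ≤ R → M.nbrs y ⊆ Λ)
    (F : Finset Λ) (hF : ∀ y : Λ, R < M.d x y → y ∈ F)
    {s ε D : ℝ} (hs : 0 < s) (hε : 0 < ε)
    (hD : ∀ b ∈ F, ∀ c : Finset Λ → ℝ, (∀ K, 0 ≤ c K) →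
      (∀ A : Finset Λ, ∑ K, (if Disjoint K A then c K else 0) ≤ gk Q Aᶜ x b) →
      ∑ K, (if gk Q Finset.univ z z - gk Q Kᶜ z z < s then c K else 0) ≤ D) :
    M.prob (M.armEvent x R) ≤
      4 * M.green x z / √(s * M.green x x) + ε / √(M.green x x) +
        ∑ b ∈ F, (ε / √(M.green b b) + D / ε ^ 2) := by
  obtain ⟨r, hr⟩ : ∃ r : Λ → ℕ, Function.Injective r :=
    ⟨fun i => Fintype.equivFin Λ i, fun i j h => (Fintype.equivFin Λ).injective (Fin.ext h)⟩
  set a : Λ × Λ → ℝ := fun e => if r e.1 < r e.2 then -2 * Q e.1 e.2 else 0 with ha_def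
  have ha : IsBond Q a := exists_isBond hQ r hr
  set E : Finset (Λ × Λ) := Finset.univ.filter fun e =>
    r e.1 < r e.2 ∧ (M.nbrs e.1 ⊆ Λ ∨ M.nbrs e.2 ⊆ Λ) with hE_def
  have hE : ∀ e : Λ × Λ, e ∈ E ↔ r e.1 < r e.2 ∧ (M.nbrs e.1 ⊆ Λ ∨ M.nbrs e.2 ⊆ Λ) := by
    simp [hE_def]
  set S := E.powerset.filter fun ω => ∃ b ∈ F, bondConn ω x b with hS_def
  set H : (Λ → ℝ) → ℝ := fun φ => ∑ ω, if ∃ b ∈ F, bondConn ω x b then bondWt a φ ω else 0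
    with hH_def
  have hH0 : ∀ φ, 0 ≤ H φ := fun φ => Finset.sum_nonneg fun ω _ => by
    split_ifs
    exacts [bondWt_nonneg ha.nonneg φ ω, le_rfl]
  have hHc : Continuous H := continuous_finsetSum _ fun ω _ => by
    split_ifs
    exacts [continuous_bondWt a ω, continuous_const]
  have hpt : ∀ ω, ∑ ω₀ ∈ S, ((∏ e ∈ ω₀, M.openProb (M.φ ω) (e.1, e.2)) *
      ∏ e ∈ E \ ω₀, (1 - M.openProb (M.φ ω) (e.1, e.2))) ≤ H fun i : Λ => M.φ ω i := by
    intro ω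
    rw [hS_def, Finset.sum_filter]
    refine sum_conn_le_sum_bondWt E ha.nonneg (fun i : Λ => M.φ ω i)
      (fun e => M.openProb (M.φ ω) (e.1, e.2)) (fun e => M.openProb_nonneg _ _) ?_ x F
    intro e he
    obtain ⟨h1, h2⟩ := (hE e).1 he
    have hne : e.1 ≠ e.2 := fun h' => by rw [h'] at h1; exact lt_irrefl _ h1
    have hQe : Q e.1 e.2 = -M.lam e.1 e.2 := by
      rcases h2 with h2 | h2
      · rw [hloc _ h2, if_neg hne, zero_sub]
      · rw [hQ.symm, hloc _ h2, if_neg hne.symm, zero_sub, M.lam_symm]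
    have hmax : max (M.φ ω e.1 * M.φ ω e.2) 0 ≥ max (M.φ ω e.1) 0 * max (M.φ ω e.2) 0 := by
      rcases le_total (M.φ ω e.1) 0 with h3 | h3
      · rw [max_eq_right h3, zero_mul]; exact le_max_right _ _
      rcases le_total (M.φ ω e.2) 0 with h4 | h4
      · rw [max_eq_right h4, mul_zero]; exact le_max_right _ _
      · rw [max_eq_left h3, max_eq_left h4]; exact le_max_left _ _
    simp only [openProb, bondClosed, ha_def, if_pos h1, hQe]
    refine sub_le_sub_left (exp_le_exp.2 (neg_le_neg ?_)) 1
    have := mul_le_mul_of_nonneg_left hmax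
      (mul_nonneg zero_le_two (M.lam_nonneg e.1 e.2))
    linarith
  have hprob : M.P (M.armEvent x R) ≤ ENNReal.ofReal (∫ φ, H φ ∂gaussLaw Q) := by
    have := hQ.isProbabilityMeasure_gaussLaw
    calc M.P (M.armEvent x R)
        ≤ M.P (⋃ ω₀ ∈ S, {ω | E.filter (fun e : Λ × Λ => M.opn 0 ω e.1 e.2) = ω₀}) := by
          refine measure_mono fun ω hω => ?_
          have := M.exists_bondConn_of_conn hr hE x hR hinner hF hω
          simp only [Set.mem_iUnion, Set.mem_ofPred_eq]
          exact ⟨_, Finset.mem_filter.2 ⟨Finset.mem_powerset.2 (Finset.filter_subset _ _), this⟩,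
            rfl⟩
      _ ≤ ∑ ω₀ ∈ S, M.P {ω | E.filter (fun e : Λ × Λ => M.opn 0 ω e.1 e.2) = ω₀} :=
          measure_biUnion_finset_le _ _
      _ ≤ ∑ ω₀ ∈ S, ∫⁻ ω, ENNReal.ofReal ((∏ e ∈ ω₀, M.openProb (M.φ ω) (e.1, e.2)) *
            ∏ e ∈ E \ ω₀, (1 - M.openProb (M.φ ω) (e.1, e.2))) ∂M.P :=
          Finset.sum_le_sum fun ω₀ h => M.prob_open_eq r E ω₀ (fun e he => ((hE e).1 he).1)
            (Finset.mem_powerset.1 (Finset.mem_filter.1 h).1)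
      _ = ∫⁻ ω, ∑ ω₀ ∈ S, ENNReal.ofReal ((∏ e ∈ ω₀, M.openProb (M.φ ω) (e.1, e.2)) *
            ∏ e ∈ E \ ω₀, (1 - M.openProb (M.φ ω) (e.1, e.2))) ∂M.P := by
          refine (lintegral_finsetSum _ fun ω₀ _ => ?_).symm
          have := M.φ_meas
          simp only [openProb]
          fun_prop
      _ ≤ ∫⁻ ω, ENNReal.ofReal (H fun i : Λ => M.φ ω i) ∂M.P := by
          refine lintegral_mono fun ω => ?_
          rw [← ENNReal.ofReal_sum_of_nonneg]
          · exact ENNReal.ofReal_le_ofReal (hpt ω)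
          · exact fun ω₀ _ => mul_nonneg (Finset.prod_nonneg fun e _ => M.openProb_nonneg _ _)
              (Finset.prod_nonneg fun e _ => sub_nonneg.2 (M.openProb_le_one _ _))
      _ = ∫⁻ φ, ENNReal.ofReal (H φ) ∂gaussLaw Q := by
          rw [← M.map_eq_gaussLaw Λ hQ hG, lintegral_map hHc.measurable.ennreal_ofReal
            (measurable_pi_lambda _ fun i => M.φ_meas i)]
      _ = ENNReal.ofReal (∫ φ, H φ ∂gaussLaw Q) := by
          refine (ofReal_integral_eq_lintegral_ofReal ?_ (Eventually.of_forall hH0)).symm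
          refine Integrable.of_bound hHc.aestronglyMeasurable 1 (Eventually.of_forall fun φ => ?_)
          rw [Real.norm_eq_abs, abs_of_nonneg (hH0 φ), ← sum_bondWt a φ]
          refine Finset.sum_le_sum fun ω _ => ?_
          split_ifs
          exacts [le_rfl, bondWt_nonneg ha.nonneg φ ω]
  have hZ := hQ.integral_gaussDens_pos
  have hmain := hQ.sum_conn_le ha x z F hs hε hD
  have hinner' : ∀ ω, Integrable fun φ => jointWt Q a ω φ := fun ω => by
    simpa using hQ.integrable_mul_jointWt ha (ExpGrowth.const 1) ω
  have hHint : ∫ φ, H φ * gaussDens Q φ =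
      ∑ ω, if ∃ b ∈ F, bondConn ω x b then ∫ φ, jointWt Q a ω φ else 0 := by
    simp only [hH_def, Finset.sum_mul]
    rw [integral_finsetSum]
    · refine Finset.sum_congr rfl fun ω _ => ?_
      split_ifs
      · exact integral_congr_ae (Eventually.of_forall fun φ => mul_comm _ _)
      · simp
    · intro ω _
      split_ifs
      · exact (hinner' ω).congr (Eventually.of_forall fun φ => mul_comm _ _)
      · simp
  rw [← hHint] at hmain
  simp only [hG] at hmain
  calc M.prob (M.armEvent x R) ≤ ∫ φ, H φ ∂gaussLaw Q :=
        ENNReal.toReal_le_of_le_ofReal (integral_nonneg hH0) hprob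
    _ ≤ _ := by
        rw [hQ.integral_gaussLaw, div_le_iff₀ hZ]
        exact hmain

end Model

end ModelReduction

section GreenSums

namespace WGraph.Regular

variable {M : WGraph} {c C : ℝ}

/-- The ball `B(x,r)` as a finset. -/
def ballF (h : M.Regular c C) (x : M.V) (r : ℝ) : Finset M.V := (h.ball_finite x r).toFinset

variable (h : M.Regular c C)

include h in
lemma C_pos : 0 < C := one_pos.trans_le h.C_ge

@[simp]
lemma mem_ballF {x y : M.V} {r : ℝ} : y ∈ h.ballF x r ↔ M.d x y ≤ r := by
  simp [ballF, WGraph.ball]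

lemma card_ballF_le (x : M.V) {r : ℝ} (hr : 1 ≤ r) : ((h.ballF x r).card : ℝ) ≤ C * r ^ M.α := by
  rw [ballF, ← Set.ncard_eq_toFinset_card _ (h.ball_finite x r)]
  exact h.card_ball_le x r hr

lemma card_ballF_ge (x : M.V) {r : ℝ} (hr : 1 ≤ r) : c * r ^ M.α ≤ (h.ballF x r).card := by
  rw [ballF, ← Set.ncard_eq_toFinset_card _ (h.ball_finite x r)]
  exact h.card_ball_ge x r hr

lemma sum_rpow_dyadic_le {s : ℝ} (hs : 0 ≤ s) (y : M.V) (k : ℕ) :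
    ∑ u ∈ (h.ballF y (2 ^ k * (c / 2))).erase y, M.d y u ^ (-s) ≤
      C * (c / 2) ^ (-s) * ∑ i ∈ Finset.range k, ((2 : ℝ) ^ (M.α - s)) ^ i := by
  have hc := h.c_pos
  induction k with
  | zero =>
    rw [Finset.sum_eq_zero]
    · simp
    · intro u hu
      rw [Finset.mem_erase, h.mem_ballF] at hu
      have := h.d_ge y u hu.1.symm
      linarith
  | succ k ih =>
    have hsplit : (h.ballF y (2 ^ (k + 1) * (c / 2))).erase y ⊆
        (h.ballF y (2 ^ k * (c / 2))).erase y ∪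
          (h.ballF y (2 ^ (k + 1) * (c / 2))).filter fun u => 2 ^ k * (c / 2) < M.d y u := by
      intro u hu
      rw [Finset.mem_erase, h.mem_ballF] at hu
      rw [Finset.mem_union, Finset.mem_erase, h.mem_ballF, Finset.mem_filter, h.mem_ballF]
      rcases le_or_gt (M.d y u) (2 ^ k * (c / 2)) with h1 | h1
      exacts [Or.inl ⟨hu.1, h1⟩, Or.inr ⟨hu.2, h1⟩]
    have hd0 : ∀ u, 0 ≤ M.d y u := fun u => by
      by_cases hu : y = u
      · rw [← hu, M.d_self]
      · exact (M.d_pos y u hu).le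
    have hpos : 0 < 2 ^ k * (c / 2) := by positivity
    have hshell : ∑ u ∈ (h.ballF y (2 ^ (k + 1) * (c / 2))).filter
        (fun u => 2 ^ k * (c / 2) < M.d y u), M.d y u ^ (-s) ≤
        C * (c / 2) ^ (-s) * ((2 : ℝ) ^ (M.α - s)) ^ k := by
      calc _ ≤ ∑ _u ∈ (h.ballF y (2 ^ (k + 1) * (c / 2))).filter
            (fun u => 2 ^ k * (c / 2) < M.d y u), (2 ^ k * (c / 2)) ^ (-s) := by
            refine Finset.sum_le_sum fun u hu => ?_
            exact Real.rpow_le_rpow_of_nonpos hpos (Finset.mem_filter.1 hu).2.le (by linarith)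
        _ ≤ ∑ _u ∈ h.ballF y (2 ^ k), (2 ^ k * (c / 2)) ^ (-s) := by
            refine Finset.sum_le_sum_of_subset_of_nonneg (fun u hu => ?_)
              fun _ _ _ => by positivity
            have h1 := (Finset.mem_filter.1 hu).1
            rw [h.mem_ballF] at h1 ⊢
            refine h1.trans ?_
            have : (0 : ℝ) < 2 ^ k := by positivity
            rw [pow_succ]
            nlinarith [h.c_le]
        _ ≤ C * ((2 : ℝ) ^ k) ^ M.α * (2 ^ k * (c / 2)) ^ (-s) := by
            rw [Finset.sum_const, nsmul_eq_mul]
            exact mul_le_mul_of_nonneg_right (h.card_ballF_le y (one_le_pow₀ one_le_two))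
              (by positivity)
        _ = C * (c / 2) ^ (-s) * ((2 : ℝ) ^ (M.α - s)) ^ k := by
            rw [Real.mul_rpow (by positivity) (by positivity), ← Real.rpow_natCast,
              ← Real.rpow_natCast, ← Real.rpow_mul two_pos.le, ← Real.rpow_mul two_pos.le,
              ← Real.rpow_mul two_pos.le, show (M.α - s) * (k : ℝ) = k * M.α + k * (-s) by ring,
              Real.rpow_add two_pos]
            ring
    have hnn : ∀ u, 0 ≤ M.d y u ^ (-s) := fun u => Real.rpow_nonneg (hd0 u) _
    calc _ ≤ _ := Finset.sum_le_sum_of_subset_of_nonneg hsplit fun _ _ _ => hnn _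
      _ ≤ _ := le_add_of_nonneg_right (Finset.sum_nonneg fun _ _ => hnn _)
      _ = _ := Finset.sum_union_inter
      _ ≤ _ := by
        rw [Finset.sum_range_succ, mul_add]
        exact add_le_add ih hshell

include h in
lemma exists_dyadic {r : ℝ} (hr : 1 ≤ r) : ∃ k : ℕ, r ≤ 2 ^ k * (c / 2) ∧ 2 ^ k * c ≤ 4 * r := by
  have hc := h.c_pos
  have h1 : 1 ≤ 2 * r / c := by
    rw [le_div_iff₀ hc]; linarith [h.c_le]
  obtain ⟨n, hn1, hn2⟩ := exists_nat_pow_near h1 one_lt_two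
  refine ⟨n + 1, ?_, ?_⟩
  · rw [div_lt_iff₀ hc] at hn2
    linarith
  · rw [le_div_iff₀ hc] at hn1
    rw [pow_succ]
    linarith

include h in
lemma exists_sum_rpow_le {s : ℝ} (hs : 0 ≤ s) (hsα : s < M.α) : ∃ A, 1 ≤ A ∧ ∀ (y : M.V) (r : ℝ),
    1 ≤ r → ∑ u ∈ (h.ballF y r).erase y, M.d y u ^ (-s) ≤ A * r ^ (M.α - s) := by
  have hc := h.c_pos
  set q : ℝ := 2 ^ (M.α - s) with hq
  have hq1 : 1 < q := Real.one_lt_rpow one_lt_two (sub_pos.2 hsα)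
  set A := C * (c / 2) ^ (-s) * ((4 / c) ^ (M.α - s) / (q - 1)) with hA
  refine ⟨max 1 A, le_max_left _ _, fun y r hr => ?_⟩
  obtain ⟨k, hk1, hk2⟩ := h.exists_dyadic hr
  have hr0 : 0 < r := one_pos.trans_le hr
  have hd0 : ∀ u, 0 ≤ M.d y u := fun u => by
    by_cases hu : y = u
    · rw [← hu, M.d_self]
    · exact (M.d_pos y u hu).le
  have hgeom : ∑ i ∈ Finset.range k, q ^ i ≤ (4 / c) ^ (M.α - s) / (q - 1) * r ^ (M.α - s) := by
    rw [geom_sum_eq hq1.ne', div_mul_eq_mul_div]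
    refine div_le_div_of_nonneg_right ?_ (sub_pos.2 hq1).le
    rw [← Real.mul_rpow (by positivity) hr0.le, hq, ← Real.rpow_natCast, ← Real.rpow_mul two_pos.le,
      mul_comm (M.α - s), Real.rpow_mul two_pos.le, Real.rpow_natCast]
    have : ((2 : ℝ) ^ k) ^ (M.α - s) ≤ (4 / c * r) ^ (M.α - s) := by
      refine Real.rpow_le_rpow (by positivity) ?_ (sub_pos.2 hsα).le
      rw [div_mul_eq_mul_div, le_div_iff₀ hc]
      exact hk2
    linarith
  calc _ ≤ ∑ u ∈ (h.ballF y (2 ^ k * (c / 2))).erase y, M.d y u ^ (-s) := by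
        refine Finset.sum_le_sum_of_subset_of_nonneg (Finset.erase_subset_erase _ fun u hu => ?_)
          fun _ _ _ => Real.rpow_nonneg (hd0 _) _
        rw [h.mem_ballF] at hu ⊢
        exact hu.trans hk1
    _ ≤ _ := h.sum_rpow_dyadic_le hs y k
    _ ≤ C * (c / 2) ^ (-s) * ((4 / c) ^ (M.α - s) / (q - 1) * r ^ (M.α - s)) :=
        mul_le_mul_of_nonneg_left hgeom (mul_nonneg h.C_pos.le (by positivity))
    _ = A * r ^ (M.α - s) := by rw [hA]; ring
    _ ≤ _ := mul_le_mul_of_nonneg_right (le_max_right _ _) (by positivity)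

include h in
lemma exists_sum_rpow_le_log (hα : 0 ≤ M.α) : ∃ A, 1 ≤ A ∧ ∀ (y : M.V) (r : ℝ),
    1 ≤ r → ∑ u ∈ (h.ballF y r).erase y, M.d y u ^ (-M.α) ≤ A * (1 + Real.log r) := by
  have hc := h.c_pos
  have hl2 : 0 < Real.log 2 := Real.log_pos one_lt_two
  set B := (1 + |Real.log (4 / c)|) / Real.log 2 with hB
  set A := C * (c / 2) ^ (-M.α) * B with hA
  refine ⟨max 1 A, le_max_left _ _, fun y r hr => ?_⟩
  obtain ⟨k, hk1, hk2⟩ := h.exists_dyadic hr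
  have hr0 : 0 < r := one_pos.trans_le hr
  have hlr : 0 ≤ Real.log r := Real.log_nonneg hr
  have hd0 : ∀ u, 0 ≤ M.d y u := fun u => by
    by_cases hu : y = u
    · rw [← hu, M.d_self]
    · exact (M.d_pos y u hu).le
  have hk : (k : ℝ) ≤ B * (1 + Real.log r) := by
    have h1 : (2 : ℝ) ^ k ≤ 4 / c * r := by
      rw [div_mul_eq_mul_div, le_div_iff₀ hc]; exact hk2
    have h2 := Real.log_le_log (by positivity) h1
    rw [Real.log_pow, Real.log_mul (by positivity) hr0.ne'] at h2
    rw [hB, div_mul_eq_mul_div, le_div_iff₀ hl2]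
    nlinarith [le_abs_self (Real.log (4 / c)), abs_nonneg (Real.log (4 / c))]
  calc _ ≤ ∑ u ∈ (h.ballF y (2 ^ k * (c / 2))).erase y, M.d y u ^ (-M.α) := by
        refine Finset.sum_le_sum_of_subset_of_nonneg (Finset.erase_subset_erase _ fun u hu => ?_)
          fun _ _ _ => Real.rpow_nonneg (hd0 _) _
        rw [h.mem_ballF] at hu ⊢
        exact hu.trans hk1
    _ ≤ _ := h.sum_rpow_dyadic_le hα y k
    _ = C * (c / 2) ^ (-M.α) * k := by simp
    _ ≤ C * (c / 2) ^ (-M.α) * (B * (1 + Real.log r)) :=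
        mul_le_mul_of_nonneg_left hk (mul_nonneg h.C_pos.le (by positivity))
    _ = A * (1 + Real.log r) := by rw [hA]; ring
    _ ≤ _ := mul_le_mul_of_nonneg_right (le_max_right _ _) (by positivity)

lemma sum_green_sq_le (y : M.V) {r : ℝ} (hr : 0 ≤ r) :
    ∑ u ∈ h.ballF y r, M.green y u ^ 2 ≤
      C ^ 2 * (1 + ∑ u ∈ (h.ballF y r).erase y, M.d y u ^ (-(2 * M.ν))) := by
  have hy : y ∈ h.ballF y r := by rw [h.mem_ballF, M.d_self]; exact hr
  rw [← Finset.add_sum_erase _ _ hy, mul_add, mul_one, Finset.mul_sum]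
  refine add_le_add (pow_le_pow_left₀ (h.green_pos y y).le (h.green_le y y) 2)
    (Finset.sum_le_sum fun u hu => ?_)
  have hyu := (Finset.ne_of_mem_erase hu).symm
  have h1 := pow_le_pow_left₀ (h.green_pos y u).le (h.green_le_rpow y u hyu) 2
  refine h1.trans_eq ?_
  rw [mul_pow, ← Real.rpow_natCast (M.d y u ^ (-M.ν)), ← Real.rpow_mul (M.d_pos y u hyu).le]
  norm_num
  left
  ring_nf

include h in
lemma exists_sum_green_sq_le (hν : 1 ≤ M.ν) (hνα : M.ν < M.α / 2) :
    ∃ A, 1 ≤ A ∧ ∀ (y : M.V) (r : ℝ), 1 ≤ r →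
      ∑ u ∈ h.ballF y r, M.green y u ^ 2 ≤ A * r ^ (M.α - 2 * M.ν) := by
  obtain ⟨A, hA, hsum⟩ := h.exists_sum_rpow_le (s := 2 * M.ν) (by linarith) (by linarith)
  have hC := h.C_ge
  refine ⟨C ^ 2 * (1 + A), by nlinarith, fun y r hr => (h.sum_green_sq_le y (by linarith)).trans ?_⟩
  rw [mul_assoc]
  refine mul_le_mul_of_nonneg_left ?_ (sq_nonneg C)
  have h1 : 1 ≤ r ^ (M.α - 2 * M.ν) := Real.one_le_rpow hr (by linarith)
  linarith [hsum y r hr]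

include h in
lemma exists_sum_green_sq_le_log (hν : 1 ≤ M.ν) (hνα : M.ν = M.α / 2) :
    ∃ A, 1 ≤ A ∧ ∀ (y : M.V) (r : ℝ), 1 ≤ r →
      ∑ u ∈ h.ballF y r, M.green y u ^ 2 ≤ A * (1 + Real.log r) := by
  obtain ⟨A, hA, hsum⟩ := h.exists_sum_rpow_le_log (by linarith)
  have hC := h.C_ge
  refine ⟨C ^ 2 * (1 + A), by nlinarith, fun y r hr => (h.sum_green_sq_le y (by linarith)).trans ?_⟩
  rw [mul_assoc, show 2 * M.ν = M.α by linarith]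
  refine mul_le_mul_of_nonneg_left ?_ (sq_nonneg C)
  have h1 := Real.log_nonneg hr
  linarith [hsum y r hr]

end WGraph.Regular

end GreenSums

section LayerHitting

open Matrix

namespace WGraph.Regular

variable {M : WGraph} {c C : ℝ}

/-- `Q` is the inverse of the Green matrix on `Λ`, local at the interior vertices. -/
structure Local (M : WGraph) (Λ : Finset M.V) (Q : Matrix Λ Λ ℝ) : Prop where
  stieltjes : Stieltjes Q
  green : ∀ i j, gk Q Finset.univ i j = M.green i j
  loc : ∀ i : Λ, M.nbrs i ⊆ Λ → ∀ j : Λ, Q i j = (if i = j then M.lamTot i else 0) - M.lam i j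

lemma Local.row_sum {Λ : Finset M.V} {Q : Matrix Λ Λ ℝ} (hl : Local M Λ Q) {i : Λ}
    (hi : M.nbrs i ⊆ Λ) : ∑ j, Q i j = 0 := by
  simp only [hl.loc i hi, Finset.sum_sub_distrib, Finset.sum_ite_eq, Finset.mem_univ, if_true]
  rw [M.lamTot_eq_sum, Finset.sum_coe_sort Λ fun j => M.lam i j, sub_eq_zero]
  refine Finset.sum_subset hi fun y _ hy => ?_
  rw [M.mem_nbrs, not_not] at hy
  exact hy

variable (h : M.Regular c C)

include h in
lemma rpow_scale {η : ℝ} (hν : 1 ≤ M.ν) (hη : η = c / (4 * C)) {L : ℝ} (hL : 0 < L) :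
    2 * (C * (2 ^ M.ν * L ^ (-M.ν))) ≤ c * (η * L) ^ (-M.ν) := by
  have hc := h.c_pos
  have hC := h.C_pos
  have hη0 : 0 < η := by rw [hη]; positivity
  have h1 : (2 : ℝ) ^ M.ν * (2 * C / c) ≤ η ^ (-M.ν) := by
    have e : η⁻¹ = 2 * (2 * C / c) := by rw [hη, inv_div]; ring
    rw [Real.rpow_neg hη0.le, ← Real.inv_rpow hη0.le, e, Real.mul_rpow two_pos.le (by positivity)]
    refine mul_le_mul_of_nonneg_left ?_ (by positivity)
    refine Real.self_le_rpow_of_one_le ?_ hν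
    rw [le_div_iff₀ hc]
    linarith [h.c_le, h.C_ge]
  rw [Real.mul_rpow hη0.le hL.le]
  have h2 := mul_le_mul_of_nonneg_left h1 hc.le
  have h3 : c * (2 ^ M.ν * (2 * C / c)) = 2 * C * 2 ^ M.ν := by field_simp
  rw [h3] at h2
  calc _ = 2 * C * 2 ^ M.ν * L ^ (-M.ν) := by ring
    _ ≤ c * η ^ (-M.ν) * L ^ (-M.ν) := mul_le_mul_of_nonneg_right h2 (by positivity)
    _ = _ := by ring

lemma annulus_card_ge {η δ : ℝ} (hα : 1 ≤ M.α) (hη0 : 0 < η) (hδ : δ = η * (c / (2 * C)))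
    (x : M.V) {L : ℝ} (hL : 1 ≤ δ * L) :
    c / 2 * η ^ M.α * L ^ M.α ≤ (h.ballF x (η * L) \ h.ballF x (δ * L)).card := by
  have hc := h.c_pos
  have hC := h.C_pos
  have hcC : c / (2 * C) ≤ 1 := by
    rw [div_le_one (by positivity)]; linarith [h.c_le, h.C_ge]
  have hδ0 : 0 < δ := by rw [hδ]; positivity
  have hL0 : 0 < L := pos_of_mul_pos_right (one_pos.trans_le hL) hδ0.le
  have hδη : δ ≤ η := by rw [hδ]; exact mul_le_of_le_one_right hη0.le hcC
  have h1 := h.card_ballF_ge x (hL.trans (mul_le_mul_of_nonneg_right hδη hL0.le))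
  have h2 := h.card_ballF_le x hL
  have h3 : ((h.ballF x (η * L)).card : ℝ) ≤
      (h.ballF x (η * L) \ h.ballF x (δ * L)).card + (h.ballF x (δ * L)).card := by
    exact_mod_cast Finset.card_le_card_sdiff_add_card
  have h4 : C * (δ * L) ^ M.α ≤ c / 2 * η ^ M.α * L ^ M.α := by
    have h5 : (c / (2 * C)) ^ M.α ≤ c / (2 * C) := by
      have := Real.rpow_le_rpow_of_exponent_ge (show 0 < c / (2 * C) by positivity) hcC hα
      rwa [Real.rpow_one] at this
    rw [Real.mul_rpow hδ0.le hL0.le, hδ, Real.mul_rpow hη0.le (by positivity)]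
    calc C * (η ^ M.α * (c / (2 * C)) ^ M.α * L ^ M.α)
        ≤ C * (η ^ M.α * (c / (2 * C)) * L ^ M.α) := by gcongr
      _ = _ := by field_simp
  rw [Real.mul_rpow hη0.le hL0.le] at h1
  linarith

section OneLayer

variable {Λ : Finset M.V} {Q : Matrix Λ Λ ℝ} (hl : Local M Λ Q)

include h hl

lemma one_sub_singleton (z y : Λ) :
    1 - gk Q {y}ᶜ z z / gk Q Finset.univ z z =
      M.green z y ^ 2 / (M.green y y * M.green z z) := by
  have h1 := hl.stieltjes.gk_sub_singleton Finset.univ (Finset.mem_univ z) (Finset.mem_univ y)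
  rw [← Finset.compl_eq_univ_sdiff] at h1
  have hz := h.green_pos z z
  have hy := h.green_pos y y
  rw [hl.green z z, hl.green z y, hl.green y y] at h1
  rw [hl.green z z]
  field_simp at h1 ⊢
  linarith

lemma hit_singleton_bounds {z y : Λ} {γ κ : ℝ} (hγ : 0 < γ)
    (h1 : γ ≤ M.green z y) (h2 : M.green z y ≤ κ * γ) :
    γ ^ 2 / C ^ 2 ≤ 1 - gk Q {y}ᶜ z z / gk Q Finset.univ z z ∧
      1 - gk Q {y}ᶜ z z / gk Q Finset.univ z z ≤ (κ * γ) ^ 2 / c ^ 2 := by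
  have hc := h.c_pos
  rw [h.one_sub_singleton hl]
  have hyy := h.green_self_ge y
  have hzz := h.green_self_ge z
  have hyy' := h.green_le y y
  have hzz' := h.green_le z z
  have hg := h.green_pos z y
  constructor
  · have : M.green y y * M.green z z ≤ C ^ 2 := by
      rw [sq]; exact mul_le_mul hyy' hzz' (hc.le.trans hzz) h.C_pos.le
    exact div_le_div₀ (by positivity) (pow_le_pow_left₀ hγ.le h1 2)
      (mul_pos (h.green_pos _ _) (h.green_pos _ _)) this
  · have : c ^ 2 ≤ M.green y y * M.green z z := by
      rw [sq]; exact mul_le_mul hyy hzz hc.le (h.green_pos _ _).le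
    exact div_le_div₀ (by positivity) (pow_le_pow_left₀ hg.le h2 2) (by positivity) this

lemma hit_pair_le {z y y' : Λ} {γ κ : ℝ} (hγ : 0 < γ) (h1 : γ ≤ M.green z y)
    (h2 : M.green z y ≤ κ * γ) (h2' : M.green z y' ≤ κ * γ) :
    1 - gk Q {y}ᶜ z z / gk Q Finset.univ z z - gk Q {y'}ᶜ z z / gk Q Finset.univ z z +
      gk Q ({y, y'} : Finset Λ)ᶜ z z / gk Q Finset.univ z z ≤
      4 * (κ * γ) ^ 2 / c ^ 3 * M.green y y' := by
  have hc := h.c_pos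
  have hgz := h.green_pos z z
  have hg := h.green_pos y y'
  have hzc := h.green_self_ge z
  by_cases hyy : 2 * M.green y y' ^ 2 ≤ M.green y y * M.green y' y'
  · have h3 := hl.stieltjes.gk_pair_le (z := z) (v := y) (v' := y') (by
      rw [hl.green, hl.green, hl.green]; exact hyy)
    have e : 1 - gk Q {y}ᶜ z z / gk Q Finset.univ z z - gk Q {y'}ᶜ z z / gk Q Finset.univ z z +
        gk Q ({y, y'} : Finset Λ)ᶜ z z / gk Q Finset.univ z z =
        (gk Q Finset.univ z z - gk Q {y}ᶜ z z - gk Q {y'}ᶜ z z +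
          gk Q ({y, y'} : Finset Λ)ᶜ z z) / gk Q Finset.univ z z := by
      rw [hl.green z z]; field_simp
    rw [e]
    simp only [hl.green] at h3 ⊢
    have h5 : M.green z y * M.green z y' ≤ (κ * γ) ^ 2 := by
      rw [sq]; exact mul_le_mul h2 h2' (h.green_pos _ _).le ((h.green_pos _ _).le.trans h2)
    have h6 : c ^ 2 ≤ M.green y y * M.green y' y' := by
      rw [sq]; exact mul_le_mul (h.green_self_ge _) (h.green_self_ge _) hc.le (h.green_pos _ _).le
    rw [div_le_iff₀ hgz]
    refine h3.trans ?_
    calc 4 * M.green z y * M.green z y' * M.green y y' / (M.green y y * M.green y' y')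
        ≤ 4 * (κ * γ) ^ 2 * M.green y y' / c ^ 2 := by
          refine div_le_div₀ (by positivity) ?_ (by positivity) h6
          have := mul_le_mul_of_nonneg_right h5 hg.le
          linarith
      _ = 4 * (κ * γ) ^ 2 / c ^ 3 * M.green y y' * c := by field_simp
      _ ≤ _ := mul_le_mul_of_nonneg_left hzc (by positivity)
  · rw [not_le] at hyy
    have h3 : c / 2 ≤ M.green y y' := by
      have h6 : c ^ 2 ≤ M.green y y * M.green y' y' := by
        rw [sq]
        exact mul_le_mul (h.green_self_ge _) (h.green_self_ge _) hc.le (h.green_pos _ _).le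
      nlinarith
    have h4 : gk Q ({y, y'} : Finset Λ)ᶜ z z ≤ gk Q {y'}ᶜ z z :=
      hl.stieltjes.gk_mono (Finset.compl_subset_compl.2 (by simp)) z z
    have h5 : gk Q ({y, y'} : Finset Λ)ᶜ z z / gk Q Finset.univ z z ≤
        gk Q {y'}ᶜ z z / gk Q Finset.univ z z := by
      rw [hl.green z z]; exact div_le_div_of_nonneg_right h4 hgz.le
    have h7 := (h.hit_singleton_bounds hl hγ h1 h2).2
    have h8 : (κ * γ) ^ 2 / c ^ 2 ≤ 4 * (κ * γ) ^ 2 / c ^ 3 * M.green y y' := by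
      calc (κ * γ) ^ 2 / c ^ 2 ≤ 2 * ((κ * γ) ^ 2 / c ^ 2) := by
            have : 0 ≤ (κ * γ) ^ 2 / c ^ 2 := by positivity
            linarith
        _ = 4 * (κ * γ) ^ 2 / c ^ 3 * (c / 2) := by field_simp; ring
        _ ≤ _ := mul_le_mul_of_nonneg_left h3 (by positivity)
    linarith

end OneLayer

end WGraph.Regular

end LayerHitting

section LayerEstimate

open Matrix

namespace WGraph.Regular

variable {M : WGraph} {c C : ℝ} (h : M.Regular c C) {Λ : Finset M.V} {Q : Matrix Λ Λ ℝ}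

section Ball

variable (hl : Local M Λ Q) {x : Λ} {L : ℝ} (hinner : ∀ y, M.d x y ≤ L → y ∈ Λ ∧ M.nbrs y ⊆ Λ)

include h hl hinner

lemma le_gk_ball {η : ℝ} (hν : 1 ≤ M.ν) (hη : η = c / (4 * C)) (hL : 0 < L) {y : Λ} (hxy : x ≠ y)
    (hy : M.d x y ≤ η * L) :
    L ^ (-M.ν) ≤ gk Q (Finset.univ.filter fun u : Λ => M.d x u ≤ L) x y := by
  have hc := h.c_pos
  have hC := h.C_pos
  have hη1 : η ≤ 1 / 4 := by
    rw [hη, div_le_div_iff₀ (by positivity) (by norm_num)]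
    linarith [h.c_le, h.C_ge]
  have hyL : M.d x y ≤ L / 2 := by nlinarith
  have hxy' : (x : M.V) ≠ y := fun e => hxy (Subtype.ext e)
  have h1 := hl.stieltjes.sub_le_gk (Finset.univ.filter fun u : Λ => M.d x u ≤ L)
    (fun u hu => hl.row_sum (hinner u (by simpa using hu)).2) (x := x) (v := y)
    (by simpa [M.d_self] using hL.le) (by simp; linarith) (M := C * (2 ^ M.ν * L ^ (-M.ν)))
    (fun u hu => by
      simp only [Finset.mem_filter, Finset.mem_univ, true_and, not_le] at hu
      have h2 : L / 2 ≤ M.d u y := by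
        have := M.d_triangle x y u
        rw [M.d_symm y u] at this
        linarith
      have h3 : (u : M.V) ≠ y := fun e => by
        rw [e, M.d_self] at h2; linarith
      rw [hl.green]
      refine (h.green_le_rpow _ _ h3).trans (mul_le_mul_of_nonneg_left ?_ hC.le)
      refine (Real.rpow_le_rpow_of_nonpos (by positivity) h2 (by linarith)).trans_eq ?_
      rw [Real.div_rpow hL.le two_pos.le, Real.rpow_neg two_pos.le, div_inv_eq_mul, mul_comm])
  rw [hl.green] at h1
  have h2 := h.rpow_scale hν hη hL
  have h3 : c * (η * L) ^ (-M.ν) ≤ M.green x y := by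
    refine le_trans (mul_le_mul_of_nonneg_left ?_ hc.le) (h.green_ge_rpow _ _ hxy')
    exact Real.rpow_le_rpow_of_nonpos (M.d_pos _ _ hxy') hy (by linarith)
  have h4 : L ^ (-M.ν) ≤ C * (2 ^ M.ν * L ^ (-M.ν)) := by
    have h5 : (1 : ℝ) ≤ 2 ^ M.ν := Real.one_le_rpow (by norm_num) (by linarith)
    have h6 : 0 ≤ L ^ (-M.ν) := by positivity
    nlinarith [mul_le_mul h.C_ge h5 zero_le_one hC.le]
  linarith

end Ball

omit h in
lemma second_moment_ratio {a b d C v N γ : ℝ} (ha : a ≠ 0) (hb : b ≠ 0) (hd : d ≠ 0) (hC : C ≠ 0)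
    (hv : v ≠ 0) (hN : N ≠ 0) (hγ : γ ≠ 0) (K ℓ : ℝ) :
    (a * (N * v * γ ^ 2 / C ^ 2)) ^ 2 / (2 * (C * (d * a)) * (v * (N ^ 2 * γ ^ 4 * K * ℓ *
      (b * a)))) = v / b / (2 * C ^ 5 * d * K) / ℓ := by
  field_simp

include h in
lemma sum_green_le {ℓ L : ℝ} (hℓ : 1 ≤ ℓ) (hL : 1 ≤ L)
    (hsq : ∀ y, ∑ u ∈ h.ballF y L, M.green y u ^ 2 ≤ ℓ * L ^ (M.α - 2 * M.ν)) (y : M.V)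
    {T : Finset M.V} (hT : T ⊆ h.ballF y L) :
    ∑ u ∈ T, M.green y u ≤ C * ℓ * L ^ (M.α - M.ν) := by
  have hL0 : 0 < L := one_pos.trans_le hL
  have hC := h.C_pos
  refine abs_le_of_sq_le_sq' ?_ (by positivity) |>.2
  have hcard : (T.card : ℝ) ≤ C * L ^ M.α :=
    (Nat.cast_le.2 (Finset.card_le_card hT)).trans (h.card_ballF_le y hL)
  have hT2 : ∑ u ∈ T, M.green y u ^ 2 ≤ ℓ * L ^ (M.α - 2 * M.ν) :=
    (Finset.sum_le_sum_of_subset_of_nonneg hT fun _ _ _ => sq_nonneg _).trans (hsq y)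
  have e : L ^ M.α * L ^ (M.α - 2 * M.ν) = (L ^ (M.α - M.ν)) ^ 2 := by
    rw [← Real.rpow_natCast, ← Real.rpow_mul hL0.le, ← Real.rpow_add hL0]; congr 1; push_cast; ring
  calc (∑ u ∈ T, M.green y u) ^ 2 ≤ T.card * ∑ u ∈ T, M.green y u ^ 2 :=
        sq_sum_le_card_mul_sum_sq
    _ ≤ (C * L ^ M.α) * (ℓ * L ^ (M.α - 2 * M.ν)) :=
        mul_le_mul hcard hT2 (Finset.sum_nonneg fun _ _ => sq_nonneg _) (by positivity)
    _ = C * ℓ * (L ^ (M.α - M.ν)) ^ 2 := by rw [← e]; ring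
    _ ≤ (C * ℓ) ^ 2 * (L ^ (M.α - M.ν)) ^ 2 := by
        have := mul_le_mul h.C_ge hℓ zero_le_one hC.le
        refine mul_le_mul_of_nonneg_right ?_ (by positivity)
        nlinarith
    _ = _ := by ring

include h in
lemma layer_energy_le (hl : Local M Λ Q) {z : Λ} {γ κ ℓ L : ℝ} (hγ : 0 < γ)
    (hℓ : 1 ≤ ℓ) (hL : 1 ≤ L)
    (hsq : ∀ y, ∑ u ∈ h.ballF y L, M.green y u ^ 2 ≤ ℓ * L ^ (M.α - 2 * M.ν)) {N : ℕ}
    (hN : L ^ (-M.ν) / γ ^ 2 ≤ N) (W W' : Finset Λ)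
    (hW' : ∀ y ∈ W', γ ≤ M.green z y ∧ M.green z y ≤ κ * γ)
    (hd : ∀ y ∈ W', ∀ y' ∈ W', M.d y y' ≤ L) :
    (∑ y ∈ W', ∑ y' ∈ W', gk Q W y y' *
      (N * (1 - gk Q {y}ᶜ z z / gk Q Finset.univ z z - gk Q {y'}ᶜ z z / gk Q Finset.univ z z +
        gk Q ({y, y'} : Finset Λ)ᶜ z z / gk Q Finset.univ z z) +
      N ^ 2 * ((1 - gk Q {y}ᶜ z z / gk Q Finset.univ z z) *
        (1 - gk Q {y'}ᶜ z z / gk Q Finset.univ z z)))) ≤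
      W'.card * (N ^ 2 * γ ^ 4 * (4 * κ ^ 2 / c ^ 3 + C * κ ^ 4 / c ^ 4) * ℓ *
        L ^ (M.α - M.ν)) := by
  have hc := h.c_pos
  have hC := h.C_pos
  have hL0 : 0 < L := one_pos.trans_le hL
  have hNγ : 1 ≤ N * γ ^ 2 * L ^ M.ν := by
    rw [div_le_iff₀ (by positivity), Real.rpow_neg hL0.le, inv_le_iff_one_le_mul₀ (by positivity)]
      at hN
    linarith
  rw [← nsmul_eq_mul]
  refine Finset.sum_le_card_nsmul _ _ _ fun y hy => ?_
  have hT : (W'.map (Function.Embedding.subtype _)) ⊆ h.ballF y L := by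
    intro u hu
    obtain ⟨w, hw, rfl⟩ := Finset.mem_map.1 hu
    exact (h.mem_ballF).2 (hd y hy w hw)
  have h1 : ∑ y' ∈ W', M.green y y' ≤ C * ℓ * L ^ (M.α - M.ν) := by
    have := h.sum_green_le hℓ hL hsq y hT
    rwa [Finset.sum_map] at this
  have h2 : ∑ y' ∈ W', M.green y y' ^ 2 ≤ ℓ * L ^ (M.α - 2 * M.ν) := by
    refine le_trans ?_ (hsq y)
    refine le_trans (le_of_eq ?_)
      (Finset.sum_le_sum_of_subset_of_nonneg hT fun _ _ _ => sq_nonneg _)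
    rw [Finset.sum_map]
    rfl
  have h3 : ∀ y' ∈ W', gk Q W y y' *
      (N * (1 - gk Q {y}ᶜ z z / gk Q Finset.univ z z - gk Q {y'}ᶜ z z / gk Q Finset.univ z z +
        gk Q ({y, y'} : Finset Λ)ᶜ z z / gk Q Finset.univ z z) +
      N ^ 2 * ((1 - gk Q {y}ᶜ z z / gk Q Finset.univ z z) *
        (1 - gk Q {y'}ᶜ z z / gk Q Finset.univ z z))) ≤
      N * (4 * (κ * γ) ^ 2 / c ^ 3) * M.green y y' ^ 2 +
        N ^ 2 * ((κ * γ) ^ 2 / c ^ 2) ^ 2 * M.green y y' := by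
    intro y' hy'
    have hp := h.hit_pair_le hl hγ (hW' y hy).1 (hW' y hy).2 (hW' y' hy').2
    have ha := h.hit_singleton_bounds hl hγ (hW' y hy).1 (hW' y hy).2
    have hb := h.hit_singleton_bounds hl hγ (hW' y' hy').1 (hW' y' hy').2
    have hg : gk Q W y y' ≤ M.green y y' := by
      rw [← hl.green]; exact hl.stieltjes.gk_mono (Finset.subset_univ _) _ _
    have hb0 : 0 ≤ 1 - gk Q {y'}ᶜ z z / gk Q Finset.univ z z :=
      le_trans (by positivity) hb.1
    have hgp := h.green_pos y y'
    calc _ ≤ gk Q W y y' * (N * (4 * (κ * γ) ^ 2 / c ^ 3 * M.green y y') +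
          N ^ 2 * ((κ * γ) ^ 2 / c ^ 2 * ((κ * γ) ^ 2 / c ^ 2))) := by
          refine mul_le_mul_of_nonneg_left (add_le_add (mul_le_mul_of_nonneg_left hp
            (Nat.cast_nonneg _)) (mul_le_mul_of_nonneg_left (mul_le_mul ha.2 hb.2 hb0
              (by positivity)) (by positivity))) (hl.stieltjes.gk_nonneg _ _ _)
      _ ≤ M.green y y' * (N * (4 * (κ * γ) ^ 2 / c ^ 3 * M.green y y') +
          N ^ 2 * ((κ * γ) ^ 2 / c ^ 2 * ((κ * γ) ^ 2 / c ^ 2))) :=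
          mul_le_mul_of_nonneg_right hg (by positivity)
      _ = _ := by ring
  refine (Finset.sum_le_sum h3).trans ?_
  rw [Finset.sum_add_distrib, ← Finset.mul_sum, ← Finset.mul_sum]
  have e : L ^ (M.α - M.ν) = L ^ M.ν * L ^ (M.α - 2 * M.ν) := by
    rw [← Real.rpow_add hL0]; congr 1; ring
  have hq : 0 ≤ N * (4 * (κ * γ) ^ 2 / c ^ 3) * (ℓ * L ^ (M.α - 2 * M.ν)) := by positivity
  calc _ ≤ N * (4 * (κ * γ) ^ 2 / c ^ 3) * (ℓ * L ^ (M.α - 2 * M.ν)) +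
        N ^ 2 * ((κ * γ) ^ 2 / c ^ 2) ^ 2 * (C * ℓ * L ^ (M.α - M.ν)) := by gcongr
    _ ≤ N * (4 * (κ * γ) ^ 2 / c ^ 3) * (ℓ * L ^ (M.α - 2 * M.ν)) * (N * γ ^ 2 * L ^ M.ν) +
        N ^ 2 * ((κ * γ) ^ 2 / c ^ 2) ^ 2 * (C * ℓ * L ^ (M.α - M.ν)) := by
        exact add_le_add_left (le_mul_of_one_le_right hq hNγ) _
    _ = _ := by rw [e]; ring

set_option maxHeartbeats 800000 in
/-- A layer of independent clusters blocks the walk in each ball with probability bounded below. -/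
lemma exists_layer_hit (hν : 1 ≤ M.ν) (hα : M.ν ≤ M.α / 2) {κ : ℝ} (hκ : 1 ≤ κ) :
    ∃ p₀ : ℝ, 0 < p₀ ∧ p₀ ≤ 1 ∧ ∃ L₀ : ℝ, 1 ≤ L₀ ∧ ∀ (Λ : Finset M.V) (Q : Matrix Λ Λ ℝ),
      Local M Λ Q → ∀ (z : Λ) (γ L ℓ : ℝ), 0 < γ → L₀ ≤ L → 1 ≤ ℓ →
      (∀ y, ∑ u ∈ h.ballF y L, M.green y u ^ 2 ≤ ℓ * L ^ (M.α - 2 * M.ν)) →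
      ∀ N : ℕ, L ^ (-M.ν) / γ ^ 2 ≤ N → ∀ S : Finset Λ,
      (∀ y ∈ S, γ ≤ M.green z y ∧ M.green z y ≤ κ * γ) →
      ∃ (τ : Type) (_ : Fintype τ) (w : τ → ℝ) (B : τ → Finset Λ),
        (∀ t, 0 ≤ w t) ∧ ∑ t, w t = 1 ∧
        (∀ K, Real.exp (-min 1 (N * (1 - gk Q (K ∩ S)ᶜ z z / gk Q Finset.univ z z))) ≤
          ∑ t, if Disjoint (B t) K then w t else 0) ∧
        ∀ x : Λ, (∀ y, M.d x y ≤ L → y ∈ Λ ∧ M.nbrs y ⊆ Λ) →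
          (∀ y : Λ, M.d x y ≤ L / 2 → y ∈ S) → ∀ v : τ → Λ → ℝ,
          (∀ t, ∀ y ∈ (Finset.univ.filter fun u : Λ => M.d x u ≤ L) \ B t, (Q *ᵥ v t) y = 0) →
          (∀ t, ∀ y ∈ B t ∩ (Finset.univ.filter fun u : Λ => M.d x u ≤ L), v t y = 0) →
          (∀ t y, y ∉ (Finset.univ.filter fun u : Λ => M.d x u ≤ L) → v t y = 1) →
          p₀ / ℓ ≤ ∑ t, w t * (1 - v t x) := by
  have hc := h.c_pos
  have hC := h.C_pos
  have hc1 := h.c_le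
  have hC1 := h.C_ge
  obtain ⟨η, hη⟩ : ∃ η, η = c / (4 * C) := ⟨_, rfl⟩
  obtain ⟨δ, hδ⟩ : ∃ δ, δ = η * (c / (2 * C)) := ⟨_, rfl⟩
  obtain ⟨K, hK⟩ : ∃ K, K = 4 * κ ^ 2 / c ^ 3 + C * κ ^ 4 / c ^ 4 := ⟨_, rfl⟩
  have hη0 : 0 < η := by rw [hη]; positivity
  have hη1 : η ≤ 1 / 4 := by
    rw [hη, div_le_div_iff₀ (by positivity) (by norm_num)]; linarith
  have hδ0 : 0 < δ := by rw [hδ]; positivity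
  have hδη : δ ≤ η := by
    rw [hδ]; refine mul_le_of_le_one_right hη0.le ?_
    rw [div_le_one (by positivity)]; linarith
  have hK0 : 0 < K := by rw [hK]; positivity
  refine ⟨min 1 (c / 2 * η ^ M.α / (2 * C ^ 5 * δ ^ (-M.ν) * K)), by positivity, min_le_left _ _,
    1 / δ, by rw [le_div_iff₀ hδ0]; linarith, ?_⟩
  intro Λ Q hl z γ L ℓ hγ hL hℓ hsq N hN S hS
  have hδL : 1 ≤ δ * L := by rwa [div_le_iff₀ hδ0, mul_comm] at hL
  have hL1 : 1 ≤ L := le_trans (by rw [le_div_iff₀ hδ0]; linarith) hL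
  have hL0 : 0 < L := one_pos.trans_le hL1
  obtain ⟨τ, hτ, w, B, hw0, hw1, hexp, hhit⟩ := hl.stieltjes.exists_layer z S N
  refine ⟨τ, hτ, w, B, hw0, hw1, hexp, fun x hinner hxS v hv1 hv2 hv3 => ?_⟩
  obtain ⟨W', hW'⟩ : ∃ W' : Finset Λ,
    W' = Finset.univ.filter fun y : Λ => δ * L < M.d x y ∧ M.d x y ≤ η * L := ⟨_, rfl⟩
  have hmem : ∀ y ∈ W', δ * L < M.d x y ∧ M.d x y ≤ η * L := by simp [hW']
  have hne : ∀ y ∈ W', x ≠ y := fun y hy e => by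
    have := (hmem y hy).1
    rw [e, M.d_self] at this
    linarith
  have hηL : η * L ≤ L / 4 := by nlinarith
  have hWS : W' ⊆ S := fun y hy => hxS y (by linarith [(hmem y hy).2])
  have hcard : (W'.card : ℝ) = (h.ballF x (η * L) \ h.ballF x (δ * L)).card := by
    rw [← Finset.card_map (Function.Embedding.subtype (· ∈ Λ))]
    congr 2
    ext u
    simp only [Finset.mem_map, Finset.mem_sdiff, h.mem_ballF, Function.Embedding.subtype_apply, hW',
      Finset.mem_filter, Finset.mem_univ, true_and, not_le]
    constructor
    · rintro ⟨u, hu, rfl⟩; exact ⟨hu.2, hu.1⟩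
    · rintro ⟨h1, h2⟩
      exact ⟨⟨u, (hinner u (by linarith)).1⟩, ⟨h2, h1⟩, rfl⟩
  have hcge := h.annulus_card_ge (by linarith) hη0 hδ x hδL
  rw [← hcard] at hcge
  have hv0 : (0 : ℝ) < W'.card := lt_of_lt_of_le (by positivity) hcge
  have hN0 : (0 : ℝ) < N := lt_of_lt_of_le (by positivity) hN
  have key := hhit x (Finset.univ.filter fun u : Λ => M.d x u ≤ L) W' v (C * (δ * L) ^ (-M.ν))
    (L ^ (-M.ν)) (N * W'.card * γ ^ 2 / C ^ 2)
    (W'.card * (N ^ 2 * γ ^ 4 * K * ℓ * L ^ (M.α - M.ν)))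
    (by simp [M.d_self, hL0.le])
    (fun y hy => by simp; linarith [(hmem y hy).2]) hWS
    (fun y hy => hl.row_sum (hinner y (by simpa using hy)).2) hv1 hv2 hv3 (by positivity)
    (fun y hy => by
      refine (hl.stieltjes.gk_mono (Finset.subset_univ _) _ _).trans ?_
      rw [hl.green, h.green_symm]
      refine (h.green_le_rpow _ _ fun e => hne y hy (Subtype.ext e)).trans ?_
      refine mul_le_mul_of_nonneg_left ?_ hC.le
      exact Real.rpow_le_rpow_of_nonpos (by positivity) (hmem y hy).1.le (by linarith))
    (by positivity)
    (fun y hy => h.le_gk_ball hl hinner hν hη hL0 (hne y hy) (hmem y hy).2)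
    (by positivity)
    (by
      rw [mul_assoc, mul_div_assoc]
      refine mul_le_mul_of_nonneg_left ?_ hN0.le
      rw [mul_div_assoc, ← nsmul_eq_mul]
      exact Finset.card_nsmul_le_sum _ _ _ fun y hy =>
        (h.hit_singleton_bounds hl hγ (hS y (hWS hy)).1 (hS y (hWS hy)).2).1)
    (by positivity)
    (by
      rw [hK]
      refine h.layer_energy_le hl hγ hℓ hL1 hsq hN _ _
        (fun y hy => hS y (hWS hy)) fun y hy y' hy' => ?_
      have := M.d_triangle y x y'
      rw [M.d_symm y x] at this
      linarith [(hmem y hy).2, (hmem y' hy').2])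
  refine le_trans ?_ key
  have e2 : (L ^ (-M.ν) * (N * W'.card * γ ^ 2 / C ^ 2)) ^ 2 /
      (2 * (C * (δ * L) ^ (-M.ν)) * (W'.card * (N ^ 2 * γ ^ 4 * K * ℓ * L ^ (M.α - M.ν)))) =
      W'.card / L ^ M.α / (2 * C ^ 5 * δ ^ (-M.ν) * K) / ℓ := by
    rw [show M.α - M.ν = M.α + -M.ν by ring, Real.rpow_add hL0, Real.mul_rpow hδ0.le hL0.le]
    exact second_moment_ratio (by positivity) (by positivity) (by positivity) hC.ne' hv0.ne'
      hN0.ne' hγ.ne' _ _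
  rw [e2]
  refine div_le_div_of_nonneg_right ((min_le_right _ _).trans ?_) (by positivity)
  refine div_le_div_of_nonneg_right ?_ (by positivity)
  rwa [le_div_iff₀ (by positivity)]

end WGraph.Regular

end LayerEstimate

section Layers

open Matrix

namespace WGraph.Regular

variable {M : WGraph} {c C : ℝ} (h : M.Regular c C)

/-- A set of small capacity seen from `z` is unlikely to connect `x₀` to a distant `b` when it has
to avoid `n` layers of independent clusters. -/
lemma exists_layered_bound (hν : 1 ≤ M.ν) (hα : M.ν ≤ M.α / 2) {κ : ℝ} (hκ : 1 ≤ κ) :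
    ∃ p₀ : ℝ, 0 < p₀ ∧ p₀ ≤ 1 ∧ ∃ L₀ : ℝ, 1 ≤ L₀ ∧ ∀ (Λ : Finset M.V) (Q : Matrix Λ Λ ℝ),
      Local M Λ Q → ∀ (x₀ z b : Λ) (γ L ℓ H : ℝ) (n : ℕ), 0 < γ → L₀ ≤ L → 1 ≤ ℓ → 0 ≤ H → 0 < n →
      (∀ y, ∑ u ∈ h.ballF y L, M.green y u ^ 2 ≤ ℓ * L ^ (M.α - 2 * M.ν)) →
      (∀ k < n, ∑ l ∈ (Finset.range n).erase k, |(k : ℝ) - l| ^ (-M.ν) ≤ H) →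
      (∀ y, M.d x₀ y ≤ (4 * n + 2) * L → y ∈ Λ ∧ M.nbrs y ⊆ Λ) →
      (∀ y : Λ, M.d x₀ y ≤ (4 * n + 2) * L → γ ≤ M.green z y ∧ M.green z y ≤ κ * γ) →
      (4 * n + 2) * L < M.d x₀ b → ∀ N : ℕ, L ^ (-M.ν) / γ ^ 2 ≤ N →
      ∀ q : Finset Λ → ℝ, (∀ K, 0 ≤ q K) →
      (∀ A, ∑ K, (if Disjoint K A then q K else 0) ≤ gk Q Aᶜ x₀ b) →
      ∑ K, (if gk Q Finset.univ z z - gk Q Kᶜ z z <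
        c * (p₀ / ℓ) * n / (2 * (N * (1 + C ^ 2 * H))) then q K else 0) ≤
        C * Real.exp (-(p₀ / ℓ * n / 2)) := by
  have hc := h.c_pos
  have hC := h.C_pos
  obtain ⟨p₀, hp0, hp1, L₀, hL₀, hlayer⟩ := h.exists_layer_hit hν hα hκ
  refine ⟨p₀, hp0, hp1, max L₀ (2 * C), hL₀.trans (le_max_left _ _), ?_⟩
  intro Λ Q hl x₀ z b γ L ℓ H n hγ hL hℓ hH hn hsq hsum hinner hgz hb N hN q hq0 hq
  have hLC : 2 * C ≤ L := (le_max_right _ _).trans hL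
  have hL0 : 0 < L := by linarith
  have hn1 : (1 : ℝ) ≤ n := by exact_mod_cast hn
  have hN0 : (0 : ℝ) < N := lt_of_lt_of_le (by positivity) hN
  have hp : p₀ / ℓ ≤ 1 := div_le_one_of_le₀ (by linarith) (by linarith)
  have hpp : 0 < p₀ / ℓ := by positivity
  obtain ⟨S, hS⟩ : ∃ S : ℕ → Finset Λ, S = fun j : ℕ => Finset.univ.filter
    fun y : Λ => |M.d x₀ y - 4 * ((n : ℝ) - j) * L| ≤ L := ⟨_, rfl⟩
  have hSmem : ∀ j, ∀ y ∈ S j, |M.d x₀ y - 4 * ((n : ℝ) - j) * L| ≤ L := by simp [hS]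
  have hSd : ∀ j, ∀ y ∈ S j, M.d x₀ y ≤ (4 * n + 2) * L := fun j y hy => by
    have h1 := (abs_le.1 (hSmem j y hy)).2
    have h2 : 0 ≤ (j : ℝ) * L := by positivity
    linarith
  choose τ hτ w B hw0 hw1 hexp hhit using fun j => hlayer Λ Q hl z γ L ℓ hγ
    ((le_max_left _ _).trans hL) hℓ hsq N hN (S j) fun y hy => hgz y (hSd j y hy)
  obtain ⟨T, hT⟩ : ∃ T : ℕ → Finset Λ, T = fun j : ℕ => Finset.univ.filter
    fun y : Λ => j = 0 ∨ M.d x₀ y ≤ 4 * ((n : ℝ) - j + 1) * L := ⟨_, rfl⟩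
  have hTmem : ∀ j y, y ∈ T (j + 1) ↔ M.d x₀ y ≤ 4 * ((n : ℝ) - j) * L := fun j y => by
    simp only [hT, Finset.mem_filter, Finset.mem_univ, true_and, Nat.succ_ne_zero, false_or]
    push_cast
    rw [show (n : ℝ) - (j + 1) + 1 = n - j by ring]
  have hρ : ∀ j : ℕ, 4 * ((n : ℝ) - j) * L ≤ 4 * n * L := fun j => by
    have h2 : 0 ≤ (j : ℝ) * L := by positivity
    linarith
  have hbound := hl.stieltjes.layers_bound (b := b) (x₀ := x₀) (Cg := C) (p := p₀ / ℓ)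
    (fun x => by rw [hl.green]; exact h.green_le _ _) hC.le hp n T τ w hw0 B hw1
    (fun j hj x hx => hl.row_sum (hinner x (by
      have := (hTmem j x).1 hx
      linarith [hρ j])).2)
    (fun j hj hbT => by
      have := (hTmem j b).1 hbT
      linarith [hρ j])
    (fun j hj x hx hx' => by
      obtain ⟨x', hx'T, hQ⟩ := hx'
      rw [hTmem, not_le] at hx
      have hx'd := (hTmem j x').1 hx'T
      have hd : M.d x₀ x ≤ 4 * ((n : ℝ) - j) * L + C := by
        rw [hl.loc x' (hinner x' (by linarith [hρ j])).2, if_neg fun e => by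
          rw [e] at hx'd; linarith, zero_sub, neg_ne_zero] at hQ
        linarith [h.d_le _ _ hQ, M.d_triangle x₀ x' x]
      have hxL : ∀ y, M.d x y ≤ L → M.d x₀ y ≤ 4 * ((n : ℝ) - j) * L + C + L := fun y hy => by
        linarith [M.d_triangle x₀ x y]
      refine ⟨Finset.univ.filter fun u : Λ => M.d x u ≤ L, by simp [M.d_self, hL0.le], ?_, ?_, ?_⟩
      · simp only [Finset.mem_filter, Finset.mem_univ, true_and]
        intro hbd
        linarith [hxL b hbd, hρ j]
      · rintro u hu ⟨y, hy, hQ⟩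
        rcases j with _ | j
        · simp [hT]
        · rw [hTmem]
          simp only [Finset.mem_filter, Finset.mem_univ, true_and] at hu hy
          have hyd := hxL y hy
          rw [hl.loc y (hinner y (by linarith [hρ (j + 1)])).2, if_neg fun e => by
            rw [e] at hy; linarith, zero_sub, neg_ne_zero] at hQ
          have := h.d_le _ _ hQ
          push_cast at hyd
          linarith [M.d_triangle x₀ y u]
      · refine hhit j x (fun y hy => hinner y (by linarith [hxL y hy, hρ j])) fun y hy => ?_
        simp only [hS, Finset.mem_filter, Finset.mem_univ, true_and, abs_le]
        have h1 := M.d_triangle x₀ x y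
        have h2 := M.d_triangle x₀ y x
        rw [M.d_symm y x] at h2
        constructor <;> linarith)
    (by
      obtain ⟨m, rfl⟩ := Nat.exists_eq_succ_of_ne_zero hn.ne'
      rw [Nat.succ_eq_add_one, hTmem, M.d_self]
      push_cast
      linarith)
    q hq
  have hmin : ∀ K : Finset Λ, ∑ k ∈ Finset.range n,
      min 1 (N * (1 - gk Q (K ∩ S k)ᶜ z z / gk Q Finset.univ z z)) ≤
      N * (1 + C ^ 2 * H) * (1 - gk Q Kᶜ z z / gk Q Finset.univ z z) := fun K => by
    refine hl.stieltjes.sum_min_le z hN0 hγ n (fun k => K ∩ S k) (fun k _ v hv => ?_)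
      (fun k l => C * (|(k : ℝ) - l| * L) ^ (-M.ν)) (fun k l => by positivity) ?_ ?_ K
      (fun k _ => Finset.inter_subset_left) (by positivity)
    · rw [hl.green]
      exact (hgz v (hSd k v (Finset.mem_inter.1 hv).2)).1
    · intro k hk l hlt hkl v hv v' hv'
      have h1 := hSmem k v (Finset.mem_inter.1 hv).2
      have h2 := hSmem l v' (Finset.mem_inter.1 hv').2
      have hkl1 : 1 ≤ |(k : ℝ) - l| := by
        have : (1 : ℤ) ≤ |(k : ℤ) - l| := Int.one_le_abs (by omega)
        exact_mod_cast this
      have hd : |(k : ℝ) - l| * L ≤ M.d v v' := by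
        have h3 := M.d_triangle x₀ v v'
        have h4 := M.d_triangle x₀ v' v
        rw [M.d_symm v' v] at h4
        rw [abs_le] at h1 h2
        have h5 : L ≤ |(k : ℝ) - l| * L := le_mul_of_one_le_left hL0.le hkl1
        rcases abs_cases ((k : ℝ) - l) with ⟨e, _⟩ | ⟨e, _⟩ <;> rw [e] at h5 ⊢ <;> linarith
      have hdpos : 0 < |(k : ℝ) - l| * L := by positivity
      rw [hl.green]
      refine (h.green_le_rpow _ _ fun e => ?_).trans (mul_le_mul_of_nonneg_left
        (Real.rpow_le_rpow_of_nonpos hdpos hd (by linarith)) hC.le)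
      rw [e, M.d_self] at hd
      linarith
    · intro k hk
      have hz : gk Q Finset.univ z z ≤ C := by rw [hl.green]; exact h.green_le _ _
      have hz0 : 0 ≤ gk Q Finset.univ z z := hl.stieltjes.gk_nonneg _ _ _
      have hN1 : L ^ (-M.ν) / (N * γ ^ 2) ≤ 1 := by
        rw [div_le_one (by positivity)]
        rwa [div_le_iff₀ (by positivity)] at hN
      have e : ∀ l : ℕ, C * (|(k : ℝ) - l| * L) ^ (-M.ν) * gk Q Finset.univ z z / (N * γ ^ 2) =
          |(k : ℝ) - l| ^ (-M.ν) * (C * gk Q Finset.univ z z * (L ^ (-M.ν) / (N * γ ^ 2))) :=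
        fun l => by rw [Real.mul_rpow (abs_nonneg _) hL0.le]; ring
      rw [Finset.sum_congr rfl fun l _ => e l, ← Finset.sum_mul]
      have h1 : C * gk Q Finset.univ z z * (L ^ (-M.ν) / (N * γ ^ 2)) ≤ C * C * 1 := by gcongr
      have h2 := mul_le_mul (hsum k hk) h1 (by positivity) hH
      linarith
  have hfac : ∀ K : Finset Λ, gk Q Finset.univ z z - gk Q Kᶜ z z <
      c * (p₀ / ℓ) * n / (2 * (N * (1 + C ^ 2 * H))) → Real.exp (-(p₀ / ℓ * n / 2)) ≤
      ∏ j ∈ Finset.range n, ∑ t, if Disjoint (B j t) K then w j t else 0 := fun K hK => by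
    have hz : c ≤ gk Q Finset.univ z z := by rw [hl.green]; exact h.green_self_ge _
    have hz0 := hc.trans_le hz
    have hS0 : 0 < N * (1 + C ^ 2 * H) := by positivity
    calc Real.exp (-(p₀ / ℓ * n / 2)) ≤ Real.exp (-∑ k ∈ Finset.range n,
          min 1 (N * (1 - gk Q (K ∩ S k)ᶜ z z / gk Q Finset.univ z z))) := by
          refine Real.exp_le_exp.2 (neg_le_neg ((hmin K).trans ?_))
          have h1 : 1 - gk Q Kᶜ z z / gk Q Finset.univ z z ≤
              (p₀ / ℓ) * n / (2 * (N * (1 + C ^ 2 * H))) := by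
            rw [one_sub_div hz0.ne', div_le_iff₀ hz0]
            refine hK.le.trans ?_
            calc _ = (p₀ / ℓ) * n / (2 * (N * (1 + C ^ 2 * H))) * c := by ring
              _ ≤ _ := mul_le_mul_of_nonneg_left hz (by positivity)
          refine (mul_le_mul_of_nonneg_left h1 hS0.le).trans_eq ?_
          field_simp
      _ = ∏ j ∈ Finset.range n, Real.exp
          (-min 1 (N * (1 - gk Q (K ∩ S j)ᶜ z z / gk Q Finset.univ z z))) := by
          rw [← Real.exp_sum, Finset.sum_neg_distrib]
      _ ≤ _ := Finset.prod_le_prod (fun _ _ => (Real.exp_pos _).le) fun j _ => hexp j K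
  have hprod : ∀ K : Finset Λ,
      0 ≤ ∏ j ∈ Finset.range n, ∑ t, if Disjoint (B j t) K then w j t else 0 := fun K =>
    Finset.prod_nonneg fun j _ => Finset.sum_nonneg fun t _ => by
      split_ifs
      · exact hw0 j t
      · exact le_rfl
  have hexp1 : (1 - p₀ / ℓ) ^ n ≤ Real.exp (-(p₀ / ℓ * n)) := by
    have h1 := Real.add_one_le_exp (-(p₀ / ℓ))
    calc (1 - p₀ / ℓ) ^ n ≤ Real.exp (-(p₀ / ℓ)) ^ n :=
          pow_le_pow_left₀ (by linarith) (by linarith) n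
      _ = _ := by rw [← Real.exp_nat_mul]; congr 1; ring
  have hE := Real.exp_pos (-(p₀ / ℓ * n / 2))
  refine le_of_mul_le_mul_right ?_ hE
  rw [Finset.sum_mul]
  calc _ ≤ ∑ K, q K * ∏ j ∈ Finset.range n, ∑ t, if Disjoint (B j t) K then w j t else 0 := by
        refine Finset.sum_le_sum fun K _ => ?_
        split_ifs with hK
        · exact mul_le_mul_of_nonneg_left (hfac K hK) (hq0 K)
        · rw [zero_mul]; exact mul_nonneg (hq0 K) (hprod K)
    _ ≤ C * (1 - p₀ / ℓ) ^ n := hbound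
    _ ≤ C * Real.exp (-(p₀ / ℓ * n)) := mul_le_mul_of_nonneg_left hexp1 hC.le
    _ = _ := by rw [mul_assoc, ← Real.exp_add]; congr 2; ring

end WGraph.Regular

end Layers

section ArmBound

open Matrix

lemma sum_abs_sub_rpow_le {ν : ℝ} (hν : 1 ≤ ν) {n k : ℕ} (hk : k < n) :
    ∑ l ∈ (Finset.range n).erase k, |(k : ℝ) - l| ^ (-ν) ≤ 2 * (1 + Real.log n) := by
  have hharm : ∑ j ∈ Finset.range n, ((j : ℝ) + 1)⁻¹ ≤ 1 + Real.log n := by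
    have := harmonic_le_one_add_log n
    rw [harmonic] at this
    push_cast at this
    exact this
  have hinj : ∀ (T : Finset ℕ) (f : ℕ → ℕ), (∀ l ∈ T, f l ∈ Finset.range n) →
      Set.InjOn f T → ∑ l ∈ T, ((f l : ℝ) + 1)⁻¹ ≤ 1 + Real.log n := fun T f hf hi => by
    rw [← Finset.sum_image (f := fun j : ℕ => ((j : ℝ) + 1)⁻¹) hi]
    exact (Finset.sum_le_sum_of_subset_of_nonneg (Finset.image_subset_iff.2 hf)
      fun j _ _ => by positivity).trans hharm
  have hterm : ∀ {r : ℝ} {j : ℕ}, r = j + 1 → |r| ^ (-ν) ≤ ((j : ℝ) + 1)⁻¹ := fun {r j} e => by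
    have h1 : (0 : ℝ) ≤ j := Nat.cast_nonneg j
    rw [e, abs_of_pos (by linarith), Real.rpow_neg (by linarith)]
    exact inv_anti₀ (by linarith) (Real.self_le_rpow_of_one_le (by linarith) hν)
  rw [← Finset.sum_filter_add_sum_filter_not _ (fun l => l < k), two_mul]
  refine add_le_add ?_ ?_
  · refine le_trans (Finset.sum_le_sum fun l hl => ?_)
      (hinj _ (fun l => k - l - 1) (fun l hl => ?_) fun l hl l' hl' e => ?_)
    · simp only [Finset.mem_filter, Finset.mem_erase, Finset.mem_range] at hl
      exact hterm (by push_cast [Nat.cast_sub hl.2.le, Nat.cast_sub (Nat.sub_pos_of_lt hl.2)]; ring)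
    · simp only [Finset.mem_filter, Finset.mem_erase, Finset.mem_range] at hl ⊢
      omega
    · simp only [Finset.coe_filter, Finset.mem_erase, Finset.mem_range,
        Set.mem_ofPred_eq] at hl hl' e
      omega
  · refine le_trans (Finset.sum_le_sum fun l hl => ?_)
      (hinj _ (fun l => l - k - 1) (fun l hl => ?_) fun l hl l' hl' e => ?_)
    · simp only [Finset.mem_filter, Finset.mem_erase, Finset.mem_range, not_lt] at hl
      have hkl : k < l := lt_of_le_of_ne hl.2 (Ne.symm hl.1.1)
      rw [abs_sub_comm]
      exact hterm (by push_cast [Nat.cast_sub hkl.le, Nat.cast_sub (Nat.sub_pos_of_lt hkl)]; ring)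
    · simp only [Finset.mem_filter, Finset.mem_erase, Finset.mem_range, not_lt] at hl ⊢
      omega
    · simp only [Finset.coe_filter, Finset.mem_erase, Finset.mem_range, not_lt,
        Set.mem_ofPred_eq] at hl hl' e
      omega

namespace WGraph.Regular

variable {M : WGraph} {c C : ℝ} (h : M.Regular c C)

include h in
lemma exists_far_point (hα : 1 ≤ M.α) (x : M.V) {R : ℝ} (hR : 1 ≤ R) :
    ∃ z, 2 * R < M.d x z ∧ M.d x z ≤ 4 * C / c * R := by
  have hc := h.c_pos
  have hC := h.C_pos
  by_contra! hz
  have hsub : h.ballF x (4 * C / c * R) ⊆ h.ballF x (2 * R) := fun y hy => by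
    rw [h.mem_ballF] at hy ⊢
    by_contra! hlt
    exact absurd hy (hz y hlt).not_ge
  have hCc : 1 ≤ C / c := by rw [le_div_iff₀ hc]; linarith [h.c_le, h.C_ge]
  have e : 4 * C / c * R = (2 * (C / c)) * (2 * R) := by ring
  have h1 := h.card_ballF_ge x (r := 4 * C / c * R) (by rw [e]; nlinarith)
  have h2 := h.card_ballF_le x (r := 2 * R) (by linarith)
  have h3 : ((h.ballF x (4 * C / c * R)).card : ℝ) ≤ (h.ballF x (2 * R)).card := by
    exact_mod_cast Finset.card_le_card hsub
  rw [e, Real.mul_rpow (by positivity) (by positivity)] at h1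
  have h4 : 2 * (C / c) ≤ (2 * (C / c)) ^ M.α := Real.self_le_rpow_of_one_le (by linarith) hα
  have h5 : 0 < (2 * R) ^ M.α := by positivity
  have h6 : c * (2 * (C / c) * (2 * R) ^ M.α) ≤ c * ((2 * (C / c)) ^ M.α * (2 * R) ^ M.α) := by
    gcongr
  have h7 : c * (2 * (C / c) * (2 * R) ^ M.α) = 2 * C * (2 * R) ^ M.α := by field_simp
  rw [h7] at h6
  rw [e] at h3
  have h8 := (h6.trans h1).trans (h3.trans h2)
  nlinarith [mul_pos hC h5]

end WGraph.Regular

end ArmBound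

section ArmScale

open Matrix

/-- The arithmetic behind the choice of the capacity threshold. -/
lemma inv_threshold_le {c p ℓ n N S γ ν L R D : ℝ} (hc : 0 < c) (hp : 0 < p) (hℓ : 0 < ℓ)
    (hn : 0 < n) (hR : 0 < R) (hD : 0 < D) (hS : 0 < S) (hN0 : 0 < N) (hL : L = R / (8 * n))
    (hγ : γ = c * (D * R) ^ (-ν)) (hN : N ≤ 2 * (L ^ (-ν) / γ ^ 2)) :
    (c * (p / ℓ) * n / (2 * (N * S)))⁻¹ ≤
      4 * 8 ^ ν * D ^ (2 * ν) / (c ^ 3 * p) * R ^ ν * (n ^ (ν - 1) * S * ℓ) := by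
  have hL0 : 0 < L := by rw [hL]; positivity
  have e1 : L ^ (-ν) = 8 ^ ν * n ^ ν * (R ^ ν)⁻¹ := by
    rw [hL, Real.rpow_neg (by positivity), Real.div_rpow hR.le (by positivity),
      Real.mul_rpow (by norm_num) hn.le, inv_div]
    ring
  have e2 : γ ^ 2 = c ^ 2 * (D ^ (2 * ν) * R ^ ν * R ^ ν)⁻¹ := by
    rw [hγ, Real.rpow_neg (by positivity), Real.mul_rpow hD.le hR.le, mul_comm 2 ν,
      Real.rpow_mul hD.le, Real.rpow_two]
    field_simp
  have e3 : n ^ ν = n ^ (ν - 1) * n := by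
    rw [Real.rpow_sub_one hn.ne']; field_simp
  have hRν : 0 < R ^ ν := by positivity
  have hDν : 0 < D ^ (2 * ν) := by positivity
  have hnν : 0 < n ^ (ν - 1) := by positivity
  calc (c * (p / ℓ) * n / (2 * (N * S)))⁻¹ = N * (2 * S * ℓ / (c * p * n)) := by
        field_simp
    _ ≤ 2 * (L ^ (-ν) / γ ^ 2) * (2 * S * ℓ / (c * p * n)) :=
        mul_le_mul_of_nonneg_right hN (by positivity)
    _ = _ := by
        rw [e1, e2, e3]
        field_simp
        ring

namespace WGraph.Regular

variable {M : Model} {c C : ℝ} (h : M.toWGraph.Regular c C)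

include h in
set_option maxHeartbeats 2000000 in
/-- The one-arm bound for a given number `n` of layers. -/
lemma exists_arm_bound (hν : 1 ≤ M.ν) (hα : M.ν ≤ M.α / 2) :
    ∃ A : ℝ, 0 < A ∧ ∃ L₀ : ℝ, 1 ≤ L₀ ∧ ∃ K₁ : ℝ, 1 ≤ K₁ ∧ ∀ (x : M.V) (R ℓ : ℝ) (n : ℕ), 0 < n →
      1 ≤ ℓ → L₀ ≤ R / (8 * n) → K₁ * ℓ * Real.log R ≤ n →
      (∀ y, ∑ u ∈ h.ballF y (R / (8 * n)), M.green y u ^ 2 ≤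
        ℓ * (R / (8 * n)) ^ (M.α - 2 * M.ν)) →
      M.prob (M.armEvent x R) ≤
        A * R ^ (-(M.ν / 2)) * √((n : ℝ) ^ (M.ν - 1) * (3 + 2 * Real.log n) * ℓ) := by
  have hc := h.c_pos
  have hC := h.C_pos
  have hc1 := h.c_le
  have hC1 := h.C_ge
  obtain ⟨D, hD⟩ : ∃ D, D = 4 * C / c + 1 := ⟨_, rfl⟩
  have hD1 : 1 ≤ D := by rw [hD]; linarith [show 0 < 4 * C / c by positivity]
  have hD0 : 0 < D := by linarith
  have hκ : 1 ≤ C / c * D ^ M.ν := by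
    have h1 : 1 ≤ C / c := by rw [le_div_iff₀ hc]; linarith
    have h2 : 1 ≤ D ^ M.ν := Real.one_le_rpow hD1 (by linarith)
    nlinarith
  obtain ⟨p, hp0, hp1, L₀, hL₀, hmain⟩ := h.exists_layered_bound hν hα hκ
  obtain ⟨A₁, hA₁⟩ : ∃ A₁, A₁ = 4 * 8 ^ M.ν * D ^ (2 * M.ν) / (c ^ 3 * p) * (1 + 2 * C ^ 2) :=
    ⟨_, rfl⟩
  have hA₁0 : 0 < A₁ := by rw [hA₁]; positivity
  refine ⟨4 * C / √c * √A₁ + (1 / √c + C * (D + 1) ^ M.α * (1 / √c + C)), by positivity,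
    max L₀ C, hL₀.trans (le_max_left _ _), max 1 (2 * (3 * M.α + 3 * M.ν) / p), le_max_left _ _, ?_⟩
  intro x R ℓ n hn hℓ hLn hKn hsq
  obtain ⟨L, hL⟩ : ∃ L, L = R / (8 * n) := ⟨_, rfl⟩
  rw [← hL] at hLn hsq
  have hn1 : (1 : ℝ) ≤ n := by exact_mod_cast hn
  have hLC : C ≤ L := (le_max_right _ _).trans hLn
  have hLL₀ : L₀ ≤ L := (le_max_left _ _).trans hLn
  have hL1 : 1 ≤ L := hL₀.trans hLL₀
  have hL0 : 0 < L := by linarith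
  have hRL : R = 8 * n * L := by rw [hL]; field_simp
  have hLR : 8 * L ≤ R := by rw [hRL]; nlinarith
  have hR1 : 1 ≤ R := by linarith
  have hR0 : 0 < R := by linarith
  have hin : (4 * n + 2) * L ≤ R := by rw [hRL]; nlinarith
  have hlogn : 0 ≤ Real.log n := Real.log_nonneg hn1
  obtain ⟨z, hz1, hz2⟩ := h.exists_far_point (by linarith) x hR1
  obtain ⟨Λ, hΛ⟩ : ∃ Λ, Λ = h.ballF x ((D + 1) * R) := ⟨_, rfl⟩
  have hmemΛ : ∀ y, y ∈ Λ ↔ M.d x y ≤ (D + 1) * R := fun y => by rw [hΛ, h.mem_ballF]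
  have hDR : M.d x z ≤ D * R - R := by rw [hD]; linarith
  have hxΛ : x ∈ Λ := by rw [hmemΛ, M.d_self]; positivity
  have hzΛ : z ∈ Λ := by rw [hmemΛ]; linarith
  have hinner : ∀ y, M.d x y ≤ R → y ∈ Λ ∧ M.nbrs y ⊆ Λ := fun y hy => by
    have hDR1 : R ≤ D * R := le_mul_of_one_le_left hR0.le hD1
    refine ⟨(hmemΛ y).2 (by linarith), fun u hu => (hmemΛ u).2 ?_⟩
    have := h.d_le _ _ ((M.mem_nbrs).1 hu)
    linarith [M.d_triangle x y u]
  obtain ⟨Q, hQ1, hQ2, hQ3⟩ := h.exists_stieltjes hν Λ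
  have hl : Local M.toWGraph Λ Q := ⟨hQ1, hQ2, hQ3⟩
  obtain ⟨γ, hγ⟩ : ∃ γ, γ = c * (D * R) ^ (-M.ν) := ⟨_, rfl⟩
  have hγ0 : 0 < γ := by rw [hγ]; positivity
  have hxz : x ≠ z := fun e => by rw [e, M.d_self] at hz1; linarith
  have hgz : ∀ y, M.d x y ≤ R → γ ≤ M.green z y ∧ M.green z y ≤ C / c * D ^ M.ν * γ := by
    intro y hy
    have h1 : R ≤ M.d z y := by
      have := M.d_triangle x y z
      rw [M.d_symm y z] at this
      linarith
    have h2 : M.d z y ≤ D * R := by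
      have := M.d_triangle z x y
      rw [M.d_symm z x] at this
      linarith
    have hne : z ≠ y := fun e => by rw [e, M.d_self] at h1; linarith
    constructor
    · rw [hγ]
      exact (mul_le_mul_of_nonneg_left (Real.rpow_le_rpow_of_nonpos (M.d_pos _ _ hne) h2
        (by linarith)) hc.le).trans (h.green_ge_rpow _ _ hne)
    · refine (h.green_le_rpow _ _ hne).trans ((mul_le_mul_of_nonneg_left
        (Real.rpow_le_rpow_of_nonpos hR0 h1 (by linarith)) hC.le).trans_eq ?_)
      rw [hγ, Real.mul_rpow hD0.le hR0.le, Real.rpow_neg hD0.le]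
      field_simp
  obtain ⟨N, hN⟩ : ∃ N, N = ⌈L ^ (-M.ν) / γ ^ 2⌉₊ := ⟨_, rfl⟩
  have hN1 : L ^ (-M.ν) / γ ^ 2 ≤ N := by rw [hN]; exact Nat.le_ceil _
  have hN0 : (0 : ℝ) < N := lt_of_lt_of_le (by positivity) hN1
  have hratio : 1 ≤ L ^ (-M.ν) / γ ^ 2 := by
    rw [one_le_div (by positivity)]
    have h1 : γ ≤ R ^ (-M.ν) := by
      rw [hγ]
      have h2 : (D * R) ^ (-M.ν) ≤ R ^ (-M.ν) :=
        Real.rpow_le_rpow_of_nonpos hR0 (le_mul_of_one_le_left hR0.le hD1) (by linarith)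
      have h3 : 0 ≤ (D * R) ^ (-M.ν) := by positivity
      nlinarith
    have h2 : R ^ (-M.ν) ≤ L ^ (-M.ν) := Real.rpow_le_rpow_of_nonpos hL0 (by linarith) (by linarith)
    have h3 : R ^ (-M.ν) ≤ 1 := Real.rpow_le_one_of_one_le_of_nonpos hR1 (by linarith)
    nlinarith
  have hN2 : (N : ℝ) ≤ 2 * (L ^ (-M.ν) / γ ^ 2) := by
    have := Nat.ceil_lt_add_one (zero_le_one.trans hratio)
    rw [← hN] at this
    linarith
  obtain ⟨H, hH⟩ : ∃ H, H = 2 * (1 + Real.log n) := ⟨_, rfl⟩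
  have hH0 : 0 ≤ H := by rw [hH]; positivity
  obtain ⟨s, hs⟩ : ∃ s, s = c * (p / ℓ) * n / (2 * (N * (1 + C ^ 2 * H))) := ⟨_, rfl⟩
  have hs0 : 0 < s := by rw [hs]; positivity
  obtain ⟨ε, hε⟩ : ∃ ε, ε = R ^ (-M.α - M.ν) := ⟨_, rfl⟩
  have hε0 : 0 < ε := by rw [hε]; positivity
  have harm := M.prob_armEvent_le Λ hQ1 hQ2 hQ3 ⟨x, hxΛ⟩ ⟨z, hzΛ⟩ hR0.le (fun y hy => (hinner y hy).2)
    (Finset.univ.filter fun y : Λ => R < M.d x y) (by simp) hs0 hε0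
    (D := C * Real.exp (-(p / ℓ * n / 2))) (fun b hb q hq0 hq => by
      rw [hs]
      simp only [Finset.mem_filter, Finset.mem_univ, true_and] at hb
      exact hmain Λ Q hl ⟨x, hxΛ⟩ ⟨z, hzΛ⟩ b γ L ℓ H n hγ0 hLL₀ hℓ hH0 hn hsq
        (fun k hk => by rw [hH]; exact sum_abs_sub_rpow_le hν hk)
        (fun y hy => hinner y (hy.trans hin)) (fun y hy => hgz y (hy.trans hin))
        (hin.trans_lt hb) N hN1 q hq0 hq)
  have hRν : 0 < R ^ (-M.ν) := by positivity
  have hsc : 0 < √c := Real.sqrt_pos.2 hc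
  have hdiv : ∀ y, ε / √(M.green y y) ≤ ε / √c := fun y =>
    div_le_div_of_nonneg_left hε0.le hsc (Real.sqrt_le_sqrt (h.green_self_ge y))
  have hX : 1 ≤ (n : ℝ) ^ (M.ν - 1) * (3 + 2 * Real.log n) * ℓ := by
    have h1 : (1 : ℝ) ≤ (n : ℝ) ^ (M.ν - 1) := Real.one_le_rpow hn1 (by linarith)
    have h2 : (1 : ℝ) ≤ 3 + 2 * Real.log n := by linarith
    exact one_le_mul_of_one_le_of_one_le (one_le_mul_of_one_le_of_one_le h1 h2) hℓ
  have hRν2 : R ^ (-M.ν) ≤ R ^ (-(M.ν / 2)) :=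
    Real.rpow_le_rpow_of_exponent_le hR1 (by linarith)
  have t1 : 4 * M.green x z / √(s * M.green x x) ≤ 4 * C / √c * √A₁ * R ^ (-(M.ν / 2)) *
      √((n : ℝ) ^ (M.ν - 1) * (3 + 2 * Real.log n) * ℓ) := by
    have h1 : M.green x z ≤ C * R ^ (-M.ν) :=
      (h.green_le_rpow _ _ hxz).trans (mul_le_mul_of_nonneg_left
        (Real.rpow_le_rpow_of_nonpos hR0 (by linarith) (by linarith)) hC.le)
    have h2 : s⁻¹ ≤ A₁ * R ^ M.ν * ((n : ℝ) ^ (M.ν - 1) * (3 + 2 * Real.log n) * ℓ) := by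
      rw [hs]
      refine (inv_threshold_le hc hp0 (by linarith) (by linarith) hR0 hD0 (by positivity) hN0 hL
        hγ hN2).trans ?_
      have h3 : 1 + C ^ 2 * H ≤ (1 + 2 * C ^ 2) * (3 + 2 * Real.log n) := by
        rw [hH]; nlinarith [sq_nonneg C, mul_nonneg (sq_nonneg C) hlogn]
      rw [hA₁]
      calc _ ≤ 4 * 8 ^ M.ν * D ^ (2 * M.ν) / (c ^ 3 * p) * R ^ M.ν *
            ((n : ℝ) ^ (M.ν - 1) * ((1 + 2 * C ^ 2) * (3 + 2 * Real.log n)) * ℓ) := by gcongr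
        _ = _ := by ring
    have h4 : √(s⁻¹) ≤ √A₁ * R ^ (M.ν / 2) *
        √((n : ℝ) ^ (M.ν - 1) * (3 + 2 * Real.log n) * ℓ) := by
      refine (Real.sqrt_le_sqrt h2).trans_eq ?_
      rw [Real.sqrt_mul (by positivity), Real.sqrt_mul hA₁0.le, Real.sqrt_eq_rpow (R ^ M.ν),
        ← Real.rpow_mul hR0.le]
      ring_nf
    have h5 : √s * √c ≤ √(s * M.green x x) := by
      rw [Real.sqrt_mul hs0.le]
      exact mul_le_mul_of_nonneg_left (Real.sqrt_le_sqrt (h.green_self_ge x)) (Real.sqrt_nonneg _)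
    calc 4 * M.green x z / √(s * M.green x x) ≤ 4 * (C * R ^ (-M.ν)) / (√s * √c) := by
          have := Real.sqrt_pos.2 hs0
          exact div_le_div₀ (by positivity) (by linarith) (by positivity) h5
      _ = 4 * C / √c * R ^ (-M.ν) * √(s⁻¹) := by
          rw [Real.sqrt_inv]; have := Real.sqrt_pos.2 hs0; field_simp
      _ ≤ 4 * C / √c * R ^ (-M.ν) * (√A₁ * R ^ (M.ν / 2) *
          √((n : ℝ) ^ (M.ν - 1) * (3 + 2 * Real.log n) * ℓ)) :=
          mul_le_mul_of_nonneg_left h4 (by positivity)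
      _ = _ := by
          have : R ^ (-M.ν) * R ^ (M.ν / 2) = R ^ (-(M.ν / 2)) := by
            rw [← Real.rpow_add hR0]; ring_nf
          rw [← this]; ring
  have hDexp : C * Real.exp (-(p / ℓ * n / 2)) / ε ^ 2 ≤ C * R ^ (-M.α - M.ν) := by
    have h1 : (3 * M.α + 3 * M.ν) * Real.log R ≤ p / ℓ * n / 2 := by
      have h2 : 2 * (3 * M.α + 3 * M.ν) / p * (ℓ * Real.log R) ≤ n := by
        refine le_trans ?_ hKn
        rw [mul_assoc]
        exact mul_le_mul_of_nonneg_right (le_max_right _ _)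
          (mul_nonneg (by linarith) (Real.log_nonneg hR1))
      calc (3 * M.α + 3 * M.ν) * Real.log R =
            p / ℓ * (2 * (3 * M.α + 3 * M.ν) / p * (ℓ * Real.log R)) / 2 := by field_simp
        _ ≤ _ := by gcongr
    have h3 : Real.exp (-(p / ℓ * n / 2)) ≤ R ^ (-M.α - M.ν) * ε ^ 2 := by
      have e : R ^ (-M.α - M.ν) * ε ^ 2 = Real.exp (-((3 * M.α + 3 * M.ν) * Real.log R)) := by
        rw [hε, ← Real.rpow_natCast, ← Real.rpow_mul hR0.le, ← Real.rpow_add hR0,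
          Real.rpow_def_of_pos hR0]
        congr 1; push_cast; ring
      rw [e]
      exact Real.exp_le_exp.2 (neg_le_neg h1)
    rw [div_le_iff₀ (by positivity), mul_assoc]
    exact mul_le_mul_of_nonneg_left h3 hC.le
  have hεR : ε ≤ R ^ (-M.ν) := by
    rw [hε]; exact Real.rpow_le_rpow_of_exponent_le hR1 (by linarith)
  have t2 : ε / √(M.green x x) ≤ 1 / √c * R ^ (-M.ν) := by
    refine (hdiv x).trans ?_
    rw [div_mul_eq_mul_div, one_mul]
    exact div_le_div_of_nonneg_right hεR hsc.le
  have t3 : ∑ b ∈ Finset.univ.filter (fun y : Λ => R < M.d x y), (ε / √(M.green b b) +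
      C * Real.exp (-(p / ℓ * n / 2)) / ε ^ 2) ≤
      C * (D + 1) ^ M.α * (1 / √c + C) * R ^ (-M.ν) := by
    have hcard : ((Finset.univ.filter fun y : Λ => R < M.d x y).card : ℝ) ≤
        C * ((D + 1) * R) ^ M.α := by
      refine le_trans ?_ (h.card_ballF_le x (r := (D + 1) * R) (by nlinarith))
      rw [← hΛ]
      have := Finset.card_filter_le (Finset.univ : Finset Λ) fun y => R < M.d x y
      rw [Finset.card_univ, Fintype.card_coe] at this
      exact_mod_cast this
    refine (Finset.sum_le_card_nsmul _ _ ((1 / √c + C) * R ^ (-M.α - M.ν)) fun b _ => ?_).trans ?_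
    · rw [add_mul]
      refine add_le_add ((hdiv b).trans_eq ?_) hDexp
      rw [hε]; ring
    · rw [nsmul_eq_mul]
      refine (mul_le_mul_of_nonneg_right hcard (by positivity)).trans_eq ?_
      rw [Real.mul_rpow (by positivity) hR0.le, show -M.α - M.ν = -M.α + -M.ν by ring,
        Real.rpow_add hR0, Real.rpow_neg hR0.le M.α]
      have : R ^ M.α ≠ 0 := by positivity
      field_simp
  have hXs : 1 ≤ √((n : ℝ) ^ (M.ν - 1) * (3 + 2 * Real.log n) * ℓ) := Real.one_le_sqrt.2 hX
  have hRX : R ^ (-M.ν) ≤ R ^ (-(M.ν / 2)) *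
      √((n : ℝ) ^ (M.ν - 1) * (3 + 2 * Real.log n) * ℓ) :=
    hRν2.trans (le_mul_of_one_le_right (by positivity) hXs)
  refine (harm.trans (add_le_add (add_le_add t1 t2) t3)).trans ?_
  have h9 := mul_le_mul_of_nonneg_left hRX
    (show 0 ≤ 1 / √c + C * (D + 1) ^ M.α * (1 / √c + C) by positivity)
  linarith

end WGraph.Regular

end ArmScale

section Exponents

open Matrix

namespace WGraph.Regular

variable {M : WGraph} {c C : ℝ}

/-- The Dirichlet form of a function supported in the interior. -/
lemma Local.form_eq {Λ : Finset M.V} {Q : Matrix Λ Λ ℝ} (hl : Local M Λ Q) {f : Λ → ℝ}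
    (hf : ∀ u : Λ, f u ≠ 0 → M.nbrs u ⊆ Λ) :
    f ⬝ᵥ (Q *ᵥ f) = 1 / 2 * ∑ u : Λ, ∑ v : Λ, M.lam u v * (f u - f v) ^ 2 := by
  have h1 : f ⬝ᵥ (Q *ᵥ f) = ∑ u : Λ, ∑ v : Λ, f u * (M.lam u v * (f u - f v)) := by
    refine Finset.sum_congr rfl fun u _ => ?_
    rw [← Finset.mul_sum]
    by_cases hu : f u = 0
    · simp [hu]
    · have hi := hf u hu
      congr 1
      simp only [mulVec, dotProduct, hl.loc u hi, sub_mul, mul_sub, Finset.sum_sub_distrib, ite_mul,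
        zero_mul, Finset.sum_ite_eq, Finset.mem_univ, if_true]
      rw [← Finset.sum_mul, Finset.sum_coe_sort Λ fun v => M.lam u v, M.lamTot_eq_sum,
        Finset.sum_subset hi fun y _ hy => by rwa [M.mem_nbrs, not_not] at hy]
  have h2 : ∑ u : Λ, ∑ v : Λ, f u * (M.lam u v * (f u - f v)) =
      -∑ u : Λ, ∑ v : Λ, f v * (M.lam u v * (f u - f v)) := by
    rw [Finset.sum_comm, ← Finset.sum_neg_distrib]
    refine Finset.sum_congr rfl fun u _ => ?_
    rw [← Finset.sum_neg_distrib]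
    refine Finset.sum_congr rfl fun v _ => ?_
    rw [M.lam_symm u v]; ring
  have h3 : ∑ u : Λ, ∑ v : Λ, M.lam u v * (f u - f v) ^ 2 =
      ∑ u : Λ, ∑ v : Λ, f u * (M.lam u v * (f u - f v)) -
        ∑ u : Λ, ∑ v : Λ, f v * (M.lam u v * (f u - f v)) := by
    simp only [← Finset.sum_sub_distrib]
    exact Finset.sum_congr rfl fun u _ => Finset.sum_congr rfl fun v _ => by ring
  rw [h1]
  linarith

variable (h : M.Regular c C)

include h in
lemma form_lipschitz_le {Λ : Finset M.V} {Q : Matrix Λ Λ ℝ} (hl : Local M Λ Q) {f : Λ → ℝ}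
    (hf : ∀ u : Λ, f u ≠ 0 → M.nbrs u ⊆ Λ) {r : ℝ} (hr : 0 < r)
    (hlip : ∀ u v : Λ, |f u - f v| ≤ M.d u v / r) :
    f ⬝ᵥ (Q *ᵥ f) ≤ Λ.card * (C * C ^ M.α * (C * (C / r) ^ 2)) := by
  have hC := h.C_pos
  have hle : ∑ u : Λ, ∑ v : Λ, M.lam u v * (f u - f v) ^ 2 ≤
      Λ.card * (C * C ^ M.α * (C * (C / r) ^ 2)) := by
    rw [← nsmul_eq_mul, ← Fintype.card_coe, ← Finset.card_univ]
    refine Finset.sum_le_card_nsmul _ _ _ fun u _ => ?_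
    calc ∑ v : Λ, M.lam u v * (f u - f v) ^ 2 ≤
          ∑ v : Λ, if (v : M.V) ∈ h.ballF u C then C * (C / r) ^ 2 else 0 := by
          refine Finset.sum_le_sum fun v _ => ?_
          by_cases huv : M.lam u v = 0
          · rw [huv, zero_mul]; split_ifs <;> positivity
          · have hd := h.d_le _ _ huv
            rw [if_pos (h.mem_ballF.2 hd)]
            refine mul_le_mul (h.lam_le _ _) ?_ (sq_nonneg _) hC.le
            rw [← sq_abs]
            exact pow_le_pow_left₀ (abs_nonneg _)
              ((hlip u v).trans (div_le_div_of_nonneg_right hd hr.le)) 2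
      _ = ∑ v ∈ Λ, if v ∈ h.ballF u C then C * (C / r) ^ 2 else 0 :=
          Finset.sum_coe_sort Λ fun v => if v ∈ h.ballF u C then C * (C / r) ^ 2 else 0
      _ = (Λ.filter (· ∈ h.ballF u C)).card * (C * (C / r) ^ 2) := by
          rw [← Finset.sum_filter, Finset.sum_const, nsmul_eq_mul]
      _ ≤ C * C ^ M.α * (C * (C / r) ^ 2) := by
          refine mul_le_mul_of_nonneg_right (le_trans ?_ (h.card_ballF_le u h.C_ge)) (by positivity)
          exact_mod_cast Finset.card_le_card fun v hv => (Finset.mem_filter.1 hv).2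
  have h0 : 0 ≤ ∑ u : Λ, ∑ v : Λ, M.lam u v * (f u - f v) ^ 2 :=
    Finset.sum_nonneg fun u _ => Finset.sum_nonneg fun v _ =>
      mul_nonneg (M.lam_nonneg _ _) (sq_nonneg _)
  rw [Local.form_eq hl hf]
  linarith

include h in
/-- The exponents `ν = 1`, `α = 2` are incompatible with transience. -/
lemma exponents_ne (hν : M.ν = 1) (hα : M.α = 2) : False := by
  have hc := h.c_pos
  have hC := h.C_pos
  have hC1 := h.C_ge
  obtain ⟨A, hA1, hA⟩ := h.exists_sum_rpow_le zero_le_one (by rw [hα]; norm_num)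
  obtain ⟨x⟩ : Nonempty M.V := ⟨M.o⟩
  have key : ∀ r : ℝ, C ≤ r → c * r ≤ 80 * C ^ 6 * C ^ M.α * A := by
    intro r hr
    have hr1 : 1 ≤ r := hC1.trans hr
    have hr0 : 0 < r := by linarith
    obtain ⟨Λ, hΛ⟩ : ∃ Λ, Λ = h.ballF x (4 * r) := ⟨_, rfl⟩
    obtain ⟨Q, hQ1, hQ2, hQ3⟩ := h.exists_stieltjes hν.ge Λ
    have hl : Local M Λ Q := ⟨hQ1, hQ2, hQ3⟩
    obtain ⟨S, hS⟩ : ∃ S : Finset Λ, S = Finset.univ.filter fun u : Λ => M.d x u ≤ r := ⟨_, rfl⟩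
    obtain ⟨f, hf⟩ : ∃ f : Λ → ℝ, f = fun u : Λ => max 0 (min 1 (2 - M.d x u / r)) := ⟨_, rfl⟩
    obtain ⟨g, hg⟩ : ∃ g : Λ → ℝ, g = fun u => ∑ v ∈ S, gk Q Finset.univ u v := ⟨_, rfl⟩
    have hScard : (S.card : ℝ) = (h.ballF x r).card := by
      rw [← Finset.card_map (Function.Embedding.subtype (· ∈ Λ))]
      congr 2
      ext u
      simp only [Finset.mem_map, h.mem_ballF, Function.Embedding.subtype_apply, hS,
        Finset.mem_filter, Finset.mem_univ, true_and]
      constructor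
      · rintro ⟨u, hu, rfl⟩; exact hu
      · intro hu
        exact ⟨⟨u, by rw [hΛ, h.mem_ballF]; linarith⟩, hu, rfl⟩
    have hQg : ∀ u, (Q *ᵥ g) u = if u ∈ S then 1 else 0 := fun u => by
      have e : g = ∑ v ∈ S, fun u => gk Q Finset.univ u v := by
        ext u; simp [hg]
      rw [e, Matrix.mulVec_sum, Finset.sum_apply]
      simp only [hQ1.mulVec_gk Finset.univ (Finset.mem_univ _) (Finset.mem_univ _)]
      simp
    have hdot : ∀ f' : Λ → ℝ, f' ⬝ᵥ (Q *ᵥ g) = ∑ u ∈ S, f' u := fun f' => by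
      simp only [dotProduct, hQg, mul_ite, mul_one, mul_zero]
      rw [← Finset.sum_filter, Finset.filter_mem_eq_inter, Finset.univ_inter]
    have h1 : f ⬝ᵥ (Q *ᵥ g) = S.card := by
      rw [hdot, Finset.cast_card]
      refine Finset.sum_congr rfl fun u hu => ?_
      have hu' : M.d x u / r ≤ 1 := by
        rw [div_le_one hr0]; simpa [hS] using hu
      rw [hf]
      simp only
      rw [min_eq_left (by linarith), max_eq_right zero_le_one]
    have h2 : g ⬝ᵥ (Q *ᵥ g) ≤ S.card * (3 * C * A * r) := by
      rw [hdot, ← nsmul_eq_mul]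
      refine Finset.sum_le_card_nsmul _ _ _ fun u hu => ?_
      have hsub : S.map (Function.Embedding.subtype _) ⊆ h.ballF u (2 * r) := by
        intro v hv
        obtain ⟨w, hw, rfl⟩ := Finset.mem_map.1 hv
        have h3 : M.d x u ≤ r := by simpa [hS] using hu
        have h4 : M.d x w ≤ r := by simpa [hS] using hw
        have h5 := M.d_triangle u x w
        rw [M.d_symm u x] at h5
        rw [h.mem_ballF]
        simp only [Function.Embedding.subtype_apply]
        linarith
      have h6 : g u ≤ ∑ v ∈ h.ballF u (2 * r), M.green u v := by
        refine le_trans (le_of_eq ?_) (Finset.sum_le_sum_of_subset_of_nonneg hsub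
          fun v _ _ => (h.green_pos _ _).le)
        rw [Finset.sum_map, hg]
        exact Finset.sum_congr rfl fun v _ => hl.green u v
      have h7 : ∑ v ∈ h.ballF u (2 * r), M.green u v ≤
          C + C * ∑ v ∈ (h.ballF u (2 * r)).erase u, M.d u v ^ (-(1 : ℝ)) := by
        rw [← Finset.add_sum_erase _ _ (h.mem_ballF.2 (by rw [M.d_self]; positivity)),
          Finset.mul_sum]
        refine add_le_add (h.green_le _ _) (Finset.sum_le_sum fun v hv => ?_)
        rw [← hν]
        exact h.green_le_rpow _ _ (Finset.ne_of_mem_erase hv).symm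
      have h8 := hA u (2 * r) (by linarith)
      rw [hα, show (2 : ℝ) - 1 = 1 by norm_num, Real.rpow_one] at h8
      have h9 := mul_le_mul_of_nonneg_left h8 hC.le
      have h10 : C * 1 ≤ C * (A * r) := mul_le_mul_of_nonneg_left (by nlinarith) hC.le
      linarith
    have h3 : f ⬝ᵥ (Q *ᵥ f) ≤ Λ.card * (C * C ^ M.α * (C * (C / r) ^ 2)) := by
      refine h.form_lipschitz_le hl (fun u hu => ?_) hr0 fun u v => ?_
      · have hu2 : M.d x u < 2 * r := by
          by_contra! h4
          rw [← le_div_iff₀ hr0] at h4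
          exact hu (by rw [hf]; exact max_eq_left ((min_le_right _ _).trans (by linarith)))
        intro y hy
        rw [hΛ, h.mem_ballF]
        have := h.d_le _ _ ((M.mem_nbrs).1 hy)
        linarith [M.d_triangle x u y]
      · have h4 : |M.d x u / r - M.d x v / r| ≤ M.d u v / r := by
          rw [← sub_div, abs_div, abs_of_pos hr0]
          refine div_le_div_of_nonneg_right ?_ hr0.le
          have h5 := M.d_triangle x u v
          have h6 := M.d_triangle x v u
          rw [M.d_symm v u] at h6
          rw [abs_le]
          constructor <;> linarith
        rw [hf]
        refine le_trans ?_ h4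
        simp only [max_comm (0 : ℝ), min_comm (1 : ℝ)]
        refine (abs_max_sub_max_le_abs _ _ _).trans ((abs_inf_sub_inf_le_abs _ _ _).trans_eq ?_)
        rw [sub_sub_sub_cancel_left, abs_sub_comm]
    have h4 := form_cauchy_schwarz Q hQ1.symm (fun f => by
      by_cases hf0 : f = 0
      · simp [hf0]
      · exact (hQ1.pos f hf0).le) f g
    rw [h1] at h4
    have hΛcard : (Λ.card : ℝ) ≤ C * (16 * r ^ 2) := by
      have := h.card_ballF_le x (r := 4 * r) (by linarith)
      rw [hα, Real.rpow_two, ← hΛ] at this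
      linarith
    have hSge : c * r ^ 2 ≤ S.card := by
      have := h.card_ballF_ge x hr1
      rw [hα, Real.rpow_two] at this
      rwa [hScard]
    have hS0 : (0 : ℝ) < S.card := lt_of_lt_of_le (by positivity) hSge
    have h5 : (Λ.card : ℝ) * (C * C ^ M.α * (C * (C / r) ^ 2)) ≤ 16 * C ^ 5 * C ^ M.α :=
      (mul_le_mul_of_nonneg_right hΛcard (by positivity)).trans_eq (by field_simp)
    have h6 : (S.card : ℝ) ^ 2 ≤ 16 * C ^ 5 * C ^ M.α * (S.card * (3 * C * A * r)) := by
      refine h4.trans (mul_le_mul (h3.trans h5) h2 ?_ (by positivity))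
      rw [hdot, hg]
      exact Finset.sum_nonneg fun u _ => Finset.sum_nonneg fun v _ => hQ1.gk_nonneg _ _ _
    have h7 : (S.card : ℝ) ≤ 48 * C ^ 6 * C ^ M.α * A * r := by
      refine le_of_mul_le_mul_left ?_ hS0
      linarith
    have h8 : c * r * r ≤ 80 * C ^ 6 * C ^ M.α * A * r := by
      have : 0 ≤ C ^ 6 * C ^ M.α * A * r := by positivity
      linarith
    exact le_of_mul_le_mul_right h8 hr0
  have hbig := key (max C (80 * C ^ 6 * C ^ M.α * A / c + 1)) (le_max_left _ _)
  have h1 := mul_le_mul_of_nonneg_left (le_max_right C (80 * C ^ 6 * C ^ M.α * A / c + 1)) hc.le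
  have h2 : c * (80 * C ^ 6 * C ^ M.α * A / c + 1) = 80 * C ^ 6 * C ^ M.α * A + c := by field_simp
  linarith

end WGraph.Regular

end Exponents

section LogLog

lemma one_le_log_of_three_le {R : ℝ} (hR : 3 ≤ R) : 1 ≤ Real.log R := by
  rw [Real.le_log_iff_exp_le (by linarith)]
  linarith [Real.exp_one_lt_d9]

lemma log_log_three_pos : 0 < Real.log (Real.log 3) := by
  refine Real.log_pos ?_
  rw [Real.lt_log_iff_exp_lt (by norm_num)]
  linarith [Real.exp_one_lt_d9]

lemma log_log_three_le {R : ℝ} (hR : 3 ≤ R) : Real.log (Real.log 3) ≤ Real.log (Real.log R) :=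
  Real.log_le_log (by linarith [one_le_log_of_three_le le_rfl])
    (Real.log_le_log (by norm_num) hR)

lemma exists_log_le_mul_log_log {K β : ℝ} (hK : 1 ≤ K) (hβ : 0 ≤ β) :
    ∃ D, 0 < D ∧ ∀ R : ℝ, 3 ≤ R → ∀ n : ℝ, 0 < n → n ≤ K * Real.log R ^ β →
      3 + 2 * Real.log n ≤ D * Real.log (Real.log R) := by
  have hκ := log_log_three_pos
  have hK0 := Real.log_nonneg hK
  refine ⟨(3 + 2 * Real.log K) / Real.log (Real.log 3) + 2 * β, by positivity,
    fun R hR n hn hnK => ?_⟩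
  have hT := one_le_log_of_three_le hR
  have h1 : Real.log n ≤ Real.log K + β * Real.log (Real.log R) := by
    refine (Real.log_le_log hn hnK).trans_eq ?_
    rw [Real.log_mul (by positivity) (by positivity), Real.log_rpow (by positivity)]
  have h2 : 3 + 2 * Real.log K ≤
      (3 + 2 * Real.log K) / Real.log (Real.log 3) * Real.log (Real.log R) := by
    rw [div_mul_eq_mul_div, le_div_iff₀ hκ]
    exact mul_le_mul_of_nonneg_left (log_log_three_le hR) (by positivity)
  linarith

lemma exists_sqrt_le_log_rpow {ν β e K A : ℝ} (hν : 1 ≤ ν) (hβ : 0 ≤ β) (hK : 1 ≤ K) (hA : 0 < A)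
    (he : (β + 1) * (ν - 1) + β ≤ 2 * e) :
    ∃ D, 0 < D ∧ ∀ R : ℝ, 3 ≤ R → ∀ n : ℝ, 1 ≤ n → n ≤ K * Real.log R ^ (β + 1) →
      √(n ^ (ν - 1) * (3 + 2 * Real.log n) * (A * Real.log R ^ β)) ≤
        D * (Real.log R ^ e * Real.log (Real.log R) ^ ν) := by
  have hκ := log_log_three_pos
  obtain ⟨D, hD, hlog⟩ := exists_log_le_mul_log_log hK (show 0 ≤ β + 1 by linarith)
  have hK0 : 0 < K := by linarith
  refine ⟨√(K ^ (ν - 1) * (D * Real.log (Real.log 3) ^ (1 - 2 * ν)) * A), by positivity,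
    fun R hR n hn hnK => ?_⟩
  have hT := one_le_log_of_three_le hR
  have hT0 : 0 < Real.log R := by linarith
  have hκU := log_log_three_le hR
  have hU0 : 0 < Real.log (Real.log R) := hκ.trans_le hκU
  have h1 : n ^ (ν - 1) ≤ K ^ (ν - 1) * Real.log R ^ ((β + 1) * (ν - 1)) := by
    rw [Real.rpow_mul hT0.le, ← Real.mul_rpow hK0.le (by positivity)]
    exact Real.rpow_le_rpow (by linarith) hnK (by linarith)
  have h2 : 3 + 2 * Real.log n ≤
      D * Real.log (Real.log 3) ^ (1 - 2 * ν) * Real.log (Real.log R) ^ (2 * ν) := by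
    refine (hlog R hR n (by linarith) hnK).trans ?_
    rw [mul_assoc]
    refine mul_le_mul_of_nonneg_left ?_ hD.le
    calc Real.log (Real.log R)
        = Real.log (Real.log R) ^ (1 - 2 * ν) * Real.log (Real.log R) ^ (2 * ν) := by
          rw [← Real.rpow_add hU0, sub_add_cancel, Real.rpow_one]
      _ ≤ _ := mul_le_mul_of_nonneg_right
          (Real.rpow_le_rpow_of_nonpos hκ hκU (by linarith)) (by positivity)
  have h3 : Real.log R ^ ((β + 1) * (ν - 1)) * Real.log R ^ β ≤ Real.log R ^ (2 * e) := by
    rw [← Real.rpow_add hT0]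
    exact Real.rpow_le_rpow_of_exponent_le hT he
  have h4 : (0 : ℝ) ≤ 3 + 2 * Real.log n := by linarith [Real.log_nonneg hn]
  rw [Real.sqrt_le_left (by positivity), mul_pow, Real.sq_sqrt (by positivity), mul_pow,
    ← Real.rpow_mul_natCast hT0.le, ← Real.rpow_mul_natCast hU0.le, Nat.cast_ofNat, mul_comm e,
    mul_comm ν]
  calc n ^ (ν - 1) * (3 + 2 * Real.log n) * (A * Real.log R ^ β)
      ≤ (K ^ (ν - 1) * Real.log R ^ ((β + 1) * (ν - 1))) *
          (D * Real.log (Real.log 3) ^ (1 - 2 * ν) * Real.log (Real.log R) ^ (2 * ν)) *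
          (A * Real.log R ^ β) :=
        mul_le_mul_of_nonneg_right (mul_le_mul h1 h2 h4 (by positivity)) (by positivity)
    _ = K ^ (ν - 1) * (D * Real.log (Real.log 3) ^ (1 - 2 * ν)) * A *
          ((Real.log R ^ ((β + 1) * (ν - 1)) * Real.log R ^ β) *
            Real.log (Real.log R) ^ (2 * ν)) := by ring
    _ ≤ _ := by gcongr

lemma exists_mul_log_rpow_le (a β : ℝ) :
    ∃ R₀, 3 ≤ R₀ ∧ ∀ R, R₀ ≤ R → a * Real.log R ^ β ≤ R := by
  have h1 : ∀ᶠ R : ℝ in atTop, |Real.log R ^ β| ≤ (|a| + 1)⁻¹ * |R ^ (1 : ℝ)| := by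
    have := (isLittleO_log_rpow_rpow_atTop β (zero_lt_one (α := ℝ))).bound
      (show 0 < (|a| + 1)⁻¹ by positivity)
    simpa only [Real.norm_eq_abs] using this
  obtain ⟨R₁, hR₁⟩ := Filter.eventually_atTop.1 h1
  refine ⟨max R₁ 3, le_max_right _ _, fun R hR => ?_⟩
  have h2 := hR₁ R ((le_max_left _ _).trans hR)
  have h3 : 3 ≤ R := (le_max_right _ _).trans hR
  rw [Real.rpow_one, abs_of_pos (by linarith : 0 < R), inv_mul_eq_div,
    le_div_iff₀ (by positivity)] at h2
  have h4 := le_abs_self (a * Real.log R ^ β)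
  rw [abs_mul] at h4
  linarith [abs_nonneg (Real.log R ^ β)]

end LogLog

section OneArm

namespace WGraph.Regular

variable {M : Model} {c C : ℝ} (h : M.toWGraph.Regular c C)

include h in
lemma exists_arm_bound_log (hν : 1 ≤ M.ν) (hα : M.ν ≤ M.α / 2) {A β e : ℝ} (hA : 1 ≤ A)
    (hβ : 0 ≤ β) (he : (β + 1) * (M.ν - 1) + β ≤ 2 * e)
    (hsum : ∀ y : M.V, ∀ L R : ℝ, 1 ≤ L → L ≤ R → 3 ≤ R →
      ∑ u ∈ h.ballF y L, M.green y u ^ 2 ≤ A * Real.log R ^ β * L ^ (M.α - 2 * M.ν)) :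
    ∃ D, 0 < D ∧ ∀ (x : M.V) (R : ℝ), 3 ≤ R → M.prob (M.armEvent x R) ≤
      D * (Real.log R ^ e * Real.log (Real.log R) ^ M.ν) * R ^ (-(M.ν / 2)) := by
  have hκ := log_log_three_pos
  obtain ⟨A₁, hA₁, L₀, hL₀, K, hK, hbd⟩ := h.exists_arm_bound hν hα
  have hKA : 1 ≤ K * A := one_le_mul_of_one_le_of_one_le hK hA
  obtain ⟨D, hD, hsqrt⟩ := exists_sqrt_le_log_rpow (K := 2 * (K * A)) hν hβ (by linarith)
    (show 0 < A by linarith) he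
  obtain ⟨R₀, hR₀, hlarge⟩ := exists_mul_log_rpow_le (L₀ * (8 * (2 * (K * A)))) (β + 1)
  have he0 : 0 ≤ e := by nlinarith
  refine ⟨A₁ * D + R₀ ^ (M.ν / 2) / Real.log (Real.log 3) ^ M.ν, by positivity,
    fun x R hR => ?_⟩
  have hR0 : 0 < R := by linarith
  have hT := one_le_log_of_three_le hR
  have hT0 : 0 < Real.log R := by linarith
  have hκU := log_log_three_le hR
  have hU0 : 0 < Real.log (Real.log R) := hκ.trans_le hκU
  rcases le_or_gt R₀ R with hRR | hRR
  · obtain ⟨n, hn⟩ : ∃ n, n = ⌈K * (A * Real.log R ^ β) * Real.log R⌉₊ := ⟨_, rfl⟩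
    have hTβ : 1 ≤ Real.log R ^ β := Real.one_le_rpow hT hβ
    have hℓ : 1 ≤ A * Real.log R ^ β := one_le_mul_of_one_le_of_one_le hA hTβ
    have he1 : K * (A * Real.log R ^ β) * Real.log R = K * A * Real.log R ^ (β + 1) := by
      rw [Real.rpow_add_one hT0.ne']; ring
    have h1 : 1 ≤ K * (A * Real.log R ^ β) * Real.log R :=
      one_le_mul_of_one_le_of_one_le (one_le_mul_of_one_le_of_one_le hK hℓ) hT
    have hn0 : 0 < n := hn ▸ Nat.ceil_pos.2 (by linarith)
    have hn1 : (1 : ℝ) ≤ n := by exact_mod_cast hn0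
    have hnge : K * (A * Real.log R ^ β) * Real.log R ≤ n := hn ▸ Nat.le_ceil _
    have hnle : (n : ℝ) ≤ 2 * (K * A) * Real.log R ^ (β + 1) := by
      have := Nat.ceil_lt_add_one (show 0 ≤ K * (A * Real.log R ^ β) * Real.log R by linarith)
      rw [← hn] at this
      linarith
    have hL : L₀ ≤ R / (8 * n) := by
      rw [le_div_iff₀ (by positivity)]
      refine le_trans ?_ (hlarge R hRR)
      rw [mul_assoc L₀, mul_assoc 8]
      gcongr
    have hLR : R / (8 * n) ≤ R := div_le_self hR0.le (by linarith)
    calc M.prob (M.armEvent x R)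
        ≤ A₁ * R ^ (-(M.ν / 2)) *
            √((n : ℝ) ^ (M.ν - 1) * (3 + 2 * Real.log n) * (A * Real.log R ^ β)) :=
          hbd x R _ n hn0 hℓ hL hnge fun y => hsum y _ R (hL₀.trans hL) hLR hR
      _ ≤ A₁ * R ^ (-(M.ν / 2)) * (D * (Real.log R ^ e * Real.log (Real.log R) ^ M.ν)) := by
          gcongr
          exact hsqrt R hR n hn1 hnle
      _ = A₁ * D * (Real.log R ^ e * Real.log (Real.log R) ^ M.ν) * R ^ (-(M.ν / 2)) := by ring
      _ ≤ _ := by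
          gcongr
          exact le_add_of_nonneg_right (by positivity)
  · have hP : M.prob (M.armEvent x R) ≤ 1 := by
      have := M.Pprob
      exact ENNReal.toReal_le_of_le_ofReal zero_le_one (by simpa using prob_le_one)
    have h1 : 1 ≤ R₀ ^ (M.ν / 2) * R ^ (-(M.ν / 2)) := by
      rw [Real.rpow_neg hR0.le, ← div_eq_mul_inv, one_le_div (by positivity)]
      exact Real.rpow_le_rpow hR0.le hRR.le (by linarith)
    have h2 : 1 ≤ Real.log R ^ e * (Real.log (Real.log R) ^ M.ν / Real.log (Real.log 3) ^ M.ν) := by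
      refine one_le_mul_of_one_le_of_one_le (Real.one_le_rpow hT he0) ?_
      rw [one_le_div (by positivity)]
      exact Real.rpow_le_rpow hκ.le hκU (by linarith)
    calc M.prob (M.armEvent x R) ≤ 1 := hP
      _ ≤ (R₀ ^ (M.ν / 2) * R ^ (-(M.ν / 2))) *
          (Real.log R ^ e * (Real.log (Real.log R) ^ M.ν / Real.log (Real.log 3) ^ M.ν)) :=
          one_le_mul_of_one_le_of_one_le h1 h2
      _ = R₀ ^ (M.ν / 2) / Real.log (Real.log 3) ^ M.ν *
          (Real.log R ^ e * Real.log (Real.log R) ^ M.ν) * R ^ (-(M.ν / 2)) := by ring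
      _ ≤ _ := by
          gcongr
          exact le_add_of_nonneg_left (by positivity)

include h in
lemma exists_arm_bound_qArm (hν : 1 ≤ M.ν) (hα : M.ν ≤ M.α / 2) :
    ∃ D, 0 < D ∧ ∀ (x : M.V) (R : ℝ), 3 ≤ R →
      M.prob (M.armEvent x R) ≤ D * qArm M.ν M.α R * R ^ (-(M.ν / 2)) := by
  rcases hα.lt_or_eq with hlt | heq
  · obtain ⟨A, hA, hsum⟩ := h.exists_sum_green_sq_le hν hlt
    obtain ⟨D, hD, hbd⟩ := h.exists_arm_bound_log (β := 0) (e := (M.ν - 1) / 2) hν hα hA le_rfl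
      (by linarith) (fun y L R hL _ _ => by simpa using hsum y L hL)
    refine ⟨D, hD, fun x R hR => (hbd x R hR).trans_eq ?_⟩
    unfold qArm
    split_ifs with h1
    · simp [h1]
    · rfl
  · obtain ⟨A, hA, hsum⟩ := h.exists_sum_green_sq_le_log hν heq
    have hν1 : M.ν ≠ 1 := fun h1 => h.exponents_ne h1 (by linarith)
    obtain ⟨D, hD, hbd⟩ := h.exists_arm_bound_log (β := 1) (e := M.ν) (A := 2 * A) hν hα
      (by linarith) zero_le_one (by linarith) (fun y L R hL hLR hR => by
        have h1 := one_le_log_of_three_le hR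
        have h2 := Real.log_le_log (by linarith) hLR
        rw [show M.α - 2 * M.ν = 0 by linarith, Real.rpow_zero, mul_one, Real.rpow_one]
        refine (hsum y L hL).trans ?_
        nlinarith)
    refine ⟨D, hD, fun x R hR => (hbd x R hR).trans_eq ?_⟩
    rw [qArm, if_neg hν1, if_neg heq.not_lt]

end WGraph.Regular

end OneArm

/-- **Theorem 1.1 (critical one-arm upper bound).** There exists `C ∈ (0,∞)` such that for
all `x ∈ G` and `R ≥ 3`, `ℙ(x ↔ B(x,R)^c) ≤ C q(R) R^{-ν/2}`. -/
theorem one_arm_critical_upper_bound (M : Model)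
    (hS : M.toWGraph.Standing) (hν1 : 1 ≤ M.ν) (hνα : M.ν ≤ M.α / 2) :
    ∃ C > (0:ℝ), ∀ (x : M.V) (R : ℝ), 3 ≤ R →
      M.prob (M.armEvent x R) ≤ C * qArm M.ν M.α R * R ^ (-(M.ν / 2)) := by
  obtain ⟨c, C, h⟩ := WGraph.exists_regular hS hν1
  exact h.exists_arm_bound_qArm hν1 hνα
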